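/- Bilinear Hilbert transform bounds (Lacey–Thiele, Theorem 1.1): For all exponents p, q ∈ (1, ∞] and r ∈ (2/3, ∞) with 1/p + 1/q = 1/r, there exists a constant C = C(p,q,r) such that for all Schwartz functions f, g : ℝ → ℂ, the principal value BHT(f,g)(x) := lim_{δ→0⁺} ∫_{δ<|t|<1/δ} f(x−t) g(x+t) (1/t) dt exists for every x ∈ ℝ and ‖BHT(f,g)‖_{L^r(ℝ)} ≤ C ‖f‖_{L^p(ℝ)} ‖g‖_{L^q(ℝ)}. -/

import Mathlib

section
open MeasureTheory Filter Set
open scoped ENNReal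
namespace BHT

/-! ### Tiles and combinatorics of trees -/

@[ext] structure Tile where
  k : ℤ
  m : ℤ
  n : ℤ

noncomputable instance : DecidableEq Tile := Classical.decEq _

/-- scale of a tile -/
noncomputable def sc (σ : ℝ) (P : Tile) : ℝ := σ * (32:ℝ) ^ P.k
/-- left end point -/
noncomputable def lf (σ : ℝ) (P : Tile) : ℝ := P.n * sc σ P
/-- time interval -/
noncomputable def Iv (σ : ℝ) (P : Tile) : Set ℝ := Ico (lf σ P) (lf σ P + sc σ P)
/-- frequency -/
noncomputable def th (σ τ c : ℝ) (P : Tile) : ℝ := (P.m + τ + c) / sc σ P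

lemma sc_pos {σ : ℝ} (hσ : 0 < σ) (P : Tile) : 0 < sc σ P := by
  unfold sc; positivity

lemma lf_mem {σ : ℝ} (hσ : 0 < σ) (P : Tile) : lf σ P ∈ Iv σ P := by
  have := sc_pos hσ P
  simp [Iv, this]

lemma sc_le_iff {σ : ℝ} (hσ : 0 < σ) (P P' : Tile) : sc σ P' ≤ sc σ P ↔ P'.k ≤ P.k := by
  unfold sc
  rw [mul_le_mul_iff_right₀ hσ]
  exact zpow_le_zpow_iff_right₀ (by norm_num)

lemma sc_lt_iff {σ : ℝ} (hσ : 0 < σ) (P P' : Tile) : sc σ P' < sc σ P ↔ P'.k < P.k := by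
  rw [← not_le, sc_le_iff hσ, not_le]

lemma sc_eq_mul {σ : ℝ} (P P' : Tile) (d : ℕ) (h : P.k = P'.k + d) :
    sc σ P = sc σ P' * 32 ^ d := by
  unfold sc
  rw [h, zpow_add₀ (by norm_num)]
  simp; ring

lemma sc_lt_32 {σ : ℝ} (hσ : 0 < σ) {P P' : Tile} (h : sc σ P' < sc σ P) :
    32 * sc σ P' ≤ sc σ P := by
  rw [sc_lt_iff hσ] at h
  obtain ⟨d, hd⟩ := Int.exists_add_of_le (Int.add_one_le_iff.mpr h)
  rw [sc_eq_mul P P' (d+1) (by push_cast; omega), pow_succ]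
  have h1 : (1:ℝ) ≤ 32 ^ d := one_le_pow₀ (by norm_num)
  have := sc_pos hσ P'
  nlinarith

lemma nested {σ : ℝ} (hσ : 0 < σ) {P P' : Tile} (h : sc σ P' ≤ sc σ P) :
    Iv σ P' ⊆ Iv σ P ∨ Disjoint (Iv σ P') (Iv σ P) := by
  rw [sc_le_iff hσ] at h
  obtain ⟨d, hd⟩ := Int.exists_add_of_le h
  have hs := sc_eq_mul (σ := σ) P P' d hd
  have hp := sc_pos hσ P'
  set s := sc σ P' with hsdef
  have e1 : lf σ P = ((P.n * 32 ^ d : ℤ) : ℝ) * s := by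
    unfold lf; rw [hs]; push_cast; ring
  have e2 : lf σ P + sc σ P = (((P.n + 1) * 32 ^ d : ℤ) : ℝ) * s := by
    unfold lf; rw [hs]; push_cast; ring
  have e3 : lf σ P' = (P'.n : ℝ) * s := rfl
  have e4 : lf σ P' + s = ((P'.n + 1 : ℤ) : ℝ) * s := by rw [e3]; push_cast; ring
  unfold Iv
  rw [e2, e1, ← hsdef, e4, e3]
  have key : ∀ a b : ℤ, a ≤ b → (a:ℝ) * s ≤ b * s := fun a b hab => by
    have : (a:ℝ) ≤ b := by exact_mod_cast hab
    nlinarith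
  by_cases h1 : P'.n < P.n * 32 ^ d
  · right
    rw [Set.disjoint_left]
    rintro x ⟨_, hx⟩ ⟨hx', _⟩
    exact absurd (lt_of_lt_of_le hx (key _ _ h1)) (not_lt.mpr hx')
  by_cases h2 : (P.n + 1) * 32 ^ d ≤ P'.n
  · right
    rw [Set.disjoint_left]
    rintro x ⟨hx, _⟩ ⟨_, hx'⟩
    exact absurd (lt_of_lt_of_le hx' (key _ _ h2)) (not_lt.mpr hx)
  · left
    apply Ico_subset_Ico
    · exact key _ _ (not_lt.mp h1)
    · exact key _ _ (not_le.mp h2)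

lemma sc_le_of_subset {σ : ℝ} (hσ : 0 < σ) {P P' : Tile} (h : Iv σ P' ⊆ Iv σ P) :
    sc σ P' ≤ sc σ P := by
  have hp := sc_pos hσ P'
  unfold Iv at h
  rw [Ico_subset_Ico_iff (by linarith)] at h
  linarith [h.1, h.2]

lemma th_sub {σ τ : ℝ} (hσ : 0 < σ) (c c' : ℝ) (P : Tile) :
    (th σ τ c P - th σ τ c' P) * sc σ P = c - c' := by
  have := (sc_pos hσ P).ne'
  unfold th; field_simp; ring

lemma same_m {σ τ : ℝ} (hσ : 0 < σ) (c : ℝ) {P P' : Tile} (hk : P.k = P'.k)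
    (h : |th σ τ c P - th σ τ c P'| * sc σ P < 1) : P.m = P'.m := by
  have hs : sc σ P = sc σ P' := by unfold sc; rw [hk]
  have h0 := sc_pos hσ P
  have : (th σ τ c P - th σ τ c P') * sc σ P = ((P.m - P'.m : ℤ) : ℝ) := by
    unfold th; rw [← hs]; field_simp; push_cast; ring
  rw [← abs_of_pos h0, ← abs_mul, this, ← Int.cast_abs] at h
  have h' : |P.m - P'.m| < 1 := by exact_mod_cast h
  rw [Int.abs_lt_one_iff] at h'
  omega

/-- tree (with frequency tracked by shift `c`) -/
def IsTree (σ τ c ξ : ℝ) (P0 : Tile) (T : Finset Tile) : Prop :=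
  ∀ P ∈ T, Iv σ P ⊆ Iv σ P0 ∧ |th σ τ c P - ξ| * sc σ P ≤ 3/16

/-- strong disjointness relation of a tree with top `P0` to another tree -/
def StrDisj (σ τ c : ℝ) (T : Finset Tile) (P0 : Tile) (T' : Finset Tile) : Prop :=
  ∀ P ∈ T, ∀ P' ∈ T', sc σ P' < sc σ P → |th σ τ c P - th σ τ c P'| * sc σ P' ≤ 1/8 →
    Disjoint (Iv σ P') (Iv σ P0)

def SizeLE (σ τ : ℝ) (γ : Fin 3 → ℝ) (F : Tile → ℝ) (𝔓 : Finset Tile) (j : Fin 3) (μ : ℝ) : Prop :=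
  ∀ i, i ≠ j → ∀ ξ P0 T, T ⊆ 𝔓 → IsTree σ τ (γ i) ξ P0 T →
    ∑ P ∈ T, sc σ P * F P ^ 2 ≤ μ ^ 2 * sc σ P0

/-- energy bound -/
def Energy (σ τ : ℝ) (ci cj : ℝ) (F : Tile → ℝ) (𝔓 : Finset Tile) (E : ℝ) : Prop :=
  ∀ (N : ℕ) (T : Fin N → Finset Tile) (ξ : Fin N → ℝ) (top : Fin N → Tile) (μ : ℝ), 0 < μ →
    (∀ a, T a ⊆ 𝔓) → (∀ a, IsTree σ τ ci (ξ a) (top a) (T a)) →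
    (∀ a b, a ≠ b → Disjoint (T a) (T b)) →
    (∀ a b, a ≠ b → StrDisj σ τ cj (T a) (top a) (T b)) →
    (∀ a, ∀ P ∈ T a, F P ≤ 2 * μ) →
    (∀ a, μ ^ 2 * sc σ (top a) ≤ ∑ P ∈ T a, sc σ P * F P ^ 2) →
    μ ^ 2 * ∑ a, sc σ (top a) ≤ E

lemma isTree_singleton {σ τ : ℝ} (hσ : 0 < σ) (c : ℝ) (P : Tile) : IsTree σ τ c (th σ τ c P) P {P} := by
  intro Q hQ
  rw [Finset.mem_singleton] at hQ
  subst hQ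
  have := sc_pos hσ Q
  simp; norm_num

lemma SizeLE.le {σ τ : ℝ} (hσ : 0 < σ) {γ : Fin 3 → ℝ} {F : Tile → ℝ} {𝔓 : Finset Tile} {j : Fin 3} {μ : ℝ} (hμ : 0 ≤ μ)
    (h : SizeLE σ τ γ F 𝔓 j μ) {P : Tile} (hP : P ∈ 𝔓) : F P ≤ μ := by
  obtain ⟨i, hi⟩ : ∃ i : Fin 3, i ≠ j := exists_ne j
  have := h i hi _ P {P} (by simpa using hP) (isTree_singleton hσ (γ i) P)
  rw [Finset.sum_singleton] at this
  have h0 := sc_pos hσ P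
  have h2 : F P ^ 2 ≤ μ ^ 2 := by
    rw [mul_comm] at this
    exact le_of_mul_le_mul_right this h0
  exact le_of_sq_le_sq h2 hμ

end BHT
end

section
open MeasureTheory Filter Set
open scoped ENNReal
namespace BHT

lemma cs_tree {σ : ℝ} (hσ : 0 < σ) {T : Finset Tile} {a b c : Tile → ℝ} {x y z S : ℝ}
    (hx : 0 ≤ x) (hy : 0 ≤ y) (hz : 0 ≤ z) (hS : 0 ≤ S) 
    (hb0 : ∀ P, 0 ≤ b P) (hc0 : ∀ P, 0 ≤ c P)
    (ha : ∀ P ∈ T, a P ≤ x) (hb : ∑ P ∈ T, sc σ P * b P ^ 2 ≤ y ^ 2 * S)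
    (hc : ∑ P ∈ T, sc σ P * c P ^ 2 ≤ z ^ 2 * S) :
    ∑ P ∈ T, sc σ P * (a P * b P * c P) ≤ x * y * z * S := by
  have h1 : ∑ P ∈ T, sc σ P * (a P * b P * c P) ≤ x * ∑ P ∈ T, sc σ P * (b P * c P) := by
    rw [Finset.mul_sum]
    apply Finset.sum_le_sum
    intro P hP
    have := ha P hP
    have h2 : 0 ≤ sc σ P * (b P * c P) :=
      mul_nonneg (sc_pos hσ P).le (mul_nonneg (hb0 P) (hc0 P))
    nlinarith
  have h2 : (∑ P ∈ T, sc σ P * (b P * c P)) ^ 2 ≤ (y * z * S) ^ 2 := by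
    have := Finset.sum_mul_sq_le_sq_mul_sq T (fun P => Real.sqrt (sc σ P) * b P)
      (fun P => Real.sqrt (sc σ P) * c P)
    have e : ∀ P, Real.sqrt (sc σ P) * b P * (Real.sqrt (sc σ P) * c P) = sc σ P * (b P * c P) := by
      intro P
      have := Real.mul_self_sqrt (sc_pos hσ P).le
      calc _ = (Real.sqrt (sc σ P) * Real.sqrt (sc σ P)) * (b P * c P) := by ring
        _ = _ := by rw [this]
    simp only [e, mul_pow, Real.sq_sqrt (sc_pos hσ _).le] at this
    refine this.trans ?_
    calc _ ≤ (y ^ 2 * S) * (z ^ 2 * S) := by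
          apply mul_le_mul hb hc _ (by positivity)
          exact Finset.sum_nonneg fun P _ => mul_nonneg (sc_pos hσ P).le (sq_nonneg _)
      _ = _ := by ring
  have h3 := le_of_sq_le_sq h2 (by positivity)
  nlinarith

lemma tree_est {σ τ : ℝ} (hσ : 0 < σ) {γ : Fin 3 → ℝ} {F : Fin 3 → Tile → ℝ}
    (hF : ∀ i P, 0 ≤ F i P) {𝔓 : Finset Tile} {ν : Fin 3 → ℝ} (hν : ∀ i, 0 ≤ ν i)
    (hs : ∀ j, SizeLE σ τ γ (F j) 𝔓 j (ν j)) (i : Fin 3) {ξ : ℝ} {P0 : Tile} {T : Finset Tile}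
    (hT : T ⊆ 𝔓) (h : IsTree σ τ (γ i) ξ P0 T) :
    ∑ P ∈ T, sc σ P * ∏ j, F j P ≤ (∏ j, ν j) * sc σ P0 := by
  have hS := (sc_pos hσ P0).le
  simp only [Fin.prod_univ_three]
  have hle : ∀ j, ∀ P ∈ T, F j P ≤ ν j := fun j P hP => (hs j).le hσ (hν j) (hT hP)
  fin_cases i
  · exact cs_tree hσ (hν 0) (hν 1) (hν 2) hS (hF 1) (hF 2) (hle 0)
      (hs 1 0 (by decide) ξ P0 T hT h) (hs 2 0 (by decide) ξ P0 T hT h)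
  · have := cs_tree hσ (hν 1) (hν 0) (hν 2) hS (hF 0) (hF 2) (hle 1)
      (hs 0 1 (by decide) ξ P0 T hT h) (hs 2 1 (by decide) ξ P0 T hT h)
    simpa only [mul_comm (F 0 _) (F 1 _), mul_comm (ν 0) (ν 1)] using this
  · have := cs_tree hσ (hν 2) (hν 0) (hν 1) hS (hF 0) (hF 1) (hle 2)
      (hs 0 2 (by decide) ξ P0 T hT h) (hs 1 2 (by decide) ξ P0 T hT h)
    have e : ∀ a b c : ℝ, c * a * b = a * b * c := fun a b c => by ring
    simpa only [e] using this

/-- Greedy selection. -/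
lemma greedy {σ τ : ℝ} (hσ : 0 < σ) (ci cj ε : ℝ) (hε : ε = 1 ∨ ε = -1) (F : Tile → ℝ) (μ : ℝ)
    (hμ : 0 < μ) :
    ∀ (n : ℕ) (𝔓 : Finset Tile), 𝔓.card ≤ n →
    ∃ 𝔓' ⊆ 𝔓, ∃ L : List (Finset Tile × ℝ × Tile),
      (∀ t ∈ L, t.1 ⊆ 𝔓 ∧ IsTree σ τ ci t.2.1 t.2.2 t.1 ∧
        μ ^ 2 * sc σ t.2.2 < ∑ P ∈ t.1, sc σ P * F P ^ 2) ∧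
      L.Pairwise (fun t t' => Disjoint t.1 t'.1 ∧ ε * t'.2.1 ≤ ε * t.2.1 ∧
        ∀ P' ∈ t'.1, ¬ (Iv σ P' ⊆ Iv σ t.2.2 ∧ |th σ τ cj P' - t.2.1| * sc σ P' ≤ 3/16)) ∧
      (∀ ξ P0 T, T ⊆ 𝔓' → IsTree σ τ ci ξ P0 T → ∑ P ∈ T, sc σ P * F P ^ 2 ≤ μ ^ 2 * sc σ P0) ∧
      (∀ (W : Tile → ℝ) (K : ℝ), (∀ P, 0 ≤ W P) →
        (∀ ξ P0 T, T ⊆ 𝔓 → IsTree σ τ ci ξ P0 T → ∑ P ∈ T, W P ≤ K * sc σ P0) →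
        (∀ ξ P0 T, T ⊆ 𝔓 → IsTree σ τ cj ξ P0 T → ∑ P ∈ T, W P ≤ K * sc σ P0) →
        ∑ P ∈ 𝔓, W P ≤ ∑ P ∈ 𝔓', W P + 2 * K * (L.map fun t => sc σ t.2.2).sum) := by
  have hεε : ε * ε = 1 := by rcases hε with rfl | rfl <;> norm_num
  have hεabs : |ε| = 1 := by rcases hε with rfl | rfl <;> norm_num
  intro n
  induction n with
  | zero =>
    intro 𝔓 h
    have : 𝔓 = ∅ := by simpa using h
    subst this
    refine ⟨∅, subset_rfl, [], by simp, by simp, ?_, by simp⟩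
    intro ξ P0 T hT _
    have : T = ∅ := Finset.subset_empty.mp hT
    subst this
    have := sc_pos hσ P0
    simp; positivity
  | succ n ih =>
    intro 𝔓 hcard
    by_cases hbad : ∀ ξ P0 T, T ⊆ 𝔓 → IsTree σ τ ci ξ P0 T →
        ∑ P ∈ T, sc σ P * F P ^ 2 ≤ μ ^ 2 * sc σ P0
    · exact ⟨𝔓, subset_rfl, [], by simp, by simp, hbad, by simp⟩
    push Not at hbad
    classical
    -- candidate sets
    let good : Finset Tile → Prop := fun T => T.Nonempty ∧ ∃ ξ P0, IsTree σ τ ci ξ P0 T ∧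
        μ ^ 2 * sc σ P0 < ∑ P ∈ T, sc σ P * F P ^ 2
    have hgood : ∀ ξ P0 T, IsTree σ τ ci ξ P0 T →
        μ ^ 2 * sc σ P0 < ∑ P ∈ T, sc σ P * F P ^ 2 → T.Nonempty := by
      intro ξ P0 T _ h
      by_contra hne
      rw [Finset.not_nonempty_iff_eq_empty] at hne
      subst hne
      have := sc_pos hσ P0
      simp at h
      nlinarith [sq_nonneg μ]
    let g : Finset Tile → ℝ := fun T => if h : T.Nonempty then
      T.inf' h (fun P => ε * th σ τ ci P + (3/16) / sc σ P) else 0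
    have hgle : ∀ ξ P0 T, IsTree σ τ ci ξ P0 T → T.Nonempty → ε * ξ ≤ g T := by
      intro ξ P0 T hT hne
      simp only [g, hne, dif_pos]
      rw [Finset.le_inf'_iff]
      intro P hP
      have h1 := (hT P hP).2
      have h0 := sc_pos hσ P
      rw [← le_div_iff₀ h0] at h1
      have : ε * ξ - ε * th σ τ ci P ≤ |th σ τ ci P - ξ| := by
        calc _ = ε * (ξ - th σ τ ci P) := by ring
          _ ≤ |ε * (ξ - th σ τ ci P)| := le_abs_self _
          _ = _ := by rw [abs_mul, hεabs, one_mul, abs_sub_comm]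
      linarith
    have hne : ((𝔓.powerset).filter good).Nonempty := by
      obtain ⟨ξ, P0, T, h1, h2, h3⟩ := hbad
      exact ⟨T, by simp only [Finset.mem_filter, Finset.mem_powerset]; exact ⟨h1, hgood _ _ _ h2 h3, ξ, P0, h2, h3⟩⟩
    obtain ⟨T, hTmem, hTmax⟩ := Finset.exists_max_image _ g hne
    simp only [Finset.mem_filter, Finset.mem_powerset] at hTmem hTmax
    obtain ⟨hT𝔓, hTne, ξ0, P0, htree0, hbig⟩ := hTmem
    set ξ := ε * g T with hξ
    have hεξ : ε * ξ = g T := by rw [hξ, ← mul_assoc, hεε, one_mul]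
    have htree : IsTree σ τ ci ξ P0 T := by
      intro P hP
      refine ⟨(htree0 P hP).1, ?_⟩
      have h0 := sc_pos hσ P
      rw [← le_div_iff₀ h0]
      have h1 := (htree0 P hP).2
      rw [← le_div_iff₀ h0] at h1
      have h2 := hgle _ _ _ htree0 hTne
      have h3 : g T ≤ ε * th σ τ ci P + (3/16) / sc σ P := by
        simp only [g, hTne, dif_pos]
        exact Finset.inf'_le _ hP
      have h4 : ε * th σ τ ci P - ε * ξ0 ≤ |th σ τ ci P - ξ0| := by
        calc _ = ε * (th σ τ ci P - ξ0) := by ring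
          _ ≤ |ε * (th σ τ ci P - ξ0)| := le_abs_self _
          _ = _ := by rw [abs_mul, hεabs, one_mul]
      have h5 : |th σ τ ci P - ξ| = |ε * th σ τ ci P - g T| := by
        rw [← hεξ, ← mul_sub, abs_mul, hεabs, one_mul]
      rw [h5, abs_le]
      constructor <;> linarith
    set U := T ∪ 𝔓.filter (fun P => Iv σ P ⊆ Iv σ P0 ∧ |th σ τ cj P - ξ| * sc σ P ≤ 3/16) with hU
    have hUsub : U ⊆ 𝔓 := Finset.union_subset hT𝔓 (Finset.filter_subset _ _)
    have hcard' : (𝔓 \ U).card ≤ n := by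
      rw [Finset.card_sdiff_of_subset hUsub]
      have : 0 < U.card := Finset.card_pos.mpr (hTne.mono Finset.subset_union_left)
      omega
    obtain ⟨𝔓', hsub, L, hL1, hL2, hL3, hL4⟩ := ih (𝔓 \ U) hcard'
    have hss : 𝔓 \ U ⊆ 𝔓 := Finset.sdiff_subset
    refine ⟨𝔓', hsub.trans hss, (T, ξ, P0) :: L, ?_, ?_, hL3, ?_⟩
    · intro t ht
      rcases List.mem_cons.mp ht with rfl | ht
      · exact ⟨hT𝔓, htree, hbig⟩
      · obtain ⟨h1, h2, h3⟩ := hL1 t ht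
        exact ⟨h1.trans hss, h2, h3⟩
    · rw [List.pairwise_cons]
      refine ⟨?_, hL2⟩
      intro t ht
      obtain ⟨h1, h2, h3⟩ := hL1 t ht
      refine ⟨?_, ?_, ?_⟩
      · rw [Finset.disjoint_left]
        intro P hP hP'
        have := h1 hP'
        rw [Finset.mem_sdiff] at this
        exact this.2 (Finset.mem_union_left _ hP)
      · have hne' := hgood _ _ _ h2 h3
        have := hTmax t.1 ⟨h1.trans hss, hne', _, _, h2, h3⟩
        simp only [hεξ]
        exact (hgle _ _ _ h2 hne').trans this
      · intro P' hP' hcon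
        have := h1 hP'
        rw [Finset.mem_sdiff] at this
        exact this.2 (Finset.mem_union_right _ (Finset.mem_filter.mpr ⟨this.1, hcon⟩))
    · intro W K hW hi hj
      have h1 := hL4 W K hW (fun ξ P0 T hT => hi ξ P0 T (hT.trans hss))
        (fun ξ P0 T hT => hj ξ P0 T (hT.trans hss))
      have h2 : ∑ P ∈ 𝔓, W P = ∑ P ∈ 𝔓 \ U, W P + ∑ P ∈ U, W P :=
        (Finset.sum_sdiff hUsub).symm
      have h3 : ∑ P ∈ U, W P ≤ ∑ P ∈ T, W P + ∑ P ∈ 𝔓.filter (fun P => Iv σ P ⊆ Iv σ P0 ∧ |th σ τ cj P - ξ| * sc σ P ≤ 3/16), W P := by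
        rw [← Finset.sum_union_inter]
        have := Finset.sum_nonneg (s := T ∩ 𝔓.filter (fun P => Iv σ P ⊆ Iv σ P0 ∧ |th σ τ cj P - ξ| * sc σ P ≤ 3/16)) (fun P _ => hW P)
        linarith
      have h4 := hi ξ P0 T hT𝔓 htree
      have h5 := hj ξ P0 _ (Finset.filter_subset _ 𝔓) (fun P hP => (Finset.mem_filter.mp hP).2)
      simp only [List.map_cons, List.sum_cons]
      linarith

lemma select {σ τ : ℝ} (hσ : 0 < σ) {γ : Fin 3 → ℝ}
    (hγ : ∀ i j, i ≠ j → 1/2 ≤ |γ i - γ j| ∧ |γ i - γ j| ≤ 1)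
    {F : Fin 3 → Tile → ℝ} (hF : ∀ i P, 0 ≤ F i P) {𝔓 : Finset Tile} {ν : Fin 3 → ℝ}
    (hν : ∀ i, 0 ≤ ν i) (hs : ∀ j, SizeLE σ τ γ (F j) 𝔓 j (ν j))
    {i j : Fin 3} (hij : i ≠ j) {E μ : ℝ} (hμ : 0 < μ) (hμν : ν j ≤ 2 * μ)
    (hE : Energy σ τ (γ i) (γ j) (F j) 𝔓 E) :
    ∃ 𝔓' ⊆ 𝔓, (∀ ξ P0 T, T ⊆ 𝔓' → IsTree σ τ (γ i) ξ P0 T →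
        ∑ P ∈ T, sc σ P * F j P ^ 2 ≤ μ ^ 2 * sc σ P0) ∧
      ∑ P ∈ 𝔓, sc σ P * ∏ l, F l P ≤ ∑ P ∈ 𝔓', sc σ P * ∏ l, F l P
        + 2 * (∏ l, ν l) * (E / μ ^ 2) := by
  obtain ⟨ε, hε, hεγ⟩ : ∃ ε : ℝ, (ε = 1 ∨ ε = -1) ∧ 1/2 ≤ ε * (γ j - γ i) := by
    have := (hγ j i hij.symm).1
    rcases le_total 0 (γ j - γ i) with h | h
    · exact ⟨1, Or.inl rfl, by rw [abs_of_nonneg h] at this; linarith⟩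
    · exact ⟨-1, Or.inr rfl, by rw [abs_of_nonpos h] at this; linarith⟩
  have hεabs : |ε| = 1 := by rcases hε with rfl | rfl <;> norm_num
  obtain ⟨𝔓', hsub, L, h1, h2, h3, h4⟩ := greedy (τ := τ) hσ (γ i) (γ j) ε hε (F j) μ hμ 𝔓.card 𝔓 le_rfl
  refine ⟨𝔓', hsub, h3, ?_⟩
  have h5 := h4 (fun P => sc σ P * ∏ l, F l P) (∏ l, ν l)
    (fun P => mul_nonneg (sc_pos hσ P).le (Finset.prod_nonneg fun l _ => hF l P))
    (fun ξ P0 T hT h => tree_est hσ hF hν hs i hT h)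
    (fun ξ P0 T hT h => tree_est hσ hF hν hs j hT h)
  have key : μ ^ 2 * (L.map fun t => sc σ t.2.2).sum ≤ E := by
    have e : (L.map fun t => sc σ t.2.2).sum = ∑ a : Fin L.length, sc σ (L.get a).2.2 := by
      rw [← List.sum_ofFn]
      congr 1
      have := (List.map_ofFn (f := L.get) (g := fun t : Finset Tile × ℝ × Tile => sc σ t.2.2))
      rw [List.ofFn_get] at this
      exact this
    rw [e]
    rw [List.pairwise_iff_get] at h2
    have hmem : ∀ a : Fin L.length, L.get a ∈ L := fun a => List.get_mem L a
    refine hE L.length (fun a => (L.get a).1) (fun a => (L.get a).2.1) (fun a => (L.get a).2.2) μ hμ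
      (fun a => (h1 _ (hmem a)).1) (fun a => (h1 _ (hmem a)).2.1) ?_ ?_ ?_
      (fun a => (h1 _ (hmem a)).2.2.le)
    · intro a b hab
      rcases lt_or_gt_of_ne hab with h | h
      · exact (h2 a b h).1
      · exact (h2 b a h).1.symm
    · intro a b hab P hP P' hP' hlt hnear
      have ta := (h1 _ (hmem a)).2.1 P hP
      have tb := (h1 _ (hmem b)).2.1 P' hP'
      have hsP := sc_pos hσ P
      have hsP' := sc_pos hσ P'
      have h32 := sc_lt_32 hσ hlt
      set ξ := (L.get a).2.1
      set ξ' := (L.get b).2.1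
      -- distance of ξ to the j frequency of P'
      have d1 : |th σ τ (γ j) P - ξ| * sc σ P ≤ 3/16 + 1 := by
        have := th_sub (τ := τ) hσ (γ j) (γ i) P
        calc _ = |(th σ τ (γ i) P - ξ) * sc σ P + (th σ τ (γ j) P - th σ τ (γ i) P) * sc σ P| := by
              rw [← abs_of_pos hsP, ← abs_mul, abs_of_pos hsP]; congr 1; ring
          _ ≤ |(th σ τ (γ i) P - ξ) * sc σ P| + |(th σ τ (γ j) P - th σ τ (γ i) P) * sc σ P| := abs_add_le _ _
          _ ≤ 3/16 + 1 := by
              rw [this, abs_mul, abs_of_pos hsP]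
              exact add_le_add ta.2 (hγ j i hij.symm).2
      have d2 : |th σ τ (γ j) P - ξ| * sc σ P' ≤ 1/16 := by
        have : |th σ τ (γ j) P - ξ| * (32 * sc σ P') ≤ |th σ τ (γ j) P - ξ| * sc σ P :=
          mul_le_mul_of_nonneg_left h32 (abs_nonneg _)
        linarith
      have d3 : |th σ τ (γ j) P' - ξ| * sc σ P' ≤ 3/16 := by
        have : |th σ τ (γ j) P' - ξ| ≤ |th σ τ (γ j) P - th σ τ (γ j) P'| + |th σ τ (γ j) P - ξ| := by
          rw [abs_sub_comm (th σ τ (γ j) P)]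
          exact abs_sub_le _ _ _
        have := mul_le_mul_of_nonneg_right this hsP'.le
        linarith
      have hord : ε * ξ' < ε * ξ := by
        have e1 := th_sub (τ := τ) hσ (γ j) (γ i) P'
        have a1 : ε * (th σ τ (γ j) P' - ξ) * sc σ P' ≤ 3/16 := by
          refine le_trans (le_trans (le_abs_self _) (le_of_eq ?_)) d3
          rw [abs_mul, abs_mul, hεabs, one_mul, abs_of_pos hsP']
        have a2 : - (3/16) ≤ ε * (th σ τ (γ i) P' - ξ') * sc σ P' := by
          rw [neg_le]
          refine le_trans (le_trans (neg_le_abs _) (le_of_eq ?_)) tb.2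
          rw [abs_mul, abs_mul, hεabs, one_mul, abs_of_pos hsP']
        have a3 : 0 < (ε * ξ - ε * ξ') * sc σ P' := by
          have : (ε * ξ - ε * ξ') * sc σ P' = ε * ((th σ τ (γ j) P' - th σ τ (γ i) P') * sc σ P')
            + ε * (th σ τ (γ i) P' - ξ') * sc σ P' - ε * (th σ τ (γ j) P' - ξ) * sc σ P' := by ring
          rw [this, e1]
          linarith
        have := (mul_pos_iff_of_pos_right hsP').mp a3
        linarith
      rcases lt_or_gt_of_ne hab with h | h
      · have hn := (h2 a b h).2.2 P' hP'
        have hsub' : ¬ Iv σ P' ⊆ Iv σ (L.get a).2.2 := fun hc => hn ⟨hc, d3⟩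
        rcases nested hσ (hlt.le.trans (sc_le_of_subset hσ ta.1)) with h | h
        · exact absurd h hsub'
        · exact h
      · exact absurd (h2 b a h).2.1 (not_le.mpr hord)
    · intro a P hP
      exact ((hs j).le hσ (hν j) ((h1 _ (hmem a)).1 hP)).trans hμν
  have h6 : (L.map fun t => sc σ t.2.2).sum ≤ E / μ ^ 2 := by
    rw [le_div_iff₀ (by positivity)]; linarith
  have h7 : 0 ≤ ∏ l, ν l := Finset.prod_nonneg fun l _ => hν l
  nlinarith

end BHT
end

section
open MeasureTheory Filter Set
open scoped ENNReal
namespace BHT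

lemma IsTree.mono {σ τ c ξ : ℝ} {P0 : Tile} {T T' : Finset Tile} (h : IsTree σ τ c ξ P0 T)
    (hs : T' ⊆ T) : IsTree σ τ c ξ P0 T' := fun P hP => h P (hs hP)

lemma SizeLE.mono {σ τ : ℝ} {γ : Fin 3 → ℝ} {F : Tile → ℝ} {𝔓 𝔓' : Finset Tile} {j : Fin 3} {μ : ℝ}
    (h : SizeLE σ τ γ F 𝔓 j μ) (hs : 𝔓' ⊆ 𝔓) : SizeLE σ τ γ F 𝔓' j μ :=
  fun i hi ξ P0 T hT => h i hi ξ P0 T (hT.trans hs)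

lemma Energy.mono {σ τ : ℝ} {ci cj : ℝ} {F : Tile → ℝ} {𝔓 𝔓' : Finset Tile} {E : ℝ}
    (h : Energy σ τ ci cj F 𝔓 E) (hs : 𝔓' ⊆ 𝔓) : Energy σ τ ci cj F 𝔓' E :=
  fun N T ξ top μ hμ h1 => h N T ξ top μ hμ (fun a => (h1 a).trans hs)

lemma step {σ τ : ℝ} (hσ : 0 < σ) {γ : Fin 3 → ℝ}
    (hγ : ∀ i j, i ≠ j → 1/2 ≤ |γ i - γ j| ∧ |γ i - γ j| ≤ 1)
    {F : Fin 3 → Tile → ℝ} (hF : ∀ i P, 0 ≤ F i P) {𝔓 : Finset Tile} {ν : Fin 3 → ℝ}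
    (hν : ∀ i, 0 ≤ ν i) (hs : ∀ j, SizeLE σ τ γ (F j) 𝔓 j (ν j))
    {E : Fin 3 → ℝ} {μ : Fin 3 → ℝ} (hμ : ∀ j, 0 < μ j) (hμν : ∀ j, ν j ≤ 2 * μ j)
    (hE : ∀ i j, i ≠ j → Energy σ τ (γ i) (γ j) (F j) 𝔓 (E j)) (S : Finset (Fin 3 × Fin 3))
    (hS : ∀ p ∈ S, p.1 ≠ p.2) :
    ∃ 𝔓' ⊆ 𝔓, (∀ p ∈ S, ∀ ξ P0 T, T ⊆ 𝔓' → IsTree σ τ (γ p.1) ξ P0 T →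
        ∑ P ∈ T, sc σ P * F p.2 P ^ 2 ≤ μ p.2 ^ 2 * sc σ P0) ∧
      ∑ P ∈ 𝔓, sc σ P * ∏ l, F l P ≤ ∑ P ∈ 𝔓', sc σ P * ∏ l, F l P
        + 2 * (∏ l, ν l) * ∑ p ∈ S, (E p.2 / μ p.2 ^ 2) := by
  induction S using Finset.induction_on with
  | empty => exact ⟨𝔓, subset_rfl, by simp, by simp⟩
  | insert p S hp ih =>
    obtain ⟨𝔓', hsub, h1, h2⟩ := ih (fun p hp => hS p (Finset.mem_insert_of_mem hp))
    have hpne := hS p (Finset.mem_insert_self _ _)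
    obtain ⟨𝔓'', hsub', h1', h2'⟩ := select hσ hγ hF hν (fun j => (hs j).mono hsub) hpne
      (hμ p.2) (hμν p.2) ((hE p.1 p.2 hpne).mono hsub)
    refine ⟨𝔓'', hsub'.trans hsub, ?_, ?_⟩
    · intro q hq ξ P0 T hT
      rcases Finset.mem_insert.mp hq with rfl | hq
      · exact h1' ξ P0 T hT
      · exact h1 q hq ξ P0 T (hT.trans hsub')
    · rw [Finset.sum_insert hp]
      linarith

lemma iter {σ τ : ℝ} (hσ : 0 < σ) {γ : Fin 3 → ℝ}
    (hγ : ∀ i j, i ≠ j → 1/2 ≤ |γ i - γ j| ∧ |γ i - γ j| ≤ 1)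
    {F : Fin 3 → Tile → ℝ} (hF : ∀ i P, 0 ≤ F i P) {𝔓 : Finset Tile} {S e : Fin 3 → ℝ} {L : ℝ}
    (hS : ∀ i, 0 ≤ S i) (he : ∀ i, 0 < e i) (hSe : ∀ i, S i ≤ e i)
    (hs : ∀ j, SizeLE σ τ γ (F j) 𝔓 j (S j))
    (hE : ∀ i j, i ≠ j → Energy σ τ (γ i) (γ j) (F j) 𝔓 (e j ^ 2 * L)) (N : ℕ) :
    ∃ 𝔓' ⊆ 𝔓, (∀ j, SizeLE σ τ γ (F j) 𝔓' j (min (S j) (2⁻¹ ^ N * e j))) ∧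
      ∑ P ∈ 𝔓, sc σ P * ∏ l, F l P ≤ ∑ P ∈ 𝔓', sc σ P * ∏ l, F l P
        + ∑ n ∈ Finset.range N, 48 * 4 ^ n * L * ∏ j, min (S j) (2⁻¹ ^ n * e j) := by
  induction N with
  | zero => 
    refine ⟨𝔓, subset_rfl, ?_, by simp⟩
    intro j
    simp only [pow_zero, one_mul, min_eq_left (hSe j)]
    exact hs j
  | succ n ih =>
    obtain ⟨𝔓', hsub, h1, h2⟩ := ih
    have hμ : ∀ j, 0 < 2⁻¹ ^ (n+1) * e j := fun j => mul_pos (by positivity) (he j)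
    obtain ⟨𝔓'', hsub', h1', h2'⟩ := step hσ hγ hF (ν := fun j => min (S j) (2⁻¹ ^ n * e j))
      (fun j => le_min (hS j) (mul_pos (by positivity) (he j)).le) h1
      (μ := fun j => 2⁻¹ ^ (n+1) * e j) (E := fun j => e j ^ 2 * L) hμ
      (fun j => (min_le_right _ _).trans (le_of_eq (by rw [pow_succ]; ring)))
      (fun i j hij => (hE i j hij).mono hsub) (Finset.univ.filter fun p => p.1 ≠ p.2)
      (fun p hp => (Finset.mem_filter.mp hp).2)
    refine ⟨𝔓'', hsub'.trans hsub, ?_, ?_⟩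
    · intro j
      rcases min_choice (S j) (2⁻¹ ^ (n+1) * e j) with h | h
      · rw [h]; exact (hs j).mono (hsub'.trans hsub)
      · rw [h]
        intro i hi ξ P0 T hT
        exact h1' (i, j) (by simp [hi]) ξ P0 T hT
    · rw [Finset.sum_range_succ]
      have hval : ∀ p : Fin 3 × Fin 3, e p.2 ^ 2 * L / (2⁻¹ ^ (n+1) * e p.2) ^ 2 = 4 * 4 ^ n * L := by
        intro p
        have h4 : (4:ℝ) ^ n = 2 ^ n * 2 ^ n := by rw [← mul_pow]; norm_num
        have := (he p.2).ne'
        rw [h4, inv_pow]; field_simp; ring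
      have hsum : ∑ p ∈ Finset.univ.filter (fun p : Fin 3 × Fin 3 => p.1 ≠ p.2),
          e p.2 ^ 2 * L / (2⁻¹ ^ (n+1) * e p.2) ^ 2 = 24 * 4 ^ n * L := by
        rw [Finset.sum_congr rfl (fun p _ => hval p), Finset.sum_const]
        have : (Finset.univ.filter (fun p : Fin 3 × Fin 3 => p.1 ≠ p.2)).card = 6 := by decide
        rw [this, nsmul_eq_mul]; push_cast; ring
      rw [hsum] at h2'
      linarith

lemma min_le_geom {x y θ : ℝ} (hx : 0 ≤ x) (hy : 0 ≤ y) (h0 : 0 ≤ θ) (h1 : θ ≤ 1) :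
    min x y ≤ x ^ θ * y ^ (1 - θ) := by
  have hm : 0 ≤ min x y := le_min hx hy
  rcases hm.eq_or_lt with h | h
  · rw [← h]; positivity
  · calc min x y = (min x y) ^ θ * (min x y) ^ (1 - θ) := by
          rw [← Real.rpow_add h]; simp
      _ ≤ _ := by
          apply mul_le_mul
          · exact Real.rpow_le_rpow hm (min_le_left _ _) h0
          · exact Real.rpow_le_rpow hm (min_le_right _ _) (by linarith)
          · positivity
          · positivity

/-- The abstract size/energy estimate. -/
theorem size_energy {σ τ : ℝ} (hσ : 0 < σ) {γ : Fin 3 → ℝ}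
    (hγ : ∀ i j, i ≠ j → 1/2 ≤ |γ i - γ j| ∧ |γ i - γ j| ≤ 1)
    {F : Fin 3 → Tile → ℝ} (hF : ∀ i P, 0 ≤ F i P) {𝔓 : Finset Tile} {S e θ : Fin 3 → ℝ} {L : ℝ}
    (hL : 0 ≤ L) (hθ0 : ∀ i, 0 ≤ θ i) (hθ1 : ∀ i, θ i ≤ 1) (hθ : ∑ i, θ i < 1)
    (hS : ∀ i, 0 ≤ S i) (he : ∀ i, 0 < e i) (hSe : ∀ i, S i ≤ e i)
    (hs : ∀ j, SizeLE σ τ γ (F j) 𝔓 j (S j))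
    (hE : ∀ i j, i ≠ j → Energy σ τ (γ i) (γ j) (F j) 𝔓 (e j ^ 2 * L)) :
    ∑ P ∈ 𝔓, sc σ P * ∏ l, F l P ≤ 48 / (1 - 2⁻¹ ^ (1 - ∑ i, θ i)) * L *
      ∏ j, (S j ^ θ j * e j ^ (1 - θ j)) := by
  set ρ : ℝ := 2⁻¹ ^ (1 - ∑ i, θ i) with hρ
  have hρ0 : 0 ≤ ρ := by positivity
  have hρ1 : ρ < 1 := Real.rpow_lt_one (by norm_num) (by norm_num) (by linarith)
  set A := ∏ j, (S j ^ θ j * e j ^ (1 - θ j)) with hA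
  have hA0 : 0 ≤ A := Finset.prod_nonneg fun j _ =>
    mul_nonneg (Real.rpow_nonneg (hS j) _) (Real.rpow_nonneg (he j).le _)
  have hprod : ∀ n : ℕ, 48 * 4 ^ n * L * ∏ j, min (S j) (2⁻¹ ^ n * e j) ≤ (48 * L * A) * ρ ^ n := by
    intro n
    have h1 : ∏ j, min (S j) (2⁻¹ ^ n * e j) ≤
        ∏ j, ((S j ^ θ j * e j ^ (1 - θ j)) * ((2⁻¹:ℝ) ^ n) ^ (1 - θ j)) := by
      apply Finset.prod_le_prod
      · intro j _; exact le_min (hS j) (mul_pos (by positivity) (he j)).le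
      · intro j _
        refine (min_le_geom (hS j) (mul_pos (by positivity) (he j)).le (hθ0 j) (hθ1 j)).trans ?_
        rw [Real.mul_rpow (by positivity) (he j).le]
        apply le_of_eq; ring
    rw [Finset.prod_mul_distrib] at h1
    have h2 : ∏ j, ((2⁻¹:ℝ) ^ n) ^ (1 - θ j) = ((2⁻¹:ℝ)^n) ^ (2:ℕ) * ρ ^ n := by
      rw [← Real.rpow_sum_of_pos (by positivity)]
      have : ∑ j, (1 - θ j) = 2 + (1 - ∑ i, θ i) := by
        rw [Finset.sum_sub_distrib]; simp; ring
      rw [this, Real.rpow_add (by positivity), hρ]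
      congr 1
      · exact_mod_cast Real.rpow_natCast ((2⁻¹:ℝ)^n) 2
      · rw [← Real.rpow_natCast, ← Real.rpow_mul (by norm_num), ← Real.rpow_natCast,
          ← Real.rpow_mul (by norm_num), mul_comm]
    rw [h2] at h1
    have h3 : (4:ℝ)^n * ((2⁻¹:ℝ)^n) ^ (2:ℕ) = 1 := by
      rw [← pow_mul, mul_comm n 2, pow_mul, ← mul_pow]; norm_num
    calc _ ≤ 48 * 4 ^ n * L * (A * (((2⁻¹:ℝ)^n) ^ (2:ℕ) * ρ ^ n)) := by gcongr
      _ = 48 * L * A * ρ ^ n * (4^n * ((2⁻¹:ℝ)^n) ^ (2:ℕ)) := by ring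
      _ = _ := by rw [h3, mul_one]
  have hsum : ∀ N : ℕ, ∑ n ∈ Finset.range N, 48 * 4 ^ n * L * ∏ j, min (S j) (2⁻¹ ^ n * e j)
      ≤ 48 / (1 - ρ) * L * A := by
    intro N
    calc _ ≤ ∑ n ∈ Finset.range N, (48 * L * A) * ρ ^ n := Finset.sum_le_sum fun n _ => hprod n
      _ = (48 * L * A) * ∑ n ∈ Finset.range N, ρ ^ n := by rw [Finset.mul_sum]
      _ ≤ (48 * L * A) * (1 - ρ)⁻¹ := by
          gcongr
          have := (summable_geometric_of_lt_one hρ0 hρ1).sum_le_tsum (Finset.range N)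
            (fun i _ => by positivity)
          rwa [tsum_geometric_of_lt_one hρ0 hρ1] at this
      _ = _ := by rw [div_eq_mul_inv]; ring
  have hfin : ∀ N : ℕ, ∑ P ∈ 𝔓, sc σ P * ∏ l, F l P ≤
      (∑ P ∈ 𝔓, sc σ P) * (∏ j, e j) * (2⁻¹:ℝ) ^ N + 48 / (1 - ρ) * L * A := by
    intro N
    obtain ⟨𝔓', hsub, h1, h2⟩ := iter hσ hγ hF hS he hSe hs hE N
    refine h2.trans (add_le_add ?_ (hsum N))
    have hpos : ∀ j, 0 ≤ (2⁻¹:ℝ) ^ N * e j := fun j => (mul_pos (by positivity) (he j)).le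
    calc ∑ P ∈ 𝔓', sc σ P * ∏ l, F l P ≤ ∑ P ∈ 𝔓', sc σ P * ∏ l, ((2⁻¹:ℝ) ^ N * e l) := by
          apply Finset.sum_le_sum
          intro P hP
          apply mul_le_mul_of_nonneg_left _ (sc_pos hσ P).le
          apply Finset.prod_le_prod (fun l _ => hF l P)
          intro l _
          exact ((h1 l).le hσ (le_min (hS l) (hpos l)) hP).trans (min_le_right _ _)
      _ ≤ ∑ P ∈ 𝔓, sc σ P * ∏ l, ((2⁻¹:ℝ) ^ N * e l) := by
          apply Finset.sum_le_sum_of_subset_of_nonneg hsub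
          intro P _ _
          exact mul_nonneg (sc_pos hσ P).le (Finset.prod_nonneg fun l _ => hpos l)
      _ = (∑ P ∈ 𝔓, sc σ P) * (∏ j, e j) * ((2⁻¹:ℝ) ^ N) ^ 3 := by
          rw [← Finset.sum_mul, Finset.prod_mul_distrib]; simp; ring
      _ ≤ _ := by
          have hD : 0 ≤ (∑ P ∈ 𝔓, sc σ P) * (∏ j, e j) :=
            mul_nonneg (Finset.sum_nonneg fun P _ => (sc_pos hσ P).le)
              (Finset.prod_nonneg fun j _ => (he j).le)
          apply mul_le_mul_of_nonneg_left _ hD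
          have : (2⁻¹:ℝ) ^ N ≤ 1 := pow_le_one₀ (by norm_num) (by norm_num)
          exact pow_le_of_le_one (by positivity) this (by norm_num)
  have hlim : Tendsto (fun N : ℕ => (∑ P ∈ 𝔓, sc σ P) * (∏ j, e j) * (2⁻¹:ℝ) ^ N
      + 48 / (1 - ρ) * L * A) atTop (nhds ((∑ P ∈ 𝔓, sc σ P) * (∏ j, e j) * 0 + 48 / (1 - ρ) * L * A)) :=
    ((tendsto_pow_atTop_nhds_zero_of_lt_one (by norm_num) (by norm_num)).const_mul _).add_const _
  have := ge_of_tendsto' hlim hfin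
  simpa using this

end BHT
end

section
open MeasureTheory Filter Set
open scoped ENNReal
namespace BHT

/-- the bracket `1 + |y - c| / s` -/
noncomputable def br (c s y : ℝ) : ℝ := 1 + |y - c| / s

lemma br_one_le {s : ℝ} (hs : 0 < s) (c y : ℝ) : 1 ≤ br c s y := by
  unfold br; have : 0 ≤ |y - c| / s := by positivity
  linarith

lemma br_pos {s : ℝ} (hs : 0 < s) (c y : ℝ) : 0 < br c s y :=
  lt_of_lt_of_le one_pos (br_one_le hs c y)

lemma br_cont (c s : ℝ) : Continuous (br c s) := by
  unfold br; fun_prop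

lemma br_comm (c s y : ℝ) : br c s y = br y s c := by
  unfold br; rw [abs_sub_comm]

lemma br_anti {s s' : ℝ} (hs' : 0 < s') (h : s' ≤ s) (c y : ℝ) : br c s y ≤ br c s' y := by
  unfold br
  gcongr

lemma br_tri {s s' : ℝ} (hs' : 0 < s') (h : s' ≤ s) (c c' y : ℝ) :
    br c s c' ≤ br c s y * br c' s' y := by
  have hs : 0 < s := lt_of_lt_of_le hs' h
  have h1 := br_anti hs' h c' y
  have h2 : br c s c' ≤ br c s y * br c' s y := by
    unfold br
    have : |c' - c| ≤ |y - c| + |y - c'| := by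
      rw [add_comm, abs_sub_comm y c']; exact abs_sub_le _ _ _
    have e : |c' - c| / s ≤ |y - c| / s + |y - c'| / s := by
      rw [← add_div]; gcongr
    have e1 : 0 ≤ |y - c| / s := by positivity
    have e2 : 0 ≤ |y - c'| / s := by positivity
    nlinarith
  exact h2.trans (mul_le_mul_of_nonneg_left h1 (br_pos hs c y).le)

/-- moving the centre by at most `s` -/
lemma br_shift {s : ℝ} (hs : 0 < s) {c c' : ℝ} (h : |c - c'| ≤ s) (y : ℝ) :
    br c s y ≤ 2 * br c' s y := by
  unfold br
  have : |y - c| ≤ |y - c'| + |c - c'| := by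
    rw [abs_sub_comm c c']; exact abs_sub_le _ _ _
  have e : |y - c| / s ≤ |y - c'| / s + 1 := by
    rw [div_le_iff₀ hs, add_mul, div_mul_cancel₀ _ hs.ne']; linarith
  have : 0 ≤ |y - c'| / s := by positivity
  linarith

lemma br_sq_ge {s : ℝ} (hs : 0 < s) (c y : ℝ) : 1 + ((y - c)/s)^2 ≤ br c s y ^ 2 := by
  unfold br
  have e2 : 0 ≤ |y - c| / s := by positivity
  have : ((y - c)/s)^2 = (|y - c| / s)^2 := by rw [div_pow, div_pow, sq_abs]
  rw [this]; nlinarith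

lemma integrable_cauchy {s : ℝ} (hs : 0 < s) (c : ℝ) :
    Integrable (fun y : ℝ => (1 + ((y - c)/s)^2)⁻¹) := by
  have h := (integrable_inv_one_add_sq.comp_div hs.ne').comp_sub_right c
  simpa using h

lemma integral_cauchy {s : ℝ} (hs : 0 < s) (c : ℝ) :
    ∫ y : ℝ, (1 + ((y - c)/s)^2)⁻¹ = Real.pi * s := by
  rw [integral_sub_right_eq_self (fun y : ℝ => (1 + (y/s)^2)⁻¹) c]
  rw [Measure.integral_comp_div (fun y : ℝ => (1 + y^2)⁻¹) s, integral_univ_inv_one_add_sq,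
    abs_of_pos hs, smul_eq_mul, mul_comm]

lemma integrable_br {s : ℝ} (hs : 0 < s) (c : ℝ) :
    Integrable (fun y : ℝ => (br c s y ^ 2)⁻¹) := by
  refine (integrable_cauchy hs c).mono' ?_ ?_
  · apply Continuous.aestronglyMeasurable
    exact ((br_cont c s).pow 2).inv₀ (fun y => (pow_pos (br_pos hs c y) 2).ne')
  · refine Eventually.of_forall fun y => ?_
    rw [Real.norm_of_nonneg (inv_nonneg.mpr (pow_nonneg (br_pos hs c y).le 2))]
    exact inv_anti₀ (by positivity) (br_sq_ge hs c y)

lemma integral_br {s : ℝ} (hs : 0 < s) (c : ℝ) :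
    ∫ y : ℝ, (br c s y ^ 2)⁻¹ ≤ Real.pi * s := by
  rw [← integral_cauchy hs c]
  apply integral_mono (integrable_br hs c) (integrable_cauchy hs c)
  intro y
  exact inv_anti₀ (by positivity) (br_sq_ge hs c y)

/-- constant for sums over a lattice -/
noncomputable def C0 : ℝ := ∑' n : ℤ, 4 * ((1 + |(n:ℝ)|) ^ 2)⁻¹

lemma summable_C0 : Summable fun n : ℤ => 4 * ((1 + |(n:ℝ)|) ^ 2)⁻¹ := by
  apply Summable.mul_left
  have h : Summable fun n : ℤ => 1 / |(n:ℝ) + 2⁻¹| ^ (2:ℝ) :=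
    (Real.summable_one_div_int_add_rpow 2⁻¹ 2).mpr (by norm_num)
  refine h.of_nonneg_of_le (fun n => by positivity) (fun n => ?_)
  rw [← one_div]
  have h0 : 0 < |(n:ℝ) + 2⁻¹| := by
    rw [abs_pos]
    intro hc
    have : (2 * n + 1 : ℤ) = 0 := by
      have : (2 * (n:ℝ) + 1) = 0 := by linarith
      exact_mod_cast this
    omega
  apply one_div_le_one_div_of_le (by positivity)
  rw [show (2:ℝ) = ((2:ℕ):ℝ) by norm_num, Real.rpow_natCast]
  apply pow_le_pow_left₀ (abs_nonneg _)
  refine (abs_add_le _ _).trans ?_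
  norm_num
  linarith

lemma C0_pos : 0 < C0 := by
  refine summable_C0.tsum_pos (fun n => by positivity) 0 (by positivity)

lemma sum_int_le (S : Finset ℤ) (x : ℝ) : ∑ n ∈ S, ((1 + |(n:ℝ) - x|) ^ 2)⁻¹ ≤ C0 := by
  have h1 : ∀ n ∈ S, ((1 + |(n:ℝ) - x|) ^ 2)⁻¹ ≤ 4 * ((1 + |((n - ⌊x⌋ : ℤ):ℝ)|) ^ 2)⁻¹ := by
    intro n _
    have h2 : (1 + |((n - ⌊x⌋ : ℤ):ℝ)|) / 2 ≤ 1 + |(n:ℝ) - x| := by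
      have : |((n - ⌊x⌋ : ℤ):ℝ)| ≤ |(n:ℝ) - x| + 1 := by
        push_cast
        calc _ = |((n:ℝ) - x) + (x - ⌊x⌋)| := by ring_nf
          _ ≤ |(n:ℝ) - x| + |x - ⌊x⌋| := abs_add_le _ _
          _ ≤ _ := by
            gcongr
            rw [abs_of_nonneg (by linarith [Int.floor_le x])]
            linarith [Int.lt_floor_add_one x]
      have := abs_nonneg ((n:ℝ) - x)
      linarith
    calc _ ≤ (((1 + |((n - ⌊x⌋ : ℤ):ℝ)|) / 2) ^ 2)⁻¹ := by
          apply inv_anti₀ (by positivity)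
          exact pow_le_pow_left₀ (by positivity) h2 2
      _ = _ := by rw [div_pow, inv_div]; ring
  refine (Finset.sum_le_sum h1).trans ?_
  rw [← Finset.sum_image (s := S) (g := fun n => n - ⌊x⌋) (f := fun n : ℤ => 4 * ((1 + |(n:ℝ)|) ^ 2)⁻¹)
    (by intro a _ b _ h; simpa using h)]
  exact summable_C0.sum_le_tsum _ (fun n _ => by positivity)

lemma lattice_sum {σ : ℝ} (hσ : 0 < σ) (Q : Finset Tile) (k m : ℤ)
    (hQ : ∀ P ∈ Q, P.k = k ∧ P.m = m) (x : ℝ) :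
    ∑ P ∈ Q, (br (lf σ P) (sc σ P) x ^ 2)⁻¹ ≤ C0 := by
  set s := σ * (32:ℝ)^k with hs
  have hspos : 0 < s := by positivity
  have h1 : ∀ P ∈ Q, (br (lf σ P) (sc σ P) x ^ 2)⁻¹ = ((1 + |(P.n:ℝ) - x / s|) ^ 2)⁻¹ := by
    intro P hP
    have e : sc σ P = s := by unfold sc; rw [(hQ P hP).1]
    unfold br lf
    rw [e, abs_sub_comm, ← abs_of_pos hspos, ← abs_div, abs_of_pos hspos]
    congr 5; field_simp
  rw [Finset.sum_congr rfl h1]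
  rw [← Finset.sum_image (s := Q) (g := fun P => P.n) (f := fun n : ℤ => ((1 + |(n:ℝ) - x / s|) ^ 2)⁻¹)]
  · exact sum_int_le _ _
  · intro P hP P' hP' h
    obtain ⟨h1, h2⟩ := hQ P hP
    obtain ⟨h3, h4⟩ := hQ P' hP'
    ext
    · rw [h1, h3]
    · rw [h2, h4]
    · exact h

lemma geom_int (S : Finset ℤ) (k0 : ℤ) (h : ∀ k ∈ S, k ≤ k0) :
    ∑ k ∈ S, (32:ℝ) ^ k ≤ 2 * 32 ^ k0 := by
  have h1 : ∀ k ∈ S, (32:ℝ)^k = 32^k0 * (1/32:ℝ)^(k0 - k).toNat := by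
    intro k hk
    have := h k hk
    have e : ((k0 - k).toNat : ℤ) = k0 - k := Int.toNat_of_nonneg (by omega)
    rw [← zpow_natCast, e, one_div, inv_zpow, ← zpow_neg, ← zpow_add₀ (by norm_num)]
    congr 1; ring
  rw [Finset.sum_congr rfl h1, ← Finset.mul_sum,
    ← Finset.sum_image (s := S) (g := fun k => (k0 - k).toNat) (f := fun n : ℕ => (1/32:ℝ)^n)]
  · have hsm : Summable fun n : ℕ => (1/32:ℝ)^n := summable_geometric_of_lt_one (by norm_num) (by norm_num)
    have := hsm.sum_le_tsum (S.image fun k => (k0 - k).toNat) (fun i _ => by positivity)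
    rw [tsum_geometric_of_lt_one (by norm_num) (by norm_num)] at this
    have hp : (0:ℝ) < 32 ^ k0 := by positivity
    nlinarith
  · intro a ha b hb hab
    have h1 := h a ha
    have h2 := h b hb
    simp only at hab
    omega

lemma tree_same_m {σ τ c ξ : ℝ} (hσ : 0 < σ) {P0 : Tile} {T : Finset Tile} (hT : IsTree σ τ c ξ P0 T)
    {P P' : Tile} (hP : P ∈ T) (hP' : P' ∈ T) (hk : P.k = P'.k) : P.m = P'.m := by
  apply same_m (τ := τ) hσ c hk
  have hs : sc σ P' = sc σ P := by unfold sc; rw [hk]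
  have h1 := (hT P hP).2
  have h2 := (hT P' hP').2
  rw [hs] at h2
  have h0 := sc_pos hσ P
  have : |th σ τ c P - th σ τ c P'| ≤ |th σ τ c P - ξ| + |th σ τ c P' - ξ| := by
    rw [abs_sub_comm (th σ τ c P') ξ]; exact abs_sub_le _ _ _
  have := mul_le_mul_of_nonneg_right this h0.le
  linarith

/-- fibrewise sum over scales in a tree -/
lemma tree_scale_sum {σ : ℝ} (hσ : 0 < σ) {P0 : Tile} {T : Finset Tile} (hT : ∀ P ∈ T, P.k ≤ P0.k)
    (g : Tile → ℝ) (K : ℝ) (hK : 0 ≤ K)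
    (hg : ∀ k, ∑ P ∈ T.filter (fun P => P.k = k), g P ≤ K) :
    ∑ P ∈ T, sc σ P * g P ≤ 2 * K * sc σ P0 := by
  have hm : ∀ P ∈ T, P.k ∈ T.image Tile.k := fun P hP => Finset.mem_image_of_mem _ hP
  rw [← Finset.sum_fiberwise_of_maps_to hm]
  calc _ ≤ ∑ k ∈ T.image Tile.k, σ * 32 ^ k * K := by
        apply Finset.sum_le_sum
        intro k _
        have : ∑ P ∈ T.filter (fun P => P.k = k), sc σ P * g P
            = σ * 32 ^ k * ∑ P ∈ T.filter (fun P => P.k = k), g P := by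
          rw [Finset.mul_sum]
          apply Finset.sum_congr rfl
          intro P hP
          rw [Finset.mem_filter] at hP
          unfold sc; rw [hP.2]
        rw [this]
        exact mul_le_mul_of_nonneg_left (hg k) (by positivity)
    _ = σ * K * ∑ k ∈ T.image Tile.k, (32:ℝ)^k := by
        rw [Finset.mul_sum]; apply Finset.sum_congr rfl; intros; ring
    _ ≤ σ * K * (2 * 32 ^ P0.k) := by
        apply mul_le_mul_of_nonneg_left _ (by positivity)
        apply geom_int
        intro k hk
        obtain ⟨P, hP, rfl⟩ := Finset.mem_image.mp hk
        exact hT P hP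
    _ = _ := by unfold sc; ring

end BHT
end

section
open MeasureTheory Filter Set
open scoped ENNReal ComplexConjugate
namespace BHT

/-- weight adapted to an interval -/
noncomputable def wt (c ℓ z : ℝ) : ℝ := 1 + ((z - c)/ℓ)^2

lemma wt_one_le (c ℓ z : ℝ) : 1 ≤ wt c ℓ z := by unfold wt; nlinarith [sq_nonneg ((z-c)/ℓ)]
lemma wt_pos (c ℓ z : ℝ) : 0 < wt c ℓ z := lt_of_lt_of_le one_pos (wt_one_le c ℓ z)
lemma wt_cont (c ℓ : ℝ) : Continuous (wt c ℓ) := by unfold wt; fun_prop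

/-- families of wave packets -/
structure Pk (σ τ c : ℝ) (N : ℕ) (A : ℝ) (φ : Tile → ℝ → ℂ) : Prop where
  cont : ∀ P, Continuous (φ P)
  decay : ∀ P y, ‖φ P y‖ ≤ A / sc σ P * (br (lf σ P) (sc σ P) y ^ (N + 10))⁻¹
  orth : ∀ P P', (1/16) / sc σ P + (1/16) / sc σ P' < |th σ τ c P - th σ τ c P'| →
    ∀ c0 ℓ, ∫ z, ((wt c0 ℓ z ^ 2 : ℝ) : ℂ) * (φ P z * conj (φ P' z)) = 0
  lip : ∀ ξ, ∃ u : ℝ → ℂ, (∀ z, ‖u z‖ = 1) ∧ ∀ P, |th σ τ c P - ξ| * sc σ P ≤ 2 → ∀ y z,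
    |z - y| ≤ (sc σ P + |y - lf σ P|) / 2 →
    ‖u z * φ P z - u y * φ P y‖ ≤ A / sc σ P ^ 2 * |z - y| * (br (lf σ P) (sc σ P) y ^ 10)⁻¹

lemma inv_pow_mono {x : ℝ} (hx : 1 ≤ x) {m n : ℕ} (h : m ≤ n) : (x ^ n)⁻¹ ≤ (x ^ m)⁻¹ :=
  inv_anti₀ (by positivity) (pow_le_pow_right₀ hx h)

lemma Pk.decay10 {σ τ c A : ℝ} {N : ℕ} {φ : Tile → ℝ → ℂ} (hσ : 0 < σ) (hA : 0 ≤ A)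
    (h : Pk σ τ c N A φ) (P : Tile) (y : ℝ) :
    ‖φ P y‖ ≤ A / sc σ P * (br (lf σ P) (sc σ P) y ^ 10)⁻¹ := by
  have hs := sc_pos hσ P
  refine (h.decay P y).trans ?_
  apply mul_le_mul_of_nonneg_left _ (by positivity)
  exact inv_pow_mono (br_one_le hs _ _) (by omega)

/-- the top interval controls the weight -/
lemma wt_le {σ : ℝ} (hσ : 0 < σ) {P J : Tile} (h : Iv σ P ⊆ Iv σ J) (y : ℝ) :
    wt (lf σ J) (sc σ J) y ≤ 5 * br (lf σ P) (sc σ P) y ^ 2 := by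
  have hs := sc_pos hσ P
  have hJ := sc_pos hσ J
  have hle := sc_le_of_subset hσ h
  have h1 : |lf σ J - lf σ P| ≤ sc σ J := by
    have := h (lf_mem hσ P)
    unfold Iv at this
    rw [abs_le]; constructor <;> linarith [this.1, this.2]
  have h2 := br_shift hJ h1 y
  have h3 := br_anti hs hle (lf σ P) y
  have h4 := br_sq_ge hJ (lf σ J) y
  have h5 := br_one_le hJ (lf σ J) y
  have h6 := br_one_le hs (lf σ P) y
  unfold wt
  have : br (lf σ J) (sc σ J) y ≤ 2 * br (lf σ P) (sc σ P) y := by linarith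
  nlinarith

/-- kernel -/
noncomputable def kr (σ : ℝ) (P P' : Tile) : ℝ := (sc σ P)⁻¹ * (br (lf σ P) (sc σ P) (lf σ P') ^ 4)⁻¹

lemma kr_nonneg {σ : ℝ} (hσ : 0 < σ) (P P' : Tile) : 0 ≤ kr σ P P' := by
  have := sc_pos hσ P
  have := br_pos this (lf σ P) (lf σ P')
  unfold kr; positivity

lemma pair_bound_pt {σ τ c A : ℝ} {N : ℕ} {φ : Tile → ℝ → ℂ} (hσ : 0 < σ) (hA : 0 ≤ A)
    (h : Pk σ τ c N A φ) {P P' J : Tile} (hP : Iv σ P ⊆ Iv σ J) (hP' : Iv σ P' ⊆ Iv σ J)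
    (hle : sc σ P' ≤ sc σ P) (y : ℝ) :
    ‖((wt (lf σ J) (sc σ J) y ^ 2 : ℝ) : ℂ) * (φ P y * conj (φ P' y))‖ ≤
      25 * A ^ 2 * (sc σ P')⁻¹ * kr σ P P' * (br (lf σ P') (sc σ P') y ^ 2)⁻¹ := by
  have hs := sc_pos hσ P
  have hs' := sc_pos hσ P'
  have d1 := h.decay10 hσ hA P y
  have d2 := h.decay10 hσ hA P' y
  have w1 := wt_le hσ hP y
  have w2 := wt_le hσ hP' y
  have w0 := wt_pos (lf σ J) (sc σ J) y
  set x := br (lf σ P) (sc σ P) y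
  set x' := br (lf σ P') (sc σ P') y
  have hx : 0 < x := br_pos hs _ _
  have hx' : 0 < x' := br_pos hs' _ _
  have hx1 : 1 ≤ x := br_one_le hs _ _
  have hx1' : 1 ≤ x' := br_one_le hs' _ _
  have tri := br_tri hs' hle (lf σ P) (lf σ P') y
  have hb := br_pos hs (lf σ P) (lf σ P')
  unfold kr
  set b := br (lf σ P) (sc σ P) (lf σ P')
  rw [norm_mul, norm_mul, Complex.norm_real, Real.norm_of_nonneg (by positivity), RCLike.norm_conj]
  have hw : wt (lf σ J) (sc σ J) y ^ 2 ≤ (5 * x^2) * (5 * x'^2) := by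
    rw [sq]; exact mul_le_mul w1 w2 w0.le (by positivity)
  calc _ ≤ ((5 * x^2) * (5 * x'^2)) * ((A / sc σ P * (x ^ 10)⁻¹) * (A / sc σ P' * (x' ^ 10)⁻¹)) := by
        gcongr
    _ = 25 * A^2 * (sc σ P')⁻¹ * ((sc σ P)⁻¹ * ((x ^ 8)⁻¹ * (x'^6)⁻¹)) * (x' ^ 2)⁻¹ := by
        field_simp; ring
    _ ≤ _ := by
        gcongr
        rw [← mul_inv]
        apply inv_anti₀ (by positivity)
        calc b ^ 4 ≤ (x * x') ^ 4 := by gcongr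
          _ = x^4 * x'^4 := by ring
          _ ≤ x^8 * x'^6 := by gcongr <;> first | assumption | norm_num

lemma pair_integrable {σ τ c A : ℝ} {N : ℕ} {φ : Tile → ℝ → ℂ} (hσ : 0 < σ) (hA : 0 ≤ A)
    (h : Pk σ τ c N A φ) {P P' J : Tile} (hP : Iv σ P ⊆ Iv σ J) (hP' : Iv σ P' ⊆ Iv σ J) :
    Integrable fun y => ((wt (lf σ J) (sc σ J) y ^ 2 : ℝ) : ℂ) * (φ P y * conj (φ P' y)) := by
  have hc : ∀ P P' : Tile, AEStronglyMeasurable (fun y => ((wt (lf σ J) (sc σ J) y ^ 2 : ℝ) : ℂ) * (φ P y * conj (φ P' y))) := by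
    intro P P'
    apply Continuous.aestronglyMeasurable
    have := wt_cont (lf σ J) (sc σ J)
    have := h.cont P
    have := h.cont P'
    fun_prop
  rcases le_total (sc σ P') (sc σ P) with hle | hle
  · refine Integrable.mono' ((integrable_br (sc_pos hσ P') (lf σ P')).const_mul _) (hc P P')
      (Eventually.of_forall fun y => pair_bound_pt hσ hA h hP hP' hle y)
  · refine Integrable.mono' ((integrable_br (sc_pos hσ P) (lf σ P)).const_mul (25 * A ^ 2 * (sc σ P)⁻¹ * kr σ P' P)) (hc P P')
      (Eventually.of_forall fun y => ?_)
    refine le_trans (le_of_eq ?_) (pair_bound_pt hσ hA h hP' hP hle y)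
    simp only [norm_mul, RCLike.norm_conj]; ring

/-- the Gram matrix -/
noncomputable def gr (σ : ℝ) (φ : Tile → ℝ → ℂ) (J P P' : Tile) : ℂ :=
  ∫ y, ((wt (lf σ J) (sc σ J) y ^ 2 : ℝ) : ℂ) * (φ P y * conj (φ P' y))

lemma gr_bound {σ τ c A : ℝ} {N : ℕ} {φ : Tile → ℝ → ℂ} (hσ : 0 < σ) (hA : 0 ≤ A)
    (h : Pk σ τ c N A φ) {P P' J : Tile} (hP : Iv σ P ⊆ Iv σ J) (hP' : Iv σ P' ⊆ Iv σ J)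
    (hle : sc σ P' ≤ sc σ P) : ‖gr σ φ J P P'‖ ≤ 25 * Real.pi * A ^ 2 * kr σ P P' := by
  have hs' := sc_pos hσ P'
  unfold gr
  refine (norm_integral_le_of_norm_le ((integrable_br hs' (lf σ P')).const_mul _)
    (Eventually.of_forall fun y => pair_bound_pt hσ hA h hP hP' hle y)).trans ?_
  rw [integral_const_mul]
  have h1 := integral_br hs' (lf σ P')
  have := kr_nonneg hσ P P'
  calc _ ≤ 25 * A ^ 2 * (sc σ P')⁻¹ * kr σ P P' * (Real.pi * sc σ P') := by gcongr
    _ = _ := by field_simp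

lemma gr_norm_symm (σ : ℝ) (φ : Tile → ℝ → ℂ) (J P P' : Tile) :
    ‖gr σ φ J P P'‖ = ‖gr σ φ J P' P‖ := by
  rw [← RCLike.norm_conj (gr σ φ J P P')]
  congr 1
  unfold gr
  rw [← integral_conj]
  congr 1; ext y
  simp only [map_mul, Complex.conj_ofReal, Complex.conj_conj]
  ring

lemma gram_expand {σ τ c A : ℝ} {N : ℕ} {φ : Tile → ℝ → ℂ} (hσ : 0 < σ) (hA : 0 ≤ A)
    (h : Pk σ τ c N A φ) {J : Tile} {Q : Finset Tile} (hQ : ∀ P ∈ Q, Iv σ P ⊆ Iv σ J)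
    (a : Tile → ℂ) :
    Integrable (fun y => wt (lf σ J) (sc σ J) y ^ 2 * ‖∑ P ∈ Q, sc σ P * a P * φ P y‖ ^ 2) ∧ 
    ∫ y, wt (lf σ J) (sc σ J) y ^ 2 * ‖∑ P ∈ Q, sc σ P * a P * φ P y‖ ^ 2 ≤
      ∑ P ∈ Q, ∑ P' ∈ Q, sc σ P * sc σ P' * (‖a P‖ * ‖a P'‖) * ‖gr σ φ J P P'‖ := by
  have e : ∀ y, ((wt (lf σ J) (sc σ J) y ^ 2 * ‖∑ P ∈ Q, sc σ P * a P * φ P y‖ ^ 2 : ℝ) : ℂ)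
      = ∑ P ∈ Q, ∑ P' ∈ Q, (sc σ P * sc σ P' * (a P * conj (a P'))) *
        (((wt (lf σ J) (sc σ J) y ^ 2 : ℝ) : ℂ) * (φ P y * conj (φ P' y))) := by
    intro y
    push_cast
    rw [← Complex.mul_conj', map_sum, Finset.sum_mul_sum, Finset.mul_sum]
    apply Finset.sum_congr rfl; intro P _
    rw [Finset.mul_sum]
    apply Finset.sum_congr rfl; intro P' _
    simp only [map_mul, Complex.conj_ofReal]
    ring
  have hnti : ∀ P ∈ Q, ∀ P' ∈ Q, Integrable fun y => (sc σ P * sc σ P' * (a P * conj (a P'))) *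
        (((wt (lf σ J) (sc σ J) y ^ 2 : ℝ) : ℂ) * (φ P y * conj (φ P' y))) :=
    fun P hP P' hP' => (pair_integrable hσ hA h (hQ P hP) (hQ P' hP')).const_mul _
  have hI : Integrable fun y => ((wt (lf σ J) (sc σ J) y ^ 2 * ‖∑ P ∈ Q, sc σ P * a P * φ P y‖ ^ 2 : ℝ) : ℂ) := by
    simp only [e]
    exact integrable_finsetSum _ fun P hP => integrable_finsetSum _ fun P' hP' => hnti P hP P' hP'
  refine ⟨hI.re, ?_⟩
  have h2 : ((∫ y, wt (lf σ J) (sc σ J) y ^ 2 * ‖∑ P ∈ Q, sc σ P * a P * φ P y‖ ^ 2 : ℝ) : ℂ)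
      = ∑ P ∈ Q, ∑ P' ∈ Q, (sc σ P * sc σ P' * (a P * conj (a P'))) * gr σ φ J P P' := by
    rw [← integral_complex_ofReal]
    simp only [e]
    rw [integral_finsetSum _ (fun P hP => integrable_finsetSum _ fun P' hP' => hnti P hP P' hP')]
    apply Finset.sum_congr rfl; intro P hP
    rw [integral_finsetSum _ (hnti P hP)]
    apply Finset.sum_congr rfl; intro P' hP'
    rw [integral_const_mul]; rfl
  have h3 := congrArg norm h2
  rw [Complex.norm_real, Real.norm_of_nonneg (integral_nonneg fun y => by positivity)] at h3
  rw [h3]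
  refine (norm_sum_le _ _).trans (Finset.sum_le_sum fun P _ => (norm_sum_le _ _).trans (Finset.sum_le_sum fun P' _ => ?_))
  rw [norm_mul, norm_mul, norm_mul, norm_mul, RCLike.norm_conj, Complex.norm_real, Complex.norm_real,
    Real.norm_of_nonneg (sc_pos hσ P).le, Real.norm_of_nonneg (sc_pos hσ P').le]

/-- near frequencies -/
def Near (σ τ c : ℝ) (P P' : Tile) : Prop :=
  |th σ τ c P - th σ τ c P'| ≤ (1/16) / sc σ P + (1/16) / sc σ P'

open Classical in
lemma gram_bound {σ τ c A : ℝ} {N : ℕ} {φ : Tile → ℝ → ℂ} (hσ : 0 < σ) (hA : 0 ≤ A)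
    (h : Pk σ τ c N A φ) {J : Tile} {Q : Finset Tile} (hQ : ∀ P ∈ Q, Iv σ P ⊆ Iv σ J)
    (a : Tile → ℂ) {R : ℝ}
    (hR : ∑ P ∈ Q, ∑ P' ∈ Q with (sc σ P' < sc σ P ∧ Near σ τ c P P'), 
      sc σ P * sc σ P' * (‖a P‖ * ‖a P'‖) * kr σ P P' ≤ R) :
    ∫ y, wt (lf σ J) (sc σ J) y ^ 2 * ‖∑ P ∈ Q, sc σ P * a P * φ P y‖ ^ 2 ≤
      25 * Real.pi * A ^ 2 * (C0 * ∑ P ∈ Q, sc σ P * ‖a P‖ ^ 2 + 2 * R) := by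
  refine (gram_expand hσ hA h hQ a).2.trans ?_
  set D : Tile → Tile → ℝ := fun P P' => sc σ P * sc σ P' * (‖a P‖ * ‖a P'‖) * ‖gr σ φ J P P'‖ with hD
  have hDsymm : ∀ P P', D P P' = D P' P := by
    intro P P'; simp only [hD]; rw [gr_norm_symm σ φ J P P']; ring
  have hpos : ∀ P, 0 < sc σ P := sc_pos hσ
  have hD0 : ∀ P P', 0 ≤ D P P' := by
    intro P P'; have := hpos P; have := hpos P'; simp only [hD]; positivity
  have split : ∀ P ∈ Q, ∀ P' ∈ Q, D P P' = (if sc σ P' = sc σ P then D P P' else 0)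
      + (if sc σ P' < sc σ P then D P P' else 0) + (if sc σ P < sc σ P' then D P' P else 0) := by
    intro P _ P' _
    rcases lt_trichotomy (sc σ P') (sc σ P) with h | h | h
    · simp [h, h.ne, h.not_gt]
    · simp [h]
    · simp [h, h.ne', h.not_gt, hDsymm P P']
  have e1 : ∑ P ∈ Q, ∑ P' ∈ Q, D P P' = ∑ P ∈ Q, ∑ P' ∈ Q, (if sc σ P' = sc σ P then D P P' else 0)
      + 2 * ∑ P ∈ Q, ∑ P' ∈ Q, (if sc σ P' < sc σ P then D P P' else 0) := by
    rw [Finset.sum_congr rfl fun P hP => Finset.sum_congr rfl (split P hP)]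
    simp only [Finset.sum_add_distrib]
    have : ∑ P ∈ Q, ∑ P' ∈ Q, (if sc σ P < sc σ P' then D P' P else 0)
      = ∑ P ∈ Q, ∑ P' ∈ Q, (if sc σ P' < sc σ P then D P P' else 0) := by
      rw [Finset.sum_comm]
    rw [this]; ring
  change ∑ P ∈ Q, ∑ P' ∈ Q, D P P' ≤ _
  rw [e1]
  set K := 25 * Real.pi * A ^ 2 with hK
  have hK0 : 0 ≤ K := by positivity
  have hfar : ∀ P P', ¬ Near σ τ c P P' → D P P' = 0 := by
    intro P P' hn
    unfold Near at hn
    have := h.orth P P' (not_le.mp hn) (lf σ J) (sc σ J)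
    simp only [hD, gr, this]; simp
  -- off diagonal part
  have off : ∑ P ∈ Q, ∑ P' ∈ Q, (if sc σ P' < sc σ P then D P P' else 0) ≤ K * R := by
    refine le_trans ?_ (mul_le_mul_of_nonneg_left hR hK0)
    rw [Finset.mul_sum]
    apply Finset.sum_le_sum; intro P hP
    rw [Finset.sum_filter, Finset.mul_sum]
    apply Finset.sum_le_sum; intro P' hP'
    by_cases h1 : sc σ P' < sc σ P
    · by_cases h2 : Near σ τ c P P'
      · rw [if_pos h1, if_pos ⟨h1, h2⟩]
        have := gr_bound hσ hA h (hQ P hP) (hQ P' hP') h1.le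
        have q1 := hpos P; have q2 := hpos P'
        simp only [hD]
        calc _ ≤ sc σ P * sc σ P' * (‖a P‖ * ‖a P'‖) * (K * kr σ P P') := by gcongr
          _ = _ := by ring
      · rw [if_pos h1, if_neg (by tauto), hfar P P' h2]; simp
    · rw [if_neg h1, if_neg (by tauto)]; simp
  have diag : ∑ P ∈ Q, ∑ P' ∈ Q, (if sc σ P' = sc σ P then D P P' else 0) ≤
      K * (C0 * ∑ P ∈ Q, sc σ P * ‖a P‖ ^ 2) := by
    -- pointwise domination by the arithmetic mean
    set V : Tile → Tile → ℝ := fun P P' => if P'.k = P.k ∧ P'.m = P.m then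
      (br (lf σ P') (sc σ P') (lf σ P) ^ 2)⁻¹ else 0 with hV
    have hV0 : ∀ P P', 0 ≤ V P P' := by
      intro P P'; have := br_pos (hpos P') (lf σ P') (lf σ P)
      simp only [hV]; split_ifs <;> positivity
    have hVsymm : ∀ P P', V P P' = V P' P := by
      intro P P'
      simp only [hV]
      by_cases hh : P'.k = P.k ∧ P'.m = P.m
      · rw [if_pos hh, if_pos ⟨hh.1.symm, hh.2.symm⟩]
        have : sc σ P' = sc σ P := by unfold sc; rw [hh.1]
        rw [this, br_comm]
      · rw [if_neg hh, if_neg (fun h => hh ⟨h.1.symm, h.2.symm⟩)]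
    have hVsum : ∀ P, ∑ P' ∈ Q, V P P' ≤ C0 := by
      intro P
      simp only [hV]
      rw [← Finset.sum_filter]
      exact lattice_sum hσ _ P.k P.m (fun P' hP' => (Finset.mem_filter.mp hP').2) (lf σ P)
    have dom : ∀ P ∈ Q, ∀ P' ∈ Q, (if sc σ P' = sc σ P then D P P' else 0) ≤
        K * (V P P' * (sc σ P * ‖a P‖^2) / 2 + V P' P * (sc σ P' * ‖a P'‖^2) / 2) := by
      intro P hP P' hP'
      have q1 := hpos P; have q2 := hpos P'
      have v1 := hV0 P P'; have v2 := hV0 P' P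
      have rhs0 : 0 ≤ K * (V P P' * (sc σ P * ‖a P‖^2) / 2 + V P' P * (sc σ P' * ‖a P'‖^2) / 2) := by
        positivity
      by_cases h1 : sc σ P' = sc σ P
      · rw [if_pos h1]
        by_cases h2 : Near σ τ c P P'
        · have hk : P.k = P'.k := le_antisymm ((sc_le_iff hσ _ _).mp h1.ge) ((sc_le_iff hσ _ _).mp h1.le)
          have hm : P.m = P'.m := by
            apply same_m (τ := τ) hσ c hk
            unfold Near at h2
            rw [h1] at h2
            have := mul_le_mul_of_nonneg_right h2 q1.le
            have e : (1 / 16 / sc σ P + 1 / 16 / sc σ P) * sc σ P = 1/8 := by field_simp; norm_num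
            rw [e] at this
            linarith
          have hg := gr_bound hσ hA h (hQ P hP) (hQ P' hP') h1.le
          have hVe : V P P' = (br (lf σ P') (sc σ P') (lf σ P) ^ 2)⁻¹ := by
            simp only [hV]; rw [if_pos ⟨hk.symm, hm.symm⟩]
          have hkr : sc σ P * kr σ P P' ≤ V P P' := by
            unfold kr
            rw [hVe, ← mul_assoc, mul_inv_cancel₀ q1.ne', one_mul, h1, br_comm]
            exact inv_pow_mono (br_one_le q1 _ _) (by norm_num)
          rw [← hVsymm P P']
          simp only [hD]
          rw [h1]
          have hab : ‖a P‖ * ‖a P'‖ ≤ (‖a P‖^2 + ‖a P'‖^2)/2 := by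
            nlinarith [sq_nonneg (‖a P‖ - ‖a P'‖)]
          calc _ ≤ sc σ P * sc σ P * (‖a P‖ * ‖a P'‖) * (K * kr σ P P') := by gcongr
            _ = K * (sc σ P * kr σ P P') * (sc σ P * (‖a P‖ * ‖a P'‖)) := by ring
            _ ≤ K * V P P' * (sc σ P * ((‖a P‖^2 + ‖a P'‖^2)/2)) := by gcongr
            _ = _ := by ring
        · rw [hfar P P' h2]; exact rhs0
      · rw [if_neg h1]; exact rhs0
    refine (Finset.sum_le_sum fun P hP => Finset.sum_le_sum (dom P hP)).trans ?_
    simp only [← Finset.mul_sum, Finset.sum_add_distrib]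
    apply mul_le_mul_of_nonneg_left _ hK0
    have e3 : ∑ P ∈ Q, ∑ P' ∈ Q, V P' P * (sc σ P' * ‖a P'‖^2) / 2
        = ∑ P ∈ Q, ∑ P' ∈ Q, V P P' * (sc σ P * ‖a P‖^2) / 2 := Finset.sum_comm
    rw [e3, ← two_mul, Finset.mul_sum, Finset.mul_sum]
    apply Finset.sum_le_sum; intro P _
    rw [← Finset.sum_div, ← Finset.sum_mul]
    have q1 := hpos P
    have := mul_le_mul_of_nonneg_right (hVsum P) (show 0 ≤ sc σ P * ‖a P‖^2 by positivity)
    linarith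
  linarith

end BHT
end

section
open MeasureTheory Filter Set
open scoped ENNReal ComplexConjugate
namespace BHT

lemma Pk.integrable {σ τ c A : ℝ} {N : ℕ} {φ : Tile → ℝ → ℂ} (hσ : 0 < σ) (hA : 0 ≤ A)
    (h : Pk σ τ c N A φ) (P : Tile) : Integrable (φ P) := by
  have hs := sc_pos hσ P
  refine Integrable.mono' ((integrable_br hs (lf σ P)).const_mul (A / sc σ P))
    (h.cont P).aestronglyMeasurable (Eventually.of_forall fun y => ?_)
  refine (h.decay10 hσ hA P y).trans ?_
  apply mul_le_mul_of_nonneg_left _ (by positivity)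
  exact inv_pow_mono (br_one_le hs _ _) (by norm_num)

lemma Pk.integrable_mul {σ τ c A : ℝ} {N : ℕ} {φ : Tile → ℝ → ℂ} (hσ : 0 < σ) (hA : 0 ≤ A)
    (h : Pk σ τ c N A φ) {f : ℝ → ℂ} (hf : AEStronglyMeasurable f) (hf1 : ∀ x, ‖f x‖ ≤ 1) (P : Tile) :
    Integrable (fun y => f y * φ P y) :=
  (h.integrable hσ hA P).bdd_mul hf (Eventually.of_forall hf1)

/-- the dual function -/
noncomputable def dualG (σ : ℝ) (φ : Tile → ℝ → ℂ) (f : ℝ → ℂ) (Q : Finset Tile) (y : ℝ) : ℂ :=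
  ∑ P ∈ Q, sc σ P * conj (∫ z, f z * φ P z) * φ P y

lemma dualG_integrable {σ τ c A : ℝ} {N : ℕ} {φ : Tile → ℝ → ℂ} (hσ : 0 < σ) (hA : 0 ≤ A)
    (h : Pk σ τ c N A φ) (f : ℝ → ℂ) (Q : Finset Tile) : Integrable (dualG σ φ f Q) := by
  unfold dualG
  exact integrable_finsetSum _ fun P _ => (h.integrable hσ hA P).const_mul _

lemma dualG_cont {σ τ c A : ℝ} {N : ℕ} {φ : Tile → ℝ → ℂ}
    (h : Pk σ τ c N A φ) (f : ℝ → ℂ) (Q : Finset Tile) : Continuous (dualG σ φ f Q) := by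
  unfold dualG
  have := h.cont
  fun_prop

lemma dual_bound {σ τ c A : ℝ} {N : ℕ} {φ : Tile → ℝ → ℂ} (hσ : 0 < σ) (hA : 0 ≤ A)
    (h : Pk σ τ c N A φ) {f : ℝ → ℂ} (hf : AEStronglyMeasurable f) (hf1 : ∀ x, ‖f x‖ ≤ 1)
    (Q : Finset Tile) :
    ∑ P ∈ Q, sc σ P * ‖∫ z, f z * φ P z‖ ^ 2 ≤ ∫ y, ‖f y‖ * ‖dualG σ φ f Q y‖ := by
  have e : ((∑ P ∈ Q, sc σ P * ‖∫ z, f z * φ P z‖ ^ 2 : ℝ) : ℂ) = ∫ y, f y * dualG σ φ f Q y := by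
    unfold dualG
    simp only [Finset.mul_sum]
    rw [integral_finsetSum]
    · push_cast
      apply Finset.sum_congr rfl; intro P _
      have : ∀ y, f y * (sc σ P * conj (∫ z, f z * φ P z) * φ P y)
        = (sc σ P * conj (∫ z, f z * φ P z)) * (f y * φ P y) := fun y => by ring
      simp only [this]
      rw [integral_const_mul, ← Complex.mul_conj']
      ring
    · intro P _
      have := (h.integrable_mul hσ hA hf hf1 P).const_mul (sc σ P * conj (∫ z, f z * φ P z))
      refine this.congr (Eventually.of_forall fun y => ?_)
      simp only; ring
  have h3 := congrArg norm e
  rw [Complex.norm_real, Real.norm_of_nonneg] at h3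
  · rw [h3]
    refine (norm_integral_le_integral_norm _).trans (le_of_eq ?_)
    simp only [norm_mul]
  · exact Finset.sum_nonneg fun P _ => mul_nonneg (sc_pos hσ P).le (sq_nonneg _)

lemma wt_inv_le (c ℓ y : ℝ) : (wt c ℓ y ^ 2)⁻¹ ≤ (1 + ((y - c)/ℓ)^2)⁻¹ := by
  have := wt_one_le c ℓ y
  have h2 : wt c ℓ y = 1 + ((y - c)/ℓ)^2 := rfl
  rw [← h2]
  apply inv_anti₀ (by linarith); nlinarith

lemma integrable_f_wt {f : ℝ → ℂ} (hf : AEStronglyMeasurable f) (hf1 : ∀ x, ‖f x‖ ≤ 1) (c : ℝ) {ℓ : ℝ}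
    (hℓ : 0 < ℓ) : Integrable fun y => ‖f y‖ ^ 2 * (wt c ℓ y ^ 2)⁻¹ := by
  refine Integrable.mono' (integrable_cauchy hℓ c) ?_ (Eventually.of_forall fun y => ?_)
  · refine (hf.norm.pow 2).mul ?_
    apply Continuous.aestronglyMeasurable
    exact ((wt_cont c ℓ).pow 2).inv₀ fun y => (pow_pos (wt_pos c ℓ y) 2).ne'
  · have := wt_pos c ℓ y
    rw [Real.norm_of_nonneg (by positivity)]
    have h1 : ‖f y‖ ^ 2 ≤ 1 := pow_le_one₀ (norm_nonneg _) (hf1 y)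
    have h2 := wt_inv_le c ℓ y
    have h3 : 0 ≤ (wt c ℓ y ^ 2)⁻¹ := by positivity
    nlinarith

/-- `TT*` conclusion -/
lemma ttstar {σ τ c A : ℝ} {N : ℕ} {φ : Tile → ℝ → ℂ} (hσ : 0 < σ) (hA : 0 ≤ A)
    (h : Pk σ τ c N A φ) {f : ℝ → ℂ} (hf : AEStronglyMeasurable f) (hf1 : ∀ x, ‖f x‖ ≤ 1)
    {J : Tile} {Q : Finset Tile} (hQ : ∀ P ∈ Q, Iv σ P ⊆ Iv σ J) {K : ℝ} (hK : 0 < K)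
    (hB : ∫ y, wt (lf σ J) (sc σ J) y ^ 2 * ‖dualG σ φ f Q y‖ ^ 2 ≤
      K * ∑ P ∈ Q, sc σ P * ‖∫ z, f z * φ P z‖ ^ 2) :
    ∑ P ∈ Q, sc σ P * ‖∫ z, f z * φ P z‖ ^ 2 ≤
      K * ∫ y, ‖f y‖ ^ 2 * (wt (lf σ J) (sc σ J) y ^ 2)⁻¹ := by
  set X := ∑ P ∈ Q, sc σ P * ‖∫ z, f z * φ P z‖ ^ 2 with hX
  have hJ := sc_pos hσ J
  have i1 := integrable_f_wt hf hf1 (lf σ J) hJ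
  have i2 : Integrable fun y => wt (lf σ J) (sc σ J) y ^ 2 * ‖dualG σ φ f Q y‖ ^ 2 :=
    (gram_expand hσ hA h hQ _).1
  have h1 := dual_bound hσ hA h hf hf1 Q
  have h2 : ∫ y, ‖f y‖ * ‖dualG σ φ f Q y‖ ≤ ∫ y, ((K/2) * (‖f y‖ ^ 2 * (wt (lf σ J) (sc σ J) y ^ 2)⁻¹)
      + (K⁻¹/2) * (wt (lf σ J) (sc σ J) y ^ 2 * ‖dualG σ φ f Q y‖ ^ 2)) := by
    apply integral_mono_of_nonneg
    · exact Eventually.of_forall fun y => by positivity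
    · exact (i1.const_mul _).add (i2.const_mul _)
    · refine Eventually.of_forall fun y => ?_
      simp only
      have hw := wt_pos (lf σ J) (sc σ J) y
      set w := wt (lf σ J) (sc σ J) y
      set a := ‖f y‖
      set b := ‖dualG σ φ f Q y‖
      have e1 : (K/2) * (a ^ 2 * (w ^ 2)⁻¹) + (K⁻¹/2) * (w ^ 2 * b ^ 2) - a * b
        = (K * a / w - w * b)^2 / (2 * K) := by field_simp; ring
      have : 0 ≤ (K * a / w - w * b)^2 / (2 * K) := by positivity
      linarith
  rw [integral_add (i1.const_mul _) (i2.const_mul _), integral_const_mul, integral_const_mul] at h2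
  have h3 : (K⁻¹/2) * ∫ y, wt (lf σ J) (sc σ J) y ^ 2 * ‖dualG σ φ f Q y‖ ^ 2 ≤ X / 2 := by
    have := mul_le_mul_of_nonneg_left hB (show 0 ≤ K⁻¹/2 by positivity)
    refine this.trans (le_of_eq ?_)
    field_simp
  linarith

/-- sum over pairwise disjoint small intervals away from the top -/
lemma off_sum {σ : ℝ} (hσ : 0 < σ) {P P0 : Tile} (hP : Iv σ P ⊆ Iv σ P0) (S : Finset Tile)
    (hlt : ∀ P' ∈ S, sc σ P' < sc σ P) (hdis : ∀ P' ∈ S, Disjoint (Iv σ P') (Iv σ P0))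
    (hpair : ∀ P' ∈ S, ∀ P'' ∈ S, P' ≠ P'' → Disjoint (Iv σ P') (Iv σ P'')) :
    ∑ P' ∈ S, sc σ P' * kr σ P P' ≤ 16 * Real.pi * ((br (lf σ P) (sc σ P) (lf σ P0) ^ 2)⁻¹ +
      (br (lf σ P) (sc σ P) (lf σ P0 + sc σ P0) ^ 2)⁻¹) := by
  have hs := sc_pos hσ P
  set κ := (br (lf σ P) (sc σ P) (lf σ P0) ^ 2)⁻¹ + (br (lf σ P) (sc σ P) (lf σ P0 + sc σ P0) ^ 2)⁻¹ with hκ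
  have hb1 := br_pos hs (lf σ P) (lf σ P0)
  have hb2 := br_pos hs (lf σ P) (lf σ P0 + sc σ P0)
  have hκ0 : 0 ≤ κ := by positivity
  have hib := integrable_br hs (lf σ P)
  have term : ∀ P' ∈ S, sc σ P' * kr σ P P' ≤
      16 * (sc σ P)⁻¹ * κ * ∫ y in Iv σ P', (br (lf σ P) (sc σ P) y ^ 2)⁻¹ := by
    intro P' hP'
    have hs' := sc_pos hσ P'
    have hvol : ∫ _y in Iv σ P', kr σ P P' = sc σ P' * kr σ P P' := by
      rw [setIntegral_const]; unfold Iv; simp [hs'.le]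
    rw [← hvol, ← integral_const_mul]
    apply setIntegral_mono_on
    · refine integrableOn_const ?_ ?_
      · unfold Iv; simp
      · exact enorm_ne_top
    · exact (hib.const_mul _).integrableOn
    · unfold Iv; exact measurableSet_Ico
    intro y hy
    have hy0 : y ∉ Iv σ P0 := fun hc => Set.disjoint_left.mp (hdis P' hP') hy hc
    have hlf := hP (lf_mem hσ P)
    -- comparison of brackets
    have c1 : br (lf σ P) (sc σ P) y ≤ 2 * br (lf σ P) (sc σ P) (lf σ P') := by
      rw [br_comm _ _ y, br_comm _ _ (lf σ P')]
      apply br_shift hs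
      unfold Iv at hy
      rw [abs_le]; constructor <;> linarith [hy.1, hy.2, hlt P' hP']
    have hby := br_pos hs (lf σ P) y
    have c2 : (br (lf σ P) (sc σ P) y ^ 2)⁻¹ ≤ κ := by
      unfold Iv at hy0 hlf
      rw [Set.mem_Ico, not_and_or, not_le, not_lt] at hy0
      rcases hy0 with h | h
      · have : br (lf σ P) (sc σ P) (lf σ P0) ≤ br (lf σ P) (sc σ P) y := by
          unfold br; gcongr 1 + ?_ / _
          rw [abs_sub_comm, abs_sub_comm y, abs_of_nonneg (by linarith [hlf.1]), abs_of_nonneg (by linarith [hlf.1])]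
          linarith
        have := inv_anti₀ (by positivity) (pow_le_pow_left₀ hb1.le this 2)
        have : 0 ≤ (br (lf σ P) (sc σ P) (lf σ P0 + sc σ P0) ^ 2)⁻¹ := by positivity
        linarith
      · have : br (lf σ P) (sc σ P) (lf σ P0 + sc σ P0) ≤ br (lf σ P) (sc σ P) y := by
          unfold br; gcongr 1 + ?_ / _
          rw [abs_of_nonneg (by linarith [hlf.2]), abs_of_nonneg (by linarith [hlf.2])]
          linarith
        have := inv_anti₀ (by positivity) (pow_le_pow_left₀ hb2.le this 2)
        have : 0 ≤ (br (lf σ P) (sc σ P) (lf σ P0) ^ 2)⁻¹ := by positivity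
        linarith
    unfold kr
    set b := br (lf σ P) (sc σ P) y
    set b' := br (lf σ P) (sc σ P) (lf σ P')
    have hb' : 0 < b' := br_pos hs _ _
    have c3 : (b' ^ 4)⁻¹ ≤ 16 * ((b ^ 2)⁻¹ * (b ^ 2)⁻¹) := by
      have : (b / 2) ^ 4 ≤ b' ^ 4 := pow_le_pow_left₀ (by positivity) (by linarith) 4
      refine (inv_anti₀ (by positivity) this).trans (le_of_eq ?_)
      field_simp; norm_num
    calc (sc σ P)⁻¹ * (b' ^ 4)⁻¹ ≤ (sc σ P)⁻¹ * (16 * ((b ^ 2)⁻¹ * (b ^ 2)⁻¹)) := by gcongr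
      _ ≤ (sc σ P)⁻¹ * (16 * (κ * (b ^ 2)⁻¹)) := by gcongr
      _ = _ := by ring
  refine (Finset.sum_le_sum term).trans ?_
  rw [← Finset.mul_sum, ← integral_biUnion_finset]
  · have h1 : ∫ y in ⋃ i ∈ S, Iv σ i, (br (lf σ P) (sc σ P) y ^ 2)⁻¹ ≤ Real.pi * sc σ P :=
      (setIntegral_le_integral hib (Eventually.of_forall fun y => by
        have := br_pos hs (lf σ P) y
        simp only [Pi.zero_apply]; positivity)).trans (integral_br hs _)
    calc _ ≤ 16 * (sc σ P)⁻¹ * κ * (Real.pi * sc σ P) := by gcongr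
      _ = _ := by field_simp
  · intro P' _; unfold Iv; exact measurableSet_Ico
  · intro P' hP' P'' hP'' hne; exact hpair P' hP' P'' hP'' hne
  · intro P' _; exact hib.integrableOn

lemma tree_kappa {σ τ c ξ : ℝ} (hσ : 0 < σ) {P0 : Tile} {T : Finset Tile} (hT : IsTree σ τ c ξ P0 T) :
    ∑ P ∈ T, sc σ P * ((br (lf σ P) (sc σ P) (lf σ P0) ^ 2)⁻¹ +
      (br (lf σ P) (sc σ P) (lf σ P0 + sc σ P0) ^ 2)⁻¹) ≤ 4 * C0 * sc σ P0 := by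
  have := tree_scale_sum hσ (P0 := P0) (T := T)
    (fun P hP => (sc_le_iff hσ _ _).mp (sc_le_of_subset hσ (hT P hP).1))
    (fun P => (br (lf σ P) (sc σ P) (lf σ P0) ^ 2)⁻¹ +
      (br (lf σ P) (sc σ P) (lf σ P0 + sc σ P0) ^ 2)⁻¹) (2 * C0) (by have := C0_pos; positivity) ?_
  · linarith
  intro k
  rw [Finset.sum_add_distrib, two_mul]
  rcases (T.filter fun P => P.k = k).eq_empty_or_nonempty with h | ⟨P1, h1⟩
  · rw [h]; have := C0_pos; simp; linarith
  · rw [Finset.mem_filter] at h1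
    have hQ : ∀ P ∈ T.filter (fun P => P.k = k), P.k = k ∧ P.m = P1.m := by
      intro P hP
      rw [Finset.mem_filter] at hP
      exact ⟨hP.2, tree_same_m hσ hT hP.1 h1.1 (by rw [hP.2, h1.2])⟩
    exact add_le_add (lattice_sum hσ _ k _ hQ _) (lattice_sum hσ _ k _ hQ _)

/-- near tiles of different scales satisfy a quantitative bound -/
lemma Near.mul_le {σ τ c : ℝ} (hσ : 0 < σ) {P P' : Tile} (h : Near σ τ c P P') (hlt : sc σ P' < sc σ P) :
    |th σ τ c P - th σ τ c P'| * sc σ P' ≤ 1/16 + 1/512 := by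
  have hs := sc_pos hσ P
  have hs' := sc_pos hσ P'
  have h32 := sc_lt_32 hσ hlt
  unfold Near at h
  have := mul_le_mul_of_nonneg_right h hs'.le
  refine this.trans ?_
  rw [add_mul, div_mul_cancel₀ _ hs'.ne', div_mul_eq_mul_div]
  have : 1/16 * sc σ P' / sc σ P ≤ 1/512 := by
    rw [div_le_iff₀ hs]; linarith
  linarith

/-- lacunarity inside a tree -/
lemma lac {σ τ ci cj ξ : ℝ} (hσ : 0 < σ) (hc : 1/2 ≤ |ci - cj| ∧ |ci - cj| ≤ 1)
    {P0 : Tile} {T : Finset Tile} (hT : IsTree σ τ ci ξ P0 T)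
    {P P' : Tile} (hP : P ∈ T) (hP' : P' ∈ T) (hlt : sc σ P' < sc σ P) :
    1/4 ≤ |th σ τ cj P - th σ τ cj P'| * sc σ P' := by
  have hs := sc_pos hσ P
  have hs' := sc_pos hσ P'
  have h32 := sc_lt_32 hσ hlt
  have e1 := th_sub (τ := τ) hσ cj ci P
  have e2 := th_sub (τ := τ) hσ cj ci P'
  have t1 := (hT P hP).2
  have t2 := (hT P' hP').2
  have a1 : |th σ τ cj P - ξ| * sc σ P ≤ 1 + 3/16 := by
    have : |th σ τ cj P - ξ| ≤ |th σ τ cj P - th σ τ ci P| + |th σ τ ci P - ξ| := abs_sub_le _ _ _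
    have := mul_le_mul_of_nonneg_right this hs.le
    have e3 : |th σ τ cj P - th σ τ ci P| * sc σ P = |ci - cj| := by
      rw [← abs_of_pos hs, ← abs_mul, e1, abs_sub_comm]
    rw [add_mul, e3] at this
    linarith [hc.2]
  have a2 : |th σ τ cj P - ξ| * sc σ P' ≤ 1/16 := by
    have := mul_le_mul_of_nonneg_left h32 (abs_nonneg (th σ τ cj P - ξ))
    linarith
  have a3 : |th σ τ cj P' - th σ τ ci P'| ≤ |th σ τ cj P - th σ τ cj P'| + |th σ τ cj P - ξ| + |th σ τ ci P' - ξ| := by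
    have x1 : |th σ τ cj P' - th σ τ ci P'| ≤ |th σ τ cj P' - ξ| + |ξ - th σ τ ci P'| := abs_sub_le _ _ _
    have x2 : |th σ τ cj P' - ξ| ≤ |th σ τ cj P' - th σ τ cj P| + |th σ τ cj P - ξ| := abs_sub_le _ _ _
    rw [abs_sub_comm ξ] at x1
    rw [abs_sub_comm (th σ τ cj P') (th σ τ cj P)] at x2
    linarith
  have a4 := mul_le_mul_of_nonneg_right a3 hs'.le
  have e3 : |th σ τ cj P' - th σ τ ci P'| * sc σ P' = |ci - cj| := by
    rw [← abs_of_pos hs', ← abs_mul, e2, abs_sub_comm]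
  rw [e3] at a4
  have := hc.1
  nlinarith

/-- constant of the energy estimate -/
noncomputable def KE : ℝ := 25 * Real.pi * C0 * (1 + 512 * Real.pi)

lemma KE_pos : 0 < KE := by have := C0_pos; unfold KE; positivity

lemma disj_of_same {σ : ℝ} (hσ : 0 < σ) {P P' : Tile} (hk : P.k = P'.k) (hm : P.m = P'.m) (hne : P ≠ P') :
    Disjoint (Iv σ P) (Iv σ P') := by
  have hs : sc σ P = sc σ P' := by unfold sc; rw [hk]
  rcases nested hσ hs.le with h | h
  · exfalso
    apply hne
    unfold Iv at h
    have hp := sc_pos hσ P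
    rw [Ico_subset_Ico_iff (by linarith)] at h
    have hl : lf σ P = lf σ P' := by linarith [h.1, h.2]
    unfold lf at hl
    rw [hs] at hl
    have := mul_right_cancel₀ (sc_pos hσ P').ne' hl
    ext
    · exact hk
    · exact hm
    · exact_mod_cast this
  · exact h

open Classical in
theorem energy_bound {σ τ ci cj A : ℝ} {N : ℕ} {φ : Tile → ℝ → ℂ} (hσ : 0 < σ) (hA : 0 < A)
    (hc : 1/2 ≤ |ci - cj| ∧ |ci - cj| ≤ 1)
    (h : Pk σ τ cj N A φ) {f : ℝ → ℂ} (hf : AEStronglyMeasurable f) (hf1 : ∀ x, ‖f x‖ ≤ 1)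
    {J : Tile} {𝔓 : Finset Tile} (h𝔓 : ∀ P ∈ 𝔓, Iv σ P ⊆ Iv σ J) :
    Energy σ τ ci cj (fun P => ‖∫ z, f z * φ P z‖) 𝔓
      (KE * A ^ 2 * ∫ y, ‖f y‖ ^ 2 * (wt (lf σ J) (sc σ J) y ^ 2)⁻¹) := by
  intro n T ξ top μ hμ hsub htree hdisj hstr hF hbig
  set F : Tile → ℝ := fun P => ‖∫ z, f z * φ P z‖ with hFdef
  set Q := Finset.univ.biUnion T with hQdef
  have hQ : ∀ P ∈ Q, Iv σ P ⊆ Iv σ J := by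
    intro P hP
    obtain ⟨a, -, ha⟩ := Finset.mem_biUnion.mp hP
    exact h𝔓 P (hsub a ha)
  have hsumQ : ∀ g : Tile → ℝ, ∑ P ∈ Q, g P = ∑ a, ∑ P ∈ T a, g P := by
    intro g
    exact Finset.sum_biUnion (fun a _ b _ hab => hdisj a b hab)
  set X := ∑ P ∈ Q, sc σ P * F P ^ 2 with hX
  have hXbig : μ ^ 2 * ∑ a, sc σ (top a) ≤ X := by
    rw [hX, hsumQ, Finset.mul_sum]
    exact Finset.sum_le_sum fun a _ => hbig a
  refine hXbig.trans ?_
  have hR : ∑ P ∈ Q, ∑ P' ∈ Q with (sc σ P' < sc σ P ∧ Near σ τ cj P P'), 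
      sc σ P * sc σ P' * (‖conj (∫ z, f z * φ P z)‖ * ‖conj (∫ z, f z * φ P' z)‖) * kr σ P P' ≤
      256 * Real.pi * C0 * X := by
    simp only [RCLike.norm_conj]
    rw [hsumQ]
    have per : ∀ a, ∑ P ∈ T a, ∑ P' ∈ Q with (sc σ P' < sc σ P ∧ Near σ τ cj P P'),
        sc σ P * sc σ P' * (F P * F P') * kr σ P P' ≤ 256 * Real.pi * C0 * (μ ^ 2 * sc σ (top a)) := by
      intro a
      have inner : ∀ P ∈ T a, ∑ P' ∈ Q with (sc σ P' < sc σ P ∧ Near σ τ cj P P'),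
          sc σ P * sc σ P' * (F P * F P') * kr σ P P' ≤ (64 * Real.pi * μ ^ 2) *
          (sc σ P * ((br (lf σ P) (sc σ P) (lf σ (top a)) ^ 2)⁻¹ +
      (br (lf σ P) (sc σ P) (lf σ (top a) + sc σ (top a)) ^ 2)⁻¹)) := by
        intro P hP
        have hs := sc_pos hσ P
        have ho := off_sum hσ (htree a P hP).1 (Q.filter fun P' => sc σ P' < sc σ P ∧ Near σ τ cj P P')
          (fun P' hP' => (Finset.mem_filter.mp hP').2.1) ?_ ?_
        · calc _ ≤ ∑ P' ∈ Q with (sc σ P' < sc σ P ∧ Near σ τ cj P P'), 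
                (4 * μ ^ 2 * sc σ P) * (sc σ P' * kr σ P P') := by
                apply Finset.sum_le_sum
                intro P' hP'
                obtain ⟨b, -, hb⟩ := Finset.mem_biUnion.mp (Finset.mem_filter.mp hP').1
                have f1 := hF a P hP
                have f2 := hF b P' hb
                have k0 := kr_nonneg hσ P P'
                have hs' := sc_pos hσ P'
                have f0 : 0 ≤ F P' := norm_nonneg _
                have : F P * F P' ≤ (2 * μ) * (2 * μ) := mul_le_mul f1 f2 f0 (by positivity)
                calc _ ≤ sc σ P * sc σ P' * ((2 * μ) * (2 * μ)) * kr σ P P' := by gcongr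
                  _ = _ := by ring
            _ ≤ (4 * μ ^ 2 * sc σ P) * (16 * Real.pi * ((br (lf σ P) (sc σ P) (lf σ (top a)) ^ 2)⁻¹ +
      (br (lf σ P) (sc σ P) (lf σ (top a) + sc σ (top a)) ^ 2)⁻¹)) := by
                rw [← Finset.mul_sum]
                exact mul_le_mul_of_nonneg_left ho (by positivity)
            _ = _ := by ring
        · intro P' hP'
          rw [Finset.mem_filter] at hP'
          obtain ⟨b, -, hb⟩ := Finset.mem_biUnion.mp hP'.1
          have hn := hP'.2.2.mul_le hσ hP'.2.1
          by_cases hab : a = b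
          · subst hab
            have := lac hσ hc (htree a) hP hb hP'.2.1
            linarith
          · exact hstr a b hab P hP P' hb hP'.2.1 (by linarith)
        · -- pairwise disjointness
          have key : ∀ P' ∈ Q.filter (fun P' => sc σ P' < sc σ P ∧ Near σ τ cj P P'),
              ∀ P'' ∈ Q.filter (fun P' => sc σ P' < sc σ P ∧ Near σ τ cj P P'), P' ≠ P'' →
              sc σ P'' ≤ sc σ P' → Disjoint (Iv σ P') (Iv σ P'') := by
            intro P' hP' P'' hP'' hne hle
            rw [Finset.mem_filter] at hP' hP''
            obtain ⟨b, -, hb⟩ := Finset.mem_biUnion.mp hP'.1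
            obtain ⟨b', -, hb'⟩ := Finset.mem_biUnion.mp hP''.1
            have n1 := hP'.2.2.mul_le hσ hP'.2.1
            have n2 := hP''.2.2.mul_le hσ hP''.2.1
            have s1 := sc_pos hσ P'
            have s2 := sc_pos hσ P''
            have tri : |th σ τ cj P' - th σ τ cj P''| ≤ |th σ τ cj P - th σ τ cj P'| + |th σ τ cj P - th σ τ cj P''| := by
              rw [abs_sub_comm (th σ τ cj P) (th σ τ cj P')]; exact abs_sub_le _ _ _
            have tri' := mul_le_mul_of_nonneg_right tri s2.le
            rcases hle.lt_or_eq with hlt | heq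
            · have h32 := sc_lt_32 hσ hlt
              have := mul_le_mul_of_nonneg_left h32 (abs_nonneg (th σ τ cj P - th σ τ cj P'))
              have hsmall : |th σ τ cj P' - th σ τ cj P''| * sc σ P'' ≤ 1/8 := by linarith
              by_cases hbb : b = b'
              · subst hbb
                have := lac hσ hc (htree b) hb hb' hlt
                linarith
              · have := hstr b b' hbb P' hb P'' hb' hlt hsmall
                exact (this.mono_right (htree b P' hb).1).symm
            · have hk : P'.k = P''.k := le_antisymm ((sc_le_iff hσ _ _).mp heq.ge) ((sc_le_iff hσ _ _).mp heq.le)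
              refine disj_of_same hσ hk (same_m (τ := τ) hσ cj hk ?_) hne
              rw [← heq] at n1 ⊢
              linarith
          intro P' hP' P'' hP'' hne
          rcases le_total (sc σ P'') (sc σ P') with hh | hh
          · exact key P' hP' P'' hP'' hne hh
          · exact (key P'' hP'' P' hP' hne.symm hh).symm
      refine (Finset.sum_le_sum inner).trans ?_
      rw [← Finset.mul_sum]
      refine (mul_le_mul_of_nonneg_left (tree_kappa hσ (htree a)) (by positivity)).trans (le_of_eq ?_)
      ring
    refine (Finset.sum_le_sum fun a _ => per a).trans ?_
    rw [← Finset.mul_sum, ← Finset.mul_sum]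
    have := C0_pos
    exact mul_le_mul_of_nonneg_left hXbig (by positivity)
  have hB := gram_bound hσ hA.le h hQ (fun P => conj (∫ z, f z * φ P z)) hR
  have := C0_pos
  refine ttstar hσ hA.le h hf hf1 hQ (K := KE * A^2) (mul_pos KE_pos (by positivity)) ?_
  refine hB.trans (le_of_eq ?_)
  simp only [RCLike.norm_conj]
  rw [hX]
  unfold KE
  ring

/-- single tree version -/
lemma tree_gram {σ τ ci cj ξ A : ℝ} {N : ℕ} {φ : Tile → ℝ → ℂ} (hσ : 0 < σ) (hA : 0 < A)
    (hc : 1/2 ≤ |ci - cj| ∧ |ci - cj| ≤ 1)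
    (h : Pk σ τ cj N A φ) (f : ℝ → ℂ) {P0 : Tile} {T : Finset Tile} (hT : IsTree σ τ ci ξ P0 T) :
    ∫ y, wt (lf σ P0) (sc σ P0) y ^ 2 * ‖dualG σ φ f T y‖ ^ 2 ≤
      (KE * A ^ 2) * ∑ P ∈ T, sc σ P * ‖∫ z, f z * φ P z‖ ^ 2 := by
  classical
  have hB := gram_bound hσ hA.le h (fun P hP => (hT P hP).1) (fun P => conj (∫ z, f z * φ P z)) (R := 0) ?_
  · refine hB.trans ?_
    simp only [RCLike.norm_conj]
    have h0 : 0 ≤ ∑ P ∈ T, sc σ P * ‖∫ z, f z * φ P z‖ ^ 2 :=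
      Finset.sum_nonneg fun P _ => mul_nonneg (sc_pos hσ P).le (sq_nonneg _)
    have := C0_pos
    have e : 25 * Real.pi * A ^ 2 * (C0 * ∑ P ∈ T, sc σ P * ‖∫ z, f z * φ P z‖ ^ 2 + 2 * 0)
      = (25 * Real.pi * C0 * 1) * A^2 * ∑ P ∈ T, sc σ P * ‖∫ z, f z * φ P z‖ ^ 2 := by ring
    rw [e]
    unfold KE
    have := Real.pi_pos
    gcongr
    linarith
  · apply le_of_eq
    apply Finset.sum_eq_zero; intro P hP
    rw [Finset.filter_false_of_mem, Finset.sum_empty]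
    intro P' hP' hcon
    have h1 := hcon.2.mul_le hσ hcon.1
    have h2 := lac hσ hc hT hP hP' hcon.1
    linarith

end BHT
end

section
open MeasureTheory Filter Set
open scoped ENNReal ComplexConjugate
namespace BHT

/-- averages of `w` at scales at least `s` around `c` are bounded by `a` -/
def Avg (w : ℝ → ℝ≥0∞) (c s a : ℝ) : Prop :=
  ∀ R, s ≤ R → ∫⁻ y in Icc (c - R) (c + R), w y ≤ ENNReal.ofReal (a * R)

lemma br_dyadic {s : ℝ} (hs : 0 < s) (c y : ℝ) :
    ENNReal.ofReal ((br c s y ^ 2)⁻¹) ≤ ∑' k : ℕ, (Icc (c - 2 ^ k * s) (c + 2 ^ k * s)).indicator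
      (fun _ => ENNReal.ofReal (4 * (1/4)^k)) y := by
  have hex : ∃ k : ℕ, |y - c| ≤ 2 ^ k * s := by
    obtain ⟨k, hk⟩ := pow_unbounded_of_one_lt (|y - c| / s) (by norm_num : (1:ℝ) < 2)
    exact ⟨k, by rw [div_lt_iff₀ hs] at hk; exact hk.le⟩
  classical
  set k := Nat.find hex with hk
  have h1 : |y - c| ≤ 2 ^ k * s := Nat.find_spec hex
  refine le_trans ?_ (ENNReal.le_tsum k)
  have hmem : y ∈ Icc (c - 2 ^ k * s) (c + 2 ^ k * s) := by
    rw [abs_le] at h1; constructor <;> linarith [h1.1, h1.2]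
  rw [indicator_of_mem hmem]
  apply ENNReal.ofReal_le_ofReal
  have hb := br_one_le hs c y
  rcases Nat.eq_zero_or_pos k with h0 | hpos
  · rw [h0]; simp only [pow_zero, mul_one]
    have : (br c s y ^ 2)⁻¹ ≤ 1 := inv_le_one_of_one_le₀ (one_le_pow₀ hb)
    linarith
  · obtain ⟨j, hj⟩ : ∃ j, k = j + 1 := ⟨k - 1, by omega⟩
    have h2 : ¬ (|y - c| ≤ 2 ^ j * s) := Nat.find_min hex (by omega)
    push Not at h2
    have h3 : (2:ℝ) ^ j ≤ br c s y := by
      unfold br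
      have : (2:ℝ)^j ≤ |y - c| / s := by rw [le_div_iff₀ hs]; exact h2.le
      linarith
    rw [hj]
    have h4 : (br c s y ^ 2)⁻¹ ≤ (((2:ℝ) ^ j)^2)⁻¹ := by
      apply inv_anti₀ (by positivity); gcongr
    refine h4.trans (le_of_eq ?_)
    rw [← pow_mul, mul_comm j 2, pow_mul, one_div, inv_pow, pow_succ]
    norm_num
    field_simp
    ring

lemma avg_tail {w : ℝ → ℝ≥0∞} (hw : Measurable w) {c s a : ℝ} (hs : 0 < s) (ha : 0 ≤ a)
    (h : Avg w c s a) : ∫⁻ y, w y * ENNReal.ofReal ((br c s y ^ 2)⁻¹) ≤ ENNReal.ofReal (8 * a * s) := by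
  calc _ ≤ ∫⁻ y, ∑' k : ℕ, w y * (Icc (c - 2 ^ k * s) (c + 2 ^ k * s)).indicator
          (fun _ => ENNReal.ofReal (4 * (1/4)^k)) y := by
        apply lintegral_mono; intro y
        simp only
        rw [ENNReal.tsum_mul_left]
        gcongr
        exact br_dyadic hs c y
    _ = ∑' k : ℕ, ∫⁻ y, w y * (Icc (c - 2 ^ k * s) (c + 2 ^ k * s)).indicator
          (fun _ => ENNReal.ofReal (4 * (1/4)^k)) y := by
        apply lintegral_tsum
        intro k
        exact (hw.mul (measurable_const.indicator measurableSet_Icc)).aemeasurable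
    _ ≤ ∑' k : ℕ, ENNReal.ofReal (4 * a * s * (1/2)^k) := by
        apply ENNReal.tsum_le_tsum
        intro k
        have : ∀ y, w y * (Icc (c - 2 ^ k * s) (c + 2 ^ k * s)).indicator
            (fun _ => ENNReal.ofReal (4 * (1/4)^k)) y =
            (Icc (c - 2 ^ k * s) (c + 2 ^ k * s)).indicator (fun y => w y * ENNReal.ofReal (4 * (1/4)^k)) y := by
          intro y; by_cases hy : y ∈ Icc (c - 2 ^ k * s) (c + 2 ^ k * s) <;> simp [hy]
        simp only [this]
        rw [lintegral_indicator measurableSet_Icc, lintegral_mul_const _ hw]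
        have h2 := h (2 ^ k * s) (le_mul_of_one_le_left hs.le (one_le_pow₀ (by norm_num)))
        calc _ ≤ ENNReal.ofReal (a * (2 ^ k * s)) * ENNReal.ofReal (4 * (1/4)^k) := by gcongr
          _ = _ := by
            rw [← ENNReal.ofReal_mul (by positivity)]
            congr 1
            have : (2:ℝ)^k * (1/4)^k = (1/2)^k := by rw [← mul_pow]; norm_num
            rw [← this]; ring
    _ = _ := by
        rw [← ENNReal.ofReal_tsum_of_nonneg (fun k => by positivity)]
        · rw [tsum_mul_left, tsum_geometric_two]; congr 1; ring
        · exact summable_geometric_two.mul_left _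

/-- coefficient of a wave packet -/
noncomputable def cf (φ : Tile → ℝ → ℂ) (f : ℝ → ℂ) (P : Tile) : ℝ := ‖∫ z, f z * φ P z‖

lemma cf_nonneg (φ : Tile → ℝ → ℂ) (f : ℝ → ℂ) (P : Tile) : 0 ≤ cf φ f P := norm_nonneg _

/-- single tile bound with gain away from the support -/
lemma cf_le_far {σ τ c A : ℝ} {N : ℕ} {φ : Tile → ℝ → ℂ} (hσ : 0 < σ) (hA : 0 ≤ A)
    (h : Pk σ τ c N A φ) {f : ℝ → ℂ} (hf : Measurable f) {P : Tile} {a : ℝ} (ha : 0 ≤ a)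
    (hav : Avg (fun y => ‖f y‖ₑ) (lf σ P) (sc σ P) a) {D : ℝ} (hD : 1 ≤ D)
    (hfar : ∀ y, f y ≠ 0 → D ≤ br (lf σ P) (sc σ P) y) :
    cf φ f P ≤ 8 * A * a * (D ^ N)⁻¹ := by
  have hs := sc_pos hσ P
  have key : ENNReal.ofReal (cf φ f P) ≤ ENNReal.ofReal (8 * A * a * (D ^ N)⁻¹) := by
    unfold cf
    rw [ofReal_norm]
    refine (enorm_integral_le_lintegral_enorm _).trans ?_
    calc _ ≤ ∫⁻ y, ENNReal.ofReal (A / sc σ P * (D ^ N)⁻¹) * (‖f y‖ₑ * ENNReal.ofReal ((br (lf σ P) (sc σ P) y ^ 2)⁻¹)) := by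
          apply lintegral_mono; intro y
          simp only [enorm_mul]
          by_cases hy : f y = 0
          · simp [hy]
          have hb := br_one_le hs (lf σ P) y
          have h1 := hfar y hy
          have h2 : ‖φ P y‖ₑ ≤ ENNReal.ofReal (A / sc σ P * (D ^ N)⁻¹) * ENNReal.ofReal ((br (lf σ P) (sc σ P) y ^ 2)⁻¹) := by
            rw [← ofReal_norm, ← ENNReal.ofReal_mul (by positivity)]
            apply ENNReal.ofReal_le_ofReal
            refine (h.decay P y).trans ?_
            rw [mul_assoc]
            apply mul_le_mul_of_nonneg_left _ (by positivity)
            rw [← mul_inv]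
            apply inv_anti₀ (by positivity)
            calc D ^ N * br (lf σ P) (sc σ P) y ^ 2 ≤ br (lf σ P) (sc σ P) y ^ N * br (lf σ P) (sc σ P) y ^ 10 := by
                  gcongr
                  · norm_num
              _ = _ := by rw [pow_add]
          calc _ ≤ ‖f y‖ₑ * (ENNReal.ofReal (A / sc σ P * (D ^ N)⁻¹) * ENNReal.ofReal ((br (lf σ P) (sc σ P) y ^ 2)⁻¹)) := by gcongr
            _ = _ := by ring
      _ ≤ ENNReal.ofReal (A / sc σ P * (D ^ N)⁻¹) * ENNReal.ofReal (8 * a * sc σ P) := by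
          rw [lintegral_const_mul' _ _ ENNReal.ofReal_ne_top]
          gcongr
          exact avg_tail hf.enorm hs ha hav
      _ = _ := by
          rw [← ENNReal.ofReal_mul (by positivity)]
          congr 1; field_simp
  have hD0 : 0 < D := by linarith
  exact (ENNReal.ofReal_le_ofReal_iff (by positivity)).mp key

lemma cf_le {σ τ c A : ℝ} {N : ℕ} {φ : Tile → ℝ → ℂ} (hσ : 0 < σ) (hA : 0 ≤ A)
    (h : Pk σ τ c N A φ) {f : ℝ → ℂ} (hf : Measurable f) {P : Tile} {a : ℝ} (ha : 0 ≤ a)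
    (hav : Avg (fun y => ‖f y‖ₑ) (lf σ P) (sc σ P) a) :
    cf φ f P ≤ 8 * A * a := by
  have := cf_le_far hσ hA h hf ha hav le_rfl (fun y _ => br_one_le (sc_pos hσ P) _ _)
  simpa using this

/-- energy input -/
lemma energy_int {f : ℝ → ℂ} (hf : Measurable f) (hf1 : ∀ x, ‖f x‖ ≤ 1) {c s a : ℝ} (hs : 0 < s) (ha : 0 ≤ a)
    (hav : Avg (fun y => ‖f y‖ₑ) c s a) : ∫ y, ‖f y‖ ^ 2 * (wt c s y ^ 2)⁻¹ ≤ 16 * a * s := by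
  rw [integral_eq_lintegral_of_nonneg_ae]
  · apply ENNReal.toReal_le_of_le_ofReal (by positivity)
    calc _ ≤ ∫⁻ y, ENNReal.ofReal 2 * (‖f y‖ₑ * ENNReal.ofReal ((br c s y ^ 2)⁻¹)) := by
          apply lintegral_mono; intro y
          simp only
          rw [← ofReal_norm, ← ENNReal.ofReal_mul (by positivity), ← ENNReal.ofReal_mul (by positivity)]
          apply ENNReal.ofReal_le_ofReal
          have h1 : ‖f y‖ ^ 2 ≤ ‖f y‖ := by have := hf1 y; nlinarith [norm_nonneg (f y)]
          have h2 : (wt c s y ^ 2)⁻¹ ≤ 2 * (br c s y ^ 2)⁻¹ := by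
            have hb := br_one_le hs c y
            have hw := wt_one_le c s y
            have h3 : br c s y ^ 2 ≤ 2 * wt c s y := by
              unfold br wt
              have e : ((y - c)/s)^2 = (|y - c| / s)^2 := by rw [div_pow, div_pow, sq_abs]
              rw [e]; nlinarith [sq_nonneg (|y - c| / s - 1)]
            rw [← one_div, ← div_eq_mul_inv, div_le_div_iff₀ (by positivity) (by positivity)]
            nlinarith
          calc _ ≤ ‖f y‖ * (2 * (br c s y ^ 2)⁻¹) := by gcongr
            _ = _ := by ring
      _ ≤ ENNReal.ofReal 2 * ENNReal.ofReal (8 * a * s) := by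
          rw [lintegral_const_mul' _ _ ENNReal.ofReal_ne_top]
          gcongr
          exact avg_tail hf.enorm hs ha hav
      _ = _ := by rw [← ENNReal.ofReal_mul (by positivity)]; congr 1; ring
  · exact Eventually.of_forall fun y => by have := wt_pos c s y; positivity
  · have := wt_cont c s
    refine (((hf.norm.pow_const 2).mul (this.measurable.pow_const 2).inv)).aestronglyMeasurable

end BHT
end

section
open MeasureTheory Filter Set
open scoped ENNReal ComplexConjugate
namespace BHT

lemma geom_two (S : Finset ℤ) {x : ℝ} (hx : 0 < x) :
    ∑ k ∈ S, min (x / 32 ^ k) (32 ^ k / x) ≤ 4 := by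
  obtain ⟨k0, h1, h2⟩ := exists_mem_Ico_zpow hx (by norm_num : (1:ℝ) < 32)
  rw [← Finset.sum_filter_add_sum_filter_not S (fun k => k ≤ k0)]
  have e1 : ∑ k ∈ S with k ≤ k0, min (x / 32 ^ k) (32 ^ k / x) ≤ 2 := by
    calc _ ≤ ∑ k ∈ S with k ≤ k0, (32:ℝ)^k / x := Finset.sum_le_sum fun k _ => min_le_right _ _
      _ ≤ (2 * 32 ^ k0) / x := by
        rw [← Finset.sum_div]
        gcongr
        exact geom_int _ _ fun k hk => (Finset.mem_filter.mp hk).2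
      _ ≤ 2 := by rw [div_le_iff₀ hx]; linarith
  have e2 : ∑ k ∈ S with ¬ k ≤ k0, min (x / 32 ^ k) (32 ^ k / x) ≤ 2 := by
    calc _ ≤ ∑ k ∈ S with ¬ k ≤ k0, x * (32:ℝ)^(-k) := Finset.sum_le_sum fun k _ => by
          rw [zpow_neg, ← div_eq_mul_inv]; exact min_le_left _ _
      _ = x * ∑ k ∈ (S.filter fun k => ¬ k ≤ k0).image (fun k => -k), (32:ℝ)^k := by
        rw [Finset.sum_image (fun a _ b _ h => by simpa using h), Finset.mul_sum]
      _ ≤ x * (2 * 32 ^ (-(k0+1))) := by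
        gcongr
        apply geom_int
        intro k hk
        simp only [Finset.mem_image, Finset.mem_filter] at hk
        obtain ⟨j, hj, rfl⟩ := hk
        omega
      _ ≤ 2 := by
        rw [zpow_neg]
        have : (0:ℝ) < 32 ^ (k0+1) := by positivity
        rw [← mul_assoc, ← div_eq_mul_inv, div_le_iff₀ this]; linarith
  linarith

/-- sum over the scales of a tree with two-sided decay -/
lemma tree_two_sum {σ τ c ξ : ℝ} (hσ : 0 < σ) {P0 : Tile} {T : Finset Tile} (hT : IsTree σ τ c ξ P0 T)
    {ρ y : ℝ} (hρ : 0 < ρ) :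
    ∑ P ∈ T, min (ρ / sc σ P) (sc σ P / ρ) * (br (lf σ P) (sc σ P) y ^ 2)⁻¹ ≤ 4 * C0 := by
  have hm : ∀ P ∈ T, P.k ∈ T.image Tile.k := fun P hP => Finset.mem_image_of_mem _ hP
  rw [← Finset.sum_fiberwise_of_maps_to hm]
  have hC := C0_pos
  calc _ ≤ ∑ k ∈ T.image Tile.k, min ((ρ/σ) / 32 ^ k) (32 ^ k / (ρ/σ)) * C0 := by
        apply Finset.sum_le_sum
        intro k hk
        obtain ⟨Q, hQ, hQk⟩ := Finset.mem_image.mp hk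
        calc _ = ∑ P ∈ T with P.k = k, min ((ρ/σ) / 32 ^ k) (32 ^ k / (ρ/σ)) * (br (lf σ P) (sc σ P) y ^ 2)⁻¹ := by
              apply Finset.sum_congr rfl
              intro P hP
              have : P.k = k := (Finset.mem_filter.mp hP).2
              congr 1
              unfold sc; rw [this]
              congr 1 <;> field_simp
          _ ≤ _ := by
              rw [← Finset.mul_sum]
              apply mul_le_mul_of_nonneg_left
              · apply lattice_sum hσ _ k Q.m
                intro P hP
                rw [Finset.mem_filter] at hP
                exact ⟨hP.2, tree_same_m hσ hT hP.1 hQ (hP.2.trans hQk.symm)⟩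
              · positivity
    _ ≤ 4 * C0 := by
        rw [← Finset.sum_mul]
        gcongr
        exact geom_two _ (by positivity)

/-- distance-like function of a tree -/
noncomputable def rho (σ : ℝ) (T : Finset Tile) (hT : T.Nonempty) (z : ℝ) : ℝ :=
  T.inf' hT fun P => sc σ P + |z - lf σ P|

lemma rho_le {σ : ℝ} {T : Finset Tile} (hT : T.Nonempty) {P : Tile} (hP : P ∈ T) (z : ℝ) :
    rho σ T hT z ≤ sc σ P + |z - lf σ P| := Finset.inf'_le _ hP

lemma rho_pos {σ : ℝ} (hσ : 0 < σ) {T : Finset Tile} (hT : T.Nonempty) (z : ℝ) : 0 < rho σ T hT z := by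
  unfold rho
  rw [Finset.lt_inf'_iff]
  intro P _
  have := sc_pos hσ P
  positivity

lemma rho_ex {σ : ℝ} {T : Finset Tile} (hT : T.Nonempty) (z : ℝ) :
    ∃ P ∈ T, rho σ T hT z = sc σ P + |z - lf σ P| := by
  unfold rho
  obtain ⟨P, hP, h⟩ := Finset.exists_mem_eq_inf' hT fun P => sc σ P + |z - lf σ P|
  exact ⟨P, hP, h⟩

lemma rho_lip {σ : ℝ} {T : Finset Tile} (hT : T.Nonempty) (y z : ℝ) :
    rho σ T hT z ≤ rho σ T hT y + |z - y| := by
  obtain ⟨P, hP, h⟩ := rho_ex (σ := σ) hT y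
  have := rho_le (σ := σ) hT hP z
  have := abs_sub_le z y (lf σ P)
  linarith

lemma rho_cont {σ : ℝ} {T : Finset Tile} (hT : T.Nonempty) : Continuous (rho σ T hT) := by
  have : LipschitzWith 1 (rho σ T hT) := by
    apply LipschitzWith.of_dist_le_mul
    intro x y
    rw [Real.dist_eq, Real.dist_eq, abs_le]
    have h1 := rho_lip (σ := σ) hT x y
    have h2 := rho_lip (σ := σ) hT y x
    rw [abs_sub_comm] at h1
    simp only [NNReal.coe_one, one_mul]
    constructor <;> linarith
  exact this.continuous

lemma freq_near {σ τ ci cj ξ : ℝ} (hσ : 0 < σ) (hc : |ci - cj| ≤ 1)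
    {P0 : Tile} {T : Finset Tile} (hT : IsTree σ τ ci ξ P0 T) {P : Tile} (hP : P ∈ T) :
    |th σ τ cj P - ξ| * sc σ P ≤ 2 := by
  have hs := sc_pos hσ P
  have e1 := th_sub (τ := τ) hσ cj ci P
  have t1 := (hT P hP).2
  have : |th σ τ cj P - ξ| ≤ |th σ τ cj P - th σ τ ci P| + |th σ τ ci P - ξ| := abs_sub_le _ _ _
  have := mul_le_mul_of_nonneg_right this hs.le
  have e3 : |th σ τ cj P - th σ τ ci P| * sc σ P = |ci - cj| := by
    rw [← abs_of_pos hs, ← abs_mul, e1, abs_sub_comm]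
  rw [add_mul, e3] at this
  linarith

/-- the dual function does not oscillate below the scale `rho` -/
lemma dual_osc {σ τ ci cj ξ A : ℝ} {N : ℕ} {φ : Tile → ℝ → ℂ} (hσ : 0 < σ) (hA : 0 < A)
    (hc : 1/2 ≤ |ci - cj| ∧ |ci - cj| ≤ 1)
    (h : Pk σ τ cj N A φ) (f : ℝ → ℂ) {P0 : Tile} {T : Finset Tile} (hT : IsTree σ τ ci ξ P0 T)
    (hne : T.Nonempty) {a : ℝ} (ha : 0 < a) (hcf : ∀ P ∈ T, cf φ f P ≤ 8 * A * a)
    {y z : ℝ} (hyz : |z - y| ≤ rho σ T hne y / 9) :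
    ‖dualG σ φ f T z‖ ≤ ‖dualG σ φ f T y‖ + 16 * C0 * A ^ 2 * a * (br (lf σ P0) (sc σ P0) y ^ 2)⁻¹ := by
  obtain ⟨u, hu, hlip⟩ := h.lip ξ
  have hρ := rho_pos hσ hne y
  set ρ := rho σ T hne y with hρd
  have e1 : ‖dualG σ φ f T z‖ = ‖u z * dualG σ φ f T z‖ := by rw [norm_mul, hu, one_mul]
  have e2 : ‖dualG σ φ f T y‖ = ‖u y * dualG σ φ f T y‖ := by rw [norm_mul, hu, one_mul]
  rw [e1, e2]
  have e3 : u z * dualG σ φ f T z = u y * dualG σ φ f T y +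
      ∑ P ∈ T, sc σ P * conj (∫ z, f z * φ P z) * (u z * φ P z - u y * φ P y) := by
    unfold dualG
    rw [Finset.mul_sum, Finset.mul_sum, ← Finset.sum_add_distrib]
    apply Finset.sum_congr rfl; intro P _; ring
  rw [e3]
  refine (norm_add_le _ _).trans ?_
  gcongr
  refine (norm_sum_le _ _).trans ?_
  have h0 := sc_pos hσ P0
  have hbT := br_pos h0 (lf σ P0) y
  calc _ ≤ ∑ P ∈ T, (8 * A^2 * a / 9 * 4 * (br (lf σ P0) (sc σ P0) y ^ 2)⁻¹) *
        (min (ρ / sc σ P) (sc σ P / ρ) * (br (lf σ P) (sc σ P) y ^ 2)⁻¹) := by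
        apply Finset.sum_le_sum
        intro P hP
        have hs := sc_pos hσ P
        have hb := br_one_le hs (lf σ P) y
        set b := br (lf σ P) (sc σ P) y with hbd
        have hbs : sc σ P + |y - lf σ P| = sc σ P * b := by
          rw [hbd]; unfold br; field_simp
        have hρP : ρ ≤ sc σ P * b := by rw [← hbs]; exact rho_le hne hP y
        have hl := hlip P (freq_near hσ hc.2 hT hP) y z (by rw [hbs]; linarith)
        have hF := hcf P hP
        rw [norm_mul, norm_mul, RCLike.norm_conj]
        have : ‖((sc σ P : ℝ) : ℂ)‖ = sc σ P := by simp [abs_of_pos hs]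
        rw [this]
        change sc σ P * cf φ f P * _ ≤ _
        have hbT2 : br (lf σ P0) (sc σ P0) y ≤ 2 * b := by
          have hsub := (hT P hP).1
          have h1 : |lf σ P0 - lf σ P| ≤ sc σ P0 := by
            have := hsub (lf_mem hσ P)
            unfold Iv at this
            rw [abs_le]; constructor <;> linarith [this.1, this.2]
          have h2 := br_shift h0 h1 y
          have h3 := br_anti hs (sc_le_of_subset hσ hsub) (lf σ P) y
          linarith
        have hinv : (b ^ 2)⁻¹ ≤ 4 * (br (lf σ P0) (sc σ P0) y ^ 2)⁻¹ := by
          rw [← one_div, ← div_eq_mul_inv, div_le_div_iff₀ (by positivity) (by positivity)]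
          nlinarith
        have hmin : ρ / sc σ P * (b ^ 6)⁻¹ ≤ min (ρ / sc σ P) (sc σ P / ρ) := by
          have hr : 0 < ρ / sc σ P := by positivity
          have hrb : ρ / sc σ P ≤ b := by rw [div_le_iff₀ hs]; linarith
          apply le_min
          · apply mul_le_of_le_one_right hr.le
            exact inv_le_one_of_one_le₀ (one_le_pow₀ hb)
          · have : sc σ P / ρ = (ρ / sc σ P)⁻¹ := by rw [inv_div]
            rw [this]
            set r := ρ / sc σ P
            calc r * (b^6)⁻¹ ≤ r * (r^2)⁻¹ := by
                  gcongr
                  calc r ^ 2 ≤ b ^ 2 := by gcongr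
                    _ ≤ b ^ 6 := pow_le_pow_right₀ hb (by norm_num)
              _ = r⁻¹ := by field_simp
        calc sc σ P * cf φ f P * ‖u z * φ P z - u y * φ P y‖
            ≤ sc σ P * (8 * A * a) * (A / sc σ P ^ 2 * (ρ/9) * (b ^ 10)⁻¹) := by
              gcongr
              refine hl.trans ?_
              gcongr
          _ = 8 * A^2 * a / 9 * ((b^2)⁻¹ * (ρ / sc σ P * (b ^ 6)⁻¹)) * (b^2)⁻¹ := by
              field_simp
          _ ≤ 8 * A^2 * a / 9 * ((4 * (br (lf σ P0) (sc σ P0) y ^ 2)⁻¹) * min (ρ / sc σ P) (sc σ P / ρ)) * (b^2)⁻¹ := by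
              gcongr
          _ = _ := by ring
    _ ≤ (8 * A^2 * a / 9 * 4 * (br (lf σ P0) (sc σ P0) y ^ 2)⁻¹) * (4 * C0) := by
        rw [← Finset.mul_sum]
        apply mul_le_mul_of_nonneg_left (tree_two_sum hσ hT hρ) (by positivity)
    _ ≤ _ := by
        have := C0_pos
        have : 0 ≤ C0 * A ^ 2 * a * (br (lf σ P0) (sc σ P0) y ^ 2)⁻¹ := by positivity
        linarith

end BHT
end

section
open MeasureTheory Filter Set
open scoped ENNReal ComplexConjugate
namespace BHT

/-- averaging argument -/
lemma avg_swap {f : ℝ → ℂ} (hf : Measurable f) {ρ G H : ℝ → ℝ} (hρ : ∀ z, 0 < ρ z)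
    (hρc : Continuous ρ) (hlip : ∀ y z, ρ z ≤ ρ y + |z - y|) (hHm : Measurable H)
    (hGH : ∀ y z, |z - y| ≤ ρ y / 9 → G z ≤ H y) (hH0 : ∀ y, 0 ≤ H y) {a : ℝ} (ha : 0 ≤ a)
    (hav : ∀ y, ∫⁻ z in {z | |z - y| ≤ ρ y / 9}, ‖f z‖ₑ ≤ ENNReal.ofReal (2 * a * ρ y)) :
    ∫⁻ z, ‖f z‖ₑ * ENNReal.ofReal (G z) ≤ ENNReal.ofReal (12 * a) * ∫⁻ y, ENNReal.ofReal (H y) := by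
  set S : Set (ℝ × ℝ) := {p | |p.1 - p.2| ≤ ρ p.2 / 9} with hS
  have hSm : MeasurableSet S := by
    apply measurableSet_le
    · exact (measurable_fst.sub measurable_snd).abs
    · exact (hρc.measurable.comp measurable_snd).div_const _
  have h1 : ∀ z, ENNReal.ofReal (G z) ≤ ∫⁻ y, S.indicator (fun p => ENNReal.ofReal (6 / ρ p.2 * H p.2)) (z, y) := by
    intro z
    have hr := hρ z
    have hsub : ∀ y ∈ Icc (z - ρ z / 10) (z + ρ z / 10), |z - y| ≤ ρ y / 9 ∧ ρ y ≤ 11/10 * ρ z := by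
      intro y hy
      have h2 : |z - y| ≤ ρ z / 10 := by rw [abs_le]; constructor <;> linarith [hy.1, hy.2]
      have h3 := hlip y z
      have h4 := hlip z y
      rw [abs_sub_comm] at h4
      constructor <;> linarith
    calc ENNReal.ofReal (G z) = ∫⁻ y in Icc (z - ρ z / 10) (z + ρ z / 10), ENNReal.ofReal (5 / ρ z * G z) := by
          rw [setLIntegral_const, Real.volume_Icc]
          by_cases hG : 0 ≤ G z
          · rw [← ENNReal.ofReal_mul (by positivity)]
            congr 1
            field_simp; ring
          · push Not at hG
            rw [ENNReal.ofReal_of_nonpos hG.le, ENNReal.ofReal_of_nonpos, zero_mul]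
            exact mul_nonpos_of_nonneg_of_nonpos (by positivity) hG.le
      _ ≤ ∫⁻ y in Icc (z - ρ z / 10) (z + ρ z / 10), S.indicator (fun p => ENNReal.ofReal (6 / ρ p.2 * H p.2)) (z, y) := by
          apply setLIntegral_mono' measurableSet_Icc
          intro y hy
          obtain ⟨h2, h3⟩ := hsub y hy
          have hm : (z, y) ∈ S := h2
          rw [indicator_of_mem hm]
          apply ENNReal.ofReal_le_ofReal
          have hy0 := hρ y
          have h5 : 5 / ρ z ≤ 6 / ρ y := by
            rw [div_le_div_iff₀ hr hy0]; linarith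
          calc 5 / ρ z * G z ≤ 5 / ρ z * H y := by
                apply mul_le_mul_of_nonneg_left (hGH y z h2) (by positivity)
            _ ≤ _ := by gcongr; exact hH0 y
      _ ≤ _ := setLIntegral_le_lintegral _ _
  have hk : Measurable fun p : ℝ × ℝ => S.indicator (fun p => ENNReal.ofReal (6 / ρ p.2 * H p.2)) p := by
    apply Measurable.indicator _ hSm
    apply Measurable.ennreal_ofReal
    exact ((measurable_const.div (hρc.measurable.comp measurable_snd))).mul (hHm.comp measurable_snd)
  calc ∫⁻ z, ‖f z‖ₑ * ENNReal.ofReal (G z)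
      ≤ ∫⁻ z, ∫⁻ y, ‖f z‖ₑ * S.indicator (fun p => ENNReal.ofReal (6 / ρ p.2 * H p.2)) (z, y) := by
        apply lintegral_mono; intro z
        simp only
        rw [lintegral_const_mul' _ _ (by simp)]
        gcongr
        exact h1 z
    _ = ∫⁻ y, ∫⁻ z, ‖f z‖ₑ * S.indicator (fun p => ENNReal.ofReal (6 / ρ p.2 * H p.2)) (z, y) := by
        apply lintegral_lintegral_swap
        exact ((hf.enorm.comp measurable_fst).mul hk).aemeasurable
    _ ≤ ∫⁻ y, ENNReal.ofReal (12 * a) * ENNReal.ofReal (H y) := by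
        apply lintegral_mono; intro y
        simp only
        have hy0 := hρ y
        have e : ∀ z, ‖f z‖ₑ * S.indicator (fun p => ENNReal.ofReal (6 / ρ p.2 * H p.2)) (z, y)
            = {z | |z - y| ≤ ρ y / 9}.indicator (fun z => ‖f z‖ₑ * ENNReal.ofReal (6 / ρ y * H y)) z := by
          intro z
          by_cases hz : |z - y| ≤ ρ y / 9
          · rw [indicator_of_mem (show (z,y) ∈ S from hz), indicator_of_mem (by exact hz)]
          · rw [indicator_of_notMem (show (z,y) ∉ S from hz), indicator_of_notMem (by exact hz), mul_zero]
        simp only [e]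
        rw [lintegral_indicator (measurableSet_le (by fun_prop) (by fun_prop)), lintegral_mul_const _ hf.enorm]
        calc _ ≤ ENNReal.ofReal (2 * a * ρ y) * ENNReal.ofReal (6 / ρ y * H y) := by gcongr; exact hav y
          _ = _ := by
            rw [← ENNReal.ofReal_mul (by positivity), ← ENNReal.ofReal_mul (by positivity)]
            congr 1; field_simp; ring
    _ = _ := lintegral_const_mul' _ _ ENNReal.ofReal_ne_top

/-- constant in the size estimate -/
noncomputable def KS : ℝ := 8 + Real.pi * (144 * KE + 384 * C0)

lemma KS_ge : 8 ≤ KS := by have := C0_pos; have := KE_pos; unfold KS; linarith [show 0 ≤ Real.pi * (144 * KE + 384 * C0) by positivity]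

lemma tree_size {σ τ ci cj ξ A : ℝ} {N : ℕ} {φ : Tile → ℝ → ℂ} (hσ : 0 < σ) (hA : 0 < A)
    (hc : 1/2 ≤ |ci - cj| ∧ |ci - cj| ≤ 1)
    (h : Pk σ τ cj N A φ) {f : ℝ → ℂ} (hf : Measurable f) (hf1 : ∀ x, ‖f x‖ ≤ 1)
    {P0 : Tile} {T : Finset Tile} (hT : IsTree σ τ ci ξ P0 T)
    {a : ℝ} (ha : 0 < a) (hav : ∀ P ∈ T, Avg (fun y => ‖f y‖ₑ) (lf σ P) (sc σ P) a) :
    ∑ P ∈ T, sc σ P * cf φ f P ^ 2 ≤ (KS * A * a) ^ 2 * sc σ P0 := by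
  have h0 := sc_pos hσ P0
  rcases T.eq_empty_or_nonempty with rfl | hne
  · simp; positivity
  have hC := C0_pos
  have hK := KE_pos
  set G := dualG σ φ f T with hG
  set X := ∑ P ∈ T, sc σ P * cf φ f P ^ 2 with hX
  set H : ℝ → ℝ := fun y => ‖G y‖ + 16 * C0 * A ^ 2 * a * (br (lf σ P0) (sc σ P0) y ^ 2)⁻¹ with hH
  have hGi : Integrable G := dualG_integrable hσ hA.le h f T
  have hHi : Integrable H := hGi.norm.add ((integrable_br h0 _).const_mul _)
  have hGc : Continuous G := dualG_cont h f T
  have hX1 : X ≤ ∫ y, ‖f y‖ * ‖G y‖ := dual_bound hσ hA.le h hf.aestronglyMeasurable hf1 T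
  have hH0 : ∀ y, 0 ≤ H y := fun y => by
    have := br_pos h0 (lf σ P0) y
    simp only [hH]; positivity
  have hsw := avg_swap hf (ρ := rho σ T hne) (G := fun z => ‖G z‖) (H := H) (a := a) (rho_pos hσ hne) (rho_cont hne)
    (fun y z => rho_lip hne y z) ?_ ?_ hH0 ha.le ?_
  rotate_left
  · have hbc := br_cont (lf σ P0) (sc σ P0)
    exact (hGc.norm.measurable).add (((hbc.measurable.pow_const 2).inv).const_mul _)
  · intro y z hyz
    exact dual_osc hσ hA hc h f hT hne ha (fun P hP => cf_le hσ hA.le h hf ha.le (hav P hP)) hyz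
  · intro y
    obtain ⟨P, hP, hr⟩ := rho_ex (σ := σ) hne y
    have hs := sc_pos hσ P
    have hρ := rho_pos hσ hne y
    refine (lintegral_mono_set ?_).trans ((hav P hP (2 * rho σ T hne y) (by rw [hr]; linarith [abs_nonneg (y - lf σ P)])).trans ?_)
    · intro z hz
      change |z - y| ≤ _ at hz
      have : |z - lf σ P| ≤ |z - y| + |y - lf σ P| := abs_sub_le _ _ _
      have : |z - lf σ P| ≤ 2 * rho σ T hne y := by linarith
      rw [abs_le] at this
      constructor <;> linarith [this.1, this.2]
    · apply ENNReal.ofReal_le_ofReal; linarith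
  have hX2 : X ≤ 12 * a * ∫ y, H y := by
    refine hX1.trans ?_
    have hms : AEStronglyMeasurable (fun y => ‖f y‖ * ‖G y‖) volume :=
      (hf.norm.mul hGc.norm.measurable).aestronglyMeasurable
    rw [integral_eq_lintegral_of_nonneg_ae (Eventually.of_forall fun y => by positivity) hms]
    apply ENNReal.toReal_le_of_le_ofReal
    · have : 0 ≤ ∫ y, H y := integral_nonneg (fun y => hH0 y); positivity
    · rw [ENNReal.ofReal_mul (by positivity), ofReal_integral_eq_lintegral_ofReal hHi (Eventually.of_forall hH0)]
      refine le_trans (le_of_eq ?_) hsw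
      congr 1; ext y
      rw [ENNReal.ofReal_mul (norm_nonneg _), ofReal_norm]
  have hgram := tree_gram hσ hA hc h f hT
  change _ ≤ KE * A^2 * X at hgram
  set lam := 12 * a * (KE * A ^ 2) with hlam
  have hlam0 : 0 < lam := by positivity
  have hI : ∫ y, ‖G y‖ ≤ lam / 2 * (Real.pi * sc σ P0) + lam⁻¹/2 * (KE * A^2 * X) := by
    have i2 : Integrable fun y => wt (lf σ P0) (sc σ P0) y ^ 2 * ‖G y‖ ^ 2 :=
      (gram_expand hσ hA.le h (fun P hP => (hT P hP).1) _).1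
    have i1 := integrable_cauchy h0 (lf σ P0)
    calc ∫ y, ‖G y‖ ≤ ∫ y, (lam/2 * (1 + ((y - lf σ P0)/sc σ P0)^2)⁻¹ +
          lam⁻¹/2 * (wt (lf σ P0) (sc σ P0) y ^ 2 * ‖G y‖ ^ 2)) := by
          apply integral_mono hGi.norm ((i1.const_mul _).add (i2.const_mul _))
          intro y
          change _ ≤ lam/2 * (wt (lf σ P0) (sc σ P0) y)⁻¹ + _
          simp only
          have hw := wt_one_le (lf σ P0) (sc σ P0) y
          set w := wt (lf σ P0) (sc σ P0) y
          set b := ‖G y‖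
          have hw0 : 0 < w := by linarith
          have e1 : lam/2 * (w⁻¹)^2 + lam⁻¹/2 * (w ^ 2 * b ^ 2) - b = (lam * w⁻¹ - w * b)^2 / (2 * lam) := by
            field_simp; ring
          have : 0 ≤ (lam * w⁻¹ - w * b)^2 / (2 * lam) := by positivity
          have hwi : (w⁻¹)^2 ≤ w⁻¹ := by
            have : w⁻¹ ≤ 1 := inv_le_one_of_one_le₀ hw
            have : 0 < w⁻¹ := by positivity
            nlinarith
          have : lam/2 * (w⁻¹)^2 ≤ lam/2 * w⁻¹ := by gcongr
          linarith
      _ ≤ _ := by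
          rw [integral_add (i1.const_mul _) (i2.const_mul _), integral_const_mul, integral_const_mul, integral_cauchy h0]
          gcongr
  have hIH : ∫ y, H y ≤ lam / 2 * (Real.pi * sc σ P0) + lam⁻¹/2 * (KE * A^2 * X) +
      16 * C0 * A ^ 2 * a * (Real.pi * sc σ P0) := by
    have : ∫ y, H y = (∫ y, ‖G y‖) + 16 * C0 * A ^ 2 * a * ∫ y, (br (lf σ P0) (sc σ P0) y ^ 2)⁻¹ := by
      rw [hH, integral_add hGi.norm ((integrable_br h0 _).const_mul _), integral_const_mul]
    rw [this]
    gcongr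
    exact integral_br h0 _
  have e2 : 12 * a * (lam⁻¹/2 * (KE * A^2 * X)) = X / 2 := by
    rw [hlam]; field_simp
  have h3 : X ≤ 12 * a * (lam / 2 * (Real.pi * sc σ P0)) + X/2 + 12 * a * (16 * C0 * A ^ 2 * a * (Real.pi * sc σ P0)) := by
    have := mul_le_mul_of_nonneg_left hIH (show 0 ≤ 12 * a by positivity)
    rw [← e2]; linarith
  have h4 : X ≤ (KS * A ^ 2 * a ^ 2) * sc σ P0 := by
    have : X ≤ (KS - 8) * A ^ 2 * a ^ 2 * sc σ P0 := by
      unfold KS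
      rw [hlam] at h3
      linarith
    have : 0 ≤ 8 * A ^ 2 * a ^ 2 * sc σ P0 := by positivity
    linarith
  refine h4.trans ?_
  have := KS_ge
  have h5 : 0 ≤ A^2 * a^2 * sc σ P0 := by positivity
  have : (KS * A * a) ^ 2 * sc σ P0 = KS ^ 2 * (A^2 * a^2 * sc σ P0) := by ring
  rw [this]
  have : KS ≤ KS^2 := by nlinarith
  have := mul_le_mul_of_nonneg_right this h5
  linarith

/-- distance class of a tile relative to a set -/
def DClass (σ : ℝ) (E : Set ℝ) (l : ℕ) (P : Tile) : Prop :=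
  (2:ℝ) ^ l ≤ 1 + Metric.infDist (lf σ P) E / sc σ P ∧ 1 + Metric.infDist (lf σ P) E / sc σ P < 2 ^ (l + 1)

lemma sum_sc_le {σ : ℝ} (hσ : 0 < σ) {P0 : Tile} {T : Finset Tile} (hT : ∀ P ∈ T, Iv σ P ⊆ Iv σ P0)
    (hdis : ∀ P ∈ T, ∀ P' ∈ T, P ≠ P' → Disjoint (Iv σ P) (Iv σ P')) : ∑ P ∈ T, sc σ P ≤ sc σ P0 := by
  have hv : ∀ P, volume (Iv σ P) = ENNReal.ofReal (sc σ P) := fun P => by simp [Iv]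
  have h1 : ∑ P ∈ T, volume (Iv σ P) ≤ volume (Iv σ P0) := by
    rw [← measure_biUnion_finset]
    · exact measure_mono (iUnion₂_subset hT)
    · intro P hP P' hP' hne; exact hdis P hP P' hP' hne
    · intro P _; exact measurableSet_Ico
  simp only [hv] at h1
  rw [← ENNReal.ofReal_sum_of_nonneg (fun P _ => (sc_pos hσ P).le)] at h1
  exact (ENNReal.ofReal_le_ofReal_iff (sc_pos hσ P0).le).mp h1

lemma dclass_disj {σ τ c ξ : ℝ} (hσ : 0 < σ) {P0 : Tile} {T : Finset Tile} (hT : IsTree σ τ c ξ P0 T)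
    {E : Set ℝ} {l : ℕ} (hl : 2 ≤ l) (hD : ∀ P ∈ T, DClass σ E l P) :
    ∀ P ∈ T, ∀ P' ∈ T, P ≠ P' → Disjoint (Iv σ P) (Iv σ P') := by
  have main : ∀ P ∈ T, ∀ P' ∈ T, P ≠ P' → sc σ P ≤ sc σ P' → Disjoint (Iv σ P) (Iv σ P') := by
    intro P hP P' hP' hne hle
    rcases nested hσ hle with hsub | hd
    swap
    · exact hd
    exfalso
    have hs := sc_pos hσ P
    have hs' := sc_pos hσ P'
    rcases hle.lt_or_eq with hlt | heq
    · have h32 := sc_lt_32 hσ hlt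
      have hm := hsub (lf_mem hσ P)
      unfold Iv at hm
      have d1 := (hD P hP).2
      have d2 := (hD P' hP').1
      have d3 : Metric.infDist (lf σ P') E ≤ Metric.infDist (lf σ P) E + dist (lf σ P') (lf σ P) :=
        Metric.infDist_le_infDist_add_dist
      rw [Real.dist_eq] at d3
      have d4 : |lf σ P' - lf σ P| ≤ sc σ P' := by rw [abs_le]; constructor <;> linarith [hm.1, hm.2]
      set e1 := Metric.infDist (lf σ P) E
      set e2 := Metric.infDist (lf σ P') E
      have d1' : e1 < (2 ^ (l+1) - 1) * sc σ P := by
        have : e1 / sc σ P < 2 ^ (l+1) - 1 := by linarith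
        rwa [div_lt_iff₀ hs] at this
      have d2' : (2 ^ l - 1) * sc σ P' ≤ e2 := by
        have : 2 ^ l - 1 ≤ e2 / sc σ P' := by linarith
        rwa [le_div_iff₀ hs'] at this
      have h4 : (4:ℝ) ≤ 2 ^ l := by
        calc (4:ℝ) = 2 ^ 2 := by norm_num
          _ ≤ 2 ^ l := pow_le_pow_right₀ (by norm_num) hl
      rw [pow_succ] at d1'
      nlinarith
    · have hk : P.k = P'.k := by
        apply le_antisymm
        · exact (sc_le_iff hσ P' P).mp heq.le
        · exact (sc_le_iff hσ P P').mp heq.ge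
      have hm := tree_same_m hσ hT hP hP' hk
      have hmem := hsub (lf_mem hσ P)
      unfold Iv lf at hmem
      rw [← heq] at hmem
      have h1 : (P'.n : ℝ) ≤ P.n := le_of_mul_le_mul_right hmem.1 hs
      have h2 : (P.n : ℝ) < P'.n + 1 := by
        have := hmem.2
        have : (P.n:ℝ) * sc σ P < (P'.n + 1) * sc σ P := by linarith
        exact lt_of_mul_lt_mul_right this hs.le
      have hn : P.n = P'.n := by
        have h1' : P'.n ≤ P.n := by exact_mod_cast h1
        have h2' : P.n < P'.n + 1 := by exact_mod_cast h2
        omega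
      exact hne (Tile.ext hk hm hn)
  intro P hP P' hP' hne
  rcases le_total (sc σ P) (sc σ P') with hle | hle
  · exact main P hP P' hP' hne hle
  · exact (main P' hP' P hP hne.symm hle).symm

/-- size bound -/
lemma size_bound {σ τ A : ℝ} {N : ℕ} {γ : Fin 3 → ℝ} {φ : Tile → ℝ → ℂ} (hσ : 0 < σ) (hA : 0 < A) {j : Fin 3}
    (hc : ∀ i, i ≠ j → 1/2 ≤ |γ i - γ j| ∧ |γ i - γ j| ≤ 1)
    (h : Pk σ τ (γ j) N A φ) {f : ℝ → ℂ} (hf : Measurable f) (hf1 : ∀ x, ‖f x‖ ≤ 1)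
    {𝔓 : Finset Tile} {a : ℝ} (ha : 0 < a) (hav : ∀ P ∈ 𝔓, Avg (fun y => ‖f y‖ₑ) (lf σ P) (sc σ P) a) :
    SizeLE σ τ γ (cf φ f) 𝔓 j (KS * A * a) := by
  intro i hij ξ P0 T hT htree
  exact tree_size hσ hA (hc i hij) h hf hf1 htree ha fun P hP => hav P (hT hP)

lemma size_bound_far {σ τ A : ℝ} {N : ℕ} {γ : Fin 3 → ℝ} {φ : Tile → ℝ → ℂ} (hσ : 0 < σ) (hA : 0 < A) {j : Fin 3}
    (hc : ∀ i, i ≠ j → 1/2 ≤ |γ i - γ j| ∧ |γ i - γ j| ≤ 1)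
    (h : Pk σ τ (γ j) N A φ) {f : ℝ → ℂ} (hf : Measurable f) (hf1 : ∀ x, ‖f x‖ ≤ 1)
    {𝔓 : Finset Tile} {a : ℝ} (ha : 0 < a) (hav : ∀ P ∈ 𝔓, Avg (fun y => ‖f y‖ₑ) (lf σ P) (sc σ P) a)
    {E : Set ℝ} (hE : ∀ y, f y ≠ 0 → y ∈ E) {l : ℕ} (hD : ∀ P ∈ 𝔓, DClass σ E l P) :
    SizeLE σ τ γ (cf φ f) 𝔓 j (2 ^ N * KS * A * a * ((2 ^ l) ^ N)⁻¹) := by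
  have hK := KS_ge
  intro i hij ξ P0 T hT htree
  have h0 := sc_pos hσ P0
  by_cases hl : 2 ≤ l
  · have hdis := dclass_disj hσ htree hl (fun P hP => hD P (hT hP))
    have hss := sum_sc_le hσ (fun P hP => (htree P hP).1) hdis
    have hF : ∀ P ∈ T, cf φ f P ≤ 8 * A * a * ((2 ^ l) ^ N)⁻¹ := by
      intro P hP
      have hs := sc_pos hσ P
      apply cf_le_far hσ hA.le h hf ha.le (hav P (hT hP)) (one_le_pow₀ (by norm_num))
      intro y hy
      refine (hD P (hT hP)).1.trans ?_
      unfold br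
      gcongr
      have := Metric.infDist_le_dist_of_mem (x := lf σ P) (hE y hy)
      rwa [dist_comm, Real.dist_eq] at this
    calc ∑ P ∈ T, sc σ P * cf φ f P ^ 2 ≤ ∑ P ∈ T, sc σ P * (8 * A * a * ((2 ^ l) ^ N)⁻¹) ^ 2 := by
          apply Finset.sum_le_sum; intro P hP
          have := sc_pos hσ P
          have := cf_nonneg φ f P
          gcongr
          exact hF P hP
      _ ≤ (8 * A * a * ((2 ^ l) ^ N)⁻¹) ^ 2 * sc σ P0 := by
          rw [← Finset.sum_mul, mul_comm]; gcongr
      _ ≤ _ := by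
          have h2 : (1:ℝ) ≤ 2 ^ N := one_le_pow₀ (by norm_num)
          have : 8 ≤ 2 ^ N * KS := by nlinarith
          gcongr
  · refine (tree_size hσ hA (hc i hij) h hf hf1 htree ha fun P hP => hav P (hT hP)).trans ?_
    have hl1 : l ≤ 1 := by omega
    have : (1:ℝ) ≤ 2 ^ N * ((2 ^ l) ^ N)⁻¹ := by
      rw [← div_eq_mul_inv, one_le_div₀ (by positivity)]
      gcongr
      calc (2:ℝ) ^ l ≤ 2 ^ 1 := pow_le_pow_right₀ (by norm_num) hl1
        _ = 2 := by norm_num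
    have : KS * A * a ≤ 2 ^ N * KS * A * a * ((2 ^ l) ^ N)⁻¹ := by
      have h3 : 0 ≤ KS * A * a := by positivity
      nlinarith
    gcongr

end BHT
end

section
open MeasureTheory Filter Set
open scoped ENNReal ComplexConjugate
namespace BHT

noncomputable def KR (N : ℕ) : ℝ := 2 * 2 ^ N * KS + 16 * KE + 1

lemma KR_pos (N : ℕ) : 0 < KR N := by
  have := KS_ge; have := KE_pos; unfold KR; positivity

lemma rpow_comb {K a d θ : ℝ} (hK : 0 < K) (ha : 0 < a) (hd : 0 < d) :
    (K * a * d) ^ θ * (K * Real.sqrt a) ^ (1 - θ) = K * a ^ ((1 + θ)/2) * d ^ θ := by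
  rw [Real.mul_rpow (by positivity) hd.le, Real.mul_rpow hK.le ha.le, Real.mul_rpow hK.le (Real.sqrt_nonneg _),
    Real.sqrt_eq_rpow, ← Real.rpow_mul ha.le]
  have e1 : K ^ θ * K ^ (1 - θ) = K := by rw [← Real.rpow_add hK]; simp
  have e2 : a ^ θ * a ^ (1/2 * (1 - θ)) = a ^ ((1 + θ)/2) := by rw [← Real.rpow_add ha]; congr 1; ring
  calc _ = (K ^ θ * K ^ (1 - θ)) * (a ^ θ * a ^ (1/2 * (1 - θ))) * d ^ θ := by ring
    _ = _ := by rw [e1, e2]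

/-- estimate for tiles below one interval, in one density class -/
lemma one_J {σ τ A : ℝ} {N : ℕ} (hσ : 0 < σ) (hA : 0 < A) {γ : Fin 3 → ℝ}
    (hγ : ∀ i j, i ≠ j → 1/2 ≤ |γ i - γ j| ∧ |γ i - γ j| ≤ 1)
    {θ : Fin 3 → ℝ} (hθ0 : ∀ i, 0 ≤ θ i) (hθ1 : ∀ i, θ i ≤ 1) (hθ : ∑ i, θ i < 1)
    {φ : Fin 3 → Tile → ℝ → ℂ} (h : ∀ i, Pk σ τ (γ i) N A (φ i))
    {f : Fin 3 → ℝ → ℂ} (hf : ∀ i, Measurable (f i)) (hf1 : ∀ i x, ‖f i x‖ ≤ 1)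
    {E : Set ℝ} (hE : ∀ y, f 2 y ≠ 0 → y ∈ E) {l : ℕ} {𝔓 : Finset Tile} (hD : ∀ P ∈ 𝔓, DClass σ E l P)
    {J : Tile} (hJ : ∀ P ∈ 𝔓, Iv σ P ⊆ Iv σ J) {a : Fin 3 → ℝ} (ha : ∀ i, 0 < a i) (ha4 : ∀ i, a i ≤ 4)
    (hav : ∀ i, ∀ P ∈ 𝔓, Avg (fun y => ‖f i y‖ₑ) (lf σ P) (sc σ P) (a i))
    (havJ : ∀ i, Avg (fun y => ‖f i y‖ₑ) (lf σ J) (sc σ J) (a i)) :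
    ∑ P ∈ 𝔓, sc σ P * ∏ i, cf (φ i) (f i) P ≤
      (48 / (1 - 2⁻¹ ^ (1 - ∑ i, θ i)) * (KR N * A) ^ 3 * (((2 ^ l) ^ N)⁻¹) ^ θ 2) * sc σ J *
        ∏ i, a i ^ ((1 + θ i)/2) := by
  have hKS := KS_ge
  have hKE := KE_pos
  have hsJ := sc_pos hσ J
  set D : ℝ := ((2 ^ l) ^ N)⁻¹ with hDd
  have hD0 : 0 < D := by positivity
  have hD1 : D ≤ 1 := inv_le_one_of_one_le₀ (one_le_pow₀ (one_le_pow₀ (by norm_num)))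
  set d : Fin 3 → ℝ := fun j => if j = 2 then D else 1 with hd
  have hd0 : ∀ j, 0 < d j := fun j => by simp only [hd]; split_ifs <;> linarith
  have hd1 : ∀ j, d j ≤ 1 := fun j => by simp only [hd]; split_ifs <;> linarith
  have h2N : (1:ℝ) ≤ 2 ^ N := one_le_pow₀ (by norm_num)
  set S : Fin 3 → ℝ := fun j => 2 ^ N * KS * A * a j * d j with hS
  set e : Fin 3 → ℝ := fun j => KR N * A * Real.sqrt (a j) with he
  have hKR := KR_pos N
  have hmain := size_energy (σ := σ) (τ := τ) hσ hγ (F := fun i => cf (φ i) (f i)) (fun i P => cf_nonneg _ _ _)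
    (𝔓 := 𝔓) (S := S) (e := e) (θ := θ) (L := sc σ J) hsJ.le hθ0 hθ1 hθ ?_ ?_ ?_ ?_ ?_
  · refine hmain.trans ?_
    have hden : 0 < 1 - (2:ℝ)⁻¹ ^ (1 - ∑ i, θ i) := by
      have : (2:ℝ)⁻¹ ^ (1 - ∑ i, θ i) < 1 := Real.rpow_lt_one (by norm_num) (by norm_num) (by linarith)
      linarith
    have hp : ∏ j, (S j ^ θ j * e j ^ (1 - θ j)) ≤ ∏ j, ((KR N * A) * a j ^ ((1 + θ j)/2) * d j ^ θ j) := by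
      apply Finset.prod_le_prod
      · intro j _
        have := ha j
        have := hd0 j
        simp only [hS, he]; positivity
      · intro j _
        rw [← rpow_comb (by positivity) (ha j) (hd0 j)]
        have := ha j
        have := hd0 j
        have h3 : S j ≤ KR N * A * a j * d j := by
          simp only [hS]
          gcongr
          unfold KR
          have : 0 ≤ 2 ^ N * KS := by positivity
          linarith
        have h4 : 0 ≤ S j := by simp only [hS]; positivity
        simp only [he]
        apply mul_le_mul_of_nonneg_right _ (by positivity)
        exact Real.rpow_le_rpow h4 h3 (hθ0 j)
    have hpe : ∏ j, ((KR N * A) * a j ^ ((1 + θ j)/2) * d j ^ θ j) =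
        (KR N * A) ^ 3 * D ^ θ 2 * ∏ i, a i ^ ((1 + θ i)/2) := by
      simp only [Fin.prod_univ_three, hd]
      simp
      ring
    rw [hpe] at hp
    calc _ ≤ 48 / (1 - 2⁻¹ ^ (1 - ∑ i, θ i)) * sc σ J * ((KR N * A) ^ 3 * D ^ θ 2 * ∏ i, a i ^ ((1 + θ i)/2)) := by
          apply mul_le_mul_of_nonneg_left hp (by positivity)
      _ = _ := by ring
  · intro j; have := ha j; have := hd0 j; simp only [hS]; positivity
  · intro j; have := ha j; simp only [he]; positivity
  · intro j
    have h1 := ha j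
    have h2 : a j ≤ 2 * Real.sqrt (a j) := by
      have h5 : Real.sqrt (a j) ≤ 2 := by
        rw [Real.sqrt_le_left (by norm_num)]; linarith [ha4 j]
      calc a j = Real.sqrt (a j) * Real.sqrt (a j) := (Real.mul_self_sqrt h1.le).symm
        _ ≤ _ := by gcongr
    simp only [hS, he]
    calc 2 ^ N * KS * A * a j * d j ≤ 2 ^ N * KS * A * (2 * Real.sqrt (a j)) * 1 := by
          gcongr
          · exact hd1 j
      _ = (2 * 2 ^ N * KS) * A * Real.sqrt (a j) := by ring
      _ ≤ _ := by
          gcongr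
          unfold KR; linarith
  · intro j
    by_cases hj : j = 2
    · subst hj
      have := size_bound_far hσ hA (fun i hij => hγ i 2 hij) (h 2) (hf 2) (hf1 2) (ha 2) (hav 2) hE hD
      simp only [hS, hd, if_true]
      exact this
    · have := size_bound hσ hA (fun i hij => hγ i j hij) (h j) (hf j) (hf1 j) (ha j) (hav j)
      intro i hij ξ P0 T hT ht
      refine (this i hij ξ P0 T hT ht).trans ?_
      have h0 := sc_pos hσ P0
      have h1 := ha j
      simp only [hS, hd, if_neg hj, mul_one]
      gcongr
      nlinarith
  · intro i j hij n T ξ top μ hμ g1 g2 g3 g4 g5 g6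
    refine (energy_bound hσ hA (hγ i j hij) (h j) (hf j).aestronglyMeasurable (hf1 j) hJ n T ξ top μ hμ g1 g2 g3 g4 g5 g6).trans ?_
    have h1 := energy_int (hf j) (hf1 j) hsJ (ha j).le (havJ j)
    have haj := ha j
    calc _ ≤ KE * A^2 * (16 * a j * sc σ J) := by gcongr
      _ = (16 * KE) * (A ^ 2 * a j * sc σ J) := by ring
      _ ≤ (KR N) ^ 2 * (A ^ 2 * a j * sc σ J) := by
          gcongr
          have : 16 * KE + 1 ≤ KR N := by
            unfold KR
            have : 0 ≤ 2 * 2 ^ N * KS := by positivity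
            linarith
          nlinarith
      _ = _ := by
          simp only [he]
          rw [mul_pow, mul_pow, Real.sq_sqrt haj.le]; ring

/-- maximal intervals -/
lemma max_intervals {σ : ℝ} (hσ : 0 < σ) (Q : Finset Tile) : ∃ M ⊆ Q,
    (∀ P ∈ M, ∀ P' ∈ M, P ≠ P' → Disjoint (Iv σ P) (Iv σ P')) ∧ ∀ P ∈ Q, ∃ J ∈ M, Iv σ P ⊆ Iv σ J := by
  induction Q using Finset.strongInduction with
  | H Q ih =>
    rcases Q.eq_empty_or_nonempty with rfl | hne
    · exact ⟨∅, le_rfl, by simp, by simp⟩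
    obtain ⟨P0, hP0, hmax⟩ := Finset.exists_max_image Q (sc σ) hne
    classical
    set Q' := Q.filter fun P => ¬ Iv σ P ⊆ Iv σ P0 with hQ'
    have hlt : Q' ⊂ Q := by
      refine Finset.filter_ssubset.mpr ⟨P0, hP0, by simp⟩
    obtain ⟨M, hM, hd, hcov⟩ := ih Q' hlt
    have hdis : ∀ P ∈ M, Disjoint (Iv σ P) (Iv σ P0) := by
      intro P hP
      have h1 := Finset.mem_filter.mp (hM hP)
      exact (nested hσ (hmax P h1.1)).resolve_left h1.2
    refine ⟨insert P0 M, ?_, ?_, ?_⟩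
    · intro P hP
      rcases Finset.mem_insert.mp hP with rfl | hP
      · exact hP0
      · exact (Finset.mem_filter.mp (hM hP)).1
    · intro P hP P' hP' hne
      rcases Finset.mem_insert.mp hP with h1 | h1 <;> rcases Finset.mem_insert.mp hP' with h2 | h2
      · exact absurd (h1.trans h2.symm) hne
      · rw [h1]; exact (hdis P' h2).symm
      · rw [h2]; exact hdis P h1
      · exact hd P h1 P' h2 hne
    · intro P hP
      by_cases hs : Iv σ P ⊆ Iv σ P0
      · exact ⟨P0, Finset.mem_insert_self _ _, hs⟩
      · obtain ⟨J, hJ, hJ2⟩ := hcov P (Finset.mem_filter.mpr ⟨hP, hs⟩)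
        exact ⟨J, Finset.mem_insert_of_mem hJ, hJ2⟩

/-- dyadic geometric sum -/
lemma geom_dyadic (S : Finset ℤ) {e : ℝ} (he : 1/2 ≤ e) {b : ℝ≥0∞} (h : ∀ n ∈ S, ENNReal.ofReal (2 ^ n) ≤ b) :
    ∑ n ∈ S, ENNReal.ofReal (((2:ℝ) ^ n) ^ e) ≤ 4 * b ^ e := by
  rcases S.eq_empty_or_nonempty with rfl | hne
  · simp
  set n0 := S.max' hne with hn0
  have hle : ∀ n ∈ S, n ≤ n0 := fun n hn => S.le_max' n hn
  have h1 : ∑ n ∈ S, ((2:ℝ)^n)^e ≤ 4 * (2^n0)^e := by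
    have h1 : ∀ n ∈ S, ((2:ℝ)^n)^e ≤ (2^n0)^e * (3/4:ℝ)^(n0 - n).toNat := by
      intro n hn
      have := hle n hn
      have e1 : ((n0 - n).toNat : ℤ) = n0 - n := Int.toNat_of_nonneg (by omega)
      have e2 : (2:ℝ)^n = 2^n0 * (1/2:ℝ)^(n0 - n).toNat := by
        rw [← zpow_natCast, e1, one_div, inv_zpow, ← zpow_neg, ← zpow_add₀ (by norm_num)]
        congr 1; ring
      rw [e2, Real.mul_rpow (by positivity) (by positivity)]
      gcongr
      rw [← Real.rpow_natCast, ← Real.rpow_mul (by norm_num), mul_comm, Real.rpow_mul (by norm_num), Real.rpow_natCast]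
      gcongr
      calc (1/2:ℝ)^e ≤ (1/2:ℝ)^(1/2:ℝ) := Real.rpow_le_rpow_of_exponent_ge (by norm_num) (by norm_num) he
        _ ≤ 3/4 := by
          rw [← Real.sqrt_eq_rpow, Real.sqrt_le_left (by norm_num)]; norm_num
    refine (Finset.sum_le_sum h1).trans ?_
    rw [← Finset.mul_sum,
      ← Finset.sum_image (s := S) (g := fun k => (n0 - k).toNat) (f := fun n : ℕ => (3/4:ℝ)^n)]
    · have hsm : Summable fun n : ℕ => (3/4:ℝ)^n := summable_geometric_of_lt_one (by norm_num) (by norm_num)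
      have := hsm.sum_le_tsum (S.image fun k => (n0 - k).toNat) (fun i _ => by positivity)
      rw [tsum_geometric_of_lt_one (by norm_num) (by norm_num)] at this
      have hp : (0:ℝ) ≤ (2 ^ n0)^e := by positivity
      nlinarith
    · intro a ha b hb hab
      have h1 := hle a ha
      have h2 := hle b hb
      simp only at hab
      omega
  rw [← ENNReal.ofReal_sum_of_nonneg (fun n _ => by positivity)]
  refine (ENNReal.ofReal_le_ofReal h1).trans ?_
  rw [ENNReal.ofReal_mul (by norm_num), ← ENNReal.ofReal_rpow_of_nonneg (by positivity) (by linarith)]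
  have : ENNReal.ofReal 4 = 4 := by norm_num
  rw [this]
  gcongr
  exact h n0 (S.max'_mem hne)

lemma geom_dyadic3 (S : Finset (Fin 3 → ℤ)) {e : Fin 3 → ℝ} (he : ∀ i, 1/2 ≤ e i) {b : Fin 3 → ℝ≥0∞}
    (h : ∀ n ∈ S, ∀ i, ENNReal.ofReal (2 ^ n i) ≤ b i) :
    ∑ n ∈ S, ∏ i, ENNReal.ofReal (((2:ℝ) ^ n i) ^ e i) ≤ 64 * ∏ i, b i ^ e i := by
  classical
  set U : Fin 3 → Finset ℤ := fun i => S.image fun n => n i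
  calc _ ≤ ∑ n ∈ Fintype.piFinset U, ∏ i, ENNReal.ofReal (((2:ℝ) ^ n i) ^ e i) := by
        apply Finset.sum_le_sum_of_subset
        intro n hn
        rw [Fintype.mem_piFinset]
        intro i
        exact Finset.mem_image_of_mem _ hn
    _ = ∏ i, ∑ k ∈ U i, ENNReal.ofReal (((2:ℝ) ^ k) ^ e i) :=
        (Finset.prod_univ_sum U (fun i k => ENNReal.ofReal (((2:ℝ) ^ k) ^ e i))).symm
    _ ≤ ∏ i, (4 * b i ^ e i) := by
        apply Finset.prod_le_prod' 
        intro i _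
        apply geom_dyadic _ (he i)
        intro k hk
        obtain ⟨n, hn, rfl⟩ := Finset.mem_image.mp hk
        exact h n hn i
    _ = _ := by
        rw [Finset.prod_mul_distrib]; simp; norm_num

end BHT
end

section
open MeasureTheory Filter Set
open scoped ENNReal ComplexConjugate
namespace BHT

/-- constant of the restricted estimate -/
noncomputable def CR (N : ℕ) (θ : Fin 3 → ℝ) : ℝ := 512 * (48 / (1 - 2⁻¹ ^ (1 - ∑ i, θ i)) * KR N ^ 3)

lemma CR_pos {N : ℕ} {θ : Fin 3 → ℝ} (hθ : ∑ i, θ i < 1) : 0 < CR N θ := by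
  have := KR_pos N
  have h : (2:ℝ)⁻¹ ^ (1 - ∑ i, θ i) < 1 := Real.rpow_lt_one (by norm_num) (by norm_num) (by linarith)
  have : 0 < 1 - (2:ℝ)⁻¹ ^ (1 - ∑ i, θ i) := by linarith
  unfold CR; positivity

theorem restricted {σ τ A : ℝ} {N : ℕ} (hσ : 0 < σ) (hA : 0 < A) {γ : Fin 3 → ℝ}
    (hγ : ∀ i j, i ≠ j → 1/2 ≤ |γ i - γ j| ∧ |γ i - γ j| ≤ 1)
    {θ : Fin 3 → ℝ} (hθ0 : ∀ i, 0 ≤ θ i) (hθ1 : ∀ i, θ i ≤ 1) (hθ : ∑ i, θ i < 1)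
    {φ : Fin 3 → Tile → ℝ → ℂ} (h : ∀ i, Pk σ τ (γ i) N A (φ i))
    {f : Fin 3 → ℝ → ℂ} (hf : ∀ i, Measurable (f i)) (hf1 : ∀ i x, ‖f i x‖ ≤ 1)
    {E : Set ℝ} (hE : ∀ y, f 2 y ≠ 0 → y ∈ E) {l : ℕ} {𝔓 : Finset Tile} (hD : ∀ P ∈ 𝔓, DClass σ E l P)
    {α : Fin 3 → Tile → ℝ} (hα0 : ∀ i P, 0 ≤ α i P) (hα2 : ∀ i P, α i P ≤ 2)
    (hav : ∀ i, ∀ P ∈ 𝔓, Avg (fun y => ‖f i y‖ₑ) (lf σ P) (sc σ P) (α i P))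
    {b : Fin 3 → ℝ → ℝ≥0∞} (hb : ∀ i, ∀ P ∈ 𝔓, ∀ x ∈ Iv σ P, ENNReal.ofReal (α i P) ≤ b i x) :
    ENNReal.ofReal (∑ P ∈ 𝔓, sc σ P * ∏ i, cf (φ i) (f i) P) ≤
      ENNReal.ofReal (CR N θ * A ^ 3 * (((2 ^ l) ^ N)⁻¹) ^ θ 2) * ∫⁻ x, ∏ i, b i x ^ ((1 + θ i)/2) := by
  classical
  set Q := 𝔓.filter fun P => ∀ i, 0 < α i P with hQ
  have hQm : ∀ P ∈ Q, P ∈ 𝔓 ∧ ∀ i, 0 < α i P := fun P hP => Finset.mem_filter.mp hP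
  have hred : ∑ P ∈ 𝔓, sc σ P * ∏ i, cf (φ i) (f i) P = ∑ P ∈ Q, sc σ P * ∏ i, cf (φ i) (f i) P := by
    symm
    apply Finset.sum_subset (Finset.filter_subset _ _)
    intro P hP hPQ
    have : ∃ i, ¬ 0 < α i P := by
      by_contra hcon
      push Not at hcon
      exact hPQ (Finset.mem_filter.mpr ⟨hP, hcon⟩)
    obtain ⟨i, hi⟩ := this
    have h0 : α i P = 0 := le_antisymm (not_lt.mp hi) (hα0 i P)
    have h1 := cf_le hσ hA.le (h i) (hf i) (hα0 i P) (hav i P hP)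
    rw [h0, mul_zero] at h1
    have h2 : cf (φ i) (f i) P = 0 := le_antisymm h1 (cf_nonneg _ _ _)
    rw [Finset.prod_eq_zero (Finset.mem_univ i) h2, mul_zero]
  rw [hred]
  have hex : ∀ P : Tile, ∃ n : Fin 3 → ℤ, ∀ i, 0 < α i P → (2:ℝ) ^ n i ≤ α i P ∧ α i P < 2 ^ (n i + 1) := by
    intro P
    have : ∀ i, ∃ n : ℤ, 0 < α i P → (2:ℝ) ^ n ≤ α i P ∧ α i P < 2 ^ (n + 1) := by
      intro i
      by_cases hp : 0 < α i P
      · obtain ⟨n, h1, h2⟩ := exists_mem_Ico_zpow hp (by norm_num : (1:ℝ) < 2)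
        exact ⟨n, fun _ => ⟨h1, h2⟩⟩
      · exact ⟨0, fun hh => absurd hh hp⟩
    choose n hn using this
    exact ⟨n, hn⟩
  choose nn hnn using hex
  have hmaps : ∀ P ∈ Q, nn P ∈ Q.image nn := fun P hP => Finset.mem_image_of_mem _ hP
  rw [← Finset.sum_fiberwise_of_maps_to hmaps]
  set B : ℝ := 48 / (1 - 2⁻¹ ^ (1 - ∑ i, θ i)) * (KR N * A) ^ 3 * (((2 ^ l) ^ N)⁻¹) ^ θ 2 with hB
  have hKR := KR_pos N
  have hB0 : 0 ≤ B := by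
    have h : (2:ℝ)⁻¹ ^ (1 - ∑ i, θ i) < 1 := Real.rpow_lt_one (by norm_num) (by norm_num) (by linarith)
    have : 0 < 1 - (2:ℝ)⁻¹ ^ (1 - ∑ i, θ i) := by linarith
    positivity
  have hmax : ∀ n : Fin 3 → ℤ, ∃ M ⊆ Q.filter (fun P => nn P = n),
      (∀ P ∈ M, ∀ P' ∈ M, P ≠ P' → Disjoint (Iv σ P) (Iv σ P')) ∧
      ∀ P ∈ Q.filter (fun P => nn P = n), ∃ J ∈ M, Iv σ P ⊆ Iv σ J := fun n => max_intervals hσ _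
  choose M hMsub hMdis hMcov using hmax
  -- one class
  have hcl : ∀ n ∈ Q.image nn, ∑ P ∈ Q with nn P = n, sc σ P * ∏ i, cf (φ i) (f i) P ≤
      8 * B * ∑ J ∈ M n, sc σ J * ∏ i, ((2:ℝ) ^ n i) ^ ((1 + θ i)/2) := by
    intro n _
    have hpos : ∀ P, 0 ≤ sc σ P * ∏ i, cf (φ i) (f i) P := fun P =>
      mul_nonneg (sc_pos hσ P).le (Finset.prod_nonneg fun i _ => cf_nonneg _ _ _)
    calc _ ≤ ∑ P ∈ (M n).biUnion fun J => (Q.filter fun P => nn P = n).filter fun P => Iv σ P ⊆ Iv σ J,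
          sc σ P * ∏ i, cf (φ i) (f i) P := by
          apply Finset.sum_le_sum_of_subset_of_nonneg
          · intro P hP
            obtain ⟨J, hJ, hs⟩ := hMcov n P hP
            exact Finset.mem_biUnion.mpr ⟨J, hJ, Finset.mem_filter.mpr ⟨hP, hs⟩⟩
          · intro P _ _; exact hpos P
      _ ≤ ∑ J ∈ M n, ∑ P ∈ (Q.filter fun P => nn P = n).filter fun P => Iv σ P ⊆ Iv σ J,
          sc σ P * ∏ i, cf (φ i) (f i) P := by
          rw [Finset.sum_biUnion]
          intro J hJ J' hJ' hne
          rw [Function.onFun, Finset.disjoint_left]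
          intro P hP hP'
          have s1 := (Finset.mem_filter.mp hP).2
          have s2 := (Finset.mem_filter.mp hP').2
          exact Set.disjoint_left.mp (hMdis n J hJ J' hJ' hne) (s1 (lf_mem hσ P)) (s2 (lf_mem hσ P))
      _ ≤ ∑ J ∈ M n, 8 * B * (sc σ J * ∏ i, ((2:ℝ) ^ n i) ^ ((1 + θ i)/2)) := by
          apply Finset.sum_le_sum
          intro J hJ
          have hJ1 := Finset.mem_filter.mp (hMsub n hJ)
          have hav' : ∀ i, ∀ P ∈ Q.filter (fun P => nn P = n), Avg (fun y => ‖f i y‖ₑ) (lf σ P) (sc σ P) (2 ^ (n i + 1)) := by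
            intro i P hP R hR
            obtain ⟨h1, h2⟩ := Finset.mem_filter.mp hP
            refine (hav i P (hQm P h1).1 R hR).trans ?_
            apply ENNReal.ofReal_le_ofReal
            have hs := sc_pos hσ P
            have h3 := (hnn P i ((hQm P h1).2 i)).2
            rw [h2] at h3
            gcongr
            linarith
          have h4 : ∀ i, (2:ℝ) ^ n i ≤ 2 := by
            intro i
            have h3 := (hnn J i ((hQm J hJ1.1).2 i)).1
            rw [hJ1.2] at h3
            exact h3.trans (hα2 i J)
          have := one_J hσ hA hγ hθ0 hθ1 hθ h hf hf1 hE (l := l)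
            (𝔓 := (Q.filter fun P => nn P = n).filter fun P => Iv σ P ⊆ Iv σ J) (J := J)
            (a := fun i => 2 ^ (n i + 1))
            (fun P hP => hD P (hQm P (Finset.mem_filter.mp (Finset.mem_filter.mp hP).1).1).1)
            (fun P hP => (Finset.mem_filter.mp hP).2) (fun i => by positivity)
            (fun i => by rw [zpow_add_one₀ (by norm_num)]; linarith [h4 i])
            (fun i P hP => hav' i P (Finset.mem_filter.mp hP).1) (fun i => hav' i J (hMsub n hJ))
          refine this.trans ?_
          have hsJ := sc_pos hσ J
          have hprod : ∏ i, ((2:ℝ) ^ (n i + 1)) ^ ((1 + θ i)/2) ≤ 8 * ∏ i, ((2:ℝ) ^ n i) ^ ((1 + θ i)/2) := by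
            have : (8:ℝ) * ∏ i, ((2:ℝ) ^ n i) ^ ((1 + θ i)/2) = ∏ i, (2 * ((2:ℝ) ^ n i) ^ ((1 + θ i)/2)) := by
              rw [Finset.prod_mul_distrib]; simp; norm_num
            rw [this]
            apply Finset.prod_le_prod
            · intro i _; positivity
            · intro i _
              rw [zpow_add_one₀ (by norm_num), mul_comm, Real.mul_rpow (by norm_num) (by positivity)]
              gcongr
              calc (2:ℝ) ^ ((1 + θ i)/2) ≤ 2 ^ (1:ℝ) := by
                    apply Real.rpow_le_rpow_of_exponent_le (by norm_num); linarith [hθ1 i]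
                _ = 2 := by simp
          calc _ ≤ B * sc σ J * (8 * ∏ i, ((2:ℝ) ^ n i) ^ ((1 + θ i)/2)) := by gcongr
            _ = _ := by ring
      _ = _ := by rw [Finset.mul_sum]
  have htot : ∑ n ∈ Q.image nn, ∑ P ∈ Q with nn P = n, sc σ P * ∏ i, cf (φ i) (f i) P ≤
      8 * B * ∑ n ∈ Q.image nn, ∑ J ∈ M n, sc σ J * ∏ i, ((2:ℝ) ^ n i) ^ ((1 + θ i)/2) := by
    rw [Finset.mul_sum]; exact Finset.sum_le_sum hcl
  refine (ENNReal.ofReal_le_ofReal htot).trans ?_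
  rw [ENNReal.ofReal_mul (by positivity)]
  -- the integral bound
  have hnti : ENNReal.ofReal (∑ n ∈ Q.image nn, ∑ J ∈ M n, sc σ J * ∏ i, ((2:ℝ) ^ n i) ^ ((1 + θ i)/2)) ≤
      64 * ∫⁻ x, ∏ i, b i x ^ ((1 + θ i)/2) := by
    have hv : ∀ P, volume (Iv σ P) = ENNReal.ofReal (sc σ P) := fun P => by simp [Iv]
    have e1 : ENNReal.ofReal (∑ n ∈ Q.image nn, ∑ J ∈ M n, sc σ J * ∏ i, ((2:ℝ) ^ n i) ^ ((1 + θ i)/2)) =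
        ∫⁻ x, ∑ n ∈ Q.image nn, ∑ J ∈ M n, (Iv σ J).indicator (fun _ => ∏ i, ENNReal.ofReal (((2:ℝ) ^ n i) ^ ((1 + θ i)/2))) x := by
      have hmI : ∀ J, MeasurableSet (Iv σ J) := fun J => measurableSet_Ico
      rw [lintegral_finsetSum _ (fun n _ => Finset.measurable_fun_sum _ fun J _ => measurable_const.indicator (hmI J)),
        ENNReal.ofReal_sum_of_nonneg (fun n _ => Finset.sum_nonneg fun J _ =>
          mul_nonneg (sc_pos hσ J).le (Finset.prod_nonneg fun i _ => by positivity))]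
      apply Finset.sum_congr rfl
      intro n _
      rw [lintegral_finsetSum _ (fun J _ => measurable_const.indicator (hmI J)),
        ENNReal.ofReal_sum_of_nonneg (fun J _ =>
          mul_nonneg (sc_pos hσ J).le (Finset.prod_nonneg fun i _ => by positivity))]
      apply Finset.sum_congr rfl
      intro J _
      rw [lintegral_indicator (hmI J), setLIntegral_const, hv, mul_comm, ENNReal.ofReal_mul
        (Finset.prod_nonneg fun i _ => by positivity), ENNReal.ofReal_prod_of_nonneg (fun i _ => by positivity)]
    rw [e1, ← lintegral_const_mul' _ _ (by norm_num)]
    apply lintegral_mono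
    intro x
    simp only
    -- restrict to the classes whose union contains x
    set S := (Q.image nn).filter fun n => ∃ J ∈ M n, x ∈ Iv σ J with hS
    calc _ ≤ ∑ n ∈ S, ∏ i, ENNReal.ofReal (((2:ℝ) ^ n i) ^ ((1 + θ i)/2)) := by
          rw [hS, Finset.sum_filter]
          apply Finset.sum_le_sum
          intro n _
          by_cases hx : ∃ J ∈ M n, x ∈ Iv σ J
          · rw [if_pos hx]
            obtain ⟨J, hJ, hxJ⟩ := hx
            rw [Finset.sum_eq_single_of_mem J hJ, indicator_of_mem hxJ]
            intro J' hJ' hne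
            apply indicator_of_notMem
            exact fun hxJ' => Set.disjoint_left.mp (hMdis n J' hJ' J hJ hne) hxJ' hxJ
          · rw [if_neg hx]
            push Not at hx
            rw [Finset.sum_eq_zero]
            intro J hJ
            exact indicator_of_notMem (hx J hJ) _
      _ ≤ _ := by
          apply geom_dyadic3
          · intro i; linarith [hθ0 i]
          · intro n hn i
            obtain ⟨-, J, hJ, hxJ⟩ := Finset.mem_filter.mp hn
            have hJ1 := Finset.mem_filter.mp (hMsub n hJ)
            have h3 := (hnn J i ((hQm J hJ1.1).2 i)).1
            rw [hJ1.2] at h3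
            exact (ENNReal.ofReal_le_ofReal h3).trans (hb i J (hQm J hJ1.1).1 x hxJ)
  calc _ ≤ ENNReal.ofReal (8 * B) * (64 * ∫⁻ x, ∏ i, b i x ^ ((1 + θ i)/2)) := by gcongr
    _ = ENNReal.ofReal (8 * B * 64) * ∫⁻ x, ∏ i, b i x ^ ((1 + θ i)/2) := by
        rw [ENNReal.ofReal_mul (p := 8 * B) (by positivity), mul_assoc]
        norm_num
    _ = _ := by
        congr 2
        rw [hB]; unfold CR; ring

end BHT
end

section
open MeasureTheory Filter Set
open scoped ENNReal ComplexConjugate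
namespace BHT

/-- dyadic-radius centred maximal function -/
noncomputable def mx (w : ℝ → ℝ≥0∞) (x : ℝ) : ℝ≥0∞ :=
  ⨆ n : ℤ, ENNReal.ofReal ((2:ℝ)^(-n)) * ∫⁻ y in Icc (x - (2:ℝ)^n) (x + (2:ℝ)^n), w y

lemma mx_measurable {w : ℝ → ℝ≥0∞} (hw : Measurable w) : Measurable (mx w) := by
  unfold mx
  refine Measurable.iSup fun n => Measurable.const_mul ?_ _
  have h1 : ∀ x : ℝ, ∫⁻ y in Icc (x - (2:ℝ)^n) (x + (2:ℝ)^n), w y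
      = ∫⁻ y, ({p : ℝ × ℝ | p.1 - (2:ℝ)^n ≤ p.2 ∧ p.2 ≤ p.1 + (2:ℝ)^n}.indicator (fun p => w p.2)) (x, y) := by
    intro x
    rw [← lintegral_indicator measurableSet_Icc]
    apply lintegral_congr; intro y
    simp only [indicator, mem_Icc, mem_ofPred_eq]
  simp_rw [h1]
  apply Measurable.lintegral_prod_right'
  apply Measurable.indicator (hw.comp measurable_snd)
  exact (measurableSet_le (f := fun p : ℝ × ℝ => p.1 - (2:ℝ)^n) (g := fun p : ℝ × ℝ => p.2)
    (by fun_prop) (by fun_prop)).inter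
    (measurableSet_le (f := fun p : ℝ × ℝ => p.2) (g := fun p : ℝ × ℝ => p.1 + (2:ℝ)^n)
    (by fun_prop) (by fun_prop))

lemma le_mx (w : ℝ → ℝ≥0∞) (x : ℝ) (n : ℤ) :
    ∫⁻ y in Icc (x - (2:ℝ)^n) (x + (2:ℝ)^n), w y ≤ ENNReal.ofReal ((2:ℝ)^n) * mx w x := by
  have h : ENNReal.ofReal ((2:ℝ)^(-n)) * ∫⁻ y in Icc (x - (2:ℝ)^n) (x + (2:ℝ)^n), w y ≤ mx w x :=
    le_iSup (fun n : ℤ => ENNReal.ofReal ((2:ℝ)^(-n)) * ∫⁻ y in Icc (x - (2:ℝ)^n) (x + (2:ℝ)^n), w y) n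
  have h2 : ENNReal.ofReal ((2:ℝ)^n) * ENNReal.ofReal ((2:ℝ)^(-n)) = 1 := by
    rw [← ENNReal.ofReal_mul (by positivity), ← zpow_add₀ (by norm_num)]; simp
  calc _ = ENNReal.ofReal ((2:ℝ)^n) * (ENNReal.ofReal ((2:ℝ)^(-n)) *
        ∫⁻ y in Icc (x - (2:ℝ)^n) (x + (2:ℝ)^n), w y) := by rw [← mul_assoc, h2, one_mul]
    _ ≤ _ := by gcongr

lemma mx_avg (w : ℝ → ℝ≥0∞) (x : ℝ) {R : ℝ} (hR : 0 < R) :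
    ∫⁻ y in Icc (x - R) (x + R), w y ≤ ENNReal.ofReal (2 * R) * mx w x := by
  obtain ⟨n, h1, h2⟩ := exists_mem_Ico_zpow (x := R) (y := (2:ℝ)) hR (by norm_num)
  calc _ ≤ ∫⁻ y in Icc (x - (2:ℝ)^(n+1)) (x + (2:ℝ)^(n+1)), w y := by
        apply lintegral_mono_set
        apply Icc_subset_Icc <;> linarith
    _ ≤ _ := le_mx w x (n+1)
    _ ≤ _ := by
        gcongr
        rw [zpow_add_one₀ (by norm_num)]; linarith

lemma mx_le_of_bdd {w : ℝ → ℝ≥0∞} {B : ℝ≥0∞} (h : ∀ y, w y ≤ B) (x : ℝ) : mx w x ≤ 2 * B := by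
  unfold mx
  apply iSup_le; intro n
  calc _ ≤ ENNReal.ofReal ((2:ℝ)^(-n)) * ∫⁻ y in Icc (x - (2:ℝ)^n) (x + (2:ℝ)^n), B := by
        gcongr with y; exact h y
    _ = ENNReal.ofReal ((2:ℝ)^(-n)) * ENNReal.ofReal ((2:ℝ)^n * 2) * B := by
        rw [setLIntegral_const, Real.volume_Icc, mul_comm B, mul_assoc]
        congr 3; ring
    _ = 2 * B := by
        rw [← ENNReal.ofReal_mul (by positivity), ← mul_assoc, ← zpow_add₀ (by norm_num)]; simp

lemma mx_mono {w w' : ℝ → ℝ≥0∞} (h : ∀ y, w y ≤ w' y) (x : ℝ) : mx w x ≤ mx w' x := by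
  unfold mx
  apply iSup_mono; intro n
  gcongr with y; exact h y

lemma mx_add {w w' : ℝ → ℝ≥0∞} (hw : Measurable w) (x : ℝ) :
    mx (fun y => w y + w' y) x ≤ mx w x + mx w' x := by
  conv_lhs => unfold mx
  apply iSup_le; intro n
  rw [lintegral_add_left hw, mul_add]
  exact add_le_add (le_iSup (fun n : ℤ => ENNReal.ofReal ((2:ℝ)^(-n)) *
      ∫⁻ y in Icc (x - (2:ℝ)^n) (x + (2:ℝ)^n), w y) n) (le_iSup (fun n : ℤ => ENNReal.ofReal ((2:ℝ)^(-n)) *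
      ∫⁻ y in Icc (x - (2:ℝ)^n) (x + (2:ℝ)^n), w' y) n)

lemma mx_weak (w : ℝ → ℝ≥0∞) {t : ℝ} (ht : 0 < t) :
    ENNReal.ofReal t * volume {x | ENNReal.ofReal t < mx w x} ≤ 8 * ∫⁻ y, w y := by
  by_cases htop : ∫⁻ y, w y = ⊤
  · rw [htop]; simp
  set 𝔱 : Set (ℝ × ℤ) := {a | ENNReal.ofReal (t * (2:ℝ)^a.2) <
    ∫⁻ y in Icc (a.1 - (2:ℝ)^a.2) (a.1 + (2:ℝ)^a.2), w y} with h𝔱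
  have hR : ∀ a ∈ 𝔱, (2:ℝ)^a.2 ≤ (∫⁻ y, w y).toReal / t := by
    intro a ha
    have h1 : ENNReal.ofReal (t * (2:ℝ)^a.2) ≤ ∫⁻ y, w y :=
      le_trans (le_of_lt ha) (setLIntegral_le_lintegral _ _)
    rw [le_div_iff₀ ht, mul_comm]
    exact (ENNReal.ofReal_le_iff_le_toReal htop).1 h1
  obtain ⟨u, hu, hdis, hcov⟩ := Vitali.exists_disjoint_subfamily_covering_enlargement_closedBall 𝔱
    (fun a => a.1) (fun a => (2:ℝ)^a.2) _ hR 4 (by norm_num)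
  have hcount : u.Countable := by
    apply hdis.countable_of_nonempty_interior
    intro a _
    rw [interior_closedBall _ (by positivity)]
    exact Metric.nonempty_ball.2 (by positivity)
  have hsub : {x | ENNReal.ofReal t < mx w x} ⊆ ⋃ b ∈ u, Metric.closedBall b.1 (4 * (2:ℝ)^b.2) := by
    intro x hx
    simp only [mem_ofPred_eq, mx, lt_iSup_iff] at hx
    obtain ⟨n, hn⟩ := hx
    have hm : (x, n) ∈ 𝔱 := by
      simp only [h𝔱, mem_ofPred_eq]
      have h2 : ENNReal.ofReal ((2:ℝ)^n) * ENNReal.ofReal ((2:ℝ)^(-n)) = 1 := by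
        rw [← ENNReal.ofReal_mul (by positivity), ← zpow_add₀ (by norm_num)]; simp
      calc _ = ENNReal.ofReal ((2:ℝ)^n) * ENNReal.ofReal t := by
            rw [ENNReal.ofReal_mul ht.le, mul_comm]
        _ < ENNReal.ofReal ((2:ℝ)^n) * (ENNReal.ofReal ((2:ℝ)^(-n)) *
            ∫⁻ y in Icc (x - (2:ℝ)^n) (x + (2:ℝ)^n), w y) := by
            apply ENNReal.mul_lt_mul_right _ _ hn
            · simp; positivity
            · simp
        _ = _ := by rw [← mul_assoc, h2, one_mul]
    obtain ⟨b, hb, hsb⟩ := hcov _ hm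
    simp only [mem_iUnion]
    exact ⟨b, hb, hsb (Metric.mem_closedBall_self (by positivity))⟩
  have := hcount.to_subtype
  calc _ ≤ ENNReal.ofReal t * ∑' b : u, volume (Metric.closedBall b.1.1 (4 * (2:ℝ)^b.1.2)) := by
        gcongr
        refine (measure_mono hsub).trans ?_
        exact measure_biUnion_le _ hcount _
    _ = ∑' b : u, 8 * ENNReal.ofReal (t * (2:ℝ)^b.1.2) := by
        rw [← ENNReal.tsum_mul_left]
        congr 1; ext b
        rw [Real.volume_closedBall, ← ENNReal.ofReal_mul ht.le,
          show (8:ℝ≥0∞) = ENNReal.ofReal 8 by norm_num, ← ENNReal.ofReal_mul (by norm_num)]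
        congr 1; ring
    _ ≤ ∑' b : u, 8 * ∫⁻ y in Metric.closedBall b.1.1 ((2:ℝ)^b.1.2), w y := by
        apply ENNReal.tsum_le_tsum; intro b
        have h3 := hu b.2
        simp only [h𝔱, mem_ofPred_eq] at h3
        have := h3.le
        rw [Real.closedBall_eq_Icc]
        gcongr
    _ = 8 * ∫⁻ y in ⋃ b : u, Metric.closedBall b.1.1 ((2:ℝ)^b.1.2), w y := by
        rw [ENNReal.tsum_mul_left, lintegral_iUnion]
        · intro b; exact Metric.isClosed_closedBall.measurableSet
        · intro a b hab
          exact hdis a.2 b.2 (fun h => hab (Subtype.ext h))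
    _ ≤ _ := by gcongr 1; exact setLIntegral_le_lintegral _ _

lemma lint_pow_low {a e : ℝ} (ha : 0 ≤ a) (he : -1 < e) :
    ∫⁻ t in Ioc 0 a, ENNReal.ofReal (t ^ e) = ENNReal.ofReal (a^(e+1)/(e+1)) := by
  rw [← ofReal_integral_eq_lintegral_ofReal]
  · congr 1
    rw [← intervalIntegral.integral_of_le ha, integral_rpow (Or.inl he)]
    rw [Real.zero_rpow (by linarith)]; simp
  · have := (intervalIntegral.intervalIntegrable_rpow' he (a := 0) (b := a))
    rwa [intervalIntegrable_iff_integrableOn_Ioc_of_le ha] at this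
  · filter_upwards [ae_restrict_mem measurableSet_Ioc] with t ht
    exact Real.rpow_nonneg ht.1.le _

lemma lint_pow_high {a e : ℝ} (ha : 0 < a) (he : e < -1) :
    ∫⁻ t in Ioi a, ENNReal.ofReal (t ^ e) = ENNReal.ofReal (-a^(e+1)/(e+1)) := by
  rw [← ofReal_integral_eq_lintegral_ofReal]
  · congr 1
    rw [integral_Ioi_rpow_of_lt he ha]
  · exact integrableOn_Ioi_rpow_of_lt he ha
  · filter_upwards [ae_restrict_mem measurableSet_Ioi] with t ht
    exact Real.rpow_nonneg (ha.trans ht).le _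

lemma mx_split {w : ℝ → ℝ≥0∞} (hw : Measurable w) {t : ℝ} (ht : 0 < t) :
    ENNReal.ofReal t * volume {x | ENNReal.ofReal t < mx w x} ≤
      16 * ∫⁻ y, {y | ENNReal.ofReal (t/4) < w y}.indicator w y := by
  have hm : MeasurableSet {y | ENNReal.ofReal (t/4) < w y} := measurableSet_lt measurable_const hw
  have h1 : ∀ x, mx w x ≤ mx ({y | ENNReal.ofReal (t/4) < w y}.indicator w) x + ENNReal.ofReal (t/2) := by
    intro x
    have : w = fun y => {y | ENNReal.ofReal (t/4) < w y}.indicator w y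
        + {y | ENNReal.ofReal (t/4) < w y}ᶜ.indicator w y := by
      funext y; exact (congrFun (indicator_self_add_compl {y | ENNReal.ofReal (t/4) < w y} w) y).symm
    conv_lhs => rw [this]
    refine (mx_add (hw.indicator hm) x).trans ?_
    gcongr
    refine (mx_le_of_bdd (B := ENNReal.ofReal (t/4)) ?_ x).trans (le_of_eq ?_)
    · intro y
      by_cases hy : ENNReal.ofReal (t/4) < w y
      · rw [indicator_of_notMem (by simpa using hy)]; exact zero_le
      · rw [indicator_of_mem (by simpa using hy)]; exact not_lt.1 hy
    · rw [show (2:ℝ≥0∞) = ENNReal.ofReal 2 by norm_num, ← ENNReal.ofReal_mul (by norm_num)]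
      congr 1; ring
  have h2 : {x | ENNReal.ofReal t < mx w x} ⊆
      {x | ENNReal.ofReal (t/2) < mx ({y | ENNReal.ofReal (t/4) < w y}.indicator w) x} := by
    intro x hx
    simp only [mem_ofPred_eq] at hx ⊢
    by_contra hcon
    push Not at hcon
    have := hx.trans_le ((h1 x).trans (add_le_add_left hcon _))
    rw [← ENNReal.ofReal_add (by positivity) (by positivity), add_halves] at this
    exact lt_irrefl _ this
  calc _ ≤ 2 * (ENNReal.ofReal (t/2) * volume {x | ENNReal.ofReal (t/2) <
        mx ({y | ENNReal.ofReal (t/4) < w y}.indicator w) x}) := by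
        rw [← mul_assoc, show (2:ℝ≥0∞) * ENNReal.ofReal (t/2) = ENNReal.ofReal t by
          rw [show (2:ℝ≥0∞) = ENNReal.ofReal 2 by norm_num, ← ENNReal.ofReal_mul (by norm_num)]
          congr 1; ring]
        gcongr
    _ ≤ 2 * (8 * ∫⁻ y, {y | ENNReal.ofReal (t/4) < w y}.indicator w y) := by
        gcongr 1; exact mx_weak _ (by positivity)
    _ = _ := by rw [← mul_assoc]; norm_num

/-- constant for the maximal theorem -/
noncomputable def KM (q : ℝ) : ℝ := q * 16 * 4 ^ (q-1) / (q-1)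

lemma mx_strong {w : ℝ → ℝ≥0∞} (hw : Measurable w) {B : ℝ} (hB : ∀ y, w y ≤ ENNReal.ofReal B)
    {q : ℝ} (hq : 1 < q) : ∫⁻ x, mx w x ^ q ≤ ENNReal.ofReal (KM q) * ∫⁻ x, w x ^ q := by
  have hq0 : 0 < q := by linarith
  have hfin : ∀ x, mx w x ≠ ⊤ := fun x => ne_top_of_le_ne_top (by finiteness) (mx_le_of_bdd hB x)
  have hwfin : ∀ x, w x ≠ ⊤ := fun x => ne_top_of_le_ne_top (by finiteness) (hB x)
  have h1 : ∫⁻ x, mx w x ^ q = ∫⁻ x, ENNReal.ofReal ((mx w x).toReal ^ q) := by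
    apply lintegral_congr; intro x
    rw [← ENNReal.ofReal_rpow_of_nonneg ENNReal.toReal_nonneg hq0.le, ENNReal.ofReal_toReal (hfin x)]
  rw [h1, lintegral_rpow_eq_lintegral_meas_lt_mul volume (Eventually.of_forall fun x => ENNReal.toReal_nonneg)
    (mx_measurable hw).ennreal_toReal.aemeasurable hq0]
  have h2 : ∀ t ∈ Ioi (0:ℝ), volume {a | t < (mx w a).toReal} * ENNReal.ofReal (t^(q-1)) ≤
      ∫⁻ y, 16 * ({p : ℝ × ℝ | p.1 < 4 * (w p.2).toReal}.indicator
        (fun p => w p.2 * ENNReal.ofReal (p.1^(q-2))) (t, y)) := by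
    intro t ht
    have ht : 0 < t := ht
    have e1 : {a | t < (mx w a).toReal} = {x | ENNReal.ofReal t < mx w x} := by
      ext a; simp only [mem_ofPred_eq]
      rw [ENNReal.ofReal_lt_iff_lt_toReal ht.le (hfin a)]
    have e2 : ENNReal.ofReal (t^(q-1)) = ENNReal.ofReal t * ENNReal.ofReal (t^(q-2)) := by
      rw [← ENNReal.ofReal_mul ht.le]; congr 1
      rw [show q - 1 = 1 + (q-2) by ring, Real.rpow_add ht, Real.rpow_one]
    rw [e1, e2, ← mul_assoc, mul_comm (volume _)]
    calc _ ≤ (16 * ∫⁻ y, {y | ENNReal.ofReal (t/4) < w y}.indicator w y) * ENNReal.ofReal (t^(q-2)) := by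
          gcongr 1; exact mx_split hw ht
      _ = 16 * ((∫⁻ y, {y | ENNReal.ofReal (t/4) < w y}.indicator w y) * ENNReal.ofReal (t^(q-2))) := by
          rw [mul_assoc]
      _ = _ := by
          rw [← lintegral_mul_const' _ _ (by simp), ← lintegral_const_mul' _ _ (by simp)]
          apply lintegral_congr; intro y
          congr 1
          have : (y ∈ {y | ENNReal.ofReal (t/4) < w y}) ↔ ((t,y) ∈ {p : ℝ × ℝ | p.1 < 4 * (w p.2).toReal}) := by
            simp only [mem_ofPred_eq]
            rw [ENNReal.ofReal_lt_iff_lt_toReal (by positivity) (hwfin y), div_lt_iff₀ (by norm_num), mul_comm]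
          by_cases hy : y ∈ {y | ENNReal.ofReal (t/4) < w y}
          · rw [indicator_of_mem hy, indicator_of_mem (this.1 hy)]
          · rw [indicator_of_notMem hy, indicator_of_notMem (fun h => hy (this.2 h)), zero_mul]
  have hmeas : Measurable (fun p : ℝ × ℝ => 16 * ({p : ℝ × ℝ | p.1 < 4 * (w p.2).toReal}.indicator
        (fun p => w p.2 * ENNReal.ofReal (p.1^(q-2))) p)) := by
    apply Measurable.const_mul
    apply Measurable.indicator
    · exact (hw.comp measurable_snd).mul (by fun_prop)
    · exact measurableSet_lt measurable_fst ((hw.comp measurable_snd).ennreal_toReal.const_mul _)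
  calc _ ≤ ENNReal.ofReal q * ∫⁻ t in Ioi 0, ∫⁻ y, 16 * ({p : ℝ × ℝ | p.1 < 4 * (w p.2).toReal}.indicator
        (fun p => w p.2 * ENNReal.ofReal (p.1^(q-2))) (t, y)) := by
        gcongr 1
        exact setLIntegral_mono' measurableSet_Ioi h2
    _ = ENNReal.ofReal q * ∫⁻ y, ∫⁻ t in Ioi 0, 16 * ({p : ℝ × ℝ | p.1 < 4 * (w p.2).toReal}.indicator
        (fun p => w p.2 * ENNReal.ofReal (p.1^(q-2))) (t, y)) := by
        rw [lintegral_lintegral_swap]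
        exact hmeas.aemeasurable
    _ ≤ ENNReal.ofReal q * ∫⁻ y, ENNReal.ofReal (16 * 4^(q-1)/(q-1)) * w y ^ q := by
        gcongr with y
        have e3 : ∀ t, ({p : ℝ × ℝ | p.1 < 4 * (w p.2).toReal}.indicator
            (fun p => w p.2 * ENNReal.ofReal (p.1^(q-2))) (t, y)) =
            w y * (Iio (4 * (w y).toReal)).indicator (fun t => ENNReal.ofReal (t^(q-2))) t := by
          intro t
          by_cases h : t < 4 * (w y).toReal
          · rw [indicator_of_mem (by simpa using h), indicator_of_mem (by simpa using h)]
          · rw [indicator_of_notMem (by simpa using h), indicator_of_notMem (by simpa using h), mul_zero]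
        simp_rw [e3]
        rw [lintegral_const_mul' _ _ (by simp), lintegral_const_mul' _ _ (hwfin y),
          lintegral_indicator measurableSet_Iio, Measure.restrict_restrict measurableSet_Iio]
        calc _ ≤ 16 * (w y * ∫⁻ t in Ioc 0 (4 * (w y).toReal), ENNReal.ofReal (t^(q-2))) := by
              gcongr 2
              apply lintegral_mono_set
              intro t ht; exact ⟨ht.2, ht.1.le⟩
          _ = _ := by
              rw [lint_pow_low (by positivity) (by linarith)]
              have hw0 : 0 ≤ (w y).toReal := ENNReal.toReal_nonneg
              conv_lhs => rw [← ENNReal.ofReal_toReal (hwfin y)]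
              conv_rhs => rw [← ENNReal.ofReal_toReal (hwfin y)]
              rw [ENNReal.toReal_ofReal hw0, ENNReal.ofReal_rpow_of_nonneg hw0 hq0.le,
                show (16:ℝ≥0∞) = ENNReal.ofReal 16 by norm_num, ← ENNReal.ofReal_mul hw0,
                ← ENNReal.ofReal_mul (by norm_num), ← ENNReal.ofReal_mul (by
                  apply div_nonneg (by positivity); linarith)]
              congr 1
              rw [show q - 2 + 1 = q - 1 by ring, Real.mul_rpow (by norm_num) hw0]
              have : (w y).toReal ^ q = (w y).toReal * (w y).toReal ^ (q-1) := by
                rcases hw0.eq_or_lt with h0 | h0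
                · rw [← h0, Real.zero_rpow hq0.ne', zero_mul]
                · rw [show q = 1 + (q-1) by ring, Real.rpow_add h0, Real.rpow_one]; ring_nf
              rw [this]; ring
    _ = _ := by
        rw [lintegral_const_mul' _ _ (by simp), ← mul_assoc, ← ENNReal.ofReal_mul hq0.le]
        congr 2
        unfold KM; ring

end BHT
end

section
open MeasureTheory Filter Set
open scoped ENNReal ComplexConjugate
namespace BHT

noncomputable def sav (w : ℝ → ℝ≥0∞) (c s : ℝ) : ℝ≥0∞ :=
  ⨆ R : {R : ℝ // s ≤ R}, ENNReal.ofReal ((R:ℝ)⁻¹) * ∫⁻ y in Icc (c - R) (c + R), w y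

lemma sav_le_two {w : ℝ → ℝ≥0∞} {c s : ℝ} (hs : 0 < s) (hw : ∀ y, w y ≤ 1) : sav w c s ≤ 2 := by
  unfold sav
  apply iSup_le; rintro ⟨R, hR⟩
  have hR0 : 0 < R := hs.trans_le hR
  calc _ ≤ ENNReal.ofReal (R⁻¹) * ∫⁻ y in Icc (c - R) (c + R), 1 := by
        gcongr 2 with y
        exact hw y
    _ = 2 := by
        rw [setLIntegral_const, one_mul, Real.volume_Icc, ← ENNReal.ofReal_mul (by positivity)]
        rw [show R⁻¹ * (c + R - (c - R)) = 2 by field_simp; ring]; norm_num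

lemma sav_avg {w : ℝ → ℝ≥0∞} {c s : ℝ} (hs : 0 < s) (h : sav w c s ≠ ⊤) : Avg w c s (sav w c s).toReal := by
  intro R hR
  have hR0 : 0 < R := hs.trans_le hR
  have h1 : ENNReal.ofReal (R⁻¹) * ∫⁻ y in Icc (c - R) (c + R), w y ≤ sav w c s :=
    le_iSup (fun R : {R : ℝ // s ≤ R} => ENNReal.ofReal ((R:ℝ)⁻¹) * ∫⁻ y in Icc (c - R) (c + R), w y) ⟨R, hR⟩
  rw [ENNReal.ofReal_mul ENNReal.toReal_nonneg, ENNReal.ofReal_toReal h]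
  calc _ = ENNReal.ofReal (R⁻¹) * (∫⁻ y in Icc (c - R) (c + R), w y) * ENNReal.ofReal R := by
        rw [mul_right_comm, ← ENNReal.ofReal_mul (by positivity), inv_mul_cancel₀ hR0.ne']; simp
    _ ≤ _ := by gcongr

lemma sav_le {w w' : ℝ → ℝ≥0∞} {c s x D : ℝ} {κ : ℝ≥0∞} (hκ : κ ≠ ⊤) (hs : 0 < s) (hw : ∀ y, w y ≤ κ * w' y)
    (hD : 0 ≤ D) (hx : |x - c| ≤ D * s) : sav w c s ≤ ENNReal.ofReal (2 * (1 + D)) * κ * mx w' x := by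
  unfold sav
  apply iSup_le; rintro ⟨R, hR⟩
  have hR0 : 0 < R := hs.trans_le hR
  have h2 : D * s ≤ D * R := by gcongr
  rw [abs_le] at hx
  calc _ ≤ ENNReal.ofReal (R⁻¹) * ∫⁻ y in Icc (x - (1 + D) * R) (x + (1 + D) * R), κ * w' y := by
        gcongr 1
        refine (lintegral_mono_set ?_).trans (lintegral_mono fun y => hw y)
        apply Icc_subset_Icc <;> simp only <;> linarith [hx.1, hx.2]
    _ ≤ ENNReal.ofReal (R⁻¹) * (κ * (ENNReal.ofReal (2 * ((1+D)*R)) * mx w' x)) := by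
        rw [lintegral_const_mul' _ _ hκ]
        gcongr
        exact mx_avg w' x (by positivity)
    _ = (ENNReal.ofReal (R⁻¹) * ENNReal.ofReal (2 * ((1+D)*R))) * κ * mx w' x := by ring
    _ = _ := by
        rw [← ENNReal.ofReal_mul (by positivity)]
        congr 3; field_simp

/-- geometric sum over the integers -/
lemma geom_Z {ρ : ℝ} (h0 : 0 ≤ ρ) (h1 : ρ < 1) : Summable fun k : ℤ => ρ ^ k.natAbs := by
  apply Summable.of_nat_of_neg
  · simpa using summable_geometric_of_lt_one h0 h1
  · simpa using summable_geometric_of_lt_one h0 h1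

noncomputable def KL (ν : ℝ) : ℝ := 2 * 6 * 2 ^ ν * ∑' k : ℤ, ((2:ℝ) ^ (-(min 1 (ν - 1)))) ^ k.natAbs

set_option maxHeartbeats 1600000 in
/-- summation over the levels -/
lemma level_sum {t e : ℝ} (ht : 0 < t) (he0 : 0 < e) (he1 : e ≤ 1) (hte : 1 < t * e) (l : ℕ) (X : ℝ≥0∞) :
    ∑' k : ℤ, ENNReal.ofReal ((2:ℝ)^k) *
      (min 2 (ENNReal.ofReal (6 * 2^l * (2:ℝ)^((1 - k) * t)) * X ^ t)) ^ e ≤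
      ENNReal.ofReal (KL (t * e) * 2^l) * X := by
  set ν := t * e with hν
  set ρ : ℝ := (2:ℝ) ^ (-(min 1 (ν - 1))) with hρ
  have hρ0 : 0 < ρ := by positivity
  have hmin : 0 < min 1 (ν - 1) := lt_min one_pos (by linarith)
  have hρ1 : ρ < 1 := Real.rpow_lt_one_of_one_lt_of_neg (by norm_num) (by linarith)
  have hsum := geom_Z hρ0.le hρ1
  have hKpos : 0 < KL ν := by
    unfold KL
    have : 0 < ∑' k : ℤ, ρ ^ k.natAbs := hsum.tsum_pos (fun _ => by positivity) 0 (by positivity)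
    positivity
  rcases eq_or_ne X 0 with h0 | h0
  · rw [h0, ENNReal.zero_rpow_of_pos ht]; simp [ENNReal.zero_rpow_of_pos he0]
  rcases eq_or_ne X ⊤ with htop | htop
  · rw [htop, ENNReal.mul_top (by simpa using by positivity)]; exact le_top
  set x := X.toReal with hx
  have hx0 : 0 < x := ENNReal.toReal_pos h0 htop
  have hX : X = ENNReal.ofReal x := (ENNReal.ofReal_toReal htop).symm
  obtain ⟨a, ha1, ha2⟩ := exists_mem_Ico_zpow hx0 (by norm_num : (1:ℝ) < 2)
  have hterm : ∀ k : ℤ, ENNReal.ofReal ((2:ℝ)^k) *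
      (min 2 (ENNReal.ofReal (6 * 2^l * (2:ℝ)^((1 - k) * t)) * X ^ t)) ^ e ≤
      ENNReal.ofReal (2 * 6 * 2 ^ ν * 2^l * x * ρ ^ (k - (a+1)).natAbs) := by
    intro k
    have h2l : (1:ℝ) ≤ 2^l := one_le_pow₀ (by norm_num)
    have h2ν : (1:ℝ) ≤ 2^ν := Real.one_le_rpow (by norm_num) (by linarith)
    rcases le_or_gt k (a+1) with hk | hk
    · calc _ ≤ ENNReal.ofReal ((2:ℝ)^k) * 2 := by
            gcongr
            calc _ ≤ (2:ℝ≥0∞) ^ e := by gcongr; exact min_le_left _ _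
              _ ≤ 2 ^ (1:ℝ) := ENNReal.rpow_le_rpow_of_exponent_le (by norm_num) he1
              _ = 2 := by simp
        _ = ENNReal.ofReal ((2:ℝ)^k * 2) := by rw [ENNReal.ofReal_mul (by positivity)]; norm_num
        _ ≤ _ := by
            apply ENNReal.ofReal_le_ofReal
            obtain ⟨m, hm⟩ : ∃ m : ℕ, (a + 1) - k = m := ⟨(a+1-k).toNat, by omega⟩
            have e1 : (k - (a+1)).natAbs = m := by omega
            have e2 : (2:ℝ)^k = 2 * 2^a * (2⁻¹)^m := by
              rw [show k = 1 + a + (-(m:ℤ)) by omega, zpow_add₀ (by norm_num), zpow_add₀ (by norm_num)]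
              simp
            have e3 : (2:ℝ)⁻¹ ≤ ρ := by
              rw [hρ, ← Real.rpow_neg_one]
              apply Real.rpow_le_rpow_of_exponent_le (by norm_num)
              linarith [min_le_left 1 (ν - 1)]
            rw [e1, e2]
            calc (2:ℝ) * 2^a * (2⁻¹)^m * 2 ≤ 2 * x * ρ ^ m * 2 := by gcongr
              _ = 4 * 1 * 1 * (x * ρ^m) := by ring
              _ ≤ (2*6) * 2^ν * 2^l * (x * ρ^m) := by gcongr; norm_num
              _ = _ := by ring
    · calc _ ≤ ENNReal.ofReal ((2:ℝ)^k) * (ENNReal.ofReal (6 * 2^l * (2:ℝ)^((1 - k) * t)) * X ^ t) ^ e := by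
            gcongr; exact min_le_right _ _
        _ = ENNReal.ofReal ((2:ℝ)^k * (6 * 2^l * (2:ℝ)^((1 - k) * t) * x ^ t)^e) := by
            rw [hX, ENNReal.ofReal_rpow_of_nonneg hx0.le ht.le, ← ENNReal.ofReal_mul (by positivity),
              ENNReal.ofReal_rpow_of_nonneg (by positivity) he0.le, ← ENNReal.ofReal_mul (by positivity)]
        _ ≤ _ := by
            apply ENNReal.ofReal_le_ofReal
            obtain ⟨m, hm⟩ : ∃ m : ℕ, k - (a+1) = m := ⟨(k-(a+1)).toNat, by omega⟩
            have e1 : (k - (a+1)).natAbs = m := by omega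
            rw [e1]
            have e4 : (6 * 2^l : ℝ)^e ≤ 6 * 2^l := by
              conv_rhs => rw [← Real.rpow_one (6 * 2^l : ℝ)]
              apply Real.rpow_le_rpow_of_exponent_le _ he1
              linarith
            have e5 : (2:ℝ)^k = 2^((k:ℝ) - (a+1)) * 2^((a:ℝ)+1) := by
              rw [← Real.rpow_add (by norm_num), ← Real.rpow_intCast]; congr 1; ring
            have e6 : ((2:ℝ)^((1 - k) * t) * x ^ t)^e = 2^((1-k)*ν) * x ^ ν := by
              rw [Real.mul_rpow (by positivity) (by positivity), ← Real.rpow_mul (by norm_num), ← Real.rpow_mul hx0.le,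
                mul_assoc]
            have e7 : x ^ ν ≤ x * 2 ^ ((a+1) * (ν - 1)) := by
              calc x ^ ν = x * x^(ν - 1) := by
                    conv_lhs => rw [show ν = 1 + (ν-1) by ring]
                    rw [Real.rpow_add hx0, Real.rpow_one]
                _ ≤ x * ((2:ℝ)^(a+1))^(ν-1) := by
                    gcongr
                _ = _ := by
                    rw [← Real.rpow_intCast, ← Real.rpow_mul (by norm_num)]; push_cast; rfl
            have e8 : (2:ℝ)^((m:ℝ) * (-(ν-1))) ≤ ρ^m := by
              rw [hρ, ← Real.rpow_natCast, ← Real.rpow_mul (by norm_num)]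
              apply Real.rpow_le_rpow_of_exponent_le (by norm_num)
              have := min_le_right 1 (ν - 1)
              have hm0 : (0:ℝ) ≤ m := by positivity
              nlinarith
            have hmr : (k:ℝ) = a + 1 + m := by
              have : k = a + 1 + m := by omega
              rw [this]; push_cast; ring
            calc (2:ℝ)^k * (6 * 2^l * (2:ℝ)^((1 - k) * t) * x ^ t)^e
                = (6 * 2^l)^e * ((2:ℝ)^k * ((2:ℝ)^((1-k)*ν) * x^ν)) := by
                  rw [mul_assoc (6 * 2^l), Real.mul_rpow (by positivity) (by positivity), e6]; ring
              _ ≤ (6 * 2^l) * ((2:ℝ)^k * ((2:ℝ)^((1-k)*ν) * (x * 2 ^ ((a+1) * (ν - 1))))) := by gcongr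
              _ = (6 * 2^l) * (2^ν * x * (2:ℝ)^((m:ℝ) * (-(ν-1)))) := by
                  congr 1
                  rw [← Real.rpow_intCast]
                  rw [show (2:ℝ)^(k:ℝ) * ((2:ℝ)^((1-k)*ν) * (x * 2 ^ ((a+1) * (ν - 1)))) =
                    x * ((2:ℝ)^(k:ℝ) * (2:ℝ)^((1-k)*ν) * 2 ^ ((a+1) * (ν - 1))) by ring,
                    ← Real.rpow_add (by norm_num), ← Real.rpow_add (by norm_num),
                    mul_comm (2^ν) x, mul_assoc, ← Real.rpow_add (by norm_num)]
                  congr 2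
                  rw [hmr]; ring
              _ ≤ (6 * 2^l) * (2^ν * x * ρ^m) := by gcongr
              _ ≤ 2 * ((6 * 2^l) * (2^ν * x * ρ^m)) := by
                  have : 0 ≤ (6 * 2^l) * (2^ν * x * ρ^m) := by positivity
                  linarith
              _ = _ := by ring
  refine (ENNReal.tsum_le_tsum hterm).trans (le_of_eq ?_)
  have hs2 : Summable fun k : ℤ => ρ ^ (k - (a+1)).natAbs :=
    (Equiv.subRight (a+1)).summable_iff.2 hsum
  rw [← ENNReal.ofReal_tsum_of_nonneg (fun k => by positivity) (hs2.mul_left _), tsum_mul_left, hX,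
    ← ENNReal.ofReal_mul (by positivity)]
  congr 1
  have := (Equiv.subRight (a+1)).tsum_eq (fun k : ℤ => ρ ^ k.natAbs)
  simp only [Equiv.subRight_apply] at this
  rw [this]
  unfold KL
  ring

end BHT
end

section
open MeasureTheory Filter Set
open scoped ENNReal ComplexConjugate
namespace BHT

/-- level pieces -/
noncomputable def lev (f : ℝ → ℂ) (k : ℤ) (y : ℝ) : ℂ :=
  {y | (2:ℝ)^(k-1) < ‖f y‖ ∧ ‖f y‖ ≤ (2:ℝ)^k}.indicator (fun y => ((2:ℝ)^(-k) : ℝ) * f y) y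

lemma lev_set_meas {f : ℝ → ℂ} (hf : Measurable f) (k : ℤ) :
    MeasurableSet {y | (2:ℝ)^(k-1) < ‖f y‖ ∧ ‖f y‖ ≤ (2:ℝ)^k} :=
  (measurableSet_lt measurable_const hf.norm).inter (measurableSet_le hf.norm measurable_const)

lemma lev_meas {f : ℝ → ℂ} (hf : Measurable f) (k : ℤ) : Measurable (lev f k) := by
  unfold lev
  exact (hf.const_mul _).indicator (lev_set_meas hf k)

lemma lev_le (f : ℝ → ℂ) (k : ℤ) (y : ℝ) : ‖lev f k y‖ ≤ 1 := by
  unfold lev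
  by_cases h : y ∈ {y | (2:ℝ)^(k-1) < ‖f y‖ ∧ ‖f y‖ ≤ (2:ℝ)^k}
  · rw [indicator_of_mem h, norm_mul, Complex.norm_real, Real.norm_of_nonneg (by positivity)]
    calc _ ≤ (2:ℝ)^(-k) * (2:ℝ)^k := by gcongr; exact h.2
      _ = 1 := by rw [← zpow_add₀ (by norm_num)]; simp
  · rw [indicator_of_notMem h]; simp

lemma lev_le' (f : ℝ → ℂ) (k : ℤ) (y : ℝ) {t : ℝ} (ht : 0 < t) :
    ‖lev f k y‖ₑ ≤ ENNReal.ofReal ((2:ℝ)^((1-k)*t)) * ‖f y‖ₑ ^ t := by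
  by_cases h : y ∈ {y | (2:ℝ)^(k-1) < ‖f y‖ ∧ ‖f y‖ ≤ (2:ℝ)^k}
  · have h1 : ‖lev f k y‖ₑ ≤ 1 := by
      rw [← ofReal_norm, show (1:ℝ≥0∞) = ENNReal.ofReal 1 by simp]
      exact ENNReal.ofReal_le_ofReal (lev_le f k y)
    refine h1.trans ?_
    rw [← ofReal_norm, ENNReal.ofReal_rpow_of_nonneg (norm_nonneg _) ht.le, ← ENNReal.ofReal_mul (by positivity)]
    rw [show (1:ℝ≥0∞) = ENNReal.ofReal 1 by simp]
    apply ENNReal.ofReal_le_ofReal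
    calc (1:ℝ) = (2:ℝ)^((1-k)*t) * ((2:ℝ)^(k-1))^t := by
          rw [← Real.rpow_intCast, ← Real.rpow_mul (by norm_num), ← Real.rpow_add (by norm_num)]
          push_cast
          rw [show (1 - (k:ℝ)) * t + (k - 1) * t = 0 by ring, Real.rpow_zero]
      _ ≤ _ := by gcongr; exact h.1.le
  · unfold lev; rw [indicator_of_notMem h]; simp

lemma cf_lev {f : ℝ → ℂ} (hf : Measurable f) {φ : ℝ → ℂ} (hi : Integrable fun y => f y * φ y) :
    ‖∫ y, f y * φ y‖ₑ ≤ ∑' k : ℤ, ENNReal.ofReal ((2:ℝ)^k) * ‖∫ y, lev f k y * φ y‖ₑ := by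
  set S : ℤ → Set ℝ := fun k => {y | (2:ℝ)^(k-1) < ‖f y‖ ∧ ‖f y‖ ≤ (2:ℝ)^k} with hS
  have hSm : ∀ k, MeasurableSet (S k) := lev_set_meas hf
  have hdis : Pairwise (Function.onFun Disjoint S) := by
    intro j k hjk
    rw [Function.onFun, Set.disjoint_left]
    rintro y ⟨a1, a2⟩ ⟨b1, b2⟩
    have h1 := (zpow_lt_zpow_iff_right₀ (by norm_num : (1:ℝ) < 2)).1 (a1.trans_le b2)
    have h2 := (zpow_lt_zpow_iff_right₀ (by norm_num : (1:ℝ) < 2)).1 (b1.trans_le a2)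
    omega
  have e0 : ∫ y, f y * φ y = ∫ y in ⋃ k, S k, f y * φ y := by
    symm
    apply setIntegral_eq_integral_of_forall_compl_eq_zero
    intro y hy
    by_contra hne
    apply hy
    have hpos : 0 < ‖f y‖ := norm_pos_iff.2 (left_ne_zero_of_mul hne)
    obtain ⟨n, h1, h2⟩ := exists_mem_Ioc_zpow hpos (by norm_num : (1:ℝ) < 2)
    exact mem_iUnion.2 ⟨n+1, by simpa using h1, h2⟩
  rw [e0, integral_iUnion hSm hdis hi.integrableOn]
  refine enorm_tsum_le_tsum_enorm.trans (le_of_eq ?_)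
  congr 1; ext k
  have : ∫ y in S k, f y * φ y = (((2:ℝ)^k : ℝ) : ℂ) * ∫ y, lev f k y * φ y := by
    rw [← integral_const_mul, ← integral_indicator (hSm k)]
    congr 1; ext y
    unfold lev
    by_cases h : y ∈ S k
    · rw [indicator_of_mem h, indicator_of_mem h, ← mul_assoc, ← mul_assoc, ← Complex.ofReal_mul, ← zpow_add₀ (by norm_num)]
      simp
    · rw [indicator_of_notMem h, indicator_of_notMem h]; simp
  rw [this, enorm_mul, ← ofReal_norm, Complex.norm_real, Real.norm_of_nonneg (by positivity)]

noncomputable def KT (N : ℕ) (θ t : Fin 3 → ℝ) : ℝ :=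
  8 * CR N θ * KL (t 0 * ((1 + θ 0)/2)) * KL (t 1 * ((1 + θ 1)/2))

lemma KL_nonneg (ν : ℝ) : 0 ≤ KL ν := by
  unfold KL
  have : 0 ≤ ∑' k : ℤ, ((2:ℝ) ^ (-(min 1 (ν - 1)))) ^ k.natAbs := tsum_nonneg fun k => by positivity
  positivity

/-- estimate for one distance class and one pair of levels -/
lemma tile_class {σ τ A : ℝ} {N : ℕ} (hσ : 0 < σ) (hA : 0 < A) {γ : Fin 3 → ℝ}
    (hγ : ∀ i j, i ≠ j → 1/2 ≤ |γ i - γ j| ∧ |γ i - γ j| ≤ 1)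
    {θ t : Fin 3 → ℝ} (hθ0 : ∀ i, 0 ≤ θ i) (hθ1 : ∀ i, θ i ≤ 1) (hθ : ∑ i, θ i < 1) (ht : ∀ i, 0 < t i)
    {φ : Fin 3 → Tile → ℝ → ℂ} (h : ∀ i, Pk σ τ (γ i) N A (φ i))
    {f g w : ℝ → ℂ} (hf : Measurable f) (hg : Measurable g) (hw : Measurable w) (hw1 : ∀ x, ‖w x‖ ≤ 1)
    {E : Set ℝ} (hEne : E.Nonempty) (hE : ∀ y, w y ≠ 0 → y ∈ E)
    {V1 V2 : ℝ → ℝ≥0∞} {Λ1 Λ2 : ℝ≥0∞}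
    (hV1 : ∀ x, mx (fun y => ‖f y‖ₑ ^ t 0) x ≤ V1 x ^ t 0) (hL1 : ∀ x ∈ E, mx (fun y => ‖f y‖ₑ ^ t 0) x ≤ Λ1 ^ t 0)
    (hV2 : ∀ x, mx (fun y => ‖g y‖ₑ ^ t 1) x ≤ V2 x ^ t 1) (hL2 : ∀ x ∈ E, mx (fun y => ‖g y‖ₑ ^ t 1) x ≤ Λ2 ^ t 1)
    {l : ℕ} (𝔓 : Finset Tile) (hD : ∀ P ∈ 𝔓, DClass σ E l P) (k j : ℤ) :
    ENNReal.ofReal (∑ P ∈ 𝔓, sc σ P * (cf (φ 0) (lev f k) P * cf (φ 1) (lev g j) P * cf (φ 2) w P)) ≤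
      ENNReal.ofReal (CR N θ * A ^ 3 * (((2 ^ l) ^ N)⁻¹) ^ θ 2) * ∫⁻ x,
        (min 2 (ENNReal.ofReal (6 * 2^l * (2:ℝ)^((1 - k) * t 0)) * (min (V1 x) Λ1) ^ t 0)) ^ ((1+θ 0)/2) *
        (min 2 (ENNReal.ofReal (6 * 2^l * (2:ℝ)^((1 - j) * t 1)) * (min (V2 x) Λ2) ^ t 1)) ^ ((1+θ 1)/2) *
        (4 * mx (fun y => ‖w y‖ₑ) x) ^ ((1+θ 2)/2) := by
  set F : Fin 3 → ℝ → ℂ := ![lev f k, lev g j, w] with hF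
  set b : Fin 3 → ℝ → ℝ≥0∞ := ![fun x => min 2 (ENNReal.ofReal (6 * 2^l * (2:ℝ)^((1 - k) * t 0)) * (min (V1 x) Λ1) ^ t 0),
    fun x => min 2 (ENNReal.ofReal (6 * 2^l * (2:ℝ)^((1 - j) * t 1)) * (min (V2 x) Λ2) ^ t 1),
    fun x => 4 * mx (fun y => ‖w y‖ₑ) x] with hb
  have hF1 : ∀ i x, ‖F i x‖ ≤ 1 := by
    intro i; fin_cases i
    · exact lev_le f k
    · exact lev_le g j
    · exact hw1
  have hF1' : ∀ i x, ‖F i x‖ₑ ≤ 1 := by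
    intro i x
    rw [← ofReal_norm, show (1:ℝ≥0∞) = ENNReal.ofReal 1 by simp]
    exact ENNReal.ofReal_le_ofReal (hF1 i x)
  have hs2 : ∀ i P, sav (fun y => ‖F i y‖ₑ) (lf σ P) (sc σ P) ≤ 2 := fun i P => sav_le_two (sc_pos hσ P) (hF1' i)
  have hst : ∀ i P, sav (fun y => ‖F i y‖ₑ) (lf σ P) (sc σ P) ≠ ⊤ := fun i P =>
    ne_top_of_le_ne_top (by finiteness) (hs2 i P)
  have key : ∀ (u : ℝ → ℂ) (n : ℤ) (t : ℝ) (ht : 0 < t) (V : ℝ → ℝ≥0∞) (Λ : ℝ≥0∞)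
      (_ : ∀ x, mx (fun y => ‖u y‖ₑ ^ t) x ≤ V x ^ t) (_ : ∀ x ∈ E, mx (fun y => ‖u y‖ₑ ^ t) x ≤ Λ ^ t)
      (P : Tile) (_ : P ∈ 𝔓) (x : ℝ) (_ : x ∈ Iv σ P), sav (fun y => ‖lev u n y‖ₑ) (lf σ P) (sc σ P) ≤
        min 2 (ENNReal.ofReal (6 * 2^l * (2:ℝ)^((1 - n) * t)) * (min (V x) Λ) ^ t) := by
    intro u n t ht V Λ hV hL P hP x hx
    have hs := sc_pos hσ P
    have h2l : (1:ℝ) ≤ 2^l := one_le_pow₀ (by norm_num)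
    apply le_min
    · apply sav_le_two hs
      intro y
      rw [← ofReal_norm, show (1:ℝ≥0∞) = ENNReal.ofReal 1 by simp]
      exact ENNReal.ofReal_le_ofReal (lev_le u n y)
    rw [mul_comm (6 * 2^l : ℝ), ENNReal.ofReal_mul (by positivity)]
    rcases min_cases (V x) Λ with ⟨he, _⟩ | ⟨he, _⟩
    · rw [he]
      refine (sav_le (x := x) (D := 1) (κ := ENNReal.ofReal ((2:ℝ)^((1-n)*t))) (w' := fun y => ‖u y‖ₑ ^ t)
        (by simp) hs (fun y => lev_le' u n y ht) (by norm_num) ?_).trans ?_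
      · rw [abs_le]; constructor <;> linarith [hx.1, hx.2]
      · rw [mul_comm (ENNReal.ofReal (2 * (1 + 1)))]
        refine mul_le_mul' (mul_le_mul' le_rfl (ENNReal.ofReal_le_ofReal ?_)) (hV x)
        linarith
    · rw [he]
      have hD' := (hD P hP).2
      have hlt : Metric.infDist (lf σ P) E < 2^(l+1) * sc σ P := by
        rw [← div_lt_iff₀ hs]; linarith
      obtain ⟨e, heE, hde⟩ := (Metric.infDist_lt_iff hEne).1 hlt
      refine (sav_le (x := e) (D := 2^(l+1)) (κ := ENNReal.ofReal ((2:ℝ)^((1-n)*t))) (w' := fun y => ‖u y‖ₑ ^ t)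
        (by simp) hs (fun y => lev_le' u n y ht) (by positivity) ?_).trans ?_
      · rw [abs_sub_comm]; exact hde.le
      · rw [mul_comm (ENNReal.ofReal (2 * (1 + 2^(l+1))))]
        refine mul_le_mul' (mul_le_mul' le_rfl (ENNReal.ofReal_le_ofReal ?_)) (hL e heE)
        rw [pow_succ]; linarith
  have := restricted (f := F) (b := b) (α := fun i P => (sav (fun y => ‖F i y‖ₑ) (lf σ P) (sc σ P)).toReal)
    hσ hA hγ hθ0 hθ1 hθ h (by
      intro i; fin_cases i
      · exact lev_meas hf k
      · exact lev_meas hg j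
      · exact hw) hF1 (E := E) hE hD (fun i P => ENNReal.toReal_nonneg)
    (fun i P => ENNReal.toReal_le_of_le_ofReal (by norm_num) (by simpa using hs2 i P))
    (fun i P hP => sav_avg (sc_pos hσ P) (hst i P)) (by
      intro i P hP x hx
      rw [ENNReal.ofReal_toReal (hst i P)]
      fin_cases i
      · exact key f k (t 0) (ht 0) V1 Λ1 hV1 hL1 P hP x hx
      · exact key g j (t 1) (ht 1) V2 Λ2 hV2 hL2 P hP x hx
      · refine (sav_le (x := x) (D := 1) (κ := 1) (w' := fun y => ‖w y‖ₑ)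
          (by simp) (sc_pos hσ P) (fun y => by simp [hF]) (by norm_num) ?_).trans ?_
        · rw [abs_le]; constructor <;> linarith [hx.1, hx.2, sc_pos hσ P]
        · simp only [hb, mul_one]
          norm_num)
  simp only [Fin.prod_univ_three] at this
  exact this

theorem tile_est {σ τ A : ℝ} {N : ℕ} (hσ : 0 < σ) (hA : 0 < A) {γ : Fin 3 → ℝ}
    (hγ : ∀ i j, i ≠ j → 1/2 ≤ |γ i - γ j| ∧ |γ i - γ j| ≤ 1)
    {θ t : Fin 3 → ℝ} (hθ0 : ∀ i, 0 ≤ θ i) (hθ1 : ∀ i, θ i ≤ 1) (hθ : ∑ i, θ i < 1) (ht : ∀ i, 0 < t i)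
    (ht0 : 1 < t 0 * ((1 + θ 0)/2)) (ht1 : 1 < t 1 * ((1 + θ 1)/2)) (hN : 3 ≤ N * θ 2)
    {φ : Fin 3 → Tile → ℝ → ℂ} (h : ∀ i, Pk σ τ (γ i) N A (φ i))
    {f g w : ℝ → ℂ} (hf : Measurable f) (hg : Measurable g) (hw : Measurable w) (hw1 : ∀ x, ‖w x‖ ≤ 1)
    {B : ℝ} (hfB : ∀ x, ‖f x‖ ≤ B) (hgB : ∀ x, ‖g x‖ ≤ B)
    {E : Set ℝ} (hEne : E.Nonempty) (hE : ∀ y, w y ≠ 0 → y ∈ E)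
    {V1 V2 : ℝ → ℝ≥0∞} (hV1m : Measurable V1) (hV2m : Measurable V2) {Λ1 Λ2 : ℝ≥0∞}
    (hV1 : ∀ x, mx (fun y => ‖f y‖ₑ ^ t 0) x ≤ V1 x ^ t 0) (hL1 : ∀ x ∈ E, mx (fun y => ‖f y‖ₑ ^ t 0) x ≤ Λ1 ^ t 0)
    (hV2 : ∀ x, mx (fun y => ‖g y‖ₑ ^ t 1) x ≤ V2 x ^ t 1) (hL2 : ∀ x ∈ E, mx (fun y => ‖g y‖ₑ ^ t 1) x ≤ Λ2 ^ t 1)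
    (𝔓 : Finset Tile) :
    ENNReal.ofReal (∑ P ∈ 𝔓, sc σ P * (cf (φ 0) f P * cf (φ 1) g P * cf (φ 2) w P)) ≤
      ENNReal.ofReal (KT N θ t * A ^ 3) * ∫⁻ x, min (V1 x) Λ1 * min (V2 x) Λ2 *
        mx (fun y => ‖w y‖ₑ) x ^ ((1+θ 2)/2) := by
  classical
  set D1 : ℤ → ℕ → ℝ → ℝ≥0∞ := fun k l x =>
    (min 2 (ENNReal.ofReal (6 * 2^l * (2:ℝ)^((1 - k) * t 0)) * (min (V1 x) Λ1) ^ t 0)) ^ ((1+θ 0)/2) with hD1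
  set D2 : ℤ → ℕ → ℝ → ℝ≥0∞ := fun k l x =>
    (min 2 (ENNReal.ofReal (6 * 2^l * (2:ℝ)^((1 - k) * t 1)) * (min (V2 x) Λ2) ^ t 1)) ^ ((1+θ 1)/2) with hD2
  set M3 : ℝ → ℝ≥0∞ := fun x => (4 * mx (fun y => ‖w y‖ₑ) x) ^ ((1+θ 2)/2) with hM3
  have hD1m : ∀ k l, Measurable (D1 k l) := by
    intro k l
    exact ((measurable_const.min (((hV1m.min measurable_const).pow_const _).const_mul _))).pow_const _
  have hD2m : ∀ k l, Measurable (D2 k l) := by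
    intro k l
    exact ((measurable_const.min (((hV2m.min measurable_const).pow_const _).const_mul _))).pow_const _
  have hM3m : Measurable M3 := ((mx_measurable hw.enorm).const_mul _).pow_const _
  have hnti : ∀ (u : ℝ → ℂ), Measurable u → (∀ x, ‖u x‖ ≤ B) → ∀ i P, Integrable fun y => u y * φ i P y :=
    fun u hu huB i P => ((h i).integrable hσ hA.le P).bdd_mul hu.aestronglyMeasurable (Eventually.of_forall huB)
  have hcl : ∀ P, ∃ l, DClass σ E l P := by
    intro P
    have h1 : (1:ℝ) ≤ 1 + Metric.infDist (lf σ P) E / sc σ P := by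
      have := sc_pos hσ P
      have : 0 ≤ Metric.infDist (lf σ P) E / sc σ P := div_nonneg Metric.infDist_nonneg this.le
      linarith
    obtain ⟨n, hn1, hn2⟩ := exists_nat_pow_near h1 (by norm_num : (1:ℝ) < 2)
    exact ⟨n, hn1, hn2⟩
  have hcfE : ∀ (i : Fin 3) (u : ℝ → ℂ) P, ENNReal.ofReal (cf (φ i) u P) = ‖∫ y, u y * φ i P y‖ₑ := by
    intro i u P; unfold cf; rw [ofReal_norm]
  -- step 1
  have s1 : ∀ P, ENNReal.ofReal (sc σ P * (cf (φ 0) f P * cf (φ 1) g P * cf (φ 2) w P)) ≤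
      ∑' k : ℤ, ∑' j : ℤ, ENNReal.ofReal ((2:ℝ)^k) * ENNReal.ofReal ((2:ℝ)^j) *
        ENNReal.ofReal (sc σ P * (cf (φ 0) (lev f k) P * cf (φ 1) (lev g j) P * cf (φ 2) w P)) := by
    intro P
    have hs := (sc_pos hσ P).le
    rw [ENNReal.ofReal_mul hs, ENNReal.ofReal_mul (by positivity [cf_nonneg (φ 0) f P, cf_nonneg (φ 1) g P]),
      ENNReal.ofReal_mul (cf_nonneg _ _ _)]
    calc _ ≤ ENNReal.ofReal (sc σ P) * ((∑' k : ℤ, ENNReal.ofReal ((2:ℝ)^k) * ENNReal.ofReal (cf (φ 0) (lev f k) P)) *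
          (∑' j : ℤ, ENNReal.ofReal ((2:ℝ)^j) * ENNReal.ofReal (cf (φ 1) (lev g j) P)) * ENNReal.ofReal (cf (φ 2) w P)) := by
          gcongr
          · simp_rw [hcfE]; exact cf_lev hf (hnti f hf hfB 0 P)
          · simp_rw [hcfE]; exact cf_lev hg (hnti g hg hgB 1 P)
      _ = _ := by
          rw [← ENNReal.tsum_mul_right, ← ENNReal.tsum_mul_right, ← ENNReal.tsum_mul_left]
          congr 1; ext k
          rw [← ENNReal.tsum_mul_left, ← ENNReal.tsum_mul_right, ← ENNReal.tsum_mul_left]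
          congr 1; ext j
          rw [ENNReal.ofReal_mul hs, ENNReal.ofReal_mul (mul_nonneg (cf_nonneg _ _ _) (cf_nonneg _ _ _)),
            ENNReal.ofReal_mul (cf_nonneg _ _ _)]
          ring
  have hnn : ∀ (u v : ℝ → ℂ) P, 0 ≤ sc σ P * (cf (φ 0) u P * cf (φ 1) v P * cf (φ 2) w P) := by
    intro u v P
    exact mul_nonneg (sc_pos hσ P).le (mul_nonneg (mul_nonneg (cf_nonneg _ _ _) (cf_nonneg _ _ _)) (cf_nonneg _ _ _))
  set G : ℕ → ℝ≥0∞ := fun l => ENNReal.ofReal (CR N θ * A ^ 3 * (((2 ^ l) ^ N)⁻¹) ^ θ 2) with hG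
  have s2 : ∀ l, ∑ P ∈ 𝔓.filter (DClass σ E l),
      ENNReal.ofReal (sc σ P * (cf (φ 0) f P * cf (φ 1) g P * cf (φ 2) w P)) ≤
      G l * (ENNReal.ofReal (KL (t 0 * ((1 + θ 0)/2)) * 2^l) * (ENNReal.ofReal (KL (t 1 * ((1 + θ 1)/2)) * 2^l) *
        (4 * ∫⁻ x, min (V1 x) Λ1 * min (V2 x) Λ2 * mx (fun y => ‖w y‖ₑ) x ^ ((1+θ 2)/2)))) := by
    intro l
    calc _ ≤ ∑ P ∈ 𝔓.filter (DClass σ E l), ∑' k : ℤ, ∑' j : ℤ, ENNReal.ofReal ((2:ℝ)^k) * ENNReal.ofReal ((2:ℝ)^j) *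
        ENNReal.ofReal (sc σ P * (cf (φ 0) (lev f k) P * cf (φ 1) (lev g j) P * cf (φ 2) w P)) :=
          Finset.sum_le_sum fun P _ => s1 P
      _ = ∑' k : ℤ, ∑' j : ℤ, ENNReal.ofReal ((2:ℝ)^k) * ENNReal.ofReal ((2:ℝ)^j) *
          ENNReal.ofReal (∑ P ∈ 𝔓.filter (DClass σ E l),
            sc σ P * (cf (φ 0) (lev f k) P * cf (φ 1) (lev g j) P * cf (φ 2) w P)) := by
          rw [← Summable.tsum_finsetSum (fun _ _ => ENNReal.summable)]
          congr 1; ext k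
          rw [← Summable.tsum_finsetSum (fun _ _ => ENNReal.summable)]
          congr 1; ext j
          rw [ENNReal.ofReal_sum_of_nonneg (fun P _ => hnn _ _ P), Finset.mul_sum]
      _ ≤ ∑' k : ℤ, ∑' j : ℤ, ENNReal.ofReal ((2:ℝ)^k) * ENNReal.ofReal ((2:ℝ)^j) *
          (G l * ∫⁻ x, D1 k l x * D2 j l x * M3 x) := by
          refine ENNReal.tsum_le_tsum fun k => ENNReal.tsum_le_tsum fun j => ?_
          gcongr 1
          exact tile_class hσ hA hγ hθ0 hθ1 hθ ht h hf hg hw hw1 hEne hE hV1 hL1 hV2 hL2 _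
            (fun P hP => (Finset.mem_filter.1 hP).2) k j
      _ = G l * ∫⁻ x, (∑' k : ℤ, ENNReal.ofReal ((2:ℝ)^k) * D1 k l x) *
            (∑' j : ℤ, ENNReal.ofReal ((2:ℝ)^j) * D2 j l x) * M3 x := by
          have e1 : ∀ x, (∑' k : ℤ, ENNReal.ofReal ((2:ℝ)^k) * D1 k l x) *
            (∑' j : ℤ, ENNReal.ofReal ((2:ℝ)^j) * D2 j l x) * M3 x =
            ∑' k : ℤ, ∑' j : ℤ, ENNReal.ofReal ((2:ℝ)^k) * ENNReal.ofReal ((2:ℝ)^j) * (D1 k l x * D2 j l x * M3 x) := by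
            intro x
            rw [← ENNReal.tsum_mul_right, ← ENNReal.tsum_mul_right]
            congr 1; ext k
            rw [← ENNReal.tsum_mul_left, ← ENNReal.tsum_mul_right]
            congr 1; ext j
            ring
          have hmm : ∀ k j, Measurable fun x => ENNReal.ofReal ((2:ℝ)^k) * ENNReal.ofReal ((2:ℝ)^j) *
              (D1 k l x * D2 j l x * M3 x) := fun k j =>
            (((hD1m k l).mul (hD2m j l)).mul hM3m).const_mul _
          simp_rw [e1]
          rw [lintegral_tsum (fun k => (Measurable.tsum (hmm k)).aemeasurable), ← ENNReal.tsum_mul_left]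
          congr 1; ext k
          rw [lintegral_tsum (fun j => (hmm k j).aemeasurable), ← ENNReal.tsum_mul_left]
          congr 1; ext j
          rw [lintegral_const_mul' _ _ (by finiteness)]
          ring
      _ ≤ G l * ∫⁻ x, (ENNReal.ofReal (KL (t 0 * ((1 + θ 0)/2)) * 2^l) * (ENNReal.ofReal (KL (t 1 * ((1 + θ 1)/2)) * 2^l) * 4)) *
            (min (V1 x) Λ1 * min (V2 x) Λ2 * mx (fun y => ‖w y‖ₑ) x ^ ((1+θ 2)/2)) := by
          gcongr 2 with x
          have l1 := level_sum (ht 0) (by linarith [hθ0 0] : 0 < (1 + θ 0)/2) (by linarith [hθ1 0]) ht0 l (min (V1 x) Λ1)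
          have l2 := level_sum (ht 1) (by linarith [hθ0 1] : 0 < (1 + θ 1)/2) (by linarith [hθ1 1]) ht1 l (min (V2 x) Λ2)
          have l3 : M3 x ≤ 4 * mx (fun y => ‖w y‖ₑ) x ^ ((1+θ 2)/2) := by
            rw [hM3]; simp only
            rw [ENNReal.mul_rpow_of_nonneg _ _ (by linarith [hθ0 2])]
            gcongr
            calc (4:ℝ≥0∞) ^ ((1 + θ 2)/2) ≤ 4 ^ (1:ℝ) :=
                  ENNReal.rpow_le_rpow_of_exponent_le (by norm_num) (by linarith [hθ1 2])
              _ = 4 := by simp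
          calc _ ≤ (ENNReal.ofReal (KL (t 0 * ((1 + θ 0)/2)) * 2^l) * min (V1 x) Λ1) *
                (ENNReal.ofReal (KL (t 1 * ((1 + θ 1)/2)) * 2^l) * min (V2 x) Λ2) *
                (4 * mx (fun y => ‖w y‖ₑ) x ^ ((1+θ 2)/2)) := mul_le_mul' (mul_le_mul' l1 l2) l3
            _ = _ := by ring
      _ = _ := by
          rw [lintegral_const_mul' _ _ (by finiteness)]
          ring
  set I := ∫⁻ x, min (V1 x) Λ1 * min (V2 x) Λ2 * mx (fun y => ‖w y‖ₑ) x ^ ((1+θ 2)/2) with hI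
  have hCR := (CR_pos (N := N) hθ).le
  have hK1 := KL_nonneg (t 0 * ((1 + θ 0)/2))
  have hK2 := KL_nonneg (t 1 * ((1 + θ 1)/2))
  calc _ = ∑ P ∈ 𝔓, ENNReal.ofReal (sc σ P * (cf (φ 0) f P * cf (φ 1) g P * cf (φ 2) w P)) :=
        ENNReal.ofReal_sum_of_nonneg (fun P _ => hnn _ _ P)
    _ ≤ ∑ P ∈ 𝔓, ∑' l : ℕ, if DClass σ E l P then
          ENNReal.ofReal (sc σ P * (cf (φ 0) f P * cf (φ 1) g P * cf (φ 2) w P)) else 0 := by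
        apply Finset.sum_le_sum; intro P _
        obtain ⟨l, hl⟩ := hcl P
        refine le_trans ?_ (ENNReal.le_tsum l)
        rw [if_pos hl]
    _ = ∑' l : ℕ, ∑ P ∈ 𝔓.filter (DClass σ E l),
          ENNReal.ofReal (sc σ P * (cf (φ 0) f P * cf (φ 1) g P * cf (φ 2) w P)) := by
        rw [← Summable.tsum_finsetSum (fun _ _ => ENNReal.summable)]
        congr 1; ext l
        rw [Finset.sum_filter]
    _ ≤ ∑' l : ℕ, ENNReal.ofReal (KT N θ t * A^3 / 2 * (1/2)^l) * I := by
        refine ENNReal.tsum_le_tsum fun l => (s2 l).trans ?_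
        rw [show (4:ℝ≥0∞) = ENNReal.ofReal 4 by norm_num, hG]
        simp only
        rw [← mul_assoc, ← mul_assoc, ← mul_assoc, ← ENNReal.ofReal_mul (by positivity),
          ← ENNReal.ofReal_mul (by positivity), ← ENNReal.ofReal_mul (by positivity)]
        refine mul_le_mul' (ENNReal.ofReal_le_ofReal ?_) le_rfl
        have hgain : (((2:ℝ) ^ l) ^ N)⁻¹ ^ θ 2 ≤ (1/8)^l := by
          rw [Real.inv_rpow (by positivity), ← Real.rpow_natCast (2^l), ← Real.rpow_mul (by positivity),
            one_div, inv_pow]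
          apply inv_anti₀ (by positivity)
          calc (8:ℝ)^l = ((2:ℝ)^l)^(3:ℝ) := by
                rw [show (3:ℝ) = (3:ℕ) by norm_num, Real.rpow_natCast, ← pow_mul, mul_comm, pow_mul]; norm_num
            _ ≤ _ := Real.rpow_le_rpow_of_exponent_le (one_le_pow₀ (by norm_num)) hN
        calc _ ≤ CR N θ * A^3 * (1/8)^l * (KL (t 0 * ((1 + θ 0)/2)) * 2^l) * (KL (t 1 * ((1 + θ 1)/2)) * 2^l) * 4 := by
              refine (mul_le_mul_of_nonneg_right (mul_le_mul_of_nonneg_right (mul_le_mul_of_nonneg_right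
                (mul_le_mul_of_nonneg_left hgain ?_) ?_) ?_) ?_) <;> positivity
          _ = CR N θ * A^3 * KL (t 0 * ((1 + θ 0)/2)) * KL (t 1 * ((1 + θ 1)/2)) * 4 * ((1/8)^l * 2^l * 2^l) := by ring
          _ = _ := by
              rw [← mul_pow, ← mul_pow]
              unfold KT; norm_num; ring
    _ = _ := by
        rw [ENNReal.tsum_mul_right, ← ENNReal.ofReal_tsum_of_nonneg]
        · rw [tsum_mul_left, tsum_geometric_two]; congr 2; ring
        · intro l; unfold KT; positivity
        · exact summable_geometric_two.mul_left _

end BHT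
end

section
open MeasureTheory Filter Set
open scoped ENNReal ComplexConjugate
namespace BHT

lemma KM_pos {q : ℝ} (hq : 1 < q) : 0 < KM q := by
  unfold KM
  have : 0 < q - 1 := by linarith
  have : 0 < q := by linarith
  positivity

lemma solve_m {lam K M m x s : ℝ} (hs : 1 < s) (hl : 0 < lam) (hK : 0 < K) (hM : 0 < M) (hm : 0 < m) (hx : 0 ≤ x)
    (h : lam * m ≤ K * x ^ (1/s) * (M * m) ^ (1 - 1/s)) : m ≤ K ^ s * M ^ (s-1) * lam ^ (-s) * x := by
  have hs0 : 0 < s := by linarith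
  have h1 : m = m ^ (1/s) * m ^ (1 - 1/s) := by
    rw [← Real.rpow_add hm]; simp
  rw [Real.mul_rpow hM.le hm.le] at h
  have hp : 0 < m ^ (1 - 1/s) := by positivity
  have h2 : m ^ (1/s) ≤ K * x^(1/s) * M^(1-1/s) * lam⁻¹ := by
    rw [← div_eq_mul_inv, le_div_iff₀ hl]
    refine le_of_mul_le_mul_right ?_ hp
    calc m ^ (1/s) * lam * m ^ (1 - 1/s) = lam * (m ^ (1/s) * m ^ (1 - 1/s)) := by ring
      _ = lam * m := by rw [← h1]
      _ ≤ _ := h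
      _ = _ := by ring
  calc m = (m ^ (1/s)) ^ s := by rw [← Real.rpow_mul hm.le]; field_simp; simp
    _ ≤ (K * x^(1/s) * M^(1-1/s) * lam⁻¹) ^ s := by gcongr
    _ = _ := by
        rw [Real.mul_rpow (by positivity) (by positivity), Real.mul_rpow (by positivity) (by positivity),
          Real.mul_rpow (by positivity) (by positivity), ← Real.rpow_mul hx, ← Real.rpow_mul hM.le,
          Real.rpow_neg hl.le, Real.inv_rpow hl.le, show 1/s*s = 1 by field_simp,
          show (1 - 1/s) * s = s - 1 by field_simp, Real.rpow_one]
        ring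

lemma weak_piece {T : ℝ → ℂ} (hT : Continuous T) {W : ℝ → ℝ≥0∞} (hW : Measurable W) {K e s : ℝ} (hK : 0 < K)
    (hs : 1 < s) (hes : 1 - 1/s < e) {lam : ℝ} (hl : 0 < lam)
    (hyp : ∀ h : ℝ → ℂ, Measurable h → (∀ x, ‖h x‖ ≤ 1) → (∃ n : ℝ, ∀ x, h x ≠ 0 → |x| ≤ n) →
      {x | W x ≤ ENNReal.ofReal lam}.Nonempty → (∀ x, h x ≠ 0 → W x ≤ ENNReal.ofReal lam) →
      ‖∫ x, T x * h x‖ₑ ≤ ENNReal.ofReal K * ∫⁻ x, min (W x) (ENNReal.ofReal lam) * mx (fun y => ‖h y‖ₑ) x ^ e)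
    (n : ℝ) : volume ({x | lam < ‖T x‖} ∩ {x | W x ≤ ENNReal.ofReal lam} ∩ Icc (-n) n) ≤
      ENNReal.ofReal (K ^ s * KM (e * (s/(s-1))) ^ (s-1) * lam ^ (-s)) *
        ∫⁻ x, min (W x) (ENNReal.ofReal lam) ^ s := by
  set F := {x | lam < ‖T x‖} ∩ {x | W x ≤ ENNReal.ofReal lam} ∩ Icc (-n) n with hF
  have hFm : MeasurableSet F := ((measurableSet_lt measurable_const hT.norm.measurable).inter
    (measurableSet_le hW measurable_const)).inter measurableSet_Icc
  have hs0 : 0 < s := by linarith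
  have hs1 : 0 < s - 1 := by linarith
  have he : 1 < e * (s/(s-1)) := by
    have : 1 - 1/s = (s-1)/s := by field_simp
    rw [this, div_lt_iff₀ hs0] at hes
    rw [← mul_div_assoc, lt_div_iff₀ hs1]; linarith
  have he0 : 0 < e := by
    have : 1/s < 1 := by rw [div_lt_one hs0]; exact hs
    linarith
  set M := KM (e * (s/(s-1))) with hM
  have hMp : 0 < M := KM_pos he
  rcases eq_or_ne (volume F) 0 with h0 | h0
  · rw [h0]; exact zero_le
  have hfin : volume F ≠ ⊤ := by
    refine ne_top_of_le_ne_top ?_ (measure_mono inter_subset_right)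
    simp
  have hne : F.Nonempty := nonempty_of_measure_ne_zero h0
  set h : ℝ → ℂ := F.indicator fun x => conj (T x) / ‖T x‖ with hh
  have hTpos : ∀ x ∈ F, 0 < ‖T x‖ := fun x hx => hl.trans hx.1.1
  have hmem : ∀ x, h x ≠ 0 → x ∈ F := fun x hx => by
    by_contra hc; exact hx (indicator_of_notMem hc _)
  have hnorm : ∀ x, ‖h x‖ₑ = F.indicator (fun _ => 1) x := by
    intro x
    by_cases hx : x ∈ F
    · rw [hh, indicator_of_mem hx, indicator_of_mem hx, ← ofReal_norm, norm_div]
      have := hTpos x hx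
      simp [this.ne']
    · rw [hh, indicator_of_notMem hx, indicator_of_notMem hx]; simp
  have hyp' := hyp h ((Continuous.measurable (by fun_prop)).div (Continuous.measurable (by fun_prop)) |>.indicator hFm) (by
      intro x
      have := hnorm x
      by_cases hx : x ∈ F
      · rw [indicator_of_mem hx, ← ofReal_norm] at this
        have h2 := congrArg ENNReal.toReal this
        rw [ENNReal.toReal_ofReal (norm_nonneg _)] at h2
        simp [h2]
      · rw [hh, indicator_of_notMem hx]; simp)
    ⟨n, fun x hx => abs_le.2 (hmem x hx).2⟩ (hne.mono fun x hx => hx.1.2) (fun x hx => (hmem x hx).1.2)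
  have e1 : ENNReal.ofReal lam * volume F ≤ ‖∫ x, T x * h x‖ₑ := by
    have : ∫ x, T x * h x = ((∫ x in F, ‖T x‖ : ℝ) : ℂ) := by
      rw [← integral_complex_ofReal, ← integral_indicator hFm]
      congr 1; ext x
      by_cases hx : x ∈ F
      · rw [hh, indicator_of_mem hx, indicator_of_mem hx, ← mul_div_assoc, Complex.mul_conj, Complex.normSq_eq_norm_sq]
        have : (‖T x‖ : ℂ) ≠ 0 := by exact_mod_cast (hTpos x hx).ne'
        push_cast
        field_simp
      · rw [hh, indicator_of_notMem hx, indicator_of_notMem hx, mul_zero]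
    rw [this, ← ofReal_norm, Complex.norm_real, Real.norm_of_nonneg (integral_nonneg fun x => norm_nonneg _)]
    have hnti : IntegrableOn (fun x => ‖T x‖) F :=
      (hT.norm.continuousOn.integrableOn_Icc (a := -n) (b := n)).mono_set inter_subset_right
    rw [ofReal_integral_eq_lintegral_ofReal hnti (Eventually.of_forall fun x => norm_nonneg _)]
    rw [← setLIntegral_const]
    apply setLIntegral_mono' hFm
    intro x hx
    exact ENNReal.ofReal_le_ofReal hx.1.1.le
  set m := (volume F).toReal with hm
  have hmv : volume F = ENNReal.ofReal m := (ENNReal.ofReal_toReal hfin).symm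
  have hm0 : 0 < m := ENNReal.toReal_pos h0 hfin
  set X := ∫⁻ x, min (W x) (ENNReal.ofReal lam) ^ s with hX
  have hconj : s.HolderConjugate (s/(s-1)) := Real.HolderConjugate.conjExponent hs
  have e2 : ENNReal.ofReal lam * volume F ≤ ENNReal.ofReal K * (X ^ (1/s) * (ENNReal.ofReal (M * m)) ^ (1 - 1/s)) := by
    refine e1.trans (hyp'.trans ?_)
    gcongr 1
    have hmm : Measurable (mx (fun y => ‖h y‖ₑ)) := by
      apply mx_measurable
      simp_rw [hnorm]
      exact measurable_const.indicator hFm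
    refine (ENNReal.lintegral_mul_le_Lp_mul_Lq volume hconj (hW.min measurable_const).aemeasurable
      (hmm.pow_const e).aemeasurable).trans ?_
    gcongr 1
    rw [show 1/(s/(s-1)) = 1 - 1/s by field_simp]
    have : (0:ℝ) ≤ 1 - 1/s := by
      have : 1/s < 1 := by rw [div_lt_one hs0]; exact hs
      linarith
    gcongr 1
    simp_rw [← ENNReal.rpow_mul]
    refine (mx_strong (B := 1) (by simp_rw [hnorm]; exact measurable_const.indicator hFm) ?_ he).trans ?_
    · intro y; rw [hnorm]; by_cases hy : y ∈ F <;> simp [hy]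
    · rw [ENNReal.ofReal_mul hMp.le, ← hmv]
      gcongr 1
      have : ∀ x, ‖h x‖ₑ ^ (e * (s/(s-1))) = F.indicator (fun _ => 1) x := by
        intro x; rw [hnorm]
        by_cases hy : x ∈ F
        · simp [hy]
        · rw [indicator_of_notMem hy, ENNReal.zero_rpow_of_pos (by linarith)]
      simp_rw [this]
      rw [lintegral_indicator hFm]; simp
  rcases eq_or_ne X ⊤ with htop | htop
  · rw [htop, ENNReal.mul_top]
    · exact le_top
    · simp; positivity
  rw [hmv, ← ENNReal.ofReal_toReal htop, ← ENNReal.ofReal_mul (by positivity)]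
  rw [hmv, ← ENNReal.ofReal_toReal htop, ENNReal.ofReal_rpow_of_nonneg ENNReal.toReal_nonneg (by positivity),
    ENNReal.ofReal_rpow_of_nonneg (by positivity) (by
      have : 1/s < 1 := by rw [div_lt_one hs0]; exact hs
      linarith),
    ← ENNReal.ofReal_mul (by positivity), ← ENNReal.ofReal_mul (by positivity),
    ← ENNReal.ofReal_mul (by positivity), ENNReal.ofReal_le_ofReal_iff (by positivity)] at e2
  apply ENNReal.ofReal_le_ofReal
  apply solve_m hs hl hK hMp hm0 ENNReal.toReal_nonneg
  rw [mul_assoc]; exact e2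

lemma weak_strong {T : ℝ → ℂ} (hT : Continuous T) {W : ℝ → ℝ≥0∞} (hW : Measurable W) (hWfin : ∀ x, W x ≠ ⊤)
    {K e s r : ℝ} (hK : 0 < K) (hr : 0 < r) (hrs : r < s)
    (hs : 1 < s) (hes : 1 - 1/s < e)
    (hyp : ∀ lam : ℝ, 0 < lam → ∀ h : ℝ → ℂ, Measurable h → (∀ x, ‖h x‖ ≤ 1) → (∃ n : ℝ, ∀ x, h x ≠ 0 → |x| ≤ n) →
      {x | W x ≤ ENNReal.ofReal lam}.Nonempty → (∀ x, h x ≠ 0 → W x ≤ ENNReal.ofReal lam) →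
      ‖∫ x, T x * h x‖ₑ ≤ ENNReal.ofReal K * ∫⁻ x, min (W x) (ENNReal.ofReal lam) * mx (fun y => ‖h y‖ₑ) x ^ e) :
    ∫⁻ x, ‖T x‖ₑ ^ r ≤ ENNReal.ofReal (1 + r * (K ^ s * KM (e * (s/(s-1))) ^ (s-1)) * (1/r + 1/(s-r))) *
      ∫⁻ x, W x ^ r := by
  have hs0 : 0 < s := by linarith
  have hs1 : 0 < s - 1 := by linarith
  have he : 1 < e * (s/(s-1)) := by
    have : 1 - 1/s = (s-1)/s := by field_simp
    rw [this, div_lt_iff₀ hs0] at hes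
    rw [← mul_div_assoc, lt_div_iff₀ hs1]; linarith
  set Z := K ^ s * KM (e * (s/(s-1))) ^ (s-1) with hZ
  have hMp := KM_pos he
  have hZ0 : 0 < Z := by positivity
  have hbd : ∀ lam ∈ Ioi (0:ℝ), volume {x | lam < ‖T x‖} ≤ volume {x | lam < (W x).toReal} +
      ENNReal.ofReal (Z * lam ^ (-s)) * ∫⁻ x, min (W x) (ENNReal.ofReal lam) ^ s := by
    intro lam hl
    have hl : 0 < lam := hl
    have hsub : {x | lam < ‖T x‖} ⊆ {x | lam < (W x).toReal} ∪
        ⋃ n : ℕ, ({x | lam < ‖T x‖} ∩ {x | W x ≤ ENNReal.ofReal lam} ∩ Icc (-(n:ℝ)) n) := by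
      intro x hx
      by_cases hw : W x ≤ ENNReal.ofReal lam
      · right
        obtain ⟨n, hn⟩ := exists_nat_ge |x|
        exact mem_iUnion.2 ⟨n, ⟨hx, hw⟩, abs_le.1 hn⟩
      · left
        exact (ENNReal.ofReal_lt_iff_lt_toReal hl.le (hWfin x)).1 (not_le.1 hw)
    refine (measure_mono hsub).trans ((measure_union_le _ _).trans ?_)
    gcongr 1
    have hmono : Monotone fun n : ℕ => ({x | lam < ‖T x‖} ∩ {x | W x ≤ ENNReal.ofReal lam} ∩ Icc (-(n:ℝ)) n) := by
      intro a b hab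
      apply inter_subset_inter_right
      have : (a:ℝ) ≤ b := by exact_mod_cast hab
      apply Icc_subset_Icc <;> linarith
    rw [hmono.measure_iUnion]
    exact iSup_le fun n => weak_piece hT hW hK hs hes hl (hyp lam hl) n
  have hTr : ∫⁻ x, ‖T x‖ₑ ^ r = ∫⁻ x, ENNReal.ofReal (‖T x‖ ^ r) := by
    apply lintegral_congr; intro x
    rw [← ofReal_norm, ENNReal.ofReal_rpow_of_nonneg (norm_nonneg _) hr.le]
  have hWr : ∫⁻ x, W x ^ r = ∫⁻ x, ENNReal.ofReal ((W x).toReal ^ r) := by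
    apply lintegral_congr; intro x
    rw [← ENNReal.ofReal_rpow_of_nonneg ENNReal.toReal_nonneg hr.le, ENNReal.ofReal_toReal (hWfin x)]
  have hmeas : Measurable (fun p : ℝ × ℝ => min (W p.2) (ENNReal.ofReal p.1) ^ s * ENNReal.ofReal (p.1 ^ (r-1-s))) :=
    (((hW.comp measurable_snd).min (measurable_fst.ennreal_ofReal)).pow_const _).mul (by fun_prop)
  have hinner : ∀ x, ∫⁻ lam in Ioi (0:ℝ), min (W x) (ENNReal.ofReal lam) ^ s * ENNReal.ofReal (lam ^ (r-1-s)) ≤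
      ENNReal.ofReal (1/r + 1/(s-r)) * W x ^ r := by
    intro x
    rcases eq_or_ne (W x) 0 with h0 | h0
    · rw [h0]; simp [ENNReal.zero_rpow_of_pos hs0, ENNReal.zero_rpow_of_pos hr]
    set w := (W x).toReal with hw
    have hw0 : 0 < w := ENNReal.toReal_pos h0 (hWfin x)
    have hWw : W x = ENNReal.ofReal w := (ENNReal.ofReal_toReal (hWfin x)).symm
    have hdec : Ioi (0:ℝ) = Ioc 0 w ∪ Ioi w := (Ioc_union_Ioi_eq_Ioi hw0.le).symm
    rw [hdec]
    refine (lintegral_union_le _ _ _).trans ?_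
    have p1 : ∫⁻ lam in Ioc 0 w, min (W x) (ENNReal.ofReal lam) ^ s * ENNReal.ofReal (lam ^ (r-1-s)) ≤
        ENNReal.ofReal (w^r / r) := by
      calc _ ≤ ∫⁻ lam in Ioc 0 w, ENNReal.ofReal (lam ^ (r-1)) := by
            apply setLIntegral_mono' measurableSet_Ioc
            intro l hl
            calc _ ≤ ENNReal.ofReal l ^ s * ENNReal.ofReal (l ^ (r-1-s)) := by gcongr; exact min_le_right _ _
              _ = _ := by
                rw [ENNReal.ofReal_rpow_of_nonneg hl.1.le hs0.le, ← ENNReal.ofReal_mul (Real.rpow_nonneg hl.1.le _),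
                  ← Real.rpow_add hl.1]
                congr 2; ring
        _ = _ := by rw [lint_pow_low hw0.le (by linarith)]; congr 2 <;> ring_nf
    have p2 : ∫⁻ lam in Ioi w, min (W x) (ENNReal.ofReal lam) ^ s * ENNReal.ofReal (lam ^ (r-1-s)) ≤
        ENNReal.ofReal (w^r / (s-r)) := by
      calc _ ≤ ∫⁻ lam in Ioi w, ENNReal.ofReal (w^s) * ENNReal.ofReal (lam ^ (r-1-s)) := by
            apply setLIntegral_mono' measurableSet_Ioi
            intro l hl
            gcongr 1
            rw [← ENNReal.ofReal_rpow_of_nonneg hw0.le hs0.le, ← hWw]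
            gcongr; exact min_le_left _ _
        _ = _ := by
            rw [lintegral_const_mul' _ _ (by simp), lint_pow_high hw0 (by linarith), ← ENNReal.ofReal_mul (by positivity)]
            congr 1
            rw [show r - 1 - s + 1 = -(s - r) by ring, neg_div_neg_eq, ← mul_div_assoc, ← Real.rpow_add hw0]
            congr 2; ring
    refine (add_le_add p1 p2).trans (le_of_eq ?_)
    have : 0 < s - r := by linarith
    rw [hWw, ENNReal.ofReal_rpow_of_nonneg hw0.le hr.le, ← ENNReal.ofReal_mul (by positivity),
      ← ENNReal.ofReal_add (by positivity) (by positivity)]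
    congr 1; ring
  have hsr : 0 < s - r := by linarith
  rw [hTr, lintegral_rpow_eq_lintegral_meas_lt_mul volume (Eventually.of_forall fun x => norm_nonneg _)
    hT.norm.measurable.aemeasurable hr]
  calc _ ≤ ENNReal.ofReal r * ∫⁻ lam in Ioi (0:ℝ), (volume {x | lam < (W x).toReal} * ENNReal.ofReal (lam^(r-1)) +
        ENNReal.ofReal Z * ∫⁻ x, min (W x) (ENNReal.ofReal lam) ^ s * ENNReal.ofReal (lam ^ (r-1-s))) := by
        gcongr 1
        apply setLIntegral_mono' measurableSet_Ioi
        intro l hl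
        have hl0 : 0 < l := hl
        refine (mul_le_mul' (hbd l hl) le_rfl).trans (le_of_eq ?_)
        rw [add_mul, lintegral_mul_const' _ _ (by simp)]
        congr 1
        rw [mul_right_comm, ← ENNReal.ofReal_mul (by positivity), mul_comm (∫⁻ _, _), ← mul_assoc,
          ← ENNReal.ofReal_mul (by positivity), mul_assoc, ← Real.rpow_add hl0]
        congr 4; ring
    _ = ENNReal.ofReal r * (∫⁻ lam in Ioi (0:ℝ), volume {x | lam < (W x).toReal} * ENNReal.ofReal (lam^(r-1))) +
        ENNReal.ofReal r * (ENNReal.ofReal Z * ∫⁻ x, ∫⁻ lam in Ioi (0:ℝ),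
          min (W x) (ENNReal.ofReal lam) ^ s * ENNReal.ofReal (lam ^ (r-1-s))) := by
        rw [lintegral_add_right, mul_add, lintegral_const_mul' _ _ (by simp), lintegral_lintegral_swap]
        · exact hmeas.aemeasurable
        · exact (Measurable.lintegral_prod_right' hmeas).const_mul _
    _ ≤ (∫⁻ x, W x ^ r) + ENNReal.ofReal r * (ENNReal.ofReal Z * (ENNReal.ofReal (1/r + 1/(s-r)) * ∫⁻ x, W x ^ r)) := by
        gcongr ?_ + ?_
        · rw [hWr, lintegral_rpow_eq_lintegral_meas_lt_mul volume (Eventually.of_forall fun x => ENNReal.toReal_nonneg)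
            hW.ennreal_toReal.aemeasurable hr]
        · refine mul_le_mul' le_rfl (mul_le_mul' le_rfl ?_)
          exact (lintegral_mono hinner).trans_eq (lintegral_const_mul' _ _ (by simp))
    _ = _ := by
        have hrs' : 0 < 1/r + 1/(s-r) := by positivity
        clear_value Z
        generalize 1/r + 1/(s-r) = y at hrs' ⊢
        rw [ENNReal.ofReal_add (by norm_num) (by positivity), ENNReal.ofReal_mul (by positivity),
          ENNReal.ofReal_mul hr.le, add_mul]
        simp [mul_assoc]

end BHT
end

section
open MeasureTheory Filter Set
open scoped ENNReal ComplexConjugate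
namespace BHT

/-! ### From the model sum to the theorem -/

lemma exps {P Q : ℝ} (hP : 0 ≤ P) (hP1 : P < 1) (hQ : 0 ≤ Q) (hQ1 : Q < 1) (h0 : 0 < P + Q) (h1 : P + Q < 3/2) :
    ∃ θ t : Fin 3 → ℝ, ∃ N : ℕ, ∃ s : ℝ, (∀ i, 0 ≤ θ i) ∧ (∀ i, θ i ≤ 1) ∧ ∑ i, θ i < 1 ∧ (∀ i, 1 ≤ t i) ∧
      1 < t 0 * ((1 + θ 0)/2) ∧ 1 < t 1 * ((1 + θ 1)/2) ∧ 3 ≤ N * θ 2 ∧ t 0 * P < 1 ∧ t 1 * Q < 1 ∧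
      1 < s ∧ (P + Q)⁻¹ < s ∧ 1 - 1/s < (1 + θ 2)/2 := by
  obtain ⟨L1, hL1⟩ : ∃ L1, L1 = max 0 (2*P-1) := ⟨_, rfl⟩
  obtain ⟨L2, hL2⟩ : ∃ L1, L1 = max 0 (2*Q-1) := ⟨_, rfl⟩
  obtain ⟨L3, hL3⟩ : ∃ L1, L1 = max 0 (1 - 2*min 1 (P+Q)) := ⟨_, rfl⟩
  have hs : L1 + L2 + L3 < 1 := by
    rw [hL1, hL2, hL3]
    rcases min_cases 1 (P+Q) with ⟨e, _⟩ | ⟨e, _⟩ <;> rw [e] <;>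
    rcases max_cases 0 (2*P-1) with ⟨e, _⟩ | ⟨e, _⟩ <;> rw [e] <;>
    rcases max_cases 0 (2*Q-1) with ⟨e, _⟩ | ⟨e, _⟩ <;> rw [e] <;> [skip;skip;skip;skip; skip;skip;skip;skip] <;>
    first
    | (rw [max_eq_left (by linarith)]; linarith)
    | (rw [max_eq_right (by linarith)]; linarith)
    | (rcases max_cases 0 (1 - 2 * (P+Q)) with ⟨e, _⟩ | ⟨e, _⟩ <;> rw [e] <;> linarith)
  have a1 : 0 ≤ L1 := hL1 ▸ le_max_left _ _
  have a2 : 0 ≤ L2 := hL2 ▸ le_max_left _ _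
  have a3 : 0 ≤ L3 := hL3 ▸ le_max_left _ _
  have b1 : 2*P-1 ≤ L1 := hL1 ▸ le_max_right _ _
  have b2 : 2*Q-1 ≤ L2 := hL2 ▸ le_max_right _ _
  have b3 : 1 - 2*min 1 (P+Q) ≤ L3 := hL3 ▸ le_max_right _ _
  obtain ⟨ε, hε⟩ : ∃ ε, ε = (1 - (L1+L2+L3))/4 := ⟨_, rfl⟩
  have hε0 : 0 < ε := by rw [hε]; linarith
  have c1 : min 1 (P+Q) ≤ 1 := min_le_left _ _
  have c2 : min 1 (P+Q) ≤ P+Q := min_le_right _ _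
  set M := min 1 (P+Q) with hM
  obtain ⟨N, hN⟩ := exists_nat_ge (3/(L3+ε))
  set u := ((1-(L3+ε))/2 + M)/2 with hu
  have hu0 : 0 < u := by rw [hu]; have : 0 < M := lt_min one_pos h0
                         linarith
  set τ1 := (P + (1+(L1+ε))/2)/2 with hτ1
  set τ2 := (Q + (1+(L2+ε))/2)/2 with hτ2
  have p1 : 0 < τ1 := by rw [hτ1]; linarith
  have p2 : 0 < τ2 := by rw [hτ2]; linarith
  refine ⟨![L1+ε, L2+ε, L3+ε], ![1/τ1, 1/τ2, 1], N, 1/u, ?_, ?_, ?_, ?_, ?_, ?_, ?_, ?_, ?_, ?_, ?_, ?_⟩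
  · intro i; fin_cases i <;> simp <;> linarith
  · intro i; fin_cases i <;> simp <;> linarith
  · simp [Fin.sum_univ_succ]; linarith
  · intro i; fin_cases i <;> simp <;> apply (one_le_inv₀ (by assumption)).2 <;> linarith
  · simp; rw [inv_mul_eq_div, lt_div_iff₀ p1]; linarith
  · simp; rw [inv_mul_eq_div, lt_div_iff₀ p2]; linarith
  · simp
    rw [div_le_iff₀ (by linarith)] at hN; exact hN
  · simp; rw [inv_mul_eq_div, div_lt_iff₀ p1]; linarith
  · simp; rw [inv_mul_eq_div, div_lt_iff₀ p2]; linarith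
  · rw [lt_div_iff₀ hu0]; linarith
  · rw [one_div]; apply inv_strictAnti₀ hu0; linarith
  · simp; linarith

lemma mx_congr_ae {w w' : ℝ → ℝ≥0∞} (h : w =ᵐ[volume] w') (x : ℝ) : mx w x = mx w' x := by
  unfold mx
  congr 1; ext n; congr 1
  exact lintegral_congr_ae (ae_restrict_of_ae h)

lemma factor {p : ℝ≥0∞} (hp : 1 < p) {t r : ℝ} (ht : 1 ≤ t) (htp : t * (1/p).toReal < 1) (hr : 0 < r) :
    ∃ K : ℝ, 0 < K ∧ ∀ f : ℝ → ℂ, Measurable f → (∃ B, ∀ x, ‖f x‖ ≤ B) → eLpNorm f p volume ≠ 0 →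
      eLpNorm f p volume ≠ ⊤ → ∃ W : ℝ → ℝ≥0∞, Measurable W ∧ (∀ x, W x ≠ ⊤) ∧
        (∀ x, mx (fun y => ‖f y‖ₑ ^ t) x ≤ (2 * eLpNorm f p volume * W x ^ (r * (1/p).toReal)) ^ t) ∧
        ∫⁻ x, W x ^ r ≤ ENNReal.ofReal K := by
  have ht0 : 0 < t := by linarith
  rcases eq_or_ne p ⊤ with hpt | hpt
  · refine ⟨1, one_pos, fun f hf hB h0 h1 => ⟨fun _ => 0, measurable_const, by simp, ?_, ?_⟩⟩
    · intro x
      rw [hpt]; simp only [ENNReal.div_top, ENNReal.toReal_zero, mul_zero, ENNReal.rpow_zero, mul_one]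
      have : (fun y => ‖f y‖ₑ ^ t) =ᵐ[volume] fun y => min (‖f y‖ₑ ^ t) (eLpNorm f ⊤ volume ^ t) := by
        filter_upwards [ae_le_eLpNormEssSup (f := f)] with y hy
        rw [min_eq_left]
        gcongr
        simpa using hy
      rw [mx_congr_ae this]
      refine (mx_le_of_bdd (fun y => min_le_right _ _) x).trans ?_
      rw [ENNReal.mul_rpow_of_nonneg _ _ ht0.le]
      gcongr
      calc (2:ℝ≥0∞) = 2 ^ (1:ℝ) := by simp
        _ ≤ 2 ^ t := ENNReal.rpow_le_rpow_of_exponent_le (by norm_num) ht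
    · simp [ENNReal.zero_rpow_of_pos hr]
  · have hp0 : 0 < p.toReal := ENNReal.toReal_pos (by positivity) hpt
    have hpi : (1/p).toReal = 1/p.toReal := by simp
    rw [hpi] at htp ⊢
    have hq : 1 < p.toReal/t := by
      rw [lt_div_iff₀ ht0]
      rw [mul_one_div, div_lt_one hp0] at htp; linarith
    refine ⟨KM (p.toReal/t), KM_pos hq, fun f hf hB h0 h1 => ?_⟩
    obtain ⟨B, hB⟩ := hB
    have hB0 : 0 ≤ B := (norm_nonneg _).trans (hB 0)
    have hbd : ∀ y, ‖f y‖ₑ ^ t ≤ ENNReal.ofReal (B ^ t) := by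
      intro y
      rw [← ENNReal.ofReal_rpow_of_nonneg hB0 ht0.le, ← ofReal_norm]
      gcongr; exact hB y
    set a := eLpNorm f p volume with ha
    have hat : a ^ t ≠ 0 := by simp [h0, h1]
    have hat' : a ^ t ≠ ⊤ := by simp [h0, h1, ht0.le]
    have hm := mx_measurable (hf.enorm.pow_const t)
    refine ⟨fun x => (mx (fun y => ‖f y‖ₑ ^ t) x / a ^ t) ^ (p.toReal/(r*t)), (hm.div_const _).pow_const _, ?_, ?_, ?_⟩
    · intro x
      apply ENNReal.rpow_ne_top_of_nonneg (by positivity)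
      apply ENNReal.div_ne_top _ hat
      exact ne_top_of_le_ne_top (by finiteness) (mx_le_of_bdd hbd x)
    · intro x
      rw [ENNReal.mul_rpow_of_nonneg _ _ ht0.le, ENNReal.mul_rpow_of_nonneg _ _ ht0.le, ← ENNReal.rpow_mul,
        ← ENNReal.rpow_mul, show p.toReal / (r * t) * (r * (1/p.toReal) * t) = 1 by field_simp, ENNReal.rpow_one,
        mul_assoc, ENNReal.mul_div_cancel hat hat']
      apply le_mul_of_one_le_left zero_le
      apply ENNReal.one_le_rpow (by norm_num) ht0
    · simp_rw [← ENNReal.rpow_mul]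
      rw [show p.toReal / (r*t) * r = p.toReal/t by field_simp]
      simp_rw [ENNReal.div_rpow_of_nonneg _ _ (show 0 ≤ p.toReal/t by positivity), ENNReal.div_eq_inv_mul]
      rw [lintegral_const_mul' _ _ (by simp [h0, h1]), mul_comm]
      refine (mul_le_mul' (mx_strong (hf.enorm.pow_const t) hbd hq) le_rfl).trans ?_
      simp_rw [← ENNReal.rpow_mul]
      rw [show t * (p.toReal / t) = p.toReal by field_simp, mul_assoc]
      have : a ^ p.toReal = ∫⁻ x, ‖f x‖ₑ ^ p.toReal := by
        rw [ha, eLpNorm_eq_lintegral_rpow_enorm_toReal (by positivity) hpt, ← ENNReal.rpow_mul]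
        rw [one_div_mul_cancel hp0.ne', ENNReal.rpow_one]
      rw [← this, ENNReal.mul_inv_cancel, mul_one]
      · simp [h0, h1]
      · simp [h0, h1, hp0.le]

/-- the bilinear form of `T` is controlled by model sums -/
def RedProp (N : ℕ) (C : ℝ) (f g T : ℝ → ℂ) : Prop :=
  ∀ h : ℝ → ℂ, Measurable h → (∀ x, ‖h x‖ ≤ 1) → (∃ n : ℝ, ∀ x, h x ≠ 0 → |x| ≤ n) → ∀ R : ℝ≥0∞,
    (∀ (σ τ A : ℝ) (γ : Fin 3 → ℝ) (φ : Fin 3 → Tile → ℝ → ℂ) (𝔓 : Finset Tile), 0 < σ → 0 < A →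
      (∀ i j, i ≠ j → 1/2 ≤ |γ i - γ j| ∧ |γ i - γ j| ≤ 1) → (∀ i, Pk σ τ (γ i) N A (φ i)) →
      ENNReal.ofReal (∑ P ∈ 𝔓, sc σ P * (cf (φ 0) f P * cf (φ 1) g P * cf (φ 2) h P)) ≤ ENNReal.ofReal (A^3) * R) →
    ‖∫ x, T x * h x‖ₑ ≤ ENNReal.ofReal C * R

theorem from_red {p q r : ℝ≥0∞} (hp : 1 < p) (hq : 1 < q) (hr : 2/3 < r) (hrt : r ≠ ⊤) (hpq : 1/p + 1/q = 1/r) :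
    ∃ N : ℕ, ∀ C0 : ℝ, 0 < C0 → ∃ C : ℝ, 0 < C ∧ ∀ f g T : ℝ → ℂ, Measurable f → Measurable g → Continuous T →
      (∃ B, ∀ x, ‖f x‖ ≤ B) → (∃ B, ∀ x, ‖g x‖ ≤ B) → eLpNorm f p volume ≠ 0 → eLpNorm f p volume ≠ ⊤ →
      eLpNorm g q volume ≠ 0 → eLpNorm g q volume ≠ ⊤ → RedProp N C0 f g T →
      eLpNorm T r volume ≤ ENNReal.ofReal C * eLpNorm f p volume * eLpNorm g q volume := by
  have hr0' : r ≠ 0 := (lt_of_le_of_lt zero_le hr).ne'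
  have hr0 : 0 < r.toReal := ENNReal.toReal_pos hr0' hrt
  obtain ⟨P, hP⟩ : ∃ P, P = (1/p).toReal := ⟨_, rfl⟩
  obtain ⟨Q, hQ⟩ : ∃ Q, Q = (1/q).toReal := ⟨_, rfl⟩
  have hsum : P + Q = 1/r.toReal := by
    rw [hP, hQ, ← ENNReal.toReal_add, hpq]
    · simp
    · simp; positivity
    · simp; positivity
  have l1 : ∀ p : ℝ≥0∞, 1 < p → (1/p).toReal < 1 := by
    intro p hp
    have : 1/p < 1 := by rw [one_div]; exact ENNReal.inv_lt_one.2 hp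
    rw [← ENNReal.toReal_one]
    exact (ENNReal.toReal_lt_toReal (ne_top_of_lt this) (by simp)).2 this
  have hr3 : (2/3:ℝ) < r.toReal := by
    have := (ENNReal.toReal_lt_toReal (ne_top_of_lt hr) hrt).2 hr
    simpa using this
  obtain ⟨θ, t, N, s, hθ0, hθ1, hθ, ht, ht0, ht1, hN, htP, htQ, hs, hrs, hes⟩ := exps (P := P) (Q := Q)
    (hP ▸ ENNReal.toReal_nonneg) (hP ▸ l1 p hp) (hQ ▸ ENNReal.toReal_nonneg) (hQ ▸ l1 q hq)
    (by rw [hsum]; positivity) (by rw [hsum, div_lt_iff₀ hr0]; linarith)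
  rw [hP] at htP; rw [hQ] at htQ
  obtain ⟨K1, hK1, HF⟩ := factor hp (ht 0) htP hr0
  obtain ⟨K2, hK2, HG⟩ := factor hq (ht 1) htQ hr0
  rw [← hP] at HF; rw [← hQ] at HG
  set r' := r.toReal with hr'
  have hrs' : r' < s := by rw [hsum] at hrs; simpa using hrs
  refine ⟨N, fun C0 hC0 => ?_⟩
  have hKT : 0 ≤ |KT N θ t| := abs_nonneg _
  obtain ⟨K, hK⟩ : ∃ K, K = 4 * C0 * (|KT N θ t| + 1) := ⟨_, rfl⟩
  have hKp : 0 < K := by rw [hK]; positivity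
  set e := (1 + θ 2)/2 with he
  have he1 : 1 < e * (s/(s-1)) := by
    have hs0 : 0 < s := by linarith
    have hs1 : 0 < s - 1 := by linarith
    have : 1 - 1/s = (s-1)/s := by field_simp
    rw [this, div_lt_iff₀ hs0] at hes
    rw [← mul_div_assoc, lt_div_iff₀ hs1]; linarith
  have hKM := KM_pos he1
  have hsr : 0 < s - r' := by linarith
  obtain ⟨M, hM⟩ : ∃ M, M = 1 + r' * (K ^ s * KM (e * (s/(s-1))) ^ (s-1)) * (1/r' + 1/(s-r')) := ⟨_, rfl⟩
  have hMp : 0 < M := by rw [hM]; positivity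
  refine ⟨(M * (K1 + K2)) ^ (1/r'), by positivity, ?_⟩
  intro f g T hf hg hT hfB hgB hf0 hf1 hg0 hg1 hred
  obtain ⟨W1, hW1m, hW1t, hW1, hW1i⟩ := HF f hf hfB hf0 hf1
  obtain ⟨W2, hW2m, hW2t, hW2, hW2i⟩ := HG g hg hgB hg0 hg1
  set a := eLpNorm f p volume with ha
  set b := eLpNorm g q volume with hb
  obtain ⟨c, hc⟩ : ∃ c : ℝ, c = a.toReal * b.toReal := ⟨_, rfl⟩
  have hc0 : 0 < c := by rw [hc]; exact mul_pos (ENNReal.toReal_pos hf0 hf1) (ENNReal.toReal_pos hg0 hg1)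
  have hcab : ENNReal.ofReal c = a * b := by
    rw [hc, ENNReal.ofReal_mul ENNReal.toReal_nonneg, ENNReal.ofReal_toReal hf1, ENNReal.ofReal_toReal hg1]
  have hα : 0 ≤ r' * P := mul_nonneg hr0.le (hP ▸ ENNReal.toReal_nonneg)
  have hβ : 0 ≤ r' * Q := mul_nonneg hr0.le (hQ ▸ ENNReal.toReal_nonneg)
  have hαβ : r' * P + r' * Q = 1 := by rw [← mul_add, hsum]; field_simp
  set W : ℝ → ℝ≥0∞ := fun x => max (W1 x) (W2 x) with hW
  have hWm : Measurable W := hW1m.max hW2m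
  have hWt : ∀ x, W x ≠ ⊤ := fun x => (max_lt (hW1t x).lt_top (hW2t x).lt_top).ne
  have hWi : ∫⁻ x, W x ^ r' ≤ ENNReal.ofReal (K1 + K2) := by
    rw [ENNReal.ofReal_add hK1.le hK2.le]
    calc _ ≤ ∫⁻ x, (W1 x ^ r' + W2 x ^ r') := by
          apply lintegral_mono; intro x
          simp only [hW]
          rcases max_cases (W1 x) (W2 x) with ⟨e, _⟩ | ⟨e, _⟩ <;> rw [e]
          · exact le_self_add
          · exact le_add_self
      _ = _ := lintegral_add_left (hW1m.pow_const _) _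
      _ ≤ _ := add_le_add hW1i hW2i
  have hV1 : ∀ x, mx (fun y => ‖f y‖ₑ ^ t 0) x ≤ (2 * a * W x ^ (r'*P)) ^ t 0 := fun x => (hW1 x).trans (by
    have := ht 0
    gcongr; exact le_max_left _ _)
  have hV2 : ∀ x, mx (fun y => ‖g y‖ₑ ^ t 1) x ≤ (2 * b * W x ^ (r'*Q)) ^ t 1 := fun x => (hW2 x).trans (by
    have := ht 1
    gcongr; exact le_max_right _ _)
  have main := weak_strong (T := fun x => T x * ((c⁻¹:ℝ):ℂ)) (by fun_prop) hWm hWt hKp hr0 hrs' hs hes (by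
    intro lam hlam h hh hh1 hhs hEne hE
    obtain ⟨B1, hB1⟩ := hfB
    obtain ⟨B2, hB2⟩ := hgB
    have h1 := hred h hh hh1 hhs (ENNReal.ofReal (|KT N θ t|) * ∫⁻ x, min (2 * a * W x ^ (r'*P)) (2 * a * ENNReal.ofReal lam ^ (r'*P)) *
        min (2 * b * W x ^ (r'*Q)) (2 * b * ENNReal.ofReal lam ^ (r'*Q)) * mx (fun y => ‖h y‖ₑ) x ^ e) (by
      intro σ τ A γ φ 𝔓 hσ hA hγ hφ
      refine (tile_est hσ hA hγ hθ0 hθ1 hθ (fun i => by linarith [ht i]) ht0 ht1 hN hφ hf hg hh hh1 (B := max B1 B2)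
        (Λ1 := 2 * a * ENNReal.ofReal lam ^ (r'*P)) (Λ2 := 2 * b * ENNReal.ofReal lam ^ (r'*Q))
        (fun x => (hB1 x).trans (le_max_left _ _)) (fun x => (hB2 x).trans (le_max_right _ _)) hEne hE
        ((hWm.pow_const _).const_mul _) ((hWm.pow_const _).const_mul _) hV1 (fun x hx => (hV1 x).trans ?_)
        hV2 (fun x hx => (hV2 x).trans ?_) 𝔓).trans ?_
      · have hx : W x ≤ ENNReal.ofReal lam := hx
        have := ht 0
        gcongr
      · have hx : W x ≤ ENNReal.ofReal lam := hx
        have := ht 1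
        gcongr
      · rw [← mul_assoc, ← ENNReal.ofReal_mul (by positivity), mul_comm (A^3)]
        gcongr
        exact le_abs_self _)
    have h2 : ∀ x, min (2 * a * W x ^ (r'*P)) (2 * a * ENNReal.ofReal lam ^ (r'*P)) *
        min (2 * b * W x ^ (r'*Q)) (2 * b * ENNReal.ofReal lam ^ (r'*Q)) = 4 * (a * b) * min (W x) (ENNReal.ofReal lam) := by
      intro x
      have hmin : ∀ (y : ℝ≥0∞) (α : ℝ), 0 ≤ α → min (2 * y * W x ^ α) (2 * y * ENNReal.ofReal lam ^ α) =
          2 * y * min (W x) (ENNReal.ofReal lam) ^ α := by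
        intro y α hα
        rcases le_total (W x) (ENNReal.ofReal lam) with h | h
        · rw [min_eq_left h, min_eq_left]; gcongr
        · rw [min_eq_right h, min_eq_right]; gcongr
      rw [hmin _ _ hα, hmin _ _ hβ]
      calc _ = (2*2) * (a*b) * (min (W x) (ENNReal.ofReal lam) ^ (r'*P) * min (W x) (ENNReal.ofReal lam) ^ (r'*Q)) := by ring
        _ = _ := by rw [← ENNReal.rpow_add_of_nonneg _ _ hα hβ, hαβ, ENNReal.rpow_one]; norm_num
    simp_rw [h2, mul_assoc] at h1
    rw [lintegral_const_mul' _ _ (by simp), lintegral_const_mul' _ _ (by finiteness),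
      lintegral_const_mul' _ _ (by finiteness), ← mul_assoc a, ← hcab] at h1
    have h3 : ∫ x, T x * ((c⁻¹:ℝ):ℂ) * h x = (∫ x, T x * h x) * ((c⁻¹:ℝ):ℂ) := by
      rw [← integral_mul_const]; congr 1; ext x; ring
    rw [h3, enorm_mul]
    have h4 : ‖((c⁻¹:ℝ):ℂ)‖ₑ = ENNReal.ofReal c⁻¹ := by
      rw [← ofReal_norm, Complex.norm_real, Real.norm_of_nonneg (by positivity)]
    rw [h4]
    refine (mul_le_mul' h1 le_rfl).trans ?_
    generalize (∫⁻ x, min (W x) (ENNReal.ofReal lam) * mx (fun y => ‖h y‖ₑ) x ^ e) = I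
    have h5 : ENNReal.ofReal c * ENNReal.ofReal c⁻¹ = 1 := by
      rw [← ENNReal.ofReal_mul hc0.le, mul_inv_cancel₀ hc0.ne']; simp
    calc _ = (ENNReal.ofReal c * ENNReal.ofReal c⁻¹) * (4 * ENNReal.ofReal C0 * ENNReal.ofReal |KT N θ t|) * I := by ring
      _ = ENNReal.ofReal (4 * C0 * |KT N θ t|) * I := by
        rw [h5, one_mul, ENNReal.ofReal_mul (by positivity), ENNReal.ofReal_mul (by norm_num)]; simp
      _ ≤ _ := by
        rw [hK]; gcongr; linarith)
  rw [← hM] at main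
  have main2 := main.trans (mul_le_mul' le_rfl hWi)
  rw [← ENNReal.ofReal_mul hMp.le] at main2
  rw [eLpNorm_eq_lintegral_rpow_enorm_toReal hr0' hrt]
  have hTT : ∀ x, ‖T x‖ₑ = ENNReal.ofReal c * ‖T x * ((c⁻¹:ℝ):ℂ)‖ₑ := by
    intro x
    rw [enorm_mul]
    have h4 : ‖((c⁻¹:ℝ):ℂ)‖ₑ = ENNReal.ofReal c⁻¹ := by
      rw [← ofReal_norm, Complex.norm_real, Real.norm_of_nonneg (by positivity)]
    have h5 : ENNReal.ofReal c * ENNReal.ofReal c⁻¹ = 1 := by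
      rw [← ENNReal.ofReal_mul hc0.le, mul_inv_cancel₀ hc0.ne']; simp
    rw [h4, mul_left_comm, h5, mul_one]
  rw [← hr']
  calc (∫⁻ x, ‖T x‖ₑ ^ r') ^ (1/r') = (ENNReal.ofReal c ^ r' * ∫⁻ x, ‖T x * ((c⁻¹:ℝ):ℂ)‖ₑ ^ r') ^ (1/r') := by
        rw [← lintegral_const_mul' _ _ (by finiteness)]
        congr 2; ext x
        rw [hTT x, ENNReal.mul_rpow_of_nonneg _ _ hr0.le]
    _ = ENNReal.ofReal c * (∫⁻ x, ‖T x * ((c⁻¹:ℝ):ℂ)‖ₑ ^ r') ^ (1/r') := by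
        rw [ENNReal.mul_rpow_of_nonneg _ _ (by positivity), ← ENNReal.rpow_mul, mul_one_div_cancel hr0.ne', ENNReal.rpow_one]
    _ ≤ ENNReal.ofReal c * (ENNReal.ofReal (M * (K1+K2))) ^ (1/r') := by gcongr
    _ = _ := by
        rw [hcab, ENNReal.ofReal_rpow_of_nonneg (by positivity) (by positivity)]; ring

end BHT
end

section
open MeasureTheory Filter Set
open scoped ENNReal ComplexConjugate
namespace BHT

/-! ### Fourier identities at unit scale -/

noncomputable def ee (x : ℝ) : ℂ := Complex.exp (2 * Real.pi * x * Complex.I)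

lemma ee_add (x y : ℝ) : ee (x + y) = ee x * ee y := by
  unfold ee; rw [← Complex.exp_add]; congr 1; push_cast; ring

lemma ee_zero : ee 0 = 1 := by simp [ee]

lemma norm_ee (x : ℝ) : ‖ee x‖ = 1 := by
  unfold ee
  rw [show 2 * (Real.pi:ℂ) * x * Complex.I = ((2 * Real.pi * x : ℝ) : ℂ) * Complex.I by push_cast; ring]
  exact Complex.norm_exp_ofReal_mul_I _

lemma ee_cont : Continuous ee := by unfold ee; fun_prop

lemma conj_ee (x : ℝ) : conj (ee x) = ee (-x) := by
  unfold ee; rw [← Complex.exp_conj]; congr 1; simp [Complex.conj_ofNat]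

lemma int_mul_ee {X : Type*} [TopologicalSpace X] [MeasurableSpace X] [OpensMeasurableSpace X]
    [SecondCountableTopologyEither X ℂ] {μ : Measure X} {f : X → ℂ} (hf : Integrable f μ) {l : X → ℝ} (hl : Continuous l) :
    Integrable (fun x => f x * ee (l x)) μ := by
  apply hf.mul_bdd (c := 1) (ee_cont.comp hl).aestronglyMeasurable
  exact Eventually.of_forall fun x => by simp [norm_ee]

/-- Fourier pairs -/
structure FI (f fh : ℝ → ℂ) : Prop where
  c1 : Continuous f
  c2 : Continuous fh
  i1 : Integrable f
  i2 : Integrable fh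
  inv : ∀ y, f y = ∫ ξ, fh ξ * ee (ξ * y)
  ft : ∀ ξ, fh ξ = ∫ z, f z * ee (-(ξ * z))

lemma tri {F G Fh Gh ψ h p q : ℝ → ℂ} (hFh : Integrable Fh) (hGh : Integrable Gh) (hψ : Integrable ψ) (hh : Integrable h)
    (hF : ∀ y, F y = ∫ ξ, Fh ξ * ee (ξ * y)) (hG : ∀ y, G y = ∫ ξ, Gh ξ * ee (ξ * y))
    (hp : ∀ ω, p ω = ∫ t, ψ t * ee (-(ω * t))) (hq : ∀ ω, q ω = ∫ x, h x * ee (ω * x)) :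
    ∫ z : ℝ × ℝ, F (z.1 - z.2) * G (z.1 + z.2) * ψ z.2 * h z.1 =
      ∫ w : ℝ × ℝ, Fh w.1 * Gh w.2 * p (w.1 - w.2) * q (w.1 + w.2) := by
  set Θ : ℝ × ℝ → ℝ × ℝ → ℂ := fun z w => (h z.1 * ψ z.2) * (Fh w.1 * Gh w.2) *
    ee (w.1 * (z.1 - z.2) + w.2 * (z.1 + z.2)) with hΘ
  have hnti : Integrable (Function.uncurry Θ) ((volume : Measure (ℝ × ℝ)).prod (volume : Measure (ℝ × ℝ))) := by
    have h1 : Integrable (fun z : ℝ × ℝ => h z.1 * ψ z.2) := hh.mul_prod hψ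
    have h2 : Integrable (fun z : ℝ × ℝ => Fh z.1 * Gh z.2) := hFh.mul_prod hGh
    exact int_mul_ee (h1.mul_prod h2) (by fun_prop)
  have e1 : ∀ z : ℝ × ℝ, F (z.1 - z.2) * G (z.1 + z.2) * ψ z.2 * h z.1 = ∫ w, Θ z w := by
    intro z
    simp only [hΘ]
    rw [hF, hG]
    calc _ = (h z.1 * ψ z.2) * ((∫ ξ, Fh ξ * ee (ξ * (z.1 - z.2))) * ∫ ξ, Gh ξ * ee (ξ * (z.1 + z.2))) := by ring
      _ = _ := by
        rw [← integral_prod_mul, ← integral_const_mul, ← Measure.volume_eq_prod]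
        congr 1; ext w; rw [ee_add]; ring
  have e2 : ∀ w : ℝ × ℝ, ∫ z, Θ z w = Fh w.1 * Gh w.2 * p (w.1 - w.2) * q (w.1 + w.2) := by
    intro w
    simp only [hΘ]
    rw [hp, hq]
    calc _ = ∫ z : ℝ × ℝ, (Fh w.1 * Gh w.2) * ((h z.1 * ee ((w.1 + w.2) * z.1)) * (ψ z.2 * ee (-((w.1 - w.2) * z.2)))) := by
          congr 1; ext z
          rw [show w.1 * (z.1 - z.2) + w.2 * (z.1 + z.2) = (w.1 + w.2) * z.1 + (-((w.1 - w.2) * z.2)) by ring, ee_add]; ring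
      _ = _ := by
        rw [integral_const_mul, Measure.volume_eq_prod, integral_prod_mul
          (f := fun x => h x * ee ((w.1 + w.2) * x)) (g := fun x => ψ x * ee (-((w.1 - w.2) * x)))]; ring
  simp_rw [e1, ← e2]
  exact integral_integral_swap hnti

/-- frequency localised pieces -/
noncomputable def FL (φ : ℝ → ℂ) (f : ℝ → ℂ) (u y : ℝ) : ℂ := ∫ z, f z * (φ (y - z) * ee (u * (y - z)))

lemma FL_inv {f fh φ a : ℝ → ℂ} (hf : FI f fh) (hφ : FI φ a) (u y : ℝ) :
    FL φ f u y = ∫ ξ, (fh ξ * a (ξ - u)) * ee (ξ * y) := by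
  unfold FL
  have hnti : Integrable (Function.uncurry fun (z ω : ℝ) => (f z * a ω) * ee ((ω + u) * (y - z)))
      ((volume : Measure ℝ).prod volume) := int_mul_ee (hf.i1.mul_prod hφ.i2) (by fun_prop)
  calc _ = ∫ z, ∫ ω, (f z * a ω) * ee ((ω + u) * (y - z)) := by
        congr 1; ext z
        rw [hφ.inv, ← integral_mul_const, ← integral_const_mul]
        congr 1; ext ω
        rw [add_mul, ee_add]; ring
    _ = ∫ ω, ∫ z, (f z * a ω) * ee ((ω + u) * (y - z)) := integral_integral_swap hnti
    _ = ∫ ω, (fh (ω + u) * a ((ω + u) - u)) * ee ((ω + u) * y) := by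
        congr 1; ext ω
        rw [hf.ft, ← integral_mul_const, ← integral_mul_const]
        congr 1; ext z
        rw [show (ω + u) * (y - z) = (-((ω + u) * z)) + (ω + u) * y by ring, ee_add, add_sub_cancel_right]; ring
    _ = _ := integral_add_right_eq_self (fun ω => (fh ω * a (ω - u)) * ee (ω * y)) u

lemma int_mul_trans {f a : ℝ → ℂ} (hf : Integrable f) (ha : Continuous a) {B : ℝ} (hB : ∀ x, ‖a x‖ ≤ B) (u : ℝ) :
    Integrable (fun ξ => f ξ * a (ξ - u)) :=
  hf.mul_bdd (ha.comp (continuous_id.sub continuous_const)).aestronglyMeasurable (Eventually.of_forall fun x => hB _)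

lemma FI.bdd {f fh : ℝ → ℂ} (h : FI f fh) : ∃ B, ∀ x, ‖fh x‖ ≤ B := by
  refine ⟨∫ z, ‖f z‖, fun x => ?_⟩
  rw [h.ft]
  refine (norm_integral_le_integral_norm _).trans (le_of_eq ?_)
  congr 1; ext z; rw [norm_mul, norm_ee, mul_one]

lemma FI.bdd' {f fh : ℝ → ℂ} (h : FI f fh) : ∃ B, ∀ x, ‖f x‖ ≤ B := by
  refine ⟨∫ z, ‖fh z‖, fun x => ?_⟩
  rw [h.inv]
  refine (norm_integral_le_integral_norm _).trans (le_of_eq ?_)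
  congr 1; ext z; rw [norm_mul, norm_ee, mul_one]

lemma FL_integrand {h φ : ℝ → ℂ} (hh : Integrable h) (hφ : Integrable φ) (u : ℝ) :
    Integrable (Function.uncurry fun (y z : ℝ) => h z * (φ (y - z) * ee (u * (y - z)))) ((volume : Measure ℝ).prod volume) := by
  have := hh.convolution_integrand (ContinuousLinearMap.mul ℝ ℂ) (int_mul_ee hφ (l := fun x => u * x) (by fun_prop))
  exact this

lemma FL_integrable {h φ : ℝ → ℂ} (hh : Integrable h) (hφ : Integrable φ) (u : ℝ) : Integrable (FL φ h u) :=
  (FL_integrand hh hφ u).integral_prod_left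

lemma FL_ft {h ζ d : ℝ → ℂ} (hh : Integrable h) (hζ : FI ζ d) (u ω : ℝ) :
    ∫ y, FL ζ h u y * ee (ω * y) = (∫ x, h x * ee (ω * x)) * d (-(ω + u)) := by
  unfold FL
  have hnti : Integrable (Function.uncurry fun (y z : ℝ) => h z * (ζ (y - z) * ee (u * (y - z))) * ee (ω * y))
      ((volume : Measure ℝ).prod volume) := int_mul_ee (FL_integrand hh hζ.i1 u) (l := fun p : ℝ × ℝ => ω * p.1) (by fun_prop)
  calc _ = ∫ y, ∫ z, h z * (ζ (y - z) * ee (u * (y - z))) * ee (ω * y) := by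
        congr 1; ext y; rw [← integral_mul_const]
    _ = ∫ z, ∫ y, h z * (ζ (y - z) * ee (u * (y - z))) * ee (ω * y) := integral_integral_swap hnti
    _ = ∫ z, (h z * ee (ω * z)) * d (-(ω + u)) := by
        congr 1; ext z
        rw [hζ.ft, ← integral_const_mul,
          ← integral_sub_right_eq_self (fun y => h z * ee (ω * z) * (ζ y * ee (-(-(ω + u) * y)))) z]
        congr 1; ext y
        rw [show ω * y = ω * z + ω * (y - z) by ring, ee_add,
          show -(-(ω + u) * (y - z)) = u * (y - z) + ω * (y - z) by ring, ee_add]; ring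
    _ = _ := integral_mul_const _ _

/-- the data of the decomposition -/
structure Dat (φ a ρ b ζ d ψ p : ℝ → ℂ) : Prop where
  ha : FI φ a
  hb : FI ρ b
  hd : FI ζ d
  hψ : Integrable ψ
  hp : ∀ ω, p ω = ∫ t, ψ t * ee (-(ω * t))
  sa : ∀ x, 1/64 < |x| → a x = 0
  sp : ∀ x, 1/64 < |x - 1| → p x = 0
  b1 : ∀ x, |x| ≤ 1/32 → b x = 1
  d1 : ∀ x, |x| ≤ 5/64 → d x = 1
  sb : ∀ x, 1/16 < |x| → b x = 0
  sd : ∀ x, 1/8 < |x| → d x = 0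

theorem unit_id {φ a ρ b ζ d ψ p : ℝ → ℂ} (D : Dat φ a ρ b ζ d ψ p) {f fh g gh h : ℝ → ℂ} (hf : FI f fh) (hg : FI g gh)
    (hh : Integrable h) :
    (∫ x, a x) * ∫ z : ℝ × ℝ, f (z.1 - z.2) * g (z.1 + z.2) * ψ z.2 * h z.1 =
      ∫ u, ∫ z : ℝ × ℝ, FL φ f u (z.1 - z.2) * FL ρ g (u - 1) (z.1 + z.2) * ψ z.2 * FL ζ h (-(2*u-1)) z.1 := by
  obtain ⟨Ba, hBa⟩ := D.ha.bdd
  obtain ⟨Bb, hBb⟩ := D.hb.bdd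
  set q : ℝ → ℂ := fun ω => ∫ x, h x * ee (ω * x) with hq
  set X : ℝ × ℝ → ℂ := fun w => fh w.1 * gh w.2 * p (w.1 - w.2) * q (w.1 + w.2) with hX
  have hpc : Continuous p := by
    rw [show p = fun ω => ∫ t, ψ t * ee (-(ω * t)) from funext D.hp]
    apply continuous_of_dominated (bound := fun t => ‖ψ t‖)
    · intro ω; exact (int_mul_ee D.hψ (by fun_prop)).aestronglyMeasurable
    · intro ω; exact Eventually.of_forall fun t => by rw [norm_mul, norm_ee, mul_one]
    · exact D.hψ.norm
    · exact Eventually.of_forall fun t => continuous_const.mul (ee_cont.comp (by fun_prop))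
  have hqc : Continuous q := by
    apply continuous_of_dominated (bound := fun t => ‖h t‖)
    · intro ω; exact (int_mul_ee hh (by fun_prop)).aestronglyMeasurable
    · intro ω; exact Eventually.of_forall fun t => by rw [norm_mul, norm_ee, mul_one]
    · exact hh.norm
    · exact Eventually.of_forall fun t => continuous_const.mul (ee_cont.comp (by fun_prop))
  have hpB : ∀ x, ‖p x‖ ≤ ∫ t, ‖ψ t‖ := by
    intro x; rw [D.hp]
    refine (norm_integral_le_integral_norm _).trans (le_of_eq ?_)
    congr 1; ext z; rw [norm_mul, norm_ee, mul_one]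
  have hqB : ∀ x, ‖q x‖ ≤ ∫ t, ‖h t‖ := by
    intro x
    refine (norm_integral_le_integral_norm _).trans (le_of_eq ?_)
    congr 1; ext z; rw [norm_mul, norm_ee, mul_one]
  have hXi : Integrable X := by
    have h1 : Integrable (fun w : ℝ × ℝ => fh w.1 * gh w.2) := hf.i2.mul_prod hg.i2
    exact (h1.mul_bdd (hpc.comp (by fun_prop)).aestronglyMeasurable (Eventually.of_forall fun x => hpB _)).mul_bdd
      (hqc.comp (by fun_prop)).aestronglyMeasurable (Eventually.of_forall fun x => hqB _)
  have e1 : ∀ u, ∫ z : ℝ × ℝ, FL φ f u (z.1 - z.2) * FL ρ g (u - 1) (z.1 + z.2) * ψ z.2 * FL ζ h (-(2*u-1)) z.1 =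
      ∫ w, X w * a (w.1 - u) := by
    intro u
    rw [tri (int_mul_trans hf.i2 D.ha.c2 hBa u) (int_mul_trans hg.i2 D.hb.c2 hBb (u-1)) D.hψ (FL_integrable hh D.hd.i1 _)
      (FL_inv hf D.ha u) (FL_inv hg D.hb (u-1)) D.hp (fun ω => rfl)]
    congr 1; ext w
    rw [FL_ft hh D.hd]
    simp only [hX]
    by_cases hA : 1/64 < |w.1 - u|
    · rw [D.sa _ hA]; ring
    by_cases hP : 1/64 < |w.1 - w.2 - 1|
    · rw [D.sp _ hP]; ring
    push Not at hA hP
    rw [abs_le] at hA hP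
    rw [D.b1 (w.2 - (u-1)) (by rw [abs_le]; constructor <;> linarith),
      D.d1 _ (by rw [abs_le]; constructor <;> linarith)]
    ring
  have hnti : Integrable (Function.uncurry fun (u : ℝ) (w : ℝ × ℝ) => X w * a (w.1 - u))
      ((volume : Measure ℝ).prod (volume : Measure (ℝ × ℝ))) := by
    rw [integrable_prod_iff']
    · constructor
      · exact Eventually.of_forall fun w => (D.ha.i2.comp_sub_left w.1).const_mul (X w)
      · simp only [Function.uncurry, norm_mul]
        have : ∀ w : ℝ × ℝ, ∫ u, ‖X w‖ * ‖a (w.1 - u)‖ = ‖X w‖ * ∫ u, ‖a u‖ := by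
          intro w
          rw [integral_const_mul, integral_sub_left_eq_self (fun x => ‖a x‖)]
        simp_rw [this]
        exact hXi.norm.mul_const _
    · apply AEStronglyMeasurable.mul
      · exact hXi.aestronglyMeasurable.comp_snd
      · exact (D.ha.c2.comp (by fun_prop)).aestronglyMeasurable
  simp_rw [e1]
  rw [integral_integral_swap hnti, tri hf.i2 hg.i2 D.hψ hh hf.inv hg.inv D.hp (q := q) (fun ω => rfl), ← integral_const_mul]
  congr 1; ext w
  rw [integral_const_mul, integral_sub_left_eq_self a, mul_comm]

end BHT
end

section
open MeasureTheory Filter Set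
open scoped ENNReal ComplexConjugate FourierTransform
namespace BHT

/-! ### Wave packets -/

lemma fourier_ee (f : ℝ → ℂ) (ξ : ℝ) : 𝓕 f ξ = ∫ z, f z * ee (-(ξ * z)) := by
  rw [Real.fourier_real_eq_integral_exp_smul]
  congr 1; ext z
  rw [smul_eq_mul, mul_comm]; congr 1
  unfold ee; congr 1; push_cast; ring

lemma ee_sub (x y : ℝ) : ee (x - y) = ee x * ee (-y) := by rw [sub_eq_add_neg, ee_add]

lemma moments {f : ℝ → ℂ} (hf : ∀ n : ℕ, n ≤ 4 → Integrable (fun x : ℝ => x ^ n • f x)) {ε : ℝ} (hε : 0 < ε)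
    (h : ∀ l : ℝ, |l| < ε → ∫ z, f z * ee (-(l * z)) = 0) (n : ℕ) (hn : n ≤ 4) : ∫ z : ℝ, (z:ℂ) ^ n * f z = 0 := by
  have h1 := Real.iteratedDeriv_fourier (f := f) (N := 4) (n := n) (fun m hm => hf m (by exact_mod_cast hm)) (by exact_mod_cast hn)
  have h2 : (𝓕 f) =ᶠ[nhds 0] fun _ => 0 := by
    filter_upwards [Metric.ball_mem_nhds (0:ℝ) hε] with l hl
    rw [fourier_ee]; apply h; simpa using hl
  have h3 : iteratedDeriv n (𝓕 f) 0 = 0 := by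
    rw [h2.iteratedDeriv_eq n]
    simp [iteratedDeriv_const]
  rw [h1, fourier_ee] at h3
  simp only [zero_mul, neg_zero, ee_zero, mul_one, mul_pow, smul_eq_mul, mul_assoc] at h3
  rw [integral_const_mul, integral_const_mul, integral_const_mul] at h3
  have hne : ((-2:ℂ)) ^ n ≠ 0 := by simp
  have hpi : (Real.pi : ℂ) ^ n ≠ 0 := by simp [Real.pi_ne_zero]
  have hI : Complex.I ^ n ≠ 0 := by simp
  simpa [hne, hpi, hI, Real.pi_ne_zero] using h3

noncomputable def pkt (Φ : ℝ → ℂ) (w σ τ c : ℝ) (P : Tile) (z : ℝ) : ℂ :=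
  (((sc σ P)⁻¹ : ℝ) : ℂ) * Φ ((z - lf σ P) / sc σ P) * ee (w * th σ τ c P * z)

lemma pkt_ft {Φ Φh : ℝ → ℂ} (hΦ : FI Φ Φh) {w σ τ c : ℝ} (hσ : 0 < σ) (P : Tile) (ξ : ℝ) :
    ∃ κ : ℂ, ∫ z, pkt Φ w σ τ c P z * ee (-(ξ * z)) = κ * Φh (sc σ P * (ξ - w * th σ τ c P)) := by
  have hs := sc_pos hσ P
  set s := sc σ P with hsd
  refine ⟨ee ((w * th σ τ c P - ξ) * lf σ P), ?_⟩
  unfold pkt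
  rw [hΦ.ft, ← integral_const_mul]
  have h1 := integral_sub_right_eq_self (μ := volume) (fun z => (((s)⁻¹ : ℝ) : ℂ) * Φ (z / s) * (ee (w * th σ τ c P * (z + lf σ P)) *
    ee (-(ξ * (z + lf σ P))))) (lf σ P)
  have h2 := Measure.integral_comp_mul_left (fun z => (((s)⁻¹ : ℝ) : ℂ) * Φ (z / s) * (ee (w * th σ τ c P * (z + lf σ P)) *
    ee (-(ξ * (z + lf σ P))))) s
  simp only [sub_add_cancel] at h1
  rw [← hsd]
  calc _ = _ := by congr 1; ext z; rw [mul_assoc]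
    _ = _ := h1
    _ = ∫ x, s • ((fun z => (((s)⁻¹ : ℝ) : ℂ) * Φ (z / s) * (ee (w * th σ τ c P * (z + lf σ P)) *
      ee (-(ξ * (z + lf σ P))))) (s * x)) := by
        rw [integral_smul, h2, abs_of_pos (by positivity), smul_smul, mul_inv_cancel₀ hs.ne', one_smul]
    _ = _ := by
        congr 1; ext x
        simp only [mul_div_cancel_left₀ _ hs.ne']
        rw [← ee_add, Complex.real_smul, mul_comm (Φ x), ← mul_assoc (ee _), ← ee_add, ← mul_assoc, ← mul_assoc]
        push_cast
        rw [mul_inv_cancel₀ (by exact_mod_cast hs.ne'), one_mul, mul_comm (Φ x)]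
        congr 2; ring

lemma orth0 {Φ Φh : ℝ → ℂ} (hΦ : FI Φ Φh) {w σ τ c : ℝ} (hσ : 0 < σ) (hw : w ≠ 0)
    (hsupp : ∀ x, |w|/16 < |x| → Φh x = 0) (P P' : Tile) (hi : Integrable (pkt Φ w σ τ c P)) {l : ℝ}
    (hl : |l| < |w| * (|th σ τ c P - th σ τ c P'| - ((1/16) / sc σ P + (1/16) / sc σ P'))) :
    ∫ z, (pkt Φ w σ τ c P z * conj (pkt Φ w σ τ c P' z)) * ee (-(l * z)) = 0 := by
  have hs := sc_pos hσ P
  have hs' := sc_pos hσ P'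
  set F := pkt Φ w σ τ c P with hF
  set s' := sc σ P' with hsd
  set κ : ℂ := (((s')⁻¹ : ℝ) : ℂ)
  have e1 : ∀ z, (F z * conj (pkt Φ w σ τ c P' z)) * ee (-(l * z)) =
      ∫ ω, (F z * (κ * conj (Φh ω))) * ee (-(ω * ((z - lf σ P')/s')) - w * th σ τ c P' * z - l * z) := by
    intro z
    have : conj (Φ ((z - lf σ P')/s')) = ∫ ω, conj (Φh ω) * ee (-(ω * ((z - lf σ P')/s'))) := by
      rw [hΦ.inv, ← integral_conj]
      congr 1; ext ω; rw [map_mul, conj_ee]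
    unfold pkt
    rw [map_mul, map_mul, this, conj_ee, Complex.conj_ofReal, ← hsd]
    rw [← integral_const_mul, ← integral_mul_const, ← integral_const_mul, ← integral_mul_const]
    congr 1; ext ω
    rw [ee_sub, ee_sub]; ring
  have hnti : Integrable (Function.uncurry fun (z ω : ℝ) =>
      (F z * (κ * conj (Φh ω))) * ee (-(ω * ((z - lf σ P')/s')) - w * th σ τ c P' * z - l * z))
      ((volume : Measure ℝ).prod volume) := by
    have : Integrable (fun ω => κ * conj (Φh ω)) := by
      have : Integrable (fun ω => conj (Φh ω)) := by
        refine hΦ.i2.norm.mono' (Complex.continuous_conj.comp hΦ.c2).aestronglyMeasurable ?_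
        exact Eventually.of_forall fun x => by simp
      exact this.const_mul _
    exact int_mul_ee (hi.mul_prod this) (by fun_prop)
  simp_rw [e1]
  rw [integral_integral_swap hnti]
  apply integral_eq_zero_of_ae
  refine Eventually.of_forall fun ω => ?_
  simp only [Pi.zero_apply]
  obtain ⟨κ', hκ'⟩ := pkt_ft hΦ hσ (w := w) (τ := τ) (c := c) P (ω / s' + w * th σ τ c P' + l)
  calc _ = ∫ z, (κ * conj (Φh ω) * ee (ω * (lf σ P'/s'))) * (F z * ee (-((ω / s' + w * th σ τ c P' + l) * z))) := by
        congr 1; ext z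
        rw [show -(ω * ((z - lf σ P')/s')) - w * th σ τ c P' * z - l * z = ω * (lf σ P'/s') +
          -((ω / s' + w * th σ τ c P' + l) * z) by ring, ee_add]; ring
    _ = 0 := by
      rw [integral_const_mul, hκ']
      by_cases h1 : |w|/16 < |ω|
      · rw [hsupp _ h1]; simp
      by_cases h2 : |w|/16 < |sc σ P * (ω / s' + w * th σ τ c P' + l - w * th σ τ c P)|
      · rw [hsupp _ h2]; simp
      exfalso
      push Not at h1 h2
      rw [abs_mul, abs_of_pos hs, ← le_div_iff₀' hs] at h2
      have h3 : |ω/s'| ≤ |w|/16/s' := by rw [abs_div, abs_of_pos hs']; gcongr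
      have h4 : |w| * |th σ τ c P - th σ τ c P'| ≤ |w|/16/sc σ P + |w|/16/s' + |l| := by
        rw [← abs_mul]
        calc _ = |-(ω / s' + w * th σ τ c P' + l - w * th σ τ c P) + ω/s' + l| := by congr 1; ring
          _ ≤ |-(ω / s' + w * th σ τ c P' + l - w * th σ τ c P)| + |ω/s'| + |l| :=
            (abs_add_le _ _).trans (by gcongr; exact abs_add_le _ _)
          _ ≤ _ := by rw [abs_neg]; gcongr
      have : |w| * (|th σ τ c P - th σ τ c P'| - ((1/16) / sc σ P + (1/16) / s')) =
        |w| * |th σ τ c P - th σ τ c P'| - (|w|/16/sc σ P + |w|/16/s') := by ring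
      linarith

lemma hasDerivAt_ee (l x : ℝ) : HasDerivAt (fun x => ee (l * x)) (ee (l * x) * (2 * Real.pi * l * Complex.I)) x := by
  unfold ee
  have h : HasDerivAt (fun x : ℝ => 2 * (Real.pi:ℂ) * ((l * x : ℝ):ℂ) * Complex.I) (2 * Real.pi * l * Complex.I) x := by
    have := ((((hasDerivAt_id x).const_mul l).ofReal_comp).const_mul (2 * (Real.pi:ℂ))).mul_const Complex.I
    simpa using this
  exact h.cexp

theorem pkt_Pk {Φ Φ' Φh : ℝ → ℂ} (hΦ : FI Φ Φh) (hd : ∀ x, HasDerivAt Φ (Φ' x) x) {A1 : ℝ} {N : ℕ} (hA1 : 0 < A1)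
    (b1 : ∀ x, ‖Φ x‖ ≤ A1 * ((1 + |x|) ^ (N+10))⁻¹) (b2 : ∀ x, ‖Φ' x‖ ≤ A1 * ((1 + |x|) ^ (N+10))⁻¹)
    {w : ℝ} (hw : w ≠ 0) (hw2 : |w| ≤ 2) (hsupp : ∀ x, |w|/16 < |x| → Φh x = 0) {σ τ c : ℝ} (hσ : 0 < σ) :
    Pk σ τ c N (2^15 * A1) (pkt Φ w σ τ c) := by
  have hbr : ∀ P z, 1 + |(z - lf σ P)/sc σ P| = br (lf σ P) (sc σ P) z := by
    intro P z; unfold br; rw [abs_div, abs_of_pos (sc_pos hσ P)]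
  have cont : ∀ P, Continuous (pkt Φ w σ τ c P) := by
    intro P; unfold pkt
    exact (continuous_const.mul (hΦ.c1.comp (by fun_prop))).mul (ee_cont.comp (by fun_prop))
  have decay : ∀ P y, ‖pkt Φ w σ τ c P y‖ ≤ A1 / sc σ P * (br (lf σ P) (sc σ P) y ^ (N+10))⁻¹ := by
    intro P y
    have hs := sc_pos hσ P
    unfold pkt
    rw [norm_mul, norm_mul, norm_ee, mul_one, Complex.norm_real, Real.norm_of_nonneg (by positivity)]
    calc _ ≤ (sc σ P)⁻¹ * (A1 * ((1 + |(y - lf σ P)/sc σ P|) ^ (N+10))⁻¹) := by gcongr; exact b1 _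
      _ = _ := by rw [hbr]; ring
  have hnti : ∀ P, Integrable (pkt Φ w σ τ c P) := by
    intro P
    have hs := sc_pos hσ P
    refine ((integrable_br hs (lf σ P)).const_mul (A1 / sc σ P)).mono' (cont P).aestronglyMeasurable ?_
    refine Eventually.of_forall fun y => (decay P y).trans ?_
    gcongr 1
    exact inv_pow_mono (br_one_le hs _ _) (by omega)
  refine ⟨cont, ?_, ?_, ?_⟩
  · intro P y
    have hs := sc_pos hσ P
    have := br_pos hs (lf σ P) y
    refine (decay P y).trans ?_
    gcongr; linarith
  · intro P P' hsep c0 ℓ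
    have hs := sc_pos hσ P
    have hs' := sc_pos hσ P'
    set F : ℝ → ℂ := fun z => pkt Φ w σ τ c P z * conj (pkt Φ w σ τ c P' z) with hF
    have hFc : Continuous F := (cont P).mul (Complex.continuous_conj.comp (cont P'))
    have hmi : ∀ n : ℕ, n ≤ 4 → Integrable (fun x : ℝ => x ^ n • F x) := by
      intro n hn
      set K := (1 + |lf σ P| + sc σ P) with hK
      have hK1 : 1 ≤ K := by rw [hK]; have := abs_nonneg (lf σ P); linarith
      refine ((integrable_br hs (lf σ P)).const_mul (K^n * (A1 / sc σ P) * (A1 / sc σ P'))).mono'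
        ((by fun_prop : Continuous fun x : ℝ => x ^ n).smul hFc).aestronglyMeasurable ?_
      refine Eventually.of_forall fun y => ?_
      have hb := br_one_le hs (lf σ P) y
      have hb' := br_one_le hs' (lf σ P') y
      have hy : |y| ≤ K * br (lf σ P) (sc σ P) y := by
        have e : |y - lf σ P| = sc σ P * (br (lf σ P) (sc σ P) y - 1) := by unfold br; field_simp; ring
        have h1 : |y| ≤ |lf σ P| + |y - lf σ P| := by
          calc |y| = |lf σ P + (y - lf σ P)| := by congr 1; ring
            _ ≤ _ := abs_add_le _ _
        rw [e] at h1
        have := abs_nonneg (lf σ P)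
        rw [hK]; nlinarith
      rw [norm_smul, norm_pow, Real.norm_eq_abs]
      simp only [hF, norm_mul, RCLike.norm_conj]
      set X := br (lf σ P) (sc σ P) y
      have d1 := decay P y
      have d2 : ‖pkt Φ w σ τ c P' y‖ ≤ A1 / sc σ P' := by
        refine (decay P' y).trans ?_
        apply mul_le_of_le_one_right (by positivity)
        exact inv_le_one_of_one_le₀ (one_le_pow₀ hb')
      calc _ ≤ (K * X) ^ n * ((A1 / sc σ P * (X ^ (N+10))⁻¹) * (A1 / sc σ P')) := by
            gcongr
        _ = K^n * (A1 / sc σ P) * (A1 / sc σ P') * (X ^ n * (X ^ (N+10))⁻¹) := by rw [mul_pow]; ring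
        _ ≤ _ := by
          gcongr 1
          rw [← div_eq_mul_inv, div_le_iff₀ (by positivity), ← div_eq_inv_mul, le_div_iff₀ (by positivity), ← pow_add]
          exact pow_le_pow_right₀ hb (by omega)
    have hmom := moments hmi (ε := |w| * (|th σ τ c P - th σ τ c P'| - ((1/16) / sc σ P + (1/16) / sc σ P')))
      (mul_pos (abs_pos.2 hw) (by linarith)) (fun l hl => orth0 hΦ hσ hw hsupp P P' (hnti P) hl)
    have hmi' : ∀ n : ℕ, n ≤ 4 → Integrable (fun x : ℝ => (x:ℂ) ^ n * F x) := by
      intro n hn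
      refine (hmi n hn).congr (Eventually.of_forall fun x => ?_)
      simp
    set x : ℝ := 1/ℓ
    set a : ℝ := 1 + x^2*c0^2
    set b : ℝ := -2*x^2*c0
    set d : ℝ := x^2
    have e : ∀ z, ((wt c0 ℓ z ^ 2 : ℝ) : ℂ) * F z = ((a^2:ℝ):ℂ) * ((z:ℂ)^0 * F z) + ((2*a*b:ℝ):ℂ) * ((z:ℂ)^1 * F z) +
        ((b^2+2*a*d:ℝ):ℂ) * ((z:ℂ)^2 * F z) + ((2*b*d:ℝ):ℂ) * ((z:ℂ)^3 * F z) + ((d^2:ℝ):ℂ) * ((z:ℂ)^4 * F z) := by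
      intro z
      have : wt c0 ℓ z ^ 2 = a^2 * z^0 + 2*a*b*z^1 + (b^2+2*a*d)*z^2 + 2*b*d*z^3+d^2*z^4 := by
        simp only [wt, a, b, d, x]; ring
      rw [this]; push_cast; ring
    change ∫ z, ((wt c0 ℓ z ^ 2 : ℝ) : ℂ) * F z = 0
    simp_rw [e]
    have i0 := (hmi' 0 (by norm_num)).const_mul ((a^2:ℝ):ℂ)
    have i1 := (hmi' 1 (by norm_num)).const_mul ((2*a*b:ℝ):ℂ)
    have i2 := (hmi' 2 (by norm_num)).const_mul ((b^2+2*a*d:ℝ):ℂ)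
    have i3 := (hmi' 3 (by norm_num)).const_mul ((2*b*d:ℝ):ℂ)
    have i4 := (hmi' 4 (by norm_num)).const_mul ((d^2:ℝ):ℂ)
    have j1 : Integrable fun x : ℝ => ((a^2:ℝ):ℂ) * ((x:ℂ)^0 * F x) + ((2*a*b:ℝ):ℂ) * ((x:ℂ)^1 * F x) := i0.add i1
    have j2 : Integrable fun x : ℝ => ((a^2:ℝ):ℂ) * ((x:ℂ)^0 * F x) + ((2*a*b:ℝ):ℂ) * ((x:ℂ)^1 * F x) +
      ((b^2+2*a*d:ℝ):ℂ) * ((x:ℂ)^2 * F x) := j1.add i2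
    have j3 : Integrable fun x : ℝ => ((a^2:ℝ):ℂ) * ((x:ℂ)^0 * F x) + ((2*a*b:ℝ):ℂ) * ((x:ℂ)^1 * F x) +
      ((b^2+2*a*d:ℝ):ℂ) * ((x:ℂ)^2 * F x) + ((2*b*d:ℝ):ℂ) * ((x:ℂ)^3 * F x) := j2.add i3
    rw [integral_add j3 i4, integral_add j2 i3, integral_add j1 i2, integral_add i0 i1]
    simp only [integral_const_mul]
    rw [hmom 0 (by norm_num), hmom 1 (by norm_num), hmom 2 (by norm_num), hmom 3 (by norm_num), hmom 4 (by norm_num)]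
    simp
  · intro ξ
    refine ⟨fun z => ee (-(w * ξ * z)), fun z => norm_ee _, ?_⟩
    intro P hP y z hyz
    have hs := sc_pos hσ P
    set s := sc σ P with hsd
    set l := w * (th σ τ c P - ξ) with hl
    have hls : |l| ≤ 4 / s := by
      rw [le_div_iff₀ hs, hl, abs_mul, mul_assoc]
      nlinarith [abs_nonneg w, mul_nonneg (abs_nonneg (th σ τ c P - ξ)) hs.le]
    set ψ : ℝ → ℂ := fun z => (((s)⁻¹ : ℝ) : ℂ) * (Φ ((z - lf σ P) / s) * ee (l * z)) with hψ
    have hψe : ∀ z, ee (-(w * ξ * z)) * pkt Φ w σ τ c P z = ψ z := by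
      intro z
      simp only [hψ, pkt, ← hsd]
      rw [show l * z = w * th σ τ c P * z + -(w * ξ * z) by rw [hl]; ring, ee_add]; ring
    rw [hψe, hψe]
    set ψ' : ℝ → ℂ := fun z => (((s)⁻¹ : ℝ) : ℂ) * (((s⁻¹ : ℝ):ℂ) * Φ' ((z - lf σ P) / s) * ee (l * z) +
      Φ ((z - lf σ P) / s) * (ee (l * z) * (2 * Real.pi * l * Complex.I))) with hψ'
    have hder : ∀ x, HasDerivAt ψ (ψ' x) x := by
      intro x
      have h1 : HasDerivAt (fun z : ℝ => (z - lf σ P) / s) (s⁻¹) x := by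
        simpa using ((hasDerivAt_id x).sub_const (lf σ P)).div_const s
      have h2 := (hd ((x - lf σ P)/s)).scomp x h1
      rw [Complex.real_smul] at h2
      exact (h2.mul (hasDerivAt_ee l x)).const_mul _
    have hbd : ∀ x ∈ segment ℝ y z, ‖ψ' x‖ ≤ 2^15 * A1 / s ^ 2 * (br (lf σ P) s y ^ 10)⁻¹ := by
      intro x hx
      have hxy : |x - y| ≤ |z - y| := by
        rw [segment_eq_uIcc] at hx
        exact abs_sub_left_of_mem_uIcc hx
      have hbx : br (lf σ P) s y / 2 ≤ br (lf σ P) s x := by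
        unfold br
        have : |y - lf σ P| ≤ |x - y| + |x - lf σ P| := by
          calc |y - lf σ P| = |-(x - y) + (x - lf σ P)| := by congr 1; ring
            _ ≤ |-(x-y)| + _ := abs_add_le _ _
            _ = _ := by rw [abs_neg]
        have h2 : |y - lf σ P| / 2 - s/2 ≤ |x - lf σ P| := by linarith
        have h3 : (|y - lf σ P| / 2 - s/2)/s ≤ |x - lf σ P| / s := by gcongr
        have h4 : (|y - lf σ P| / 2 - s/2)/s = (|y - lf σ P|/s)/2 - 1/2 := by field_simp
        linarith
      have hy0 := br_pos hs (lf σ P) y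
      have hx1 := br_one_le hs (lf σ P) x
      have hpow : (br (lf σ P) s x ^ (N+10))⁻¹ ≤ 2^10 * (br (lf σ P) s y ^ 10)⁻¹ := by
        calc _ ≤ (br (lf σ P) s x ^ 10)⁻¹ := inv_pow_mono hx1 (by omega)
          _ ≤ ((br (lf σ P) s y / 2) ^ 10)⁻¹ := by gcongr
          _ = _ := by rw [div_pow, inv_div]; ring
      have n1 : ‖Φ ((x - lf σ P)/s)‖ ≤ A1 * (2^10 * (br (lf σ P) s y ^ 10)⁻¹) := by
        refine (b1 _).trans ?_
        rw [hbr]; gcongr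
      have n2 : ‖Φ' ((x - lf σ P)/s)‖ ≤ A1 * (2^10 * (br (lf σ P) s y ^ 10)⁻¹) := by
        refine (b2 _).trans ?_
        rw [hbr]; gcongr
      simp only [hψ']
      rw [norm_mul, Complex.norm_real, Real.norm_of_nonneg (by positivity)]
      set Y := A1 * (2^10 * (br (lf σ P) s y ^ 10)⁻¹) with hY
      have hY0 : 0 ≤ Y := (norm_nonneg _).trans n1
      have n3 : ‖(2 * (Real.pi:ℂ) * l * Complex.I)‖ ≤ 31 / s := by
        rw [norm_mul, norm_mul, norm_mul]
        simp only [Complex.norm_ofNat, Complex.norm_real, Complex.norm_I, mul_one, Real.norm_eq_abs, abs_of_pos Real.pi_pos]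
        have := Real.pi_lt_d2
        calc 2 * Real.pi * |l| ≤ 2 * 3.15 * (4/s) := by gcongr
          _ = 25.2 / s := by ring
          _ ≤ _ := by gcongr; norm_num
      calc s⁻¹ * _ ≤ s⁻¹ * (s⁻¹ * Y + Y * (31 / s)) := by
            gcongr
            refine (norm_add_le _ _).trans ?_
            rw [norm_mul, norm_mul, norm_mul, norm_mul, norm_ee, mul_one, one_mul, Complex.norm_real, Real.norm_of_nonneg (by positivity)]
            gcongr
        _ = _ := by rw [hY]; field_simp; ring
    have := (convex_segment y z).norm_image_sub_le_of_norm_hasDerivWithin_le (f := ψ) (f' := ψ')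
      (fun x hx => (hder x).hasDerivWithinAt) hbd (left_mem_segment ℝ y z) (right_mem_segment ℝ y z)
    refine this.trans (le_of_eq ?_)
    rw [Real.norm_eq_abs]; ring

end BHT
end

section
open MeasureTheory Filter Set
open scoped ENNReal ComplexConjugate
namespace BHT

/-! ### Discretization -/

lemma FI.refl_shift {φ a : ℝ → ℂ} (h : FI φ a) (κ : ℝ) :
    FI (fun x => φ (κ - x)) (fun ξ => a (-ξ) * ee (-(ξ * κ))) where
  c1 := h.c1.comp (by fun_prop)
  c2 := (h.c2.comp (by fun_prop)).mul (ee_cont.comp (by fun_prop))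
  i1 := h.i1.comp_sub_left κ
  i2 := int_mul_ee (l := fun ξ => -(ξ * κ)) h.i2.comp_neg (by fun_prop)
  inv := by
    intro y
    rw [h.inv, ← integral_neg_eq_self]
    congr 1; ext ξ
    rw [mul_assoc, ← ee_add]; congr 2; ring
  ft := by
    intro ξ
    have := integral_sub_left_eq_self (fun z => φ z * ee (-(ξ * (κ - z)))) volume κ
    simp only [sub_sub_cancel] at this
    rw [this, h.ft, ← integral_mul_const]
    congr 1; ext z
    rw [mul_assoc, ← ee_add]; congr 2; ring

lemma FI.scale {f fh : ℝ → ℂ} (h : FI f fh) {s : ℝ} (hs : 0 < s) :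
    FI (fun x => f (s * x)) (fun ξ => ((s⁻¹:ℝ):ℂ) * fh (s⁻¹ * ξ)) where
  c1 := h.c1.comp (by fun_prop)
  c2 := continuous_const.mul (h.c2.comp (by fun_prop))
  i1 := h.i1.comp_mul_left' hs.ne'
  i2 := (h.i2.comp_mul_left' (inv_ne_zero hs.ne')).const_mul _
  inv := by
    intro y
    have := Measure.integral_comp_mul_left (fun ξ => ((s⁻¹:ℝ):ℂ) * fh ξ * ee (s * ξ * y)) s⁻¹
    simp only [mul_inv_cancel_left₀ hs.ne'] at this
    rw [this, h.inv, abs_of_pos (by positivity), inv_inv, ← integral_smul]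
    congr 1; ext ξ
    rw [show ξ * (s * y) = s * ξ * y by ring, Complex.real_smul]
    have : (s:ℂ) ≠ 0 := by exact_mod_cast hs.ne'
    push_cast; field_simp
  ft := by
    intro ξ
    have := Measure.integral_comp_mul_left (fun z => f z * ee (-(ξ * (s⁻¹ * z)))) s
    simp only [inv_mul_cancel_left₀ hs.ne'] at this
    rw [this, h.ft, abs_of_pos (by positivity), Complex.real_smul]
    congr 2; ext z; congr 3; ring

lemma shift_Pk {φ φ' a : ℝ → ℂ} (h : FI φ a) (hd : ∀ x, HasDerivAt φ (φ' x) x) {D : ℝ} {N : ℕ} (hD : 0 < D)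
    (b1 : ∀ x, ‖φ x‖ ≤ D * ((1 + |x|) ^ (N+10))⁻¹) (b2 : ∀ x, ‖φ' x‖ ≤ D * ((1 + |x|) ^ (N+10))⁻¹)
    {w : ℝ} (hw : w ≠ 0) (hw2 : |w| ≤ 2) (hsupp : ∀ x, |w|/16 < |x| → a x = 0) {σ τ c : ℝ} (hσ : 0 < σ)
    {κ v : ℝ} (hκ : |κ| ≤ 1 + |v|) :
    Pk σ τ c N (2^15 * (D * (2 + |v|)^(N+10))) (pkt (fun x => φ (κ - x)) w σ τ c) := by
  have key : ∀ x, D * ((1 + |κ - x|) ^ (N+10))⁻¹ ≤ D * (2 + |v|)^(N+10) * ((1 + |x|) ^ (N+10))⁻¹ := by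
    intro x
    rw [mul_assoc]
    refine mul_le_mul_of_nonneg_left ?_ hD.le
    rw [← div_eq_mul_inv, ← div_pow, ← inv_pow]
    refine pow_le_pow_left₀ (by positivity) ?_ _
    rw [inv_eq_one_div, div_le_div_iff₀ (by positivity) (by positivity)]
    have : |x| ≤ |κ| + |κ - x| := by
      have := abs_sub κ (κ - x); simpa using this
    nlinarith [abs_nonneg v, abs_nonneg (κ - x)]
  refine pkt_Pk (Φ' := fun x => - φ' (κ - x)) (h.refl_shift κ) ?_ (by positivity) (fun x => (b1 _).trans (key x))
    (fun x => by rw [norm_neg]; exact (b2 _).trans (key x)) hw hw2 ?_ hσ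
  · intro x
    have := (hd (κ - x)).scomp x ((hasDerivAt_id x).const_sub κ)
    simpa [Function.comp_def] using this
  · intro x hx
    rw [hsupp _ (by simpa using hx), zero_mul]

lemma FL_cf {φ f : ℝ → ℂ} {σ : ℝ} (hσ : 0 < σ) (τ w c κ : ℝ) (P : Tile) :
    ‖FL φ (fun z => f (sc σ P * z)) (-(w * (P.m + τ + c))) (P.n + κ)‖ = cf (pkt (fun x => φ (κ - x)) w σ τ c) f P := by
  have hs := sc_pos hσ P
  unfold FL cf pkt th lf
  set s := sc σ P
  have := Measure.integral_comp_mul_left (fun z => f z * (φ (P.n + κ - s⁻¹ * z) * ee (-(w * (P.m + τ + c)) * (P.n + κ - s⁻¹ * z)))) s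
  simp only [inv_mul_cancel_left₀ hs.ne'] at this
  rw [this, abs_of_pos (by positivity), ← integral_smul]
  rw [show ‖∫ z, f z * (((s⁻¹:ℝ):ℂ) * φ (κ - (z - P.n * s) / s) * ee (w * ((P.m + τ + c)/s) * z))‖ =
    ‖ee (-(w * (P.m + τ + c)) * (P.n + κ)) * ∫ z, f z * (((s⁻¹:ℝ):ℂ) * φ (κ - (z - P.n * s) / s) * ee (w * ((P.m + τ + c)/s) * z))‖
    by rw [norm_mul, norm_ee, one_mul]]
  rw [← integral_const_mul]
  congr 2; ext z
  rw [show κ - (z - P.n * s) / s = P.n + κ - s⁻¹ * z by field_simp; ring,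
    show -(w * (P.m + τ + c)) * (P.n + κ - s⁻¹ * z) = -(w * (P.m + τ + c)) * (P.n + κ) + w * ((P.m + τ + c)/s) * z by field_simp; ring,
    ee_add, Complex.real_smul]
  ring

lemma tsum_lintegral_le {α ι : Type*} [MeasurableSpace α] (μ : Measure α) (f : ι → α → ℝ≥0∞) :
    ∑' i, ∫⁻ x, f i x ∂μ ≤ ∫⁻ x, ∑' i, f i x ∂μ := by
  classical
  rw [ENNReal.tsum_eq_iSup_sum]
  refine iSup_le fun s => ?_
  have : ∑ i ∈ s, ∫⁻ x, f i x ∂μ ≤ ∫⁻ x, ∑ i ∈ s, f i x ∂μ := by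
    induction s using Finset.induction_on with
    | empty => simp
    | insert a s ha ih =>
      simp only [Finset.sum_insert ha]
      exact (add_le_add le_rfl ih).trans (le_lintegral_add _ _)
  exact this.trans (lintegral_mono fun x => ENNReal.sum_le_tsum s)

lemma lintegral_le_tsum_unit (E : ℝ → ℝ≥0∞) :
    ∫⁻ x, E x ≤ ∑' n : ℤ, ∫⁻ τ in Ico (0:ℝ) 1, E (n + τ) := by
  rw [← setLIntegral_univ, ← iUnion_Ico_intCast ℝ]
  refine (lintegral_iUnion_le _ _).trans (ENNReal.tsum_le_tsum fun n => ?_)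
  have := (measurePreserving_add_left volume (n:ℝ)).setLIntegral_comp_preimage_emb
    (measurableEmbedding_addLeft (n:ℝ)) E (Ico (n:ℝ) (n+1))
  rw [← this]
  have e : (fun x : ℝ => (n:ℝ) + x) ⁻¹' Ico (n:ℝ) (n+1) = Ico 0 1 := by
    ext x; simp
  rw [e]

lemma lintegral_le_tsum_scale (E : ℝ → ℝ≥0∞) :
    ∫⁻ s in Ioi (0:ℝ), E s ≤ ∑' k : ℤ, ∫⁻ σ in Ico (1:ℝ) 32, ENNReal.ofReal ((32:ℝ)^k) * E (σ * (32:ℝ)^k) := by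
  have hsub : Ioi (0:ℝ) ⊆ ⋃ k : ℤ, (fun σ => σ * (32:ℝ)^k) '' Ico (1:ℝ) 32 := by
    intro s hs
    obtain ⟨k, hk⟩ := exists_mem_Ico_zpow (x := s) (y := (32:ℝ)) hs (by norm_num)
    refine mem_iUnion.2 ⟨k, s / (32:ℝ)^k, ?_, ?_⟩
    · have : (0:ℝ) < (32:ℝ)^k := by positivity
      constructor
      · rw [le_div_iff₀ this]; linarith [hk.1]
      · rw [div_lt_iff₀ this]
        have := hk.2; rw [zpow_add₀ (by norm_num)] at this; linarith
    · have : (32:ℝ)^k ≠ 0 := by positivity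
      field_simp
  refine (lintegral_mono_set hsub).trans ((lintegral_iUnion_le _ _).trans (ENNReal.tsum_le_tsum fun k => ?_))
  have h0 : (0:ℝ) < (32:ℝ)^k := by positivity
  rw [lintegral_image_eq_lintegral_abs_deriv_mul (f' := fun _ => (32:ℝ)^k) measurableSet_Ico]
  · rw [abs_of_pos h0]
  · intro x _
    simpa using ((hasDerivAt_id x).mul_const ((32:ℝ)^k)).hasDerivWithinAt
  · intro x _ y _ hxy
    exact mul_right_cancel₀ h0.ne' hxy

end BHT
end

section
open MeasureTheory Filter Set
open scoped ENNReal ComplexConjugate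
namespace BHT

noncomputable def Lam (ψ f g h : ℝ → ℂ) (s : ℝ) : ℂ :=
  ∫ z : ℝ × ℝ, f (z.1 - z.2) * g (z.1 + z.2) * (((s⁻¹:ℝ):ℂ) * ψ (s⁻¹ * z.2)) * h z.1

lemma Lam_scale (ψ f g h : ℝ → ℂ) {s : ℝ} (hs : 0 < s) :
    Lam ψ f g h s = (s:ℂ) * ∫ z : ℝ × ℝ, f (s * (z.1 - z.2)) * g (s * (z.1 + z.2)) * ψ z.2 * h (s * z.1) := by
  have := Measure.integral_comp_smul (volume : Measure (ℝ × ℝ))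
    (fun z : ℝ × ℝ => f (z.1 - z.2) * g (z.1 + z.2) * (((s⁻¹:ℝ):ℂ) * ψ (s⁻¹ * z.2)) * h z.1) s
  simp only [Prod.smul_fst, Prod.smul_snd, smul_eq_mul, inv_mul_cancel_left₀ hs.ne', Module.finrank_prod,
    Module.finrank_self] at this
  rw [abs_of_pos (by positivity)] at this
  have h2 : Lam ψ f g h s = ((s^2:ℝ)) • ∫ z : ℝ × ℝ, f (s * z.1 - s * z.2) * g (s * z.1 + s * z.2) * (((s⁻¹:ℝ):ℂ) * ψ z.2) * h (s * z.1) := by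
    rw [this, smul_smul, show s^2 * (s^(1+1))⁻¹ = 1 by field_simp, one_smul]; rfl
  rw [h2, ← integral_smul, ← integral_const_mul]
  congr 1; ext z
  rw [Complex.real_smul, mul_sub, mul_add]
  have : (s:ℂ) ≠ 0 := by exact_mod_cast hs.ne'
  push_cast; field_simp

structure Reg (N : ℕ) (D : ℝ) (φ φ' : ℝ → ℂ) : Prop where
  d : ∀ x, HasDerivAt φ (φ' x) x
  b1 : ∀ x, ‖φ x‖ ≤ D * ((1 + |x|) ^ (N+10))⁻¹
  b2 : ∀ x, ‖φ' x‖ ≤ D * ((1 + |x|) ^ (N+10))⁻¹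

lemma unit_le {φ a ρ b ζ d ψ p : ℝ → ℂ} (D : Dat φ a ρ b ζ d ψ p) {f fh g gh h : ℝ → ℂ} (hf : FI f fh) (hg : FI g gh)
    (hh : Integrable h) :
    ‖∫ x, a x‖ₑ * ‖∫ z : ℝ × ℝ, f (z.1 - z.2) * g (z.1 + z.2) * ψ z.2 * h z.1‖ₑ ≤
      ∫⁻ τ in Ico (0:ℝ) 1, ∫⁻ α in Ico (0:ℝ) 1, ∫⁻ v, ∑' m : ℤ, ∑' n : ℤ,
        ‖FL φ f (m + τ) (n + α - v) * FL ρ g (m + τ - 1) (n + α + v) * ψ v * FL ζ h (-(2*(m + τ)-1)) (n + α)‖ₑ := by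
  rw [← enorm_mul, unit_id D hf hg hh]
  calc _ ≤ ∫⁻ u, ∫⁻ x, ∫⁻ v, ‖FL φ f u (x - v) * FL ρ g (u - 1) (x + v) * ψ v * FL ζ h (-(2*u-1)) x‖ₑ := by
        refine (enorm_integral_le_lintegral_enorm _).trans (lintegral_mono fun u => ?_)
        refine (enorm_integral_le_lintegral_enorm _).trans ?_
        rw [Measure.volume_eq_prod]
        exact lintegral_prod_le _
    _ ≤ ∑' m : ℤ, ∫⁻ τ in Ico (0:ℝ) 1, ∫⁻ x, ∫⁻ v, ‖FL φ f (m+τ) (x - v) * FL ρ g (m+τ - 1) (x + v) * ψ v * FL ζ h (-(2*(m+τ)-1)) x‖ₑ :=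
        lintegral_le_tsum_unit _
    _ ≤ ∑' m : ℤ, ∫⁻ τ in Ico (0:ℝ) 1, ∑' n : ℤ, ∫⁻ α in Ico (0:ℝ) 1, ∫⁻ v,
          ‖FL φ f (m+τ) (n + α - v) * FL ρ g (m+τ - 1) (n + α + v) * ψ v * FL ζ h (-(2*(m+τ)-1)) (n + α)‖ₑ := by
        refine ENNReal.tsum_le_tsum fun m => lintegral_mono fun τ => ?_
        exact lintegral_le_tsum_unit (fun x => ∫⁻ v, ‖FL φ f (m+τ) (x - v) * FL ρ g (m+τ - 1) (x + v) * ψ v * FL ζ h (-(2*(m+τ)-1)) x‖ₑ)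
    _ ≤ ∑' m : ℤ, ∫⁻ τ in Ico (0:ℝ) 1, ∫⁻ α in Ico (0:ℝ) 1, ∫⁻ v, ∑' n : ℤ,
          ‖FL φ f (m+τ) (n + α - v) * FL ρ g (m+τ - 1) (n + α + v) * ψ v * FL ζ h (-(2*(m+τ)-1)) (n + α)‖ₑ := by
        refine ENNReal.tsum_le_tsum fun m => lintegral_mono fun τ => ?_
        refine (tsum_lintegral_le _ _).trans (lintegral_mono fun α => ?_)
        exact tsum_lintegral_le _ _
    _ ≤ _ := by
        refine (tsum_lintegral_le _ _).trans (lintegral_mono fun τ => ?_)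
        refine (tsum_lintegral_le _ _).trans (lintegral_mono fun α => ?_)
        exact tsum_lintegral_le _ _

/-- the hypothesis on model sums -/
def ModHyp (N : ℕ) (f g h : ℝ → ℂ) (R : ℝ≥0∞) : Prop :=
  ∀ (σ τ A : ℝ) (φ0 φ1 φ2 : Tile → ℝ → ℂ) (𝔓 : Finset Tile), 0 < σ → 0 < A →
    Pk σ τ 0 N A φ0 → Pk σ τ (-1) N A φ1 → Pk σ τ (-1/2) N A φ2 →
    ENNReal.ofReal (∑ P ∈ 𝔓, sc σ P * (cf φ0 f P * cf φ1 g P * cf φ2 h P)) ≤ ENNReal.ofReal (A^3) * R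

def tileE : ℤ × ℤ × ℤ ≃ Tile where
  toFun x := ⟨x.1, x.2.1, x.2.2⟩
  invFun P := (P.k, P.m, P.n)
  left_inv _ := rfl
  right_inv _ := rfl

theorem model_bd {φ a ρ b ζ d ψ p φ' ρ' ζ' : ℝ → ℂ} (D : Dat φ a ρ b ζ d ψ p) {N : ℕ} {B : ℝ} (hB : 0 < B)
    (rφ : Reg N B φ φ') (rρ : Reg N B ρ ρ') (rζ : Reg N B ζ ζ')
    {f fh g gh h : ℝ → ℂ} (hf : FI f fh) (hg : FI g gh) (hh : Integrable h) {R : ℝ≥0∞} (hR : ModHyp N f g h R) :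
    ‖∫ x, a x‖ₑ * ∫⁻ s in Ioi (0:ℝ), ‖Lam ψ f g h s‖ₑ * ENNReal.ofReal s⁻¹ ≤
      31 * (∫⁻ v, ‖ψ v‖ₑ * (ENNReal.ofReal ((2^15 * (B * (2 + |v|)^(N+10)))^3) * R)) := by
  have point : ∀ σ : ℝ, 1 ≤ σ → ∀ τ α : ℝ, α ∈ Ico (0:ℝ) 1 → ∀ v : ℝ,
      ∑' k : ℤ, ∑' m : ℤ, ∑' n : ℤ, ENNReal.ofReal ((32:ℝ)^k) *
        ‖FL φ (fun x => f (σ*(32:ℝ)^k*x)) (m + τ) (n + α - v) * FL ρ (fun x => g (σ*(32:ℝ)^k*x)) (m + τ - 1) (n + α + v) * ψ v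
          * FL ζ (fun x => h (σ*(32:ℝ)^k*x)) (-(2*(m + τ)-1)) (n + α)‖ₑ ≤
      ‖ψ v‖ₑ * (ENNReal.ofReal ((2^15 * (B * (2 + |v|)^(N+10)))^3) * R) := by
    intro σ hσ1 τ α hα v
    have hσ : 0 < σ := by linarith
    set P0 := pkt (fun x => φ ((α - v) - x)) (-1) σ τ 0
    set P1 := pkt (fun x => ρ ((α + v) - x)) (-1) σ τ (-1)
    set P2 := pkt (fun x => ζ (α - x)) 2 σ τ (-1/2)
    have hab : |α| ≤ 1 := by rw [abs_of_nonneg hα.1]; exact hα.2.le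
    have p0 : Pk σ τ 0 N (2^15 * (B * (2 + |v|)^(N+10))) P0 :=
      shift_Pk D.ha rφ.d hB rφ.b1 rφ.b2 (by norm_num) (by norm_num)
        (fun x hx => D.sa x (lt_of_le_of_lt (by norm_num) hx)) hσ ((abs_sub _ _).trans (by linarith))
    have p1 : Pk σ τ (-1) N (2^15 * (B * (2 + |v|)^(N+10))) P1 :=
      shift_Pk D.hb rρ.d hB rρ.b1 rρ.b2 (by norm_num) (by norm_num)
        (fun x hx => D.sb x (lt_of_le_of_lt (by norm_num) hx)) hσ ((abs_add_le _ _).trans (by linarith))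
    have p2 : Pk σ τ (-1/2) N (2^15 * (B * (2 + |v|)^(N+10))) P2 :=
      shift_Pk D.hd rζ.d hB rζ.b1 rζ.b2 (by norm_num) (by norm_num)
        (fun x hx => D.sd x (lt_of_le_of_lt (by norm_num) hx)) hσ (by linarith [abs_nonneg v])
    have tl : ∀ P : Tile, ENNReal.ofReal ((32:ℝ)^P.k) *
        ‖FL φ (fun x => f (σ*(32:ℝ)^P.k*x)) (P.m + τ) (P.n + α - v) * FL ρ (fun x => g (σ*(32:ℝ)^P.k*x)) (P.m + τ - 1) (P.n + α + v) * ψ v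
          * FL ζ (fun x => h (σ*(32:ℝ)^P.k*x)) (-(2*(P.m + τ)-1)) (P.n + α)‖ₑ ≤
        ‖ψ v‖ₑ * ENNReal.ofReal (sc σ P * (cf P0 f P * cf P1 g P * cf P2 h P)) := by
      intro P
      have e0 := FL_cf (φ := φ) (f := f) hσ τ (-1) 0 (α - v) P
      have e1 := FL_cf (φ := ρ) (f := g) hσ τ (-1) (-1) (α + v) P
      have e2 := FL_cf (φ := ζ) (f := h) hσ τ 2 (-1/2) α P
      rw [show -(-1 * ((P.m:ℝ) + τ + 0)) = P.m + τ by ring, show (P.n:ℝ) + (α - v) = P.n + α - v by ring] at e0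
      rw [show -(-1 * ((P.m:ℝ) + τ + -1)) = P.m + τ - 1 by ring, show (P.n:ℝ) + (α + v) = P.n + α + v by ring] at e1
      rw [show -(2 * ((P.m:ℝ) + τ + -1/2)) = -(2*(P.m + τ) - 1) by ring] at e2
      unfold sc at e0 e1 e2
      rw [← ofReal_norm_eq_enorm, ← ofReal_norm_eq_enorm (ψ v), ← ENNReal.ofReal_mul (by positivity),
        ← ENNReal.ofReal_mul (by positivity), norm_mul, norm_mul, norm_mul, e0, e1, e2]
      refine ENNReal.ofReal_le_ofReal ?_
      have c0 := cf_nonneg P0 f P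
      have c1 := cf_nonneg P1 g P
      have c2 := cf_nonneg P2 h P
      calc _ = (32:ℝ)^P.k * (‖ψ v‖ * (cf P0 f P * cf P1 g P * cf P2 h P)) := by ring
        _ ≤ sc σ P * (‖ψ v‖ * (cf P0 f P * cf P1 g P * cf P2 h P)) := by
            refine mul_le_mul_of_nonneg_right ?_ (by positivity)
            unfold sc
            have : (0:ℝ) < (32:ℝ)^P.k := by positivity
            nlinarith
        _ = _ := by ring
    set X : Tile → ℝ≥0∞ := fun P => ENNReal.ofReal ((32:ℝ)^P.k) *
        ‖FL φ (fun x => f (σ*(32:ℝ)^P.k*x)) (P.m + τ) (P.n + α - v) * FL ρ (fun x => g (σ*(32:ℝ)^P.k*x)) (P.m + τ - 1) (P.n + α + v) * ψ v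
          * FL ζ (fun x => h (σ*(32:ℝ)^P.k*x)) (-(2*(P.m + τ)-1)) (P.n + α)‖ₑ with hX
    have e : ∑' k : ℤ, ∑' m : ℤ, ∑' n : ℤ, X ⟨k, m, n⟩ = ∑' P, X P := by
      rw [← tileE.tsum_eq X, ENNReal.tsum_prod']
      congr 1; ext k
      rw [ENNReal.tsum_prod']; rfl
    calc _ = ∑' P, X P := e
      _ ≤ ∑' P, ‖ψ v‖ₑ * ENNReal.ofReal (sc σ P * (cf P0 f P * cf P1 g P * cf P2 h P)) := ENNReal.tsum_le_tsum tl
      _ = ‖ψ v‖ₑ * ∑' P, ENNReal.ofReal (sc σ P * (cf P0 f P * cf P1 g P * cf P2 h P)) := ENNReal.tsum_mul_left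
      _ ≤ _ := by
        refine mul_le_mul' le_rfl ?_
        rw [ENNReal.tsum_eq_iSup_sum]
        refine iSup_le fun 𝔓 => ?_
        rw [← ENNReal.ofReal_sum_of_nonneg]
        · exact hR σ τ _ P0 P1 P2 𝔓 hσ (by positivity) p0 p1 p2
        · intro P _
          have c0 := cf_nonneg P0 f P
          have c1 := cf_nonneg P1 g P
          have c2 := cf_nonneg P2 h P
          have := sc_pos hσ P
          positivity
  set KK := ∫⁻ v, ‖ψ v‖ₑ * (ENNReal.ofReal ((2^15 * (B * (2 + |v|)^(N+10)))^3) * R) with hKK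
  set Y : ℝ → ℤ → ℝ → ℝ → ℝ → ℝ≥0∞ := fun σ k τ α v => ∑' m : ℤ, ∑' n : ℤ, ENNReal.ofReal ((32:ℝ)^k) *
        ‖FL φ (fun x => f (σ*(32:ℝ)^k*x)) (m + τ) (n + α - v) * FL ρ (fun x => g (σ*(32:ℝ)^k*x)) (m + τ - 1) (n + α + v) * ψ v
          * FL ζ (fun x => h (σ*(32:ℝ)^k*x)) (-(2*(m + τ)-1)) (n + α)‖ₑ with hY
  calc _ ≤ ∫⁻ s in Ioi (0:ℝ), ‖∫ x, a x‖ₑ * (‖Lam ψ f g h s‖ₑ * ENNReal.ofReal s⁻¹) := lintegral_const_mul_le _ _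
    _ ≤ ∑' k : ℤ, ∫⁻ σ in Ico (1:ℝ) 32, ENNReal.ofReal ((32:ℝ)^k) * (‖∫ x, a x‖ₑ * (‖Lam ψ f g h (σ * (32:ℝ)^k)‖ₑ *
          ENNReal.ofReal (σ * (32:ℝ)^k)⁻¹)) := lintegral_le_tsum_scale _
    _ ≤ ∑' k : ℤ, ∫⁻ σ in Ico (1:ℝ) 32, ∫⁻ τ in Ico (0:ℝ) 1, ∫⁻ α in Ico (0:ℝ) 1, ∫⁻ v, Y σ k τ α v := by
        refine ENNReal.tsum_le_tsum fun k => setLIntegral_mono' measurableSet_Ico fun σ hσ => ?_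
        have hs : 0 < σ * (32:ℝ)^k := by have := hσ.1; positivity
        rw [Lam_scale _ _ _ _ hs, enorm_mul]
        have e : ‖((σ * (32:ℝ)^k : ℝ):ℂ)‖ₑ * ENNReal.ofReal (σ * (32:ℝ)^k)⁻¹ = 1 := by
          rw [← ofReal_norm_eq_enorm, ← ENNReal.ofReal_mul (by positivity), Complex.norm_real, Real.norm_of_nonneg hs.le,
            mul_inv_cancel₀ hs.ne', ENNReal.ofReal_one]
        rw [mul_right_comm, e, one_mul]
        refine (mul_le_mul' le_rfl (unit_le D (hf.scale hs) (hg.scale hs) (hh.comp_mul_left' hs.ne'))).trans ?_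
        refine (lintegral_const_mul_le _ _).trans (lintegral_mono fun τ => ?_)
        refine (lintegral_const_mul_le _ _).trans (lintegral_mono fun α => ?_)
        refine (lintegral_const_mul_le _ _).trans (lintegral_mono fun v => ?_)
        simp only [hY, ENNReal.tsum_mul_left]
        exact le_rfl
    _ ≤ ∫⁻ σ in Ico (1:ℝ) 32, ∫⁻ τ in Ico (0:ℝ) 1, ∫⁻ α in Ico (0:ℝ) 1, ∫⁻ v, ∑' k : ℤ, Y σ k τ α v := by
        refine (tsum_lintegral_le _ _).trans (lintegral_mono fun σ => ?_)
        refine (tsum_lintegral_le _ _).trans (lintegral_mono fun τ => ?_)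
        refine (tsum_lintegral_le _ _).trans (lintegral_mono fun α => ?_)
        exact tsum_lintegral_le _ _
    _ ≤ ∫⁻ σ in Ico (1:ℝ) 32, ∫⁻ τ in Ico (0:ℝ) 1, ∫⁻ α in Ico (0:ℝ) 1, KK := by
        refine setLIntegral_mono' measurableSet_Ico fun σ hσ => lintegral_mono fun τ =>
          setLIntegral_mono' measurableSet_Ico fun α hα => lintegral_mono fun v => ?_
        exact point σ hσ.1 τ α hα v
    _ = 31 * KK := by
        simp only [lintegral_const, Measure.restrict_apply_univ, Real.volume_Ico]
        norm_num
        rw [mul_comm]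

end BHT
end

section
open MeasureTheory Filter Set
open scoped ENNReal ComplexConjugate Topology
namespace BHT

/-! ### The bilinear Hilbert transform -/

structure Nice (M : ℝ) (f : ℝ → ℂ) : Prop where
  c : Continuous f
  b : ∀ x, ‖f x‖ ≤ M
  q : ∀ x, x^2 * ‖f x‖ ≤ M
  l : ∀ x y, ‖f x - f y‖ ≤ M * |x - y|

noncomputable def dd (f g : ℝ → ℂ) (x t : ℝ) : ℂ := f (x - t) * g (x + t) - g (x - t) * f (x + t)

lemma dd_neg (f g : ℝ → ℂ) (x t : ℝ) : dd f g x (-t) = - dd f g x t := by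
  unfold dd; simp only [sub_neg_eq_add, ← sub_eq_add_neg]; ring

lemma dd_cont {M : ℝ} {f g : ℝ → ℂ} (hf : Nice M f) (hg : Nice M g) : Continuous (fun z : ℝ × ℝ => dd f g z.1 z.2) := by
  have := hf.c; have := hg.c
  unfold dd; fun_prop

lemma prod_q {M : ℝ} (hM : 0 < M) {f g : ℝ → ℂ} (hf : Nice M f) (hg : Nice M g) (x t : ℝ) :
    t^2 * ‖f (x - t) * g (x + t)‖ ≤ M^2 := by
  rw [norm_mul]
  have a0 := norm_nonneg (f (x-t)); have b0 := norm_nonneg (g (x+t))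
  have a1 := hf.b (x-t); have b1 := hg.b (x+t)
  have a2 := hf.q (x-t); have b2 := hg.q (x+t)
  rcases le_total 0 (x*t) with h | h
  · have : t^2 ≤ (x+t)^2 := by nlinarith [sq_nonneg x]
    have : t^2 * ‖g (x+t)‖ ≤ M := (mul_le_mul_of_nonneg_right this b0).trans b2
    nlinarith
  · have : t^2 ≤ (x-t)^2 := by nlinarith [sq_nonneg x]
    have : t^2 * ‖f (x-t)‖ ≤ M := (mul_le_mul_of_nonneg_right this a0).trans a2
    nlinarith

lemma dd_bd {M : ℝ} (hM : 0 < M) {f g : ℝ → ℂ} (hf : Nice M f) (hg : Nice M g) (x t : ℝ) :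
    ‖dd f g x t‖ ≤ 8 * M^2 * (|t| * (1 + t^2)⁻¹) := by
  have h1 : ‖dd f g x t‖ ≤ 4 * M^2 * |t| := by
    have e : dd f g x t = (f (x-t) - f (x+t)) * g (x+t) + f (x+t) * (g (x+t) - g (x-t)) := by unfold dd; ring
    rw [e]
    refine (norm_add_le _ _).trans ?_
    rw [norm_mul, norm_mul]
    have l1 := hf.l (x-t) (x+t)
    have l2 := hg.l (x+t) (x-t)
    rw [show x - t - (x+t) = -(2*t) by ring, abs_neg, abs_mul, abs_two] at l1
    rw [show x + t - (x-t) = (2*t) by ring, abs_mul, abs_two] at l2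
    have := mul_le_mul l1 (hg.b (x+t)) (norm_nonneg _) (by positivity)
    have := mul_le_mul (hf.b (x+t)) l2 (norm_nonneg _) (by positivity)
    nlinarith
  have h2 : t^2 * ‖dd f g x t‖ ≤ 2 * M^2 := by
    have a := prod_q hM hf hg x t
    have b := prod_q hM hg hf x t
    have c : ‖dd f g x t‖ ≤ ‖f (x-t) * g (x+t)‖ + ‖g (x-t) * f (x+t)‖ := norm_sub_le _ _
    nlinarith [sq_nonneg t]
  rw [← mul_assoc, ← div_eq_mul_inv, le_div_iff₀ (by positivity)]
  have h0 := norm_nonneg (dd f g x t)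
  have ht := abs_nonneg t
  rcases le_total |t| 1 with h | h
  · have : t^2 ≤ 1 := by rw [← sq_abs]; nlinarith
    nlinarith [sq_nonneg M]
  · have : 1 ≤ t^2 := by rw [← sq_abs]; nlinarith
    have : 0 < M^2 := by positivity
    nlinarith

noncomputable def hil (f g : ℝ → ℂ) (x : ℝ) : ℂ := ∫ t in Ioi (0:ℝ), dd f g x t * (1/(t:ℂ))

lemma dd_bd' {M : ℝ} (hM : 0 < M) {f g : ℝ → ℂ} (hf : Nice M f) (hg : Nice M g) (x t : ℝ) :
    ‖dd f g x t * (1/(t:ℂ))‖ ≤ 8 * M^2 * (1 + t^2)⁻¹ := by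
  rcases eq_or_ne t 0 with rfl | ht
  · simp; positivity
  rw [norm_mul, norm_div, norm_one, Complex.norm_real, Real.norm_eq_abs]
  have ht' : 0 < |t| := abs_pos.2 ht
  calc _ ≤ 8 * M^2 * (|t| * (1 + t^2)⁻¹) * (1 / |t|) := by gcongr; exact dd_bd hM hf hg x t
    _ = _ := by field_simp

lemma ddt_meas {M : ℝ} {f g : ℝ → ℂ} (hf : Nice M f) (hg : Nice M g) (x : ℝ) :
    Measurable (fun t : ℝ => dd f g x t * (1/(t:ℂ))) := by
  have := (dd_cont hf hg).comp (Continuous.prodMk_right x)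
  have h2 : Measurable (fun t : ℝ => dd f g x t) := this.measurable
  fun_prop

lemma ddt_int {M : ℝ} (hM : 0 < M) {f g : ℝ → ℂ} (hf : Nice M f) (hg : Nice M g) (x : ℝ) :
    Integrable (fun t : ℝ => dd f g x t * (1/(t:ℂ))) :=
  Integrable.mono' (integrable_inv_one_add_sq.const_mul (8*M^2)) (ddt_meas hf hg x).aestronglyMeasurable
    (Eventually.of_forall fun t => dd_bd' hM hf hg x t)

lemma hil_cont {M : ℝ} (hM : 0 < M) {f g : ℝ → ℂ} (hf : Nice M f) (hg : Nice M g) : Continuous (hil f g) := by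
  unfold hil
  refine continuous_of_dominated (bound := fun t => 8*M^2*(1+t^2)⁻¹) (fun x => (ddt_meas hf hg x).aestronglyMeasurable)
    (fun x => Eventually.of_forall fun t => dd_bd' hM hf hg x t) (integrable_inv_one_add_sq.const_mul (8*M^2)).integrableOn ?_
  refine Eventually.of_forall fun t => ?_
  have := (dd_cont hf hg).comp (Continuous.prodMk_left t)
  exact Continuous.mul this continuous_const

lemma hil_bdd {M : ℝ} (hM : 0 < M) {f g : ℝ → ℂ} (hf : Nice M f) (hg : Nice M g) : ∃ B, ∀ x, ‖hil f g x‖ ≤ B := by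
  refine ⟨∫ t in Ioi (0:ℝ), 8*M^2*(1+t^2)⁻¹, fun x => ?_⟩
  exact norm_integral_le_of_norm_le (integrable_inv_one_add_sq.const_mul (8*M^2)).integrableOn
    (Eventually.of_forall fun t => dd_bd' hM hf hg x t)

lemma pv_eq {M : ℝ} {f g : ℝ → ℂ} (hf : Nice M f) (hg : Nice M g) (x : ℝ) {δ : ℝ} (hδ : 0 < δ) :
    ∫ t in {t : ℝ | δ < |t| ∧ |t| < 1/δ}, f (x - t) * g (x + t) * (1/(t:ℂ)) =
      ∫ t in Ioo δ (1/δ), dd f g x t * (1/(t:ℂ)) := by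
  set u : ℝ → ℂ := fun t => f (x - t) * g (x + t) * (1/(t:ℂ)) with hu
  have hset : {t : ℝ | δ < |t| ∧ |t| < 1/δ} = Ioo δ (1/δ) ∪ (fun t => -t) ⁻¹' (Ioo δ (1/δ)) := by
    ext t
    simp only [mem_setOf_eq, mem_union, mem_Ioo, mem_preimage]
    constructor
    · rintro ⟨h1, h2⟩
      rcases le_total 0 t with h | h
      · rw [abs_of_nonneg h] at h1 h2; exact Or.inl ⟨h1, h2⟩
      · rw [abs_of_nonpos h] at h1 h2; exact Or.inr ⟨h1, h2⟩
    · rintro (⟨h1, h2⟩ | ⟨h1, h2⟩)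
      · rw [abs_of_pos (by linarith)]; exact ⟨h1, h2⟩
      · rw [abs_of_neg (by linarith)]; exact ⟨h1, h2⟩
  have hcf := hf.c
  have hcg := hg.c
  have i1 : IntegrableOn u (Ioo δ (1/δ)) := by
    refine IntegrableOn.mono_set (t := Icc δ (1/δ)) ?_ Ioo_subset_Icc_self
    refine ContinuousOn.integrableOn_compact isCompact_Icc ?_
    refine ContinuousOn.mul (by fun_prop) (ContinuousOn.div continuousOn_const (by fun_prop) ?_)
    intro t ht
    have : 0 < t := hδ.trans_le ht.1
    exact_mod_cast this.ne'
  have i2 : IntegrableOn (fun t => u (-t)) (Ioo δ (1/δ)) := by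
    refine IntegrableOn.mono_set (t := Icc δ (1/δ)) ?_ Ioo_subset_Icc_self
    refine ContinuousOn.integrableOn_compact isCompact_Icc ?_
    refine ContinuousOn.mul (by fun_prop) (ContinuousOn.div continuousOn_const (by fun_prop) ?_)
    intro t ht
    have : 0 < t := hδ.trans_le ht.1
    exact_mod_cast (neg_ne_zero.2 this.ne')
  have mp := Measure.measurePreserving_neg (volume : Measure ℝ)
  have me : MeasurableEmbedding (fun t : ℝ => -t) := (MeasurableEquiv.neg ℝ).measurableEmbedding
  have i3 : IntegrableOn u ((fun t => -t) ⁻¹' (Ioo δ (1/δ))) := by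
    have := (mp.integrableOn_comp_preimage me (f := fun t => u (-t)) (s := Ioo δ (1/δ))).2 i2
    simpa [Function.comp_def] using this
  have e3 : ∫ t in (fun t => -t) ⁻¹' (Ioo δ (1/δ)), u t = ∫ t in Ioo δ (1/δ), u (-t) := by
    have := mp.setIntegral_preimage_emb me (fun t => u (-t)) (Ioo δ (1/δ))
    simpa using this
  rw [hset, setIntegral_union ?_ (measurableSet_Ioo.preimage measurable_neg) i1 i3, e3, ← integral_add i1 i2]
  · congr 1; ext t
    simp only [hu, dd, sub_neg_eq_add, ← sub_eq_add_neg]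
    push_cast
    rw [one_div_neg_eq_neg_one_div]; ring
  · rw [Set.disjoint_left]
    intro t h1 h2
    simp only [mem_preimage, mem_Ioo] at h1 h2
    linarith

lemma pv_tendsto {M : ℝ} (hM : 0 < M) {f g : ℝ → ℂ} (hf : Nice M f) (hg : Nice M g) (x : ℝ) :
    Tendsto (fun δ : ℝ => ∫ t in {t : ℝ | δ < |t| ∧ |t| < 1/δ}, f (x - t) * g (x + t) * (1/(t:ℂ)))
      (𝓝[>] 0) (𝓝 (hil f g x)) := by
  have h1 : Tendsto (fun δ : ℝ => ∫ t, (Ioo δ (1/δ)).indicator (fun t => dd f g x t * (1/(t:ℂ))) t) (𝓝[>] 0)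
      (𝓝 (∫ t, (Ioi (0:ℝ)).indicator (fun t => dd f g x t * (1/(t:ℂ))) t)) := by
    refine tendsto_integral_filter_of_dominated_convergence (fun t => 8*M^2*(1+t^2)⁻¹) ?_ ?_
      (integrable_inv_one_add_sq.const_mul (8*M^2)) ?_
    · exact Eventually.of_forall fun δ => ((ddt_meas hf hg x).indicator measurableSet_Ioo).aestronglyMeasurable
    · exact Eventually.of_forall fun δ => Eventually.of_forall fun t =>
        (norm_indicator_le_norm_self _ _).trans (dd_bd' hM hf hg x t)
    · refine Eventually.of_forall fun t => ?_
      refine tendsto_const_nhds.congr' ?_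
      rcases le_or_gt t 0 with ht | ht
      · filter_upwards [self_mem_nhdsWithin] with δ hδ
        have hδ : 0 < δ := hδ
        rw [indicator_of_notMem (by simpa using ht), indicator_of_notMem]
        intro h; linarith [h.1]
      · have : Ioo (0:ℝ) (min t (1/t)) ∈ 𝓝[>] (0:ℝ) := Ioo_mem_nhdsGT (by positivity)
        filter_upwards [this] with δ hδ
        rw [indicator_of_mem (by exact ht), indicator_of_mem]
        refine ⟨hδ.2.trans_le (min_le_left _ _), ?_⟩
        have := hδ.2.trans_le (min_le_right _ _)
        rwa [lt_one_div ht hδ.1]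
  rw [integral_indicator measurableSet_Ioi] at h1
  refine h1.congr' ?_
  filter_upwards [self_mem_nhdsWithin] with δ hδ
  rw [integral_indicator measurableSet_Ioo, pv_eq hf hg x hδ]

end BHT
end

section
open MeasureTheory Filter Set
open scoped ENNReal ComplexConjugate Topology
namespace BHT

lemma inv_image {t : ℝ} (ht : 0 < t) : (fun s : ℝ => s⁻¹ * t) '' Ioi 0 = Ioi 0 := by
  ext w
  constructor
  · rintro ⟨s, hs, rfl⟩
    have : 0 < s := hs
    simp only [mem_Ioi]; positivity
  · intro hw
    have : 0 < w := hw
    refine ⟨t / w, by simp only [mem_Ioi]; positivity, ?_⟩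
    simp only []; field_simp

lemma inv_inj {t : ℝ} (ht : 0 < t) : InjOn (fun s : ℝ => s⁻¹ * t) (Ioi 0) := by
  intro x _ y _ h
  exact inv_injective (mul_right_cancel₀ ht.ne' h)

lemma inv_der {t : ℝ} : ∀ s ∈ Ioi (0:ℝ), HasDerivWithinAt (fun s : ℝ => s⁻¹ * t) (-(s^2)⁻¹ * t) (Ioi 0) s := by
  intro s hs
  exact ((hasDerivAt_inv (ne_of_gt hs)).mul_const t).hasDerivWithinAt

lemma psi_s_pos {ψ : ℝ → ℂ} (hψ : Integrable ψ) {t : ℝ} (ht : 0 < t) :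
    IntegrableOn (fun s : ℝ => (((s^2)⁻¹ : ℝ) : ℂ) * ψ (s⁻¹ * t)) (Ioi 0) ∧
    ∫ s in Ioi (0:ℝ), (((s^2)⁻¹ : ℝ) : ℂ) * ψ (s⁻¹ * t) = ((t⁻¹:ℝ):ℂ) * ∫ w in Ioi (0:ℝ), ψ w := by
  have e : ∀ s : ℝ, (((s^2)⁻¹ : ℝ) : ℂ) * ψ (s⁻¹ * t) = ((t⁻¹:ℝ):ℂ) * (|(-(s^2)⁻¹ * t)| • ψ (s⁻¹ * t)) := by
    intro s
    rw [neg_mul, abs_neg, abs_of_nonneg (by positivity), Complex.real_smul, ← mul_assoc, ← Complex.ofReal_mul]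
    congr 2; field_simp
  simp_rw [e]
  constructor
  · refine Integrable.const_mul ?_ _
    have := (integrableOn_image_iff_integrableOn_abs_deriv_smul measurableSet_Ioi inv_der (inv_inj ht) ψ).1
    rw [inv_image ht] at this
    exact this hψ.integrableOn
  · rw [integral_const_mul]
    have := integral_image_eq_integral_abs_deriv_smul measurableSet_Ioi inv_der (inv_inj ht) ψ
    rw [inv_image ht] at this
    rw [this]

lemma psi_s {ψ : ℝ → ℂ} (hψ : Integrable ψ) {t : ℝ} (ht : t ≠ 0) :
    IntegrableOn (fun s : ℝ => (((s^2)⁻¹ : ℝ) : ℂ) * ψ (s⁻¹ * t)) (Ioi 0) ∧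
    ∫ s in Ioi (0:ℝ), (((s^2)⁻¹ : ℝ) : ℂ) * ψ (s⁻¹ * t) = ((|t|⁻¹:ℝ):ℂ) * (if 0 < t then ∫ w in Ioi (0:ℝ), ψ w else
      ∫ w in Ioi (0:ℝ), ψ (-w)) := by
  rcases lt_or_gt_of_ne ht with h | h
  · have := psi_s_pos (hψ.comp_neg) (neg_pos.2 h)
    simp only [mul_neg, neg_neg] at this
    rw [if_neg (by linarith), abs_of_neg h]
    exact this
  · rw [if_pos h, abs_of_pos h]
    exact psi_s_pos hψ h

/-- the kernel -/
noncomputable def JJ (ψ f g h : ℝ → ℂ) (q : (ℝ × ℝ) × ℝ) : ℂ :=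
  (h q.1.1 * dd f g q.1.1 q.1.2) * ((((q.2^2)⁻¹ : ℝ) : ℂ) * ψ (q.2⁻¹ * q.1.2))

lemma JJ_meas {M : ℝ} {ψ f g h : ℝ → ℂ} (hψm : Measurable ψ) (hf : Nice M f) (hg : Nice M g) (hh : Measurable h) :
    Measurable (JJ ψ f g h) := by
  have h1 : Measurable (fun q : (ℝ × ℝ) × ℝ => dd f g q.1.1 q.1.2) := (dd_cont hf hg).measurable.comp measurable_fst
  unfold JJ
  fun_prop

lemma JJ_int {M : ℝ} (hM : 0 < M) {ψ f g h : ℝ → ℂ} (hψ : Integrable ψ) (hψm : Measurable ψ) (hf : Nice M f) (hg : Nice M g)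
    (hh : Measurable h) (hhi : Integrable h) :
    Integrable (JJ ψ f g h) ((volume : Measure (ℝ × ℝ)).prod (volume.restrict (Ioi (0:ℝ)))) := by
  have hm := JJ_meas hψm hf hg hh
  have hae : ∀ᵐ z : ℝ × ℝ, z.2 ≠ 0 := by
    rw [Measure.volume_eq_prod]
    have : ∀ᵐ t : ℝ, t ≠ 0 := by simp [ae_iff]
    exact Measure.quasiMeasurePreserving_snd.ae this
  rw [integrable_prod_iff hm.aestronglyMeasurable]
  constructor
  · filter_upwards [hae] with z hz
    exact ((psi_s hψ hz).1).const_mul (h z.1 * dd f g z.1 z.2)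
  · have hb : Integrable (fun z : ℝ × ℝ => ‖h z.1‖ * (8 * M^2 * (1 + z.2^2)⁻¹ * ∫ w, ‖ψ w‖)) := by
      rw [Measure.volume_eq_prod]
      exact hhi.norm.mul_prod ((integrable_inv_one_add_sq.const_mul (8*M^2)).mul_const _)
    refine hb.mono' (hm.norm.stronglyMeasurable.integral_prod_right).aestronglyMeasurable ?_
    filter_upwards [hae] with z hz
    rw [Real.norm_of_nonneg (integral_nonneg fun _ => norm_nonneg _)]
    have e : ∀ s : ℝ, ‖JJ ψ f g h (z, s)‖ = ‖h z.1‖ * ‖dd f g z.1 z.2‖ * ((s^2)⁻¹ * ‖ψ (s⁻¹ * z.2)‖) := by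
      intro s
      unfold JJ
      rw [norm_mul, norm_mul, norm_mul, Complex.norm_real, Real.norm_of_nonneg (by positivity)]
    have ps := (psi_s (ψ := fun w => ((‖ψ w‖:ℝ):ℂ)) hψ.norm.ofReal hz).2
    have ps2 : ∫ s in Ioi (0:ℝ), (s^2)⁻¹ * ‖ψ (s⁻¹ * z.2)‖ ≤ |z.2|⁻¹ * ∫ w, ‖ψ w‖ := by
      have e2 : ∫ s in Ioi (0:ℝ), (s^2)⁻¹ * ‖ψ (s⁻¹ * z.2)‖ = |z.2|⁻¹ * (if 0 < z.2 then ∫ w in Ioi (0:ℝ), ‖ψ w‖ else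
          ∫ w in Ioi (0:ℝ), ‖ψ (-w)‖) := by
        have : ∀ s : ℝ, (((s^2)⁻¹ : ℝ) : ℂ) * ((‖ψ (s⁻¹ * z.2)‖:ℝ):ℂ) = (((s^2)⁻¹ * ‖ψ (s⁻¹ * z.2)‖ : ℝ):ℂ) := by
          intro s; push_cast; rfl
        simp_rw [this] at ps
        rw [integral_complex_ofReal, integral_complex_ofReal, integral_complex_ofReal] at ps
        split_ifs at ps ⊢ <;> exact_mod_cast ps
      rw [e2]
      refine mul_le_mul_of_nonneg_left ?_ (by positivity)
      split_ifs
      · exact setIntegral_le_integral hψ.norm (Eventually.of_forall fun _ => norm_nonneg _)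
      · refine (setIntegral_le_integral hψ.comp_neg.norm (Eventually.of_forall fun _ => norm_nonneg _)).trans ?_
        rw [integral_neg_eq_self (fun w => ‖ψ w‖)]
    simp_rw [e]
    rw [integral_const_mul, mul_assoc]
    refine mul_le_mul_of_nonneg_left ?_ (norm_nonneg _)
    have hz' : 0 < |z.2| := abs_pos.2 hz
    calc _ ≤ (8 * M^2 * (|z.2| * (1 + z.2^2)⁻¹)) * (|z.2|⁻¹ * ∫ w, ‖ψ w‖) := by
          refine mul_le_mul (dd_bd hM hf hg _ _) ps2 ?_ (by positivity)
          exact integral_nonneg fun s => by positivity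
      _ = _ := by field_simp

lemma bi_int {M : ℝ} {f g h u : ℝ → ℂ} (hf : Nice M f) (hg : Nice M g) (hu : Integrable u) (hh : Integrable h) :
    Integrable (fun z : ℝ × ℝ => f (z.1 - z.2) * g (z.1 + z.2) * u z.2 * h z.1) := by
  have h1 : Integrable (fun z : ℝ × ℝ => h z.1 * u z.2) := by
    rw [Measure.volume_eq_prod]; exact hh.mul_prod hu
  have hcf := hf.c
  have hcg := hg.c
  have h3 : Integrable (fun z : ℝ × ℝ => f (z.1 - z.2) * g (z.1 + z.2) * (h z.1 * u z.2)) := by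
    refine h1.bdd_mul (c := M * M) (by fun_prop) (Eventually.of_forall fun z => ?_)
    rw [norm_mul]
    exact mul_le_mul (hf.b _) (hg.b _) (norm_nonneg _) ((norm_nonneg _).trans (hf.b 0))
  refine h3.congr (Eventually.of_forall fun z => ?_)
  simp only []; ring

theorem hil_pair {M : ℝ} (hM : 0 < M) {ψ f g h : ℝ → ℂ} (hψ : Integrable ψ) (hψm : Measurable ψ) (hf : Nice M f) (hg : Nice M g)
    (hh : Measurable h) (hhi : Integrable h) :
    ((∫ w in Ioi (0:ℝ), ψ w) - ∫ w in Ioi (0:ℝ), ψ (-w)) * ∫ x, hil f g x * h x =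
      ∫ s in Ioi (0:ℝ), ((s⁻¹:ℝ):ℂ) * (Lam ψ f g h s - Lam ψ g f h s) := by
  have hJ := JJ_int hM hψ hψm hf hg hh hhi
  have hsw := integral_integral_swap (f := fun z s => JJ ψ f g h (z, s)) hJ
  have hae : ∀ᵐ z : ℝ × ℝ, z.2 ≠ 0 := by
    rw [Measure.volume_eq_prod]
    have : ∀ᵐ t : ℝ, t ≠ 0 := by simp [ae_iff]
    exact Measure.quasiMeasurePreserving_snd.ae this
  have hR : ∫ s in Ioi (0:ℝ), ∫ z, JJ ψ f g h (z, s) =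
      ∫ s in Ioi (0:ℝ), ((s⁻¹:ℝ):ℂ) * (Lam ψ f g h s - Lam ψ g f h s) := by
    refine setIntegral_congr_fun measurableSet_Ioi fun s hs => ?_
    have hs : 0 < s := hs
    have hu : Integrable (fun t => ((s⁻¹:ℝ):ℂ) * ψ (s⁻¹ * t)) := (hψ.comp_mul_left' (inv_ne_zero hs.ne')).const_mul _
    unfold Lam
    beta_reduce
    rw [← integral_sub (bi_int hf hg hu hhi) (bi_int hg hf hu hhi), ← integral_const_mul]
    congr 1; ext z
    unfold JJ dd
    push_cast
    ring
  rw [← hR, ← hsw]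
  set cp := ∫ w in Ioi (0:ℝ), ψ w
  set cm := ∫ w in Ioi (0:ℝ), ψ (-w)
  set W : ℝ → ℝ → ℂ := fun x t => dd f g x t * (((|t|⁻¹:ℝ):ℂ) * (if 0 < t then cp else cm)) with hW
  have e1 : ∫ z, ∫ s in Ioi (0:ℝ), JJ ψ f g h (z, s) = ∫ z : ℝ × ℝ, h z.1 * W z.1 z.2 := by
    refine integral_congr_ae ?_
    filter_upwards [hae] with z hz
    simp only [JJ]
    rw [integral_const_mul, (psi_s hψ hz).2]; ring
  have i1 : Integrable (fun z : ℝ × ℝ => h z.1 * W z.1 z.2) := by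
    refine hJ.integral_prod_left.congr ?_
    filter_upwards [hae] with z hz
    simp only [JJ]
    rw [integral_const_mul, (psi_s hψ hz).2]; ring
  rw [e1, Measure.volume_eq_prod, integral_prod _ (by rw [← Measure.volume_eq_prod]; exact i1), ← integral_const_mul]
  congr 1; ext x
  simp only []
  rw [integral_const_mul]
  have hi := ddt_int hM hf hg x
  have ew : ∀ t ∈ Ioi (0:ℝ), W x t = dd f g x t * (1/(t:ℂ)) * cp := by
    intro t ht
    have ht : 0 < t := ht
    simp only [hW, if_pos ht, abs_of_pos ht]; push_cast; ring
  have ew2 : ∀ t ∈ Ioi (0:ℝ), W x (-t) = dd f g x t * (1/(t:ℂ)) * (-cm) := by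
    intro t ht
    have ht : 0 < t := ht
    simp only [hW, dd_neg, abs_neg, abs_of_pos ht]
    rw [if_neg (by linarith)]; push_cast; ring
  have iw : Integrable (W x) := by
    have a : IntegrableOn (W x) (Ioi 0) :=
      (integrableOn_congr_fun ew measurableSet_Ioi).2 (hi.mul_const cp).integrableOn
    have b : IntegrableOn (W x) (Iic 0) := by
      have b1 : IntegrableOn (fun t => W x (-t)) (Ioi 0) :=
        (integrableOn_congr_fun ew2 measurableSet_Ioi).2 (hi.mul_const (-cm)).integrableOn
      have b2 := (integrableOn_Ici_iff_integrableOn_Ioi).2 b1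
      have := (Measure.measurePreserving_neg (volume : Measure ℝ)).integrableOn_comp_preimage
        (MeasurableEquiv.neg ℝ).measurableEmbedding (f := fun t => W x (-t)) (s := Ici 0)
      have := this.2 b2
      simpa [Function.comp_def] using this
    rw [← integrableOn_univ, ← Iic_union_Ioi (a := (0:ℝ))]
    exact b.union a
  have es : ∫ t, W x t = (∫ t in Ioi (0:ℝ), W x t) + ∫ t in Ioi (0:ℝ), W x (-t) := by
    rw [integral_comp_neg_Ioi, neg_zero, add_comm,
      ← setIntegral_union (Iic_disjoint_Ioi le_rfl) measurableSet_Ioi iw.integrableOn iw.integrableOn, Iic_union_Ioi, setIntegral_univ]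
  rw [es, setIntegral_congr_fun measurableSet_Ioi ew, setIntegral_congr_fun measurableSet_Ioi ew2, integral_mul_const, integral_mul_const]
  unfold hil
  ring

end BHT
end

section
open MeasureTheory Filter Set
open scoped ENNReal ComplexConjugate Topology
namespace BHT

lemma Lam_meas {ψ f g h : ℝ → ℂ} (hψ : Measurable ψ) (hf : Measurable f) (hg : Measurable g) (hh : Measurable h) :
    Measurable (Lam ψ f g h) := by
  have : Measurable (fun q : ℝ × (ℝ × ℝ) => f (q.2.1 - q.2.2) * g (q.2.1 + q.2.2) * (((q.1⁻¹:ℝ):ℂ) * ψ (q.1⁻¹ * q.2.2)) * h q.2.1) := by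
    fun_prop
  exact (this.stronglyMeasurable.integral_prod_right (ν := (volume : Measure (ℝ × ℝ)))).measurable

lemma gam2 : ∀ i j : Fin 3, i ≠ j → 1/2 ≤ |(![-1, 0, -1/2] : Fin 3 → ℝ) i - (![-1, 0, -1/2] : Fin 3 → ℝ) j| ∧
    |(![-1, 0, -1/2] : Fin 3 → ℝ) i - (![-1, 0, -1/2] : Fin 3 → ℝ) j| ≤ 1 := by
  intro i j hij
  fin_cases i <;> fin_cases j <;> first | exact absurd rfl hij | (norm_num [abs_le, le_abs])

lemma gam1 : ∀ i j : Fin 3, i ≠ j → 1/2 ≤ |(![0, -1, -1/2] : Fin 3 → ℝ) i - (![0, -1, -1/2] : Fin 3 → ℝ) j| ∧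
    |(![0, -1, -1/2] : Fin 3 → ℝ) i - (![0, -1, -1/2] : Fin 3 → ℝ) j| ≤ 1 := by
  intro i j hij
  fin_cases i <;> fin_cases j <;> first | exact absurd rfl hij | (norm_num [abs_le, le_abs])

theorem red {φ a ρ b ζ d ψ p φ' ρ' ζ' : ℝ → ℂ} (D : Dat φ a ρ b ζ d ψ p) {N : ℕ} {B : ℝ} (hB : 0 < B)
    (rφ : Reg N B φ φ') (rρ : Reg N B ρ ρ') (rζ : Reg N B ζ ζ') (hψm : Measurable ψ)
    (hm0 : ∫ x, a x ≠ 0) (hc0 : (∫ w in Ioi (0:ℝ), ψ w) - ∫ w in Ioi (0:ℝ), ψ (-w) ≠ 0)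
    (hKK : ∫⁻ v, ‖ψ v‖ₑ * ENNReal.ofReal ((2^15 * (B * (2 + |v|)^(N+10)))^3) ≠ ⊤) :
    ∃ C0 : ℝ, 0 < C0 ∧ ∀ (M : ℝ) (f fh g gh : ℝ → ℂ), 0 < M → Nice M f → Nice M g → FI f fh → FI g gh →
      RedProp N C0 f g (hil f g) := by
  set m0 := ∫ x, a x
  set c0 := (∫ w in Ioi (0:ℝ), ψ w) - ∫ w in Ioi (0:ℝ), ψ (-w)
  set KK := ∫⁻ v, ‖ψ v‖ₑ * ENNReal.ofReal ((2^15 * (B * (2 + |v|)^(N+10)))^3)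
  have hm0' : 0 < ‖m0‖ := norm_pos_iff.2 hm0
  have hc0' : 0 < ‖c0‖ := norm_pos_iff.2 hc0
  refine ⟨62 * KK.toReal / (‖c0‖ * ‖m0‖) + 1, by positivity, ?_⟩
  intro M f fh g gh hM hf hg ff fg h hh hh1 hhs R hR
  have hhi : Integrable h := by
    obtain ⟨n, hn⟩ := hhs
    have : IntegrableOn h (Icc (-n) n) :=
      Measure.integrableOn_of_bounded (M := 1) (by simp) hh.aestronglyMeasurable (Eventually.of_forall hh1)
    refine (integrableOn_iff_integrable_of_support_subset ?_).1 this
    intro x hx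
    exact abs_le.1 (hn x hx)
  have M1 : ModHyp N f g h R := by
    intro σ τ A φ0 φ1 φ2 𝔓 hσ hA p0 p1 p2
    have := hR σ τ A ![0, -1, -1/2] ![φ0, φ1, φ2] 𝔓 hσ hA ?_ ?_
    · simpa using this
    · exact gam1
    · intro i; fin_cases i
      · exact p0
      · exact p1
      · exact p2
  have M2 : ModHyp N g f h R := by
    intro σ τ A φ0 φ1 φ2 𝔓 hσ hA p0 p1 p2
    have := hR σ τ A ![-1, 0, -1/2] ![φ1, φ0, φ2] 𝔓 hσ hA ?_ ?_
    · simpa [mul_comm, mul_left_comm, mul_assoc] using this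
    · exact gam2
    · intro i; fin_cases i
      · exact p1
      · exact p0
      · exact p2
  have b1 := model_bd D hB rφ rρ rζ ff fg hhi M1
  have b2 := model_bd D hB rφ rρ rζ fg ff hhi M2
  have eK : ∫⁻ v, ‖ψ v‖ₑ * (ENNReal.ofReal ((2^15 * (B * (2 + |v|)^(N+10)))^3) * R) = KK * R := by
    rw [← lintegral_mul_const]
    · congr 1; ext v; rw [mul_assoc]
    · fun_prop
  rw [eK] at b1 b2
  have key : ‖c0‖ₑ * ‖∫ x, hil f g x * h x‖ₑ ≤
      (∫⁻ s in Ioi (0:ℝ), ‖Lam ψ f g h s‖ₑ * ENNReal.ofReal s⁻¹) + ∫⁻ s in Ioi (0:ℝ), ‖Lam ψ g f h s‖ₑ * ENNReal.ofReal s⁻¹ := by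
    rw [← enorm_mul, hil_pair hM D.hψ hψm hf hg hh hhi, ← lintegral_add_left]
    · refine (enorm_integral_le_lintegral_enorm _).trans (setLIntegral_mono' measurableSet_Ioi fun s hs => ?_)
      have hs : 0 < s := hs
      rw [enorm_mul, ← add_mul, mul_comm]
      refine mul_le_mul' (enorm_sub_le) ?_
      rw [← ofReal_norm, Complex.norm_real, Real.norm_of_nonneg (by positivity)]
    · have := Lam_meas hψm hf.c.measurable hg.c.measurable hh
      fun_prop
  have tot : (‖c0‖ₑ * ‖m0‖ₑ) * ‖∫ x, hil f g x * h x‖ₑ ≤ 62 * KK * R := by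
    calc _ = ‖m0‖ₑ * (‖c0‖ₑ * ‖∫ x, hil f g x * h x‖ₑ) := by ring
      _ ≤ ‖m0‖ₑ * ((∫⁻ s in Ioi (0:ℝ), ‖Lam ψ f g h s‖ₑ * ENNReal.ofReal s⁻¹) + ∫⁻ s in Ioi (0:ℝ), ‖Lam ψ g f h s‖ₑ * ENNReal.ofReal s⁻¹) :=
        mul_le_mul' le_rfl key
      _ ≤ 31 * (KK * R) + 31 * (KK * R) := by rw [mul_add]; exact add_le_add b1 b2
      _ = _ := by ring
  have hcm : ‖c0‖ₑ * ‖m0‖ₑ = ENNReal.ofReal (‖c0‖ * ‖m0‖) := by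
    rw [ENNReal.ofReal_mul (by positivity), ofReal_norm, ofReal_norm]
  have hcm0 : ENNReal.ofReal (‖c0‖ * ‖m0‖) ≠ 0 := by
    rw [Ne, ENNReal.ofReal_eq_zero, not_le]; positivity
  rw [hcm, mul_comm, ← ENNReal.le_div_iff_mul_le (Or.inl hcm0) (Or.inl ENNReal.ofReal_ne_top)] at tot
  refine tot.trans ?_
  calc _ = ENNReal.ofReal (62 * KK.toReal / (‖c0‖ * ‖m0‖)) * R := by
        rw [ENNReal.ofReal_div_of_pos (by positivity), ENNReal.ofReal_mul (p := 62) (by norm_num), ENNReal.ofReal_toReal hKK,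
          div_eq_mul_inv, div_eq_mul_inv]
        norm_num
        ring
    _ ≤ _ := mul_le_mul' (ENNReal.ofReal_le_ofReal (by linarith)) le_rfl

end BHT
end

section
open MeasureTheory Filter Set
open scoped ENNReal ComplexConjugate Topology FourierTransform SchwartzMap ContDiff
namespace BHT

lemma FI_schwartz (S : 𝓢(ℝ, ℂ)) : FI S (𝓕 S : 𝓢(ℝ, ℂ)) where
  c1 := S.continuous
  c2 := (𝓕 S).continuous
  i1 := S.integrable
  i2 := (𝓕 S).integrable
  inv := by
    intro y
    have hS : (𝓕⁻ (𝓕 S : 𝓢(ℝ, ℂ)) : 𝓢(ℝ, ℂ)) = S := FourierTransform.fourierInv_fourier_eq S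
    conv_lhs => rw [← hS, SchwartzMap.fourierInv_coe, Real.fourierInv_eq']
    congr 1; ext ξ
    rw [smul_eq_mul, mul_comm]; congr 1
    unfold ee; congr 1; simp; ring
  ft := by
    intro ξ
    rw [SchwartzMap.fourier_coe]
    exact fourier_ee _ _

lemma FI_inv (S : 𝓢(ℝ, ℂ)) : FI (𝓕⁻ S : 𝓢(ℝ, ℂ)) S := by
  have := FI_schwartz (𝓕⁻ S)
  rwa [FourierTransform.fourier_fourierInv_eq] at this

lemma schwartz_dec (S : 𝓢(ℝ, ℂ)) (M : ℕ) : ∃ D : ℝ, 0 < D ∧ ∀ x, ‖S x‖ ≤ D * ((1 + |x|)^M)⁻¹ := by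
  have h := fun x => SchwartzMap.one_add_le_sup_seminorm_apply (𝕜 := ℝ) (m := (M, 0)) (le_refl M) (le_refl 0) S x
  set K := 2 ^ (M, 0).1 * (Finset.Iic (M, 0)).sup (fun m => SchwartzMap.seminorm ℝ m.1 m.2) S with hK
  refine ⟨max K 1, by positivity, fun x => ?_⟩
  have := h x
  rw [norm_iteratedFDeriv_zero, Real.norm_eq_abs] at this
  rw [← div_eq_mul_inv, le_div_iff₀ (by positivity), mul_comm]
  exact this.trans (le_max_left _ _)

lemma schwartz_dec' (S : 𝓢(ℝ, ℂ)) (M : ℕ) : ∃ D : ℝ, 0 < D ∧ ∀ x, ‖deriv S x‖ ≤ D * ((1 + |x|)^M)⁻¹ :=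
  schwartz_dec (SchwartzMap.derivCLM ℝ ℂ S) M

lemma schwartz_nice (S : 𝓢(ℝ, ℂ)) : ∃ M0 : ℝ, ∀ M, M0 ≤ M → Nice M S := by
  obtain ⟨D, hD, h⟩ := schwartz_dec S 2
  obtain ⟨D', hD', h'⟩ := schwartz_dec' S 0
  refine ⟨max D D', fun M hM => ?_⟩
  have m1 := (le_max_left _ _).trans hM
  have m2 := (le_max_right _ _).trans hM
  refine ⟨S.continuous, fun x => ?_, fun x => ?_, fun x y => ?_⟩
  · refine (h x).trans (le_trans ?_ m1)
    have : ((1 + |x|)^2)⁻¹ ≤ 1 := inv_le_one_of_one_le₀ (by nlinarith [abs_nonneg x])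
    nlinarith
  · have := h x
    rw [← div_eq_mul_inv, le_div_iff₀ (by positivity)] at this
    have h2 : x^2 ≤ (1 + |x|)^2 := by rw [← sq_abs]; nlinarith [abs_nonneg x]
    nlinarith [norm_nonneg (S x)]
  · have := Convex.norm_image_sub_le_of_norm_deriv_le (𝕜 := ℝ) (f := S) (s := univ) (C := M) (x := y) (y := x)
      (fun z _ => S.differentiable z) (fun z _ => by have := h' z; simp at this; linarith) convex_univ (mem_univ _) (mem_univ _)
    simpa using this

lemma schwartz_reg (S : 𝓢(ℝ, ℂ)) (N : ℕ) : ∃ B0 : ℝ, ∀ B, B0 ≤ B → Reg N B S (deriv S) := by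
  obtain ⟨D, hD, h⟩ := schwartz_dec S (N+10)
  obtain ⟨D', hD', h'⟩ := schwartz_dec' S (N+10)
  refine ⟨max D D', fun B hB => ?_⟩
  have m1 := (le_max_left _ _).trans hB
  have m2 := (le_max_right _ _).trans hB
  exact ⟨fun x => (S.differentiable x).hasDerivAt, fun x => (h x).trans (by gcongr), fun x => (h' x).trans (by gcongr)⟩

lemma bump (c r R : ℝ) (hr : 0 < r) (hrR : r < R) : ∃ a : 𝓢(ℝ, ℂ), (∀ x, |x - c| ≤ r → a x = 1) ∧
    (∀ x, R < |x - c| → a x = 0) ∧ ∫ x, a x ≠ 0 := by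
  let u : ContDiffBump c := ⟨r, R, hr, hrR⟩
  have hc : HasCompactSupport (fun x => ((u x : ℝ) : ℂ)) := by
    exact u.hasCompactSupport.comp_left (g := fun x : ℝ => (x:ℂ)) (by simp)
  have hd : ContDiff ℝ ∞ (fun x => ((u x : ℝ) : ℂ)) := by
    exact Complex.ofRealCLM.contDiff.comp u.contDiff
  refine ⟨hc.toSchwartzMap hd, ?_, ?_, ?_⟩
  · intro x hx
    have : u x = 1 := u.one_of_mem_closedBall (by simpa [Real.dist_eq] using hx)
    simp [this]
  · intro x hx
    have : u x = 0 := u.zero_of_le_dist (by simpa [Real.dist_eq] using hx.le)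
    simp [this]
  · have := u.integral_pos (μ := volume)
    simp only [HasCompactSupport.toSchwartzMap_toFun]
    rw [integral_complex_ofReal]
    exact_mod_cast this.ne'

lemma schwartz_top (S : 𝓢(ℝ, ℂ)) : Tendsto S atTop (𝓝 0) :=
  (S.toZeroAtInfty.zero_at_infty').mono_left atTop_le_cocompact

lemma schwartz_bot (S : 𝓢(ℝ, ℂ)) : Tendsto S atBot (𝓝 0) :=
  (S.toZeroAtInfty.zero_at_infty').mono_left atBot_le_cocompact

theorem red_all (N : ℕ) : ∃ C0 : ℝ, 0 < C0 ∧ ∀ f g : 𝓢(ℝ, ℂ), RedProp N C0 f g (hil f g) := by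
  obtain ⟨a, a1, a0, ai⟩ := bump 0 (1/128) (1/64) (by norm_num) (by norm_num)
  obtain ⟨b, b1, b0, -⟩ := bump 0 (1/32) (1/16) (by norm_num) (by norm_num)
  obtain ⟨d, d1, d0, -⟩ := bump 0 (5/64) (1/8) (by norm_num) (by norm_num)
  obtain ⟨e, e1, e0, ei⟩ := bump 1 (1/128) (1/64) (by norm_num) (by norm_num)
  simp only [sub_zero] at a0 b0 b1 d0 d1
  set χ : 𝓢(ℝ, ℂ) := 𝓕⁻ e with hχ
  set ψ : 𝓢(ℝ, ℂ) := SchwartzMap.derivCLM ℝ ℂ χ with hψ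
  have hψd : ∀ x, ψ x = deriv χ x := fun x => rfl
  have hder : ∀ x, HasDerivAt χ (ψ x) x := fun x => (χ.differentiable x).hasDerivAt
  have hχ0 : χ 0 = ∫ x, e x := by
    rw [(FI_inv e).inv 0]; simp [ee_zero]
  have D : Dat (𝓕⁻ a : 𝓢(ℝ, ℂ)) a (𝓕⁻ b : 𝓢(ℝ, ℂ)) b (𝓕⁻ d : 𝓢(ℝ, ℂ)) d ψ (𝓕 (ψ : ℝ → ℂ)) := by
    refine ⟨FI_inv a, FI_inv b, FI_inv d, ψ.integrable, fun w => fourier_ee _ _, a0, ?_, b1, d1, b0, d0⟩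
    intro x hx
    have h1 : (ψ : ℝ → ℂ) = deriv χ := funext hψd
    have h2 := Real.fourier_deriv (f := χ) χ.integrable χ.differentiable (by rw [← h1]; exact ψ.integrable)
    rw [h1, h2]
    have h3 : 𝓕 (χ : ℝ → ℂ) x = e x := by
      rw [← SchwartzMap.fourier_coe, hχ, FourierTransform.fourier_fourierInv_eq]
    simp [h3, e0 x hx]
  obtain ⟨Ba, ra⟩ := schwartz_reg (𝓕⁻ a) N
  obtain ⟨Bb, rb⟩ := schwartz_reg (𝓕⁻ b) N
  obtain ⟨Bd, rd⟩ := schwartz_reg (𝓕⁻ d) N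
  set B := max 1 (max Ba (max Bb Bd)) with hBdef
  have hB : 0 < B := lt_of_lt_of_le one_pos (le_max_left _ _)
  have hc0 : (∫ w in Ioi (0:ℝ), ψ w) - ∫ w in Ioi (0:ℝ), ψ (-w) ≠ 0 := by
    have i1 : ∫ w in Ioi (0:ℝ), ψ w = 0 - χ 0 :=
      integral_Ioi_of_hasDerivAt_of_tendsto' (fun x _ => hder x) ψ.integrable.integrableOn (schwartz_top χ)
    have i2 : ∫ w in Ioi (0:ℝ), ψ (-w) = χ 0 - 0 := by
      rw [integral_comp_neg_Ioi, neg_zero]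
      exact integral_Iic_of_hasDerivAt_of_tendsto' (fun x _ => hder x) ψ.integrable.integrableOn (schwartz_bot χ)
    rw [i1, i2, hχ0]
    intro h
    apply ei
    linear_combination (-1/2) * h
  have hKK : ∫⁻ v, ‖ψ v‖ₑ * ENNReal.ofReal ((2^15 * (B * (2 + |v|)^(N+10)))^3) ≠ ⊤ := by
    obtain ⟨E, hE, hE1⟩ := schwartz_dec ψ (3 * (N+10) + 2)
    have hfin : Integrable (fun v : ℝ => (E * (2^15 * (B * 2^(N+10)))^3) * (1 + v^2)⁻¹) :=
      integrable_inv_one_add_sq.const_mul _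
    refine ne_top_of_le_ne_top hfin.lintegral_lt_top.ne (lintegral_mono fun v => ?_)
    rw [← ofReal_norm, ← ENNReal.ofReal_mul (norm_nonneg _)]
    refine ENNReal.ofReal_le_ofReal ?_
    have hv := abs_nonneg v
    have s1 : (2^15 * (B * (2 + |v|)^(N+10)))^3 ≤ (2^15 * (B * 2^(N+10)))^3 * (1 + |v|)^(3*(N+10)) := by
      calc _ ≤ (2^15 * (B * (2 * (1 + |v|))^(N+10)))^3 := by gcongr; linarith
        _ = _ := by rw [mul_pow 2 (1 + |v|)]; ring
    have s2 : ((1 + |v|)^2)⁻¹ ≤ (1 + v^2)⁻¹ := by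
      refine inv_anti₀ (by positivity) ?_
      rw [← sq_abs v]; nlinarith
    calc _ ≤ (E * ((1 + |v|)^(3 * (N+10) + 2))⁻¹) * ((2^15 * (B * 2^(N+10)))^3 * (1 + |v|)^(3*(N+10))) := by
          refine mul_le_mul (hE1 v) s1 (by positivity) (by positivity)
      _ = (E * (2^15 * (B * 2^(N+10)))^3) * ((1 + |v|)^2)⁻¹ := by
          rw [pow_add]
          have : (1 + |v|) ≠ 0 := by positivity
          field_simp
      _ ≤ _ := by gcongr
  obtain ⟨C0, hC0, H⟩ := red D hB (ra B (by simp [hBdef])) (rb B (by simp [hBdef])) (rd B (by simp [hBdef]))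
    ψ.continuous.measurable ai hc0 hKK
  refine ⟨C0, hC0, fun f g => ?_⟩
  obtain ⟨Mf, nf⟩ := schwartz_nice f
  obtain ⟨Mg, ng⟩ := schwartz_nice g
  exact H (max 1 (max Mf Mg)) f _ g _ (by positivity) (nf _ (by simp)) (ng _ (by simp)) (FI_schwartz f) (FI_schwartz g)

theorem main_bound {p q r : ℝ≥0∞} (hp : 1 < p) (hq : 1 < q) (hr : 2/3 < r) (hrt : r ≠ ⊤) (hpq : 1/p + 1/q = 1/r) :
    ∃ C : ℝ, 0 < C ∧ ∀ f g : 𝓢(ℝ, ℂ), ∃ T : ℝ → ℂ,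
      (∀ x : ℝ, Tendsto
          (fun δ : ℝ =>
            ∫ t in {t : ℝ | δ < |t| ∧ |t| < 1/δ}, f (x - t) * g (x + t) * (1/(t:ℂ)))
          (nhdsWithin 0 (Set.Ioi 0)) (nhds (T x))) ∧
      eLpNorm T r volume ≤
        ENNReal.ofReal C * eLpNorm (⇑f) p volume * eLpNorm (⇑g) q volume := by
  obtain ⟨N, hN⟩ := from_red hp hq hr hrt hpq
  obtain ⟨C0, hC0, H⟩ := red_all N
  obtain ⟨C, hC, HC⟩ := hN C0 hC0
  refine ⟨C, hC, fun f g => ⟨hil f g, ?_, ?_⟩⟩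
  · obtain ⟨Mf, nf⟩ := schwartz_nice f
    obtain ⟨Mg, ng⟩ := schwartz_nice g
    intro x
    exact pv_tendsto (M := max 1 (max Mf Mg)) (by positivity) (nf _ (by simp)) (ng _ (by simp)) x
  · obtain ⟨Mf, nf⟩ := schwartz_nice f
    obtain ⟨Mg, ng⟩ := schwartz_nice g
    have hM : 0 < max 1 (max Mf Mg) := by positivity
    have tf := (f.memLp p volume).2.ne
    have tg := (g.memLp q volume).2.ne
    have nf' := nf (max 1 (max Mf Mg)) (by simp)
    have ng' := ng (max 1 (max Mf Mg)) (by simp)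
    have z : ∀ (S : 𝓢(ℝ, ℂ)) (p : ℝ≥0∞), 1 < p → eLpNorm S p volume = 0 → ∀ x, S x = 0 := by
      intro S p hp h x
      rw [eLpNorm_eq_zero_iff S.continuous.aestronglyMeasurable (by rintro rfl; simp at hp)] at h
      have := (Continuous.ae_eq_iff_eq (μ := volume) (f := (S : ℝ → ℂ)) (g := fun _ => 0) S.continuous continuous_const).1 h
      exact congrFun this x
    by_cases hf0 : eLpNorm f p volume = 0
    · have : hil f g = 0 := by
        ext x; simp [hil, dd, z f p hp hf0]
      rw [this]; simp
    by_cases hg0 : eLpNorm g q volume = 0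
    · have : hil f g = 0 := by
        ext x; simp [hil, dd, z g q hq hg0]
      rw [this]; simp
    exact HC f g _ f.continuous.measurable g.continuous.measurable (hil_cont (M := max 1 (max Mf Mg)) hM nf' ng') ⟨_, nf'.b⟩ ⟨_, ng'.b⟩
      hf0 tf hg0 tg (H f g)

end BHT
end

open MeasureTheory Filter Set
open scoped ENNReal

/-- **Bilinear Hilbert transform bounds (Lacey–Thiele).**
For all exponents `p, q ∈ (1, ∞]` and `r ∈ (2/3, ∞)` with `1/p + 1/q = 1/r`, there is a
constant `C = C(p,q,r)` such that for all Schwartz functions `f, g : ℝ → ℂ` the principal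
value `BHT(f,g)(x) = lim_{δ→0⁺} ∫_{δ<|t|<1/δ} f(x−t) g(x+t) dt/t` exists at every point
and `‖BHT(f,g)‖_{L^r} ≤ C ‖f‖_{L^p} ‖g‖_{L^q}`. -/
theorem bilinear_hilbert_transform_bounds :
    ∀ p q r : ℝ≥0∞, 1 < p → 1 < q → 2/3 < r → r ≠ ⊤ → 1/p + 1/q = 1/r →
    ∃ C : ℝ, 0 < C ∧ ∀ f g : SchwartzMap ℝ ℂ, ∃ T : ℝ → ℂ,
      (∀ x : ℝ, Tendsto
          (fun δ : ℝ =>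
            ∫ t in {t : ℝ | δ < |t| ∧ |t| < 1/δ}, f (x - t) * g (x + t) * (1/(t:ℂ)))
          (nhdsWithin 0 (Set.Ioi 0)) (nhds (T x))) ∧
      eLpNorm T r volume ≤
        ENNReal.ofReal C * eLpNorm (⇑f) p volume * eLpNorm (⇑g) q volume := by
  intro p q r hp hq hr hrt hpq
  exact BHT.main_bound hp hq hr hrt hpq
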